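/- There exists a real sequence (Γ_k)_{k≥1} with Γ_1 = −(4α²−1)/16 − (4β²−1)/16 such that the leading coefficients γ_n admit the full asymptotic expansion γ_n/2^n ∼ (1/(√π D_∞)) · [1 + Σ_{k≥1} Γ_k/n^k] as n → ∞; precisely, for every ℓ ≥ 0 there is a constant C > 0 such that for all n ≥ 1, | √π D_∞ · γ_n · 2^{−n} − (1 + Σ_{k=1}^{ℓ} Γ_k n^{−k}) | ≤ C n^{−(ℓ+1)}. -/

import Mathlib

open Complex Filter Set MeasureTheory

noncomputable section

/-- The segment [-1,1] regarded as a subset of the complex plane. -/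
def seg : Set ℂ := Complex.ofReal '' Set.Icc (-1) 1

open Topology Asymptotics in
/-- asymptotic expansion in powers of 1/n -/
def AE {E : Type*} [NormedAddCommGroup E] [NormedSpace ℝ E] (f : ℕ → E) : Prop :=
  ∀ l : ℕ, ∃ G : ℝ → E, AnalyticAt ℝ G 0 ∧
    (fun n : ℕ => f n - G ((n:ℝ)⁻¹)) =O[atTop] (fun n : ℕ => ((n:ℝ)⁻¹) ^ (l+1))

namespace AE
open Topology Asymptotics

variable {E F H : Type*} [NormedAddCommGroup E] [NormedSpace ℝ E]
  [NormedAddCommGroup F] [NormedSpace ℝ F] [NormedAddCommGroup H] [NormedSpace ℝ H]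

lemma inv_tendsto : Tendsto (fun n : ℕ => ((n:ℝ)⁻¹)) atTop (𝓝 0) := tendsto_inv_atTop_nhds_zero_nat

lemma pow_tendsto (l : ℕ) : Tendsto (fun n : ℕ => ((n:ℝ)⁻¹) ^ (l+1)) atTop (𝓝 0) := by
  simpa using (inv_tendsto.pow (l+1))

lemma of_analytic {G : ℝ → E} (hG : AnalyticAt ℝ G 0) : AE (fun n => G ((n:ℝ)⁻¹)) :=
  fun l => ⟨G, hG, by simpa using isBigO_zero _ _⟩

lemma const (c : E) : AE (fun _ => c) := of_analytic (G := fun _ => c) analyticAt_const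

lemma invn : AE (fun n : ℕ => ((n:ℝ)⁻¹)) := of_analytic (G := fun x => x) analyticAt_id

lemma congr' {f g : ℕ → E} (hf : AE f) (h : f =ᶠ[atTop] g) : AE g := by
  intro l
  obtain ⟨G, hG, h1⟩ := hf l
  refine ⟨G, hG, h1.congr' ?_ EventuallyEq.rfl⟩
  filter_upwards [h] with n hn
  rw [hn]

lemma add {f g : ℕ → E} (hf : AE f) (hg : AE g) : AE (fun n => f n + g n) := by
  intro l
  obtain ⟨G, hG, h1⟩ := hf l
  obtain ⟨K, hK, h2⟩ := hg l
  refine ⟨fun x => G x + K x, hG.fun_add hK, (h1.add h2).congr_left ?_⟩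
  intro n; exact sub_add_sub_comm _ _ _ _

lemma clm (L : E →L[ℝ] F) {f : ℕ → E} (hf : AE f) : AE (fun n => L (f n)) := by
  intro l
  obtain ⟨G, hG, h1⟩ := hf l
  refine ⟨fun x => L (G x), (L.analyticAt _).fun_comp hG, ?_⟩
  refine ((L.isBigO_comp _ _).trans h1).congr_left ?_
  intro n; simp

lemma neg {f : ℕ → E} (hf : AE f) : AE (fun n => - f n) := by
  simpa using hf.clm (-(ContinuousLinearMap.id ℝ E))

lemma sub {f g : ℕ → E} (hf : AE f) (hg : AE g) : AE (fun n => f n - g n) := by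
  simpa [sub_eq_add_neg] using hf.add hg.neg

lemma prod {f : ℕ → E} {g : ℕ → F} (hf : AE f) (hg : AE g) : AE (fun n => (f n, g n)) := by
  have h1 := hf.clm (ContinuousLinearMap.inl ℝ E F)
  have h2 := hg.clm (ContinuousLinearMap.inr ℝ E F)
  simpa using h1.add h2

lemma tendsto' {f : ℕ → E} {l : ℕ} {G : ℝ → E} (hG : AnalyticAt ℝ G 0)
    (h : (fun n : ℕ => f n - G ((n:ℝ)⁻¹)) =O[atTop] (fun n : ℕ => ((n:ℝ)⁻¹) ^ (l+1))) :
    Tendsto f atTop (𝓝 (G 0)) := by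
  have h1 : Tendsto (fun n : ℕ => f n - G ((n:ℝ)⁻¹)) atTop (𝓝 0) := h.trans_tendsto (pow_tendsto l)
  have h2 : Tendsto (fun n : ℕ => G ((n:ℝ)⁻¹)) atTop (𝓝 (G 0)) :=
    hG.continuousAt.tendsto.comp inv_tendsto
  simpa using h1.add h2

lemma exists_tendsto {f : ℕ → E} (hf : AE f) : ∃ L, Tendsto f atTop (𝓝 L) := by
  obtain ⟨G, hG, h1⟩ := hf 0
  exact ⟨_, tendsto' hG h1⟩

lemma comp [CompleteSpace F] {f : ℕ → E} {L : E} {Φ : E → F} (hf : AE f) (hL : Tendsto f atTop (𝓝 L))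
    (hΦ : AnalyticAt ℝ Φ L) : AE (fun n => Φ (f n)) := by
  intro l
  obtain ⟨G, hG, h1⟩ := hf l
  have hGL : G 0 = L := tendsto_nhds_unique (tendsto' hG h1) hL
  obtain ⟨K, s, hs, hK⟩ := (hΦ.contDiffAt (n := 1)).exists_lipschitzOnWith
  refine ⟨fun x => Φ (G x), AnalyticAt.fun_comp (by rw [hGL]; exact hΦ) hG, ?_⟩
  have h2 : Tendsto (fun n : ℕ => G ((n:ℝ)⁻¹)) atTop (𝓝 L) := by
    rw [← hGL]; exact hG.continuousAt.tendsto.comp inv_tendsto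
  refine IsBigO.trans (IsBigO.of_bound K ?_) h1
  filter_upwards [hL hs, h2 hs] with n hn1 hn2
  have := hK.dist_le_mul _ hn1 _ hn2
  simpa [dist_eq_norm] using this

lemma bilin [CompleteSpace H] (B : E →L[ℝ] F →L[ℝ] H) {f : ℕ → E} {g : ℕ → F} (hf : AE f) (hg : AE g) :
    AE (fun n => B (f n) (g n)) := by
  obtain ⟨L, hL⟩ := hf.exists_tendsto
  obtain ⟨M, hM⟩ := hg.exists_tendsto
  have h := (hf.prod hg).comp (Φ := fun p : E × F => B p.1 p.2) (hL.prodMk_nhds hM)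
    (B.analyticAt_bilinear _)
  exact h

lemma mul {A : Type*} [NormedRing A] [CompleteSpace A] [NormedAlgebra ℝ A] {f g : ℕ → A} (hf : AE f) (hg : AE g) :
    AE (fun n => f n * g n) := hf.bilin (ContinuousLinearMap.mul ℝ A) hg

lemma smul [CompleteSpace E] {f : ℕ → ℝ} {g : ℕ → E} (hf : AE f) (hg : AE g) :
    AE (fun n => f n • g n) := hf.bilin (ContinuousLinearMap.lsmul ℝ ℝ) hg

lemma pow {f : ℕ → ℝ} (hf : AE f) (k : ℕ) : AE (fun n => f n ^ k) := by
  induction k with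
  | zero => simpa using AE.const (1:ℝ)
  | succ k ih => simpa [pow_succ] using ih.mul hf

lemma sum {ι : Type*} (s : Finset ι) {f : ι → ℕ → E} (hf : ∀ i ∈ s, AE (f i)) :
    AE (fun n => ∑ i ∈ s, f i n) := by
  classical
  induction s using Finset.induction_on with
  | empty => simpa using AE.const (0:E)
  | insert a s ha ih =>
    simp only [Finset.sum_insert ha]
    exact (hf a (by simp)).add (ih (fun i hi => hf i (by simp [hi])))

lemma inv {f : ℕ → ℝ} {L : ℝ} (hf : AE f) (hL : Tendsto f atTop (𝓝 L)) (h0 : L ≠ 0) :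
    AE (fun n => (f n)⁻¹) := hf.comp hL (analyticAt_inv h0)

lemma div {f g : ℕ → ℝ} {L : ℝ} (hf : AE f) (hg : AE g) (hL : Tendsto g atTop (𝓝 L))
    (h0 : L ≠ 0) : AE (fun n => f n / g n) := by
  simpa [div_eq_mul_inv] using hf.mul (hg.inv hL h0)

lemma rpow {f : ℕ → ℝ} {L : ℝ} (hf : AE f) (hL : Tendsto f atTop (𝓝 L)) (h0 : 0 < L) (s : ℝ) :
    AE (fun n => (f n) ^ s) := by
  have h1 : AE (fun n => Real.exp (s * Real.log (f n))) := by
    refine hf.comp (Φ := fun x => Real.exp (s * Real.log x)) hL ?_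
    exact ((analyticAt_const).mul (analyticAt_log h0)).rexp
  refine h1.congr' ?_
  filter_upwards [hL.eventually (lt_mem_nhds h0)] with n hn
  rw [Real.rpow_def_of_pos hn, mul_comm]

lemma of_small {f : ℕ → E} (h : ∀ l : ℕ, f =O[atTop] (fun n : ℕ => ((n:ℝ)⁻¹) ^ (l+1))) : AE f :=
  fun l => ⟨fun _ => 0, analyticAt_const, by simpa using h l⟩

lemma shift {f : ℕ → E} (hf : AE f) : AE (fun n => f (n+1)) := by
  intro l
  obtain ⟨G, hG, h1⟩ := hf l
  refine ⟨fun x => G (x / (1+x)), ?_, ?_⟩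
  · refine AnalyticAt.fun_comp (g := G) (f := fun x : ℝ => x / (1+x)) (by simpa using hG) ?_
    exact analyticAt_id.div (analyticAt_const.add analyticAt_id) (by simp)
  · have h2 := h1.comp_tendsto (tendsto_add_atTop_nat 1)
    have h3 : ((fun n : ℕ => ((n:ℝ)⁻¹) ^ (l+1)) ∘ fun n : ℕ => n+1) =O[atTop]
        (fun n : ℕ => ((n:ℝ)⁻¹) ^ (l+1)) := by
      refine IsBigO.of_bound 1 ?_
      filter_upwards [eventually_ge_atTop 1] with n hn
      have hn' : (0:ℝ) < n := by exact_mod_cast hn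
      simp only [Function.comp, norm_pow, norm_inv, Real.norm_natCast, one_mul]
      gcongr; simp
    refine (h2.trans h3).congr' ?_ EventuallyEq.rfl
    filter_upwards [eventually_ge_atTop 1] with n hn
    have hn' : (0:ℝ) < n := by exact_mod_cast hn
    simp only [Function.comp]
    congr 2
    push_cast
    field_simp

/-- divide out the leading term -/
lemma mul_n {f : ℕ → E} {L : E} (hf : AE f) (hL : Tendsto f atTop (𝓝 L)) :
    AE (fun n => (n:ℝ) • (f n - L)) := by
  intro l
  obtain ⟨G, hG, h1⟩ := hf (l+1)
  have hGL : G 0 = L := tendsto_nhds_unique (tendsto' hG h1) hL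
  refine ⟨dslope G 0, ?_, ?_⟩
  · obtain ⟨p, hp⟩ := hG
    exact ⟨_, hp.has_fpower_series_dslope_fslope⟩
  have h2 : (fun n : ℕ => (n:ℝ)) =O[atTop] (fun n : ℕ => (n:ℝ)) := isBigO_refl _ _
  refine (h2.smul h1).congr' ?_ ?_
  · filter_upwards [eventually_ge_atTop 1] with n hn
    have hn' : (0:ℝ) < n := by exact_mod_cast hn
    rw [dslope_of_ne _ (by positivity), slope_def_module, hGL]
    simp only [sub_zero, inv_inv]
    rw [← smul_sub]; congr 1; abel
  · filter_upwards [eventually_ge_atTop 1] with n hn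
    have hn' : (0:ℝ) < n := by exact_mod_cast hn
    rw [smul_eq_mul, pow_succ _ (l+1)]
    field_simp

lemma extract {f : ℕ → ℝ} (hf : AE f) : ∃ Γ : ℕ → ℝ, Tendsto f atTop (𝓝 (Γ 0)) ∧
    Tendsto (fun n : ℕ => (n:ℝ) * (f n - Γ 0)) atTop (𝓝 (Γ 1)) ∧
    ∀ l : ℕ, ∃ C > (0:ℝ), ∀ n : ℕ, 1 ≤ n →
      |f n - ∑ k ∈ Finset.range (l+1), Γ k / (n:ℝ)^k| ≤ C / (n:ℝ)^(l+1) := by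
  classical
  let Q := {g : ℕ → ℝ // AE g}
  let lim : Q → ℝ := fun g => g.2.exists_tendsto.choose
  have hlim : ∀ g : Q, Tendsto g.1 atTop (𝓝 (lim g)) := fun g => g.2.exists_tendsto.choose_spec
  let step : Q → Q := fun g => ⟨fun n => (n:ℝ) • (g.1 n - lim g), g.2.mul_n (hlim g)⟩
  let s : ℕ → Q := fun k => step^[k] ⟨f, hf⟩
  have hs0 : (s 0).1 = f := rfl
  have hs : ∀ k n, (s (k+1)).1 n = (n:ℝ) * ((s k).1 n - lim (s k)) := by
    intro k n
    simp only [s, Function.iterate_succ_apply', step, smul_eq_mul]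
  refine ⟨fun k => lim (s k), hlim (s 0), ?_, ?_⟩
  · have := hlim (s 1)
    refine this.congr ?_
    intro n
    exact hs 0 n
  · intro l
    have key : ∀ l (n : ℕ), 1 ≤ n → f n - ∑ k ∈ Finset.range (l+1), lim (s k) / (n:ℝ)^k
        = (s (l+1)).1 n / (n:ℝ)^(l+1) := by
      intro l n hn
      have hn' : (n:ℝ) ≠ 0 := by positivity
      induction l with
      | zero => rw [hs, hs0]; simp; field_simp
      | succ l ih =>
        rw [Finset.sum_range_succ, ← sub_sub, ih, hs (l+1)]
        field_simp
        ring
    have hb : ∃ C, ∀ n, |(s (l+1)).1 n| ≤ C := by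
      obtain ⟨C, hC⟩ := (Metric.isBounded_range_of_tendsto _ (hlim (s (l+1)))).exists_norm_le
      exact ⟨C, fun n => by simpa using hC _ (mem_range_self n)⟩
    obtain ⟨C, hC⟩ := hb
    refine ⟨|C| + 1, by positivity, fun n hn => ?_⟩
    rw [key l n hn, abs_div, abs_of_nonneg (by positivity : (0:ℝ) ≤ (n:ℝ)^(l+1))]
    gcongr
    linarith [hC n, le_abs_self C]

end AE

abbrev l2 := lp (fun _ : ℕ => ℝ) 2

/-- basis vectors -/
def eb (j : ℕ) : l2 := lp.single 2 j (1:ℝ)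

section
open Topology

lemma eb_apply (j k : ℕ) : (eb j : ℕ → ℝ) k = if k = j then 1 else 0 := by
  simp [eb, lp.single_apply, Pi.single_apply]

lemma inner_eb (j : ℕ) (c : l2) : inner ℝ (eb j) c = c j := by
  rw [eb, lp.inner_single_left]; simp

lemma norm_eb (j : ℕ) : ‖eb j‖ = 1 := by
  rw [eb, lp.norm_single (by norm_num)]; simp

lemma l2_norm_sq (c : l2) : HasSum (fun j => (c j)^2) (‖c‖^2) := by
  have h := lp.hasSum_norm (p := 2) (by norm_num) c
  simpa using h

lemma l2_sum_le (c : l2) (s : Finset ℕ) : ∑ j ∈ s, (c j)^2 ≤ ‖c‖^2 :=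
  sum_le_hasSum s (fun _ _ => sq_nonneg _) (l2_norm_sq c)

lemma l2_hasSum (c : l2) : HasSum (fun j => (c j) • eb j) c := by
  have h := lp.hasSum_single (p := 2) (by norm_num) c
  refine h.congr_fun ?_ |> fun x => x
  intro j
  simp only [eb]
  rw [← lp.single_smul]; simp

lemma bessel_clm {V : Type*} [NormedAddCommGroup V] [NormedSpace ℝ V] [CompleteSpace V]
    (v : ℕ → V) (C : ℝ) (hC : 0 ≤ C)
    (hv : ∀ (s : Finset ℕ) (c : ℕ → ℝ), ‖∑ j ∈ s, c j • v j‖ ^ 2 ≤ C ^ 2 * ∑ j ∈ s, (c j) ^ 2) :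
    ∃ T : l2 →L[ℝ] V, ‖T‖ ≤ C ∧ (∀ j, T (eb j) = v j) ∧ ∀ c : l2, HasSum (fun j => c j • v j) (T c) := by
  have hsum : ∀ c : l2, Summable (fun j => c j • v j) := by
    intro c
    rw [summable_iff_vanishing_norm]
    intro ε hε
    have hs := (l2_norm_sq c).summable
    rw [summable_iff_vanishing_norm] at hs
    obtain ⟨s, hs⟩ := hs (ε^2 / (C^2+1)) (by positivity)
    refine ⟨s, fun t ht => ?_⟩
    have h1 := hs t ht
    rw [Real.norm_of_nonneg (Finset.sum_nonneg fun _ _ => sq_nonneg _), lt_div_iff₀ (by positivity)] at h1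
    have h2 := hv t c
    have h3 : ‖∑ j ∈ t, c j • v j‖ ^ 2 < ε^2 := by
      have := Finset.sum_nonneg (s := t) (fun j _ => sq_nonneg (c j))
      rcases this.eq_or_lt with h | h
      · rw [← h] at h2; nlinarith
      · nlinarith
    exact lt_of_pow_lt_pow_left₀ 2 hε.le h3
  have hnorm : ∀ c : l2, ‖∑' j, c j • v j‖ ≤ C * ‖c‖ := by
    intro c
    have h1 : Tendsto (fun s : Finset ℕ => ‖∑ j ∈ s, c j • v j‖) atTop (𝓝 ‖∑' j, c j • v j‖) :=
      (hsum c).hasSum.norm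
    refine le_of_tendsto h1 (Eventually.of_forall fun s => ?_)
    have h2 := hv s c
    refine le_of_sq_le_sq ?_ (by positivity) |> fun h => h
    nlinarith [l2_sum_le c s, sq_nonneg C]
  let T0 : l2 →ₗ[ℝ] V :=
    { toFun := fun c => ∑' j, c j • v j
      map_add' := fun c d => by
        rw [← (hsum c).tsum_add (hsum d)]; congr 1; ext j; simp [add_smul]
      map_smul' := fun r c => by
        simp only [RingHom.id_apply]
        rw [← (hsum c).tsum_const_smul]; congr 1; ext j; simp [mul_smul] }
  refine ⟨T0.mkContinuous C hnorm, T0.mkContinuous_norm_le hC hnorm, ?_, fun c => (hsum c).hasSum⟩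
  intro j
  change ∑' k, (eb j) k • v k = v j
  rw [tsum_eq_single j]
  · simp [eb_apply]
  · intro k hk; simp [eb_apply, hk]

/-- operator bound from geometric bounds on entries -/
lemma norm_le_of_entries (E : l2 →L[ℝ] l2) {C q : ℝ} (hC : 0 ≤ C) (hq : 0 ≤ q) (hq1 : q < 1)
    (h : ∀ j k, |inner ℝ (eb j) (E (eb k))| ≤ C * q ^ (j + k)) (c : l2) :
    (∀ j, |(E c) j| ≤ C / (1 - q) * q ^ j * ‖c‖) ∧ ‖E c‖ ≤ C / (1 - q)^2 * ‖c‖ := by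
  have hc : ∀ k, |c k| ≤ ‖c‖ := fun k => lp.norm_apply_le_norm (by norm_num) c k
  have h0 : 0 < 1 - q := by linarith
  have h1 : ∀ j, |(E c) j| ≤ C / (1 - q) * q ^ j * ‖c‖ := by
    intro j
    have hs : HasSum (fun k => c k * (E (eb k)) j) ((E c) j) := by
      have := ((l2_hasSum c).mapL E).mapL (innerSL ℝ (eb j))
      simpa [inner_eb] using this
    have hg : HasSum (fun k => ‖c‖ * (C * q ^ j) * q ^ k) (‖c‖ * (C * q ^ j) * (1-q)⁻¹) :=
      (hasSum_geometric_of_lt_one hq hq1).mul_left _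
    have hb := tsum_of_norm_bounded hg (f := fun k => c k * (E (eb k)) j) ?_
    · rw [hs.tsum_eq] at hb
      refine hb.trans (le_of_eq ?_)
      field_simp
    · intro k
      have := h j k
      rw [inner_eb] at this
      rw [Real.norm_eq_abs, abs_mul]
      calc |c k| * |(E (eb k)) j| ≤ ‖c‖ * (C * q^(j+k)) := by gcongr; exact hc k
        _ = _ := by rw [pow_add]; ring
  refine ⟨h1, ?_⟩
  set D := C / (1 - q) * ‖c‖ with hD
  have hD0 : 0 ≤ D := by positivity
  have h2 : ‖E c‖^2 ≤ D^2 * (1-q)⁻¹ := by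
    have hg : HasSum (fun k : ℕ => D^2 * q ^ k) (D^2 * (1-q)⁻¹) :=
      (hasSum_geometric_of_lt_one hq hq1).mul_left _
    refine hasSum_le ?_ (l2_norm_sq (E c)) hg
    intro j
    have h3 := h1 j
    have h4 : |(E c) j| ≤ D * q^j := by rw [hD]; linarith [h3]
    calc ((E c) j)^2 = |(E c) j|^2 := (sq_abs _).symm
      _ ≤ (D * q^j)^2 := by gcongr
      _ = D^2 * (q^j * q^j) := by ring
      _ ≤ D^2 * (q^j * 1) := by gcongr; exact pow_le_one₀ hq hq1.le
      _ = _ := by ring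
  have h5 : (1 - q)⁻¹ ≤ ((1-q)⁻¹)^2 := by
    have : 1 ≤ (1-q)⁻¹ := (one_le_inv₀ h0).mpr (by linarith)
    nlinarith
  refine le_of_sq_le_sq ?_ (by positivity)
  calc ‖E c‖^2 ≤ D^2 * (1-q)⁻¹ := h2
    _ ≤ D^2 * ((1-q)⁻¹)^2 := by gcongr
    _ = _ := by rw [hD]; field_simp

/-- coercive operators are invertible -/
lemma coercive_inv {V : Type*} [NormedAddCommGroup V] [InnerProductSpace ℝ V] [CompleteSpace V]
    (T : V →L[ℝ] V) {ε : ℝ} (hε : 0 < ε) (h : ∀ c, ε * ‖c‖^2 ≤ inner ℝ (T c) c) :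
    ∃ N : V →L[ℝ] V, T * N = 1 ∧ N * T = 1 ∧ ‖N‖ ≤ ε⁻¹ := by
  have hco : IsCoercive ((innerSL ℝ).comp T : V →L[ℝ] V →L[ℝ] ℝ) := by
    refine ⟨ε, hε, fun u => ?_⟩
    have := h u
    simp only [ContinuousLinearMap.comp_apply, innerSL_apply_apply]
    nlinarith
  set e := hco.continuousLinearEquivOfBilin
  have he : ∀ u, e u = T u := by
    intro u
    refine ext_inner_right ℝ fun w => ?_
    rw [hco.continuousLinearEquivOfBilin_apply]
    simp
  refine ⟨(e.symm : V →L[ℝ] V), ?_, ?_, ?_⟩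
  · ext u; simp [← he]
  · ext u; simp [← he]
  · refine ContinuousLinearMap.opNorm_le_bound _ (by positivity) fun u => ?_
    set y := e.symm u
    have h1 := h y
    have h2 : T y = u := by rw [← he]; simp [y]
    rw [h2] at h1
    have h3 := real_inner_le_norm u y
    change ‖y‖ ≤ _
    rw [inv_mul_eq_div, le_div_iff₀ hε]
    rcases (norm_nonneg y).eq_or_lt with h4 | h4
    · rw [← h4]; simp
    · nlinarith

/-- limits of uniformly invertible operators are invertible -/
lemma isUnit_of_tendsto {A : Type*} [NormedRing A] [CompleteSpace A] {T N : ℕ → A} {L : A} {C : ℝ}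
    (hT : Tendsto T atTop (𝓝 L)) (h1 : ∀ᶠ n in atTop, T n * N n = 1) (h2 : ∀ᶠ n in atTop, N n * T n = 1)
    (hC : ∀ᶠ n in atTop, ‖N n‖ ≤ C) : IsUnit L := by
  have h3 : Tendsto (fun n => ‖T n - L‖ * C) atTop (𝓝 0) := by
    have := (tendsto_iff_norm_sub_tendsto_zero.mp hT).mul_const C
    simpa using this
  have h4 : ∀ᶠ n in atTop, ‖T n - L‖ * C < 1 := h3.eventually (gt_mem_nhds one_pos)
  obtain ⟨n, a1, a2, a3, a4⟩ := (h1.and (h2.and (hC.and h4))).exists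
  -- L = T n * (1 - N n * (T n - L))
  have h5 : ‖N n * (T n - L)‖ < 1 := by
    calc ‖N n * (T n - L)‖ ≤ ‖N n‖ * ‖T n - L‖ := norm_mul_le _ _
      _ ≤ C * ‖T n - L‖ := by gcongr
      _ < 1 := by linarith [mul_comm C ‖T n - L‖]
  have h6 : L = T n * (1 - N n * (T n - L)) := by
    rw [mul_sub, ← mul_assoc, a1]; simp
  rw [h6]
  exact IsUnit.mul ⟨⟨T n, N n, a1, a2⟩, rfl⟩ (isUnit_one_sub_of_norm_lt_one h5)
end

/-- data: S analytic on a disc of radius R > 1, real on reals -/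
structure SData (S : ℂ → ℂ) (R : ℝ) : Prop where
  one_lt : 1 < R
  diff : DifferentiableOn ℂ S (Metric.ball 0 R)
  conj : ∀ z ∈ Metric.ball (0:ℂ) R, S (starRingEnd ℂ z) = starRingEnd ℂ (S z)

namespace SData
variable {S : ℂ → ℂ} {R : ℝ}

lemma im_real (h : SData S R) {x : ℝ} (hx : |x| < R) : (S (x:ℂ)).im = 0 := by
  have := h.conj (x:ℂ) (by simpa using hx)
  rw [Complex.conj_ofReal] at this
  exact (Complex.conj_eq_iff_im.mp this.symm)

lemma neg (h : SData S R) : SData (fun z => S (-z)) R where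
  one_lt := h.one_lt
  diff := h.diff.comp (differentiable_id.neg.differentiableOn) (fun z hz => by simpa using hz)
  conj := fun z hz => by
    have := h.conj (-z) (by simpa using hz)
    simpa using this

lemma cont (h : SData S R) : ContinuousOn S (Metric.ball 0 R) := h.diff.continuousOn
end SData

/-- the symbol on the upper half circle -/
def bfun (a b : ℝ) (S : ℂ → ℂ) (θ : ℝ) : ℂ :=
  cexp (I * (a * (θ - Real.pi) + b * θ) + (S (cexp (I * θ)) - S (cexp (-(I * θ)))))

def bhat (a b : ℝ) (S : ℂ → ℂ) (m : ℕ) : ℝ :=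
  (1 / Real.pi) * (∫ θ in (0:ℝ)..Real.pi, bfun a b S θ * cexp (I * m * θ)).re

def rhoP (a b : ℝ) (S : ℂ → ℂ) (t : ℝ) : ℝ :=
  Real.sin (Real.pi * a) / Real.pi * Real.exp (-t * (a + b)) *
    Real.exp ((S (Real.exp (-t) : ℝ)).re - (S (Real.exp t : ℝ)).re)

namespace SData
variable {S : ℂ → ℂ} {R : ℝ}

lemma exp_mem {τ : ℝ} (hτR : Real.exp τ < R) {ζ : ℂ} (h : |ζ.re| ≤ τ) :
    cexp ζ ∈ Metric.ball (0:ℂ) R := by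
  simp only [mem_ball_zero_iff, Complex.norm_exp]
  refine lt_of_le_of_lt (Real.exp_le_exp.mpr ?_) hτR
  exact (le_abs_self _).trans h

lemma fdiff (hS : SData S R) {τ : ℝ} (hτR : Real.exp τ < R) (c d : ℂ) :
    DifferentiableOn ℂ (fun ζ => cexp (c * ζ + d + (S (cexp ζ) - S (cexp (-ζ)))))
      {ζ | |ζ.re| ≤ τ} := by
  have h1 : DifferentiableOn ℂ (fun ζ => S (cexp ζ)) {ζ | |ζ.re| ≤ τ} :=
    hS.diff.comp differentiable_exp.differentiableOn (fun ζ h => exp_mem hτR h)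
  have h2 : DifferentiableOn ℂ (fun ζ => S (cexp (-ζ))) {ζ | |ζ.re| ≤ τ} :=
    hS.diff.comp (differentiable_exp.comp differentiable_neg).differentiableOn
      (fun ζ h => exp_mem hτR (by simpa using h))
  have h3 : DifferentiableOn ℂ (fun ζ => c * ζ + d) {ζ : ℂ | |ζ.re| ≤ τ} := by fun_prop
  exact (h3.add (h1.sub h2)).cexp

lemma bhat_eq (hS : SData S R) (a b : ℝ) {τ : ℝ} (hτ : 0 < τ) (hτR : Real.exp τ < R) :
    ∃ C, ∀ m : ℕ, |bhat a b S m - ((∫ t in (0:ℝ)..τ, rhoP a b S t * Real.exp (-(m * t)))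
      + (-1) ^ m * ∫ t in (0:ℝ)..τ, rhoP b a (fun z => S (-z)) t * Real.exp (-(m * t)))|
      ≤ C * Real.exp (-(τ * m)) := by
  set T : Set ℂ := {ζ | |ζ.re| ≤ τ}
  have hfd := fun c d => hS.fdiff hτR c d
  set f : ℕ → ℂ → ℂ := fun m ζ =>
    cexp ((a + b + m) * ζ + (-(I * Real.pi * a)) + (S (cexp ζ) - S (cexp (-ζ)))) with hf
  have hfm : ∀ m, DifferentiableOn ℂ (f m) T := fun m => hfd _ _
  -- bound for m = 0 on the left side
  have hleft : ContinuousOn (fun y : ℝ => f 0 ((-τ : ℝ) + y * I)) (Icc 0 Real.pi) := by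
    refine (hfm 0).continuousOn.comp (by fun_prop) ?_
    intro y _
    simp [T, abs_of_pos hτ]
  obtain ⟨M, hM⟩ := isCompact_Icc.exists_bound_of_continuousOn hleft
  refine ⟨M, fun m => ?_⟩
  have hrect := Complex.integral_boundary_rect_eq_zero_of_differentiableOn (f m) ((-τ : ℝ) : ℂ)
    (Real.pi * I) ?_
  swap
  · refine (hfm m).mono ?_
    intro ζ hζ
    have h1 := hζ.1
    simp only [ofReal_re, mul_re, ofReal_im, I_re, I_im, mul_zero, zero_mul, sub_zero, mem_preimage,
      mul_one] at h1
    rw [uIcc_of_le (by linarith)] at h1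
    simp only [T, mem_ofPred_eq]
    rw [abs_le]; exact ⟨h1.1, h1.2.trans hτ.le⟩
  simp only [ofReal_re, ofReal_im, mul_re, mul_im, I_re, I_im, mul_zero, zero_mul, sub_zero, mul_one,
    add_zero, ofReal_zero, zero_add, smul_eq_mul] at hrect
  have e1 : ∀ y : ℝ, f m (y * I) = bfun a b S y * cexp (I * m * y) := by
    intro y
    simp only [hf, bfun]
    rw [← Complex.exp_add]
    congr 1
    rw [mul_comm I (y:ℂ)]
    ring
  have hre : ∀ x : ℝ, |x| < R → S (x:ℂ) = ((S (x:ℂ)).re : ℂ) := by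
    intro x hx
    apply Complex.ext <;> simp [hS.im_real hx]
  have hexpR : ∀ t : ℝ, |t| ≤ τ → |Real.exp t| < R := by
    intro t ht
    rw [Real.abs_exp]
    exact lt_of_le_of_lt (Real.exp_le_exp.mpr ((le_abs_self _).trans ht)) hτR
  have e2 : ∀ x : ℝ, |x| ≤ τ → (f m (x:ℂ) * I).re =
      Real.pi * (rhoP a b S (-x) * Real.exp (m * x)) := by
    intro x hx
    simp only [hf, rhoP]
    have h1 : S (cexp (x:ℂ)) = ((S ((Real.exp x : ℝ):ℂ)).re : ℂ) := by
      rw [← hre _ (hexpR x hx), ofReal_exp]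
    have h2 : S (cexp (-(x:ℂ))) = ((S ((Real.exp (-x) : ℝ):ℂ)).re : ℂ) := by
      rw [← hre _ (hexpR (-x) (by simpa using hx))]; simp
    rw [h1, h2]
    have h3 : cexp ((a + b + m) * x + (-(I * Real.pi * a)) + (((S ((Real.exp x : ℝ):ℂ)).re : ℂ)
        - ((S ((Real.exp (-x) : ℝ):ℂ)).re : ℂ))) =
        ((Real.exp ((a + b + m) * x + ((S ((Real.exp x : ℝ):ℂ)).re - (S ((Real.exp (-x) : ℝ):ℂ)).re)) : ℝ) : ℂ)
          * cexp ((-(Real.pi * a) : ℝ) * I) := by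
      generalize (S ((Real.exp x : ℝ):ℂ)).re = p
      generalize (S ((Real.exp (-x) : ℝ):ℂ)).re = q
      rw [ofReal_exp, ← Complex.exp_add]; congr 1; push_cast; ring
    rw [h3, mul_assoc, re_ofReal_mul, mul_re, exp_ofReal_mul_I_im, I_re, I_im, Real.sin_neg, neg_neg]
    have hpi := Real.pi_ne_zero
    rw [show (a + b + m) * x + ((S ((Real.exp x : ℝ):ℂ)).re - (S ((Real.exp (-x) : ℝ):ℂ)).re)
      = (- -x * (a+b)) + ((S ((Real.exp x : ℝ):ℂ)).re - (S ((Real.exp (-x) : ℝ):ℂ)).re) + m * x by ring,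
      Real.exp_add, Real.exp_add]
    field_simp
    ring
  have e3 : ∀ x : ℝ, |x| ≤ τ → (f m (x + Real.pi * I) * I).re =
      - (Real.pi * ((-1)^m * (rhoP b a (fun z => S (-z)) (-x) * Real.exp (m * x)))) := by
    intro x hx
    simp only [hf, rhoP]
    have h1 : S (cexp (x + Real.pi * I)) = ((S (-((Real.exp x : ℝ):ℂ))).re : ℂ) := by
      have := hre (-(Real.exp x)) (by rw [abs_neg]; exact hexpR x hx)
      rw [ofReal_neg] at this
      rw [← this, Complex.exp_add, exp_pi_mul_I, ofReal_exp]; simp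
    have h2 : S (cexp (-(x + Real.pi * I))) = ((S (-((Real.exp (-x) : ℝ):ℂ))).re : ℂ) := by
      have := hre (-(Real.exp (-x))) (by rw [abs_neg]; exact hexpR (-x) (by simpa using hx))
      rw [ofReal_neg] at this
      rw [← this, neg_add, Complex.exp_add, Complex.exp_neg (Real.pi * I), exp_pi_mul_I, ofReal_exp]
      norm_num
    rw [h1, h2]
    have h3 : cexp ((a + b + m) * (x + Real.pi * I) + (-(I * Real.pi * a)) + (((S (-((Real.exp x : ℝ):ℂ))).re : ℂ)
        - ((S (-((Real.exp (-x) : ℝ):ℂ))).re : ℂ))) =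
        ((Real.exp ((a + b + m) * x + ((S (-((Real.exp x : ℝ):ℂ))).re - (S (-((Real.exp (-x) : ℝ):ℂ))).re)) : ℝ) : ℂ)
          * cexp (((Real.pi * b) + m * Real.pi : ℝ) * I) := by
      generalize (S (-((Real.exp x : ℝ):ℂ))).re = p
      generalize (S (-((Real.exp (-x) : ℝ):ℂ))).re = q
      rw [ofReal_exp, ← Complex.exp_add]; congr 1; push_cast; ring
    rw [h3, mul_assoc, re_ofReal_mul, mul_re, exp_ofReal_mul_I_im, I_re, I_im,
      Real.sin_add_nat_mul_pi]
    have hpi := Real.pi_ne_zero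
    rw [show (a + b + m) * x + ((S (-((Real.exp x : ℝ):ℂ))).re - (S (-((Real.exp (-x) : ℝ):ℂ))).re)
      = (- -x * (b+a)) + ((S (-((Real.exp x : ℝ):ℂ))).re - (S (-((Real.exp (-x) : ℝ):ℂ))).re) + m * x by ring,
      Real.exp_add, Real.exp_add, neg_neg]
    field_simp
    ring
  have e4 : ∀ y ∈ Set.uIoc (0:ℝ) Real.pi, ‖f m ((-τ:ℝ) + y * I)‖ ≤ M * Real.exp (-(τ * m)) := by
    intro y hy
    rw [uIoc_of_le Real.pi_pos.le] at hy
    have h1 := hM y ⟨hy.1.le, hy.2⟩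
    have h2 : f m ((-τ:ℝ) + y * I) = f 0 ((-τ:ℝ) + y * I) * cexp (m * ((-τ:ℝ) + y * I)) := by
      simp only [hf]; rw [← Complex.exp_add]; congr 1; push_cast; ring
    rw [h2, norm_mul, Complex.norm_exp (m * _)]
    have h3 : ((m:ℂ) * ((-τ:ℝ) + y * I)).re = -(τ * m) := by simp; ring
    rw [h3]
    gcongr
  -- assemble
  have c1 : ContinuousOn (fun x : ℝ => f m (x:ℂ)) (uIcc (-τ) 0) := by
    refine (hfm m).continuousOn.comp (by fun_prop) ?_
    intro x hx
    rw [uIcc_of_le (by linarith)] at hx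
    simp only [T, mem_ofPred_eq, ofReal_re]; rw [abs_le]; exact ⟨hx.1, hx.2.trans hτ.le⟩
  have c2 : ContinuousOn (fun x : ℝ => f m (x + Real.pi * I)) (uIcc (-τ) 0) := by
    refine (hfm m).continuousOn.comp (by fun_prop) ?_
    intro x hx
    rw [uIcc_of_le (by linarith)] at hx
    simp [T]; rw [abs_le]; exact ⟨hx.1, hx.2.trans hτ.le⟩
  have r1 : ((∫ x in (-τ)..0, f m (x:ℂ)) * I).re = Real.pi * ∫ t in (0:ℝ)..τ, rhoP a b S t * Real.exp (-(m * t)) := by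
    rw [← intervalIntegral.integral_mul_const]
    have := (Complex.reCLM.intervalIntegral_comp_comm (a := -τ) (b := 0)
      (μ := volume) (f := fun x : ℝ => f m (x:ℂ) * I) (c1.mul continuousOn_const).intervalIntegrable)
    simp only [reCLM_apply] at this
    rw [← this, ← intervalIntegral.integral_const_mul]
    have h2 := intervalIntegral.integral_comp_neg (a := -τ) (b := 0)
      (fun t : ℝ => Real.pi * (rhoP a b S t * Real.exp (-(m * t))))
    simp only [neg_zero, neg_neg] at h2
    rw [← h2]
    apply intervalIntegral.integral_congr
    intro x hx
    rw [uIcc_of_le (by linarith)] at hx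
    simp only
    rw [e2 x (by rw [abs_le]; exact ⟨hx.1, hx.2.trans hτ.le⟩)]
    simp
  have r2 : ((∫ x in (-τ)..0, f m (x + Real.pi * I)) * I).re = - (Real.pi * ((-1)^m *
      ∫ t in (0:ℝ)..τ, rhoP b a (fun z => S (-z)) t * Real.exp (-(m * t)))) := by
    rw [← intervalIntegral.integral_mul_const]
    have := (Complex.reCLM.intervalIntegral_comp_comm (a := -τ) (b := 0)
      (μ := volume) (f := fun x : ℝ => f m (x + Real.pi * I) * I) (c2.mul continuousOn_const).intervalIntegrable)
    simp only [reCLM_apply] at this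
    rw [← this, ← intervalIntegral.integral_const_mul, ← intervalIntegral.integral_const_mul,
      ← intervalIntegral.integral_neg]
    have h2 := intervalIntegral.integral_comp_neg (a := -τ) (b := 0)
      (fun t : ℝ => -(Real.pi * ((-1)^m * (rhoP b a (fun z => S (-z)) t * Real.exp (-(m * t))))))
    simp only [neg_zero, neg_neg] at h2
    rw [← h2]
    apply intervalIntegral.integral_congr
    intro x hx
    rw [uIcc_of_le (by linarith)] at hx
    simp only
    rw [e3 x (by rw [abs_le]; exact ⟨hx.1, hx.2.trans hτ.le⟩)]
    simp
  have r3 : ‖∫ y in (0:ℝ)..Real.pi, f m ((-τ:ℝ) + y * I)‖ ≤ M * Real.exp (-(τ * m)) * Real.pi := by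
    have := intervalIntegral.norm_integral_le_of_norm_le_const e4
    rwa [sub_zero, abs_of_pos Real.pi_pos] at this
  have hmain : (∫ θ in (0:ℝ)..Real.pi, bfun a b S θ * cexp (I * m * θ)) =
      (∫ x in (-τ)..0, f m (x:ℂ)) * I - (∫ x in (-τ)..0, f m (x + Real.pi * I)) * I
      + ∫ y in (0:ℝ)..Real.pi, f m ((-τ:ℝ) + y * I) := by
    rw [← intervalIntegral.integral_congr (fun y _ => e1 y)]
    linear_combination (-I) * hrect + ((∫ y in (0:ℝ)..Real.pi, f m (y * I)) - ∫ y in (0:ℝ)..Real.pi, f m ((-τ:ℝ) + y * I)) * I_sq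
  rw [bhat, hmain, add_re, sub_re, r1, r2]
  have hpi := Real.pi_pos
  have h5 := (Complex.abs_re_le_norm _).trans r3
  set Z := (∫ y in (0:ℝ)..Real.pi, f m ((-τ:ℝ) + y * I)).re
  rw [show 1 / Real.pi * (Real.pi * (∫ t in (0:ℝ)..τ, rhoP a b S t * Real.exp (-(m * t))) - -(Real.pi * ((-1) ^ m * ∫ t in (0:ℝ)..τ, rhoP b a (fun z => S (-z)) t * Real.exp (-(m * t)))) + Z) - ((∫ t in (0:ℝ)..τ, rhoP a b S t * Real.exp (-(m * t))) + (-1) ^ m * ∫ t in (0:ℝ)..τ, rhoP b a (fun z => S (-z)) t * Real.exp (-(m * t))) = Z / Real.pi by field_simp; ring,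
    abs_div, abs_of_pos hpi, div_le_iff₀ hpi]
  exact h5
end SData

abbrev LR := Lp ℝ 2 (volume : Measure ℝ)

section
open Topology

lemma integrable_exp_abs {c : ℝ} (hc : 0 < c) : Integrable (fun u : ℝ => Real.exp (-(c * |u|))) := by
  rw [← integrableOn_univ, ← Iic_union_Ioi (a := (0:ℝ))]
  refine IntegrableOn.union ?_ ?_
  · refine (integrableOn_exp_mul_Iic hc 0).congr_fun ?_ measurableSet_Iic
    intro x hx
    simp only [mem_Iic] at hx
    simp [abs_of_nonpos hx]
  · refine (integrableOn_exp_mul_Ioi (a := -c) (by linarith) 0).congr_fun ?_ measurableSet_Ioi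
    intro x hx
    simp only [mem_Ioi] at hx
    simp [abs_of_pos hx]

lemma memLp_exp_abs {c : ℝ} (hc : 0 < c) : MemLp (fun u : ℝ => Real.exp (-(c * |u|))) 2 := by
  rw [memLp_two_iff_integrable_sq (by fun_prop)]
  refine (integrable_exp_abs (c := 2 * c) (by positivity)).congr (Eventually.of_forall fun u => ?_)
  simp only [← Real.exp_nat_mul]; congr 1; push_cast; ring

def eL (c : ℝ) : LR := if hc : 0 < c then (memLp_exp_abs hc).toLp _ else 0

lemma eL_ae {c : ℝ} (hc : 0 < c) : (eL c : ℝ → ℝ) =ᵐ[volume] fun u => Real.exp (-(c * |u|)) := by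
  rw [eL, dif_pos hc]; exact MemLp.coeFn_toLp _

lemma inner_LR (f g : LR) : inner ℝ f g = ∫ u, f u * g u := by
  rw [L2.inner_def]; congr 1; ext u; simp [mul_comm]

lemma LR_integrable_mul (f g : LR) : Integrable (fun u => f u * g u) := by
  have := L2.integrable_inner (𝕜 := ℝ) g f
  simpa using this

/-- the absolute value -/
lemma LR_abs (f : LR) : ∃ g : LR, (g : ℝ → ℝ) =ᵐ[volume] (fun u => |f u|) ∧ ‖g‖ = ‖f‖ := by
  refine ⟨|f|, Lp.coeFn_abs f, norm_abs_eq_norm f⟩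

lemma exp_mul_int {c : ℝ} (hc : 0 < c) (f : LR) :
    Integrable (fun u => Real.exp (-(c * |u|)) * |f u|) ∧
    (∫ u, Real.exp (-(c * |u|)) * |f u|) ≤ ‖eL c‖ * ‖f‖ := by
  obtain ⟨g, hg, hgn⟩ := LR_abs f
  have h1 : (fun u => (eL c) u * g u) =ᵐ[volume] (fun u => Real.exp (-(c * |u|)) * |f u|) := by
    filter_upwards [eL_ae hc, hg] with u h1 h2
    rw [h1, h2]
  refine ⟨(LR_integrable_mul (eL c) g).congr h1, ?_⟩
  rw [← integral_congr_ae h1, ← inner_LR, ← hgn]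
  exact real_inner_le_norm _ _

/-- multiplication operator -/
lemma mulOp_exists (m : ℝ → ℝ) (hm : Measurable m) {C : ℝ} (hC : ∀ x, |m x| ≤ C) :
    ∃ T : LR →L[ℝ] LR, ‖T‖ ≤ C ∧ ∀ f : LR, (T f : ℝ → ℝ) =ᵐ[volume] fun u => m u * f u := by
  have hC0 : 0 ≤ C := (abs_nonneg _).trans (hC 0)
  have hmem : ∀ f : LR, MemLp (fun u => m u * f u) 2 := by
    intro f
    refine MemLp.of_le_mul (c := C) (Lp.memLp f) (hm.aestronglyMeasurable.mul (Lp.aestronglyMeasurable f)) ?_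
    refine Eventually.of_forall fun u => ?_
    rw [norm_mul]; gcongr; exact hC u
  let T0 : LR →ₗ[ℝ] LR :=
    { toFun := fun f => (hmem f).toLp _
      map_add' := fun f g => by
        rw [← MemLp.toLp_add]
        apply MemLp.toLp_congr
        filter_upwards [Lp.coeFn_add f g] with u hu
        rw [hu]; simp only [Pi.add_apply, mul_add]
      map_smul' := fun r f => by
        simp only [RingHom.id_apply]
        rw [← MemLp.toLp_const_smul]
        apply MemLp.toLp_congr
        filter_upwards [Lp.coeFn_smul r f] with u hu
        rw [hu]; simp only [Pi.smul_apply, smul_eq_mul]; ring }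
  have hb : ∀ f, ‖T0 f‖ ≤ C * ‖f‖ := by
    intro f
    refine Lp.norm_le_mul_norm_of_ae_le_mul ?_
    filter_upwards [MemLp.coeFn_toLp (hmem f)] with u hu
    change ‖((hmem f).toLp _ : ℝ → ℝ) u‖ ≤ _
    rw [hu, norm_mul]; gcongr; exact hC u
  exact ⟨T0.mkContinuous C hb, T0.mkContinuous_norm_le hC0 hb, fun f => MemLp.coeFn_toLp (hmem f)⟩

open Classical in
def mulOp (m : ℝ → ℝ) : LR →L[ℝ] LR :=
  if h : ∃ T : LR →L[ℝ] LR, ∀ f : LR, (T f : ℝ → ℝ) =ᵐ[volume] fun u => m u * f u then h.choose else 0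

lemma mulOp_ae {m : ℝ → ℝ} (hm : Measurable m) {C : ℝ} (hC : ∀ x, |m x| ≤ C) (f : LR) :
    (mulOp m f : ℝ → ℝ) =ᵐ[volume] fun u => m u * f u := by
  obtain ⟨T, -, hT⟩ := mulOp_exists m hm hC
  have h : ∃ T : LR →L[ℝ] LR, ∀ f : LR, (T f : ℝ → ℝ) =ᵐ[volume] fun u => m u * f u := ⟨T, hT⟩
  rw [mulOp, dif_pos h]; exact h.choose_spec f

lemma mulOp_norm {m : ℝ → ℝ} (hm : Measurable m) {C : ℝ} (hC : ∀ x, |m x| ≤ C) : ‖mulOp m‖ ≤ C := by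
  obtain ⟨T, hn, hT⟩ := mulOp_exists m hm hC
  have : mulOp m = T := by
    ext1 f
    apply Lp.ext
    filter_upwards [mulOp_ae hm hC f, hT f] with u h1 h2
    rw [h1, h2]
  rw [this]; exact hn

lemma inner_mulOp {m : ℝ → ℝ} (hm : Measurable m) {C : ℝ} (hC : ∀ x, |m x| ≤ C) (f g : LR) :
    inner ℝ (mulOp m f) g = ∫ u, m u * f u * g u := by
  rw [inner_LR]; apply integral_congr_ae
  filter_upwards [mulOp_ae hm hC f] with u hu
  rw [hu]

/-- kernel operators -/
lemma kerInt (r : ℝ × ℝ → ℝ) (hr : Measurable r) {C : ℝ}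
    (hC : ∀ z, |r z| ≤ C * (Real.exp (-(1/4 * |z.1|)) * Real.exp (-(1/4 * |z.2|)))) (f g : LR) :
    Integrable (fun z : ℝ × ℝ => r z * (f z.1 * g z.2)) (volume.prod volume) ∧
    |∫ z : ℝ × ℝ, r z * (f z.1 * g z.2) ∂(volume.prod volume)| ≤ C * ‖eL (1/4)‖^2 * ‖f‖ * ‖g‖ := by
  have hq : (0:ℝ) < 1/4 := by norm_num
  have hC0 : 0 ≤ C := by
    have := (abs_nonneg _).trans (hC 0)
    simpa using this
  obtain ⟨f1, f2⟩ := exp_mul_int hq f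
  obtain ⟨g1, g2⟩ := exp_mul_int hq g
  have hd := (f1.mul_prod g1).const_mul C
  have hb : ∀ z : ℝ × ℝ, ‖r z * (f z.1 * g z.2)‖ ≤ C * (Real.exp (-(1/4 * |z.1|)) * |f z.1| * (Real.exp (-(1/4 * |z.2|)) * |g z.2|)) := by
    intro z
    rw [Real.norm_eq_abs, abs_mul, abs_mul]
    calc |r z| * (|f z.1| * |g z.2|) ≤ (C * (Real.exp (-(1/4 * |z.1|)) * Real.exp (-(1/4 * |z.2|)))) * (|f z.1| * |g z.2|) := by
          gcongr; exact hC z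
      _ = _ := by ring
  have hm : AEStronglyMeasurable (fun z : ℝ × ℝ => r z * (f z.1 * g z.2)) (volume.prod volume) := by
    refine hr.aestronglyMeasurable.mul ?_
    exact ((Lp.aestronglyMeasurable f).comp_fst).mul ((Lp.aestronglyMeasurable g).comp_snd)
  refine ⟨hd.mono' hm (Eventually.of_forall hb), ?_⟩
  refine (norm_integral_le_of_norm_le hd (Eventually.of_forall hb)).trans ?_
  rw [integral_const_mul, integral_prod_mul (fun u => Real.exp (-(1/4 * |u|)) * |f u|) (fun u => Real.exp (-(1/4 * |u|)) * |g u|)]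
  have h0 : 0 ≤ ∫ u, Real.exp (-(1/4 * |u|)) * |g u| := integral_nonneg fun u => by positivity
  calc C * ((∫ u, Real.exp (-(1/4 * |u|)) * |f u|) * ∫ u, Real.exp (-(1/4 * |u|)) * |g u|)
      ≤ C * ((‖eL (1/4)‖ * ‖f‖) * (‖eL (1/4)‖ * ‖g‖)) := by gcongr
    _ = _ := by ring

lemma kerOp_exists (r : ℝ × ℝ → ℝ) (hr : Measurable r) {C : ℝ}
    (hC : ∀ z, |r z| ≤ C * (Real.exp (-(1/4 * |z.1|)) * Real.exp (-(1/4 * |z.2|)))) :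
    ∃ T : LR →L[ℝ] LR, ‖T‖ ≤ C * ‖eL (1/4)‖^2 ∧ ∀ f g : LR, inner ℝ (T f) g =
      ∫ z : ℝ × ℝ, r z * (f z.1 * g z.2) ∂(volume.prod volume) := by
  have hC0 : 0 ≤ C := by
    have := (abs_nonneg _).trans (hC 0)
    simpa using this
  have key := kerInt r hr hC
  have ex1 : ∀ f g : LR, (fun z : ℝ × ℝ => (f + g : LR) z.1) =ᵐ[volume.prod volume] fun z => f z.1 + g z.1 := by
    intro f g
    exact Measure.quasiMeasurePreserving_fst.ae_eq_comp (Lp.coeFn_add f g)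
  have ex2 : ∀ f g : LR, (fun z : ℝ × ℝ => (f + g : LR) z.2) =ᵐ[volume.prod volume] fun z => f z.2 + g z.2 := by
    intro f g
    exact Measure.quasiMeasurePreserving_snd.ae_eq_comp (Lp.coeFn_add f g)
  have ex3 : ∀ (c : ℝ) (f : LR), (fun z : ℝ × ℝ => (c • f : LR) z.1) =ᵐ[volume.prod volume] fun z => c * f z.1 := by
    intro c f
    exact Measure.quasiMeasurePreserving_fst.ae_eq_comp (Lp.coeFn_smul c f)
  have ex4 : ∀ (c : ℝ) (f : LR), (fun z : ℝ × ℝ => (c • f : LR) z.2) =ᵐ[volume.prod volume] fun z => c * f z.2 := by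
    intro c f
    exact Measure.quasiMeasurePreserving_snd.ae_eq_comp (Lp.coeFn_smul c f)
  let B0 : LR →ₗ[ℝ] LR →ₗ[ℝ] ℝ := LinearMap.mk₂ ℝ
    (fun f g => ∫ z : ℝ × ℝ, r z * (f z.1 * g z.2) ∂(volume.prod volume))
    (fun f1 f2 g => by
      rw [← integral_add (key f1 g).1 (key f2 g).1]
      apply integral_congr_ae
      filter_upwards [ex1 f1 f2] with z hz
      rw [hz]; ring)
    (fun c f g => by
      rw [smul_eq_mul, ← integral_const_mul]
      apply integral_congr_ae
      filter_upwards [ex3 c f] with z hz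
      rw [hz]; ring)
    (fun f g1 g2 => by
      rw [← integral_add (key f g1).1 (key f g2).1]
      apply integral_congr_ae
      filter_upwards [ex2 g1 g2] with z hz
      rw [hz]; ring)
    (fun c f g => by
      rw [smul_eq_mul, ← integral_const_mul]
      apply integral_congr_ae
      filter_upwards [ex4 c g] with z hz
      rw [hz]; ring)
  let B : LR →L[ℝ] LR →L[ℝ] ℝ := LinearMap.mkContinuous₂ B0 (C * ‖eL (1/4)‖^2) (fun f g => (key f g).2)
  have hB : ∀ f g : LR, inner ℝ (InnerProductSpace.continuousLinearMapOfBilin (𝕜 := ℝ) B f) g =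
      ∫ z : ℝ × ℝ, r z * (f z.1 * g z.2) ∂(volume.prod volume) := by
    intro f g
    rw [InnerProductSpace.continuousLinearMapOfBilin_apply]
    rfl
  refine ⟨InnerProductSpace.continuousLinearMapOfBilin (𝕜 := ℝ) B, ?_, hB⟩
  refine ContinuousLinearMap.opNorm_le_bound _ (by positivity) fun f => ?_
  set y := InnerProductSpace.continuousLinearMapOfBilin (𝕜 := ℝ) B f
  have h1 := (le_abs_self _).trans ((key f y).2)
  rw [← hB f y, real_inner_self_eq_norm_sq] at h1
  rcases (norm_nonneg y).eq_or_lt with h | h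
  · rw [← h]; positivity
  · nlinarith

open Classical in
def kerOp (r : ℝ × ℝ → ℝ) : LR →L[ℝ] LR :=
  if h : ∃ T : LR →L[ℝ] LR, ∀ f g : LR, inner ℝ (T f) g =
      ∫ z : ℝ × ℝ, r z * (f z.1 * g z.2) ∂(volume.prod volume) then h.choose else 0

lemma inner_kerOp {r : ℝ × ℝ → ℝ} (hr : Measurable r) {C : ℝ}
    (hC : ∀ z, |r z| ≤ C * (Real.exp (-(1/4 * |z.1|)) * Real.exp (-(1/4 * |z.2|)))) (f g : LR) :
    inner ℝ (kerOp r f) g = ∫ z : ℝ × ℝ, r z * (f z.1 * g z.2) ∂(volume.prod volume) := by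
  obtain ⟨T, -, hT⟩ := kerOp_exists r hr hC
  have h : ∃ T : LR →L[ℝ] LR, ∀ f g : LR, inner ℝ (T f) g =
      ∫ z : ℝ × ℝ, r z * (f z.1 * g z.2) ∂(volume.prod volume) := ⟨T, hT⟩
  rw [kerOp, dif_pos h]; exact h.choose_spec f g

lemma kerOp_norm {r : ℝ × ℝ → ℝ} (hr : Measurable r) {C : ℝ}
    (hC : ∀ z, |r z| ≤ C * (Real.exp (-(1/4 * |z.1|)) * Real.exp (-(1/4 * |z.2|)))) :
    ‖kerOp r‖ ≤ C * ‖eL (1/4)‖^2 := by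
  obtain ⟨T, hn, hT⟩ := kerOp_exists r hr hC
  have : kerOp r = T := by
    ext1 f
    refine ext_inner_right ℝ fun g => ?_
    rw [hT, inner_kerOp hr hC]
  rw [this]; exact hn

/-- Taylor bounds -/
lemma taylor_bound {φ : ℝ → ℝ} {M : ℝ} (hM : ∀ t, 0 ≤ t → |φ t| ≤ M) (ha : AnalyticAt ℝ φ 0) (l : ℕ) :
    ∃ c : ℕ → ℝ, c 0 = φ 0 ∧ ∃ C, ∀ t, 0 ≤ t → |φ t - ∑ k ∈ Finset.range (l+1), c k * t ^ k| ≤ C * t ^ (l+1) := by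
  obtain ⟨p, hp⟩ := ha
  refine ⟨fun k => p.coeff k, hp.coeff_zero _, ?_⟩
  have h1 := hp.isBigO_sub_partialSum_pow (l+1)
  obtain ⟨C, hC⟩ := h1.bound
  rw [Metric.eventually_nhds_iff] at hC
  obtain ⟨δ, hδ, hC⟩ := hC
  have hM0 : 0 ≤ M := (abs_nonneg _).trans (hM 0 le_rfl)
  have hpart : ∀ t, p.partialSum (l+1) t = ∑ k ∈ Finset.range (l+1), p.coeff k * t^k := by
    intro t
    simp only [FormalMultilinearSeries.partialSum]
    refine Finset.sum_congr rfl fun k _ => ?_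
    rw [FormalMultilinearSeries.apply_eq_pow_smul_coeff, smul_eq_mul, mul_comm]
  refine ⟨|C| + (M + ∑ k ∈ Finset.range (l+1), |p.coeff k| * δ^k) / δ^(l+1), fun t ht => ?_⟩
  by_cases htδ : t < δ
  · have h2 := hC (y := t) (by simpa [abs_of_nonneg ht] using htδ)
    rw [zero_add, hpart, Real.norm_eq_abs, Real.norm_of_nonneg (by positivity), Real.norm_of_nonneg ht] at h2
    refine h2.trans ?_
    gcongr
    have : 0 ≤ (M + ∑ k ∈ Finset.range (l+1), |p.coeff k| * δ^k) / δ^(l+1) := by positivity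
    linarith [le_abs_self C]
  · push Not at htδ
    have h3 : ∀ k ∈ Finset.range (l+1), |p.coeff k * t^k| ≤ |p.coeff k| * δ^k / δ^(l+1) * t^(l+1) := by
      intro k hk
      rw [abs_mul, abs_of_nonneg (pow_nonneg ht k), mul_div_assoc, mul_assoc]
      gcongr
      have hk' : k ≤ l + 1 := by have := Finset.mem_range.mp hk; omega
      obtain ⟨j, hj⟩ := Nat.exists_eq_add_of_le hk'
      rw [hj, pow_add, pow_add, div_mul_eq_mul_div, le_div_iff₀ (by positivity)]
      have : δ^j ≤ t^j := by gcongr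
      have h4 : 0 ≤ t^k * δ^k := by positivity
      nlinarith
    have h4 : M ≤ M / δ^(l+1) * t^(l+1) := by
      have : δ^(l+1) ≤ t^(l+1) := by gcongr
      rw [div_mul_eq_mul_div, le_div_iff₀ (by positivity)]
      gcongr
    calc |φ t - ∑ k ∈ Finset.range (l+1), p.coeff k * t ^ k|
        ≤ |φ t| + ∑ k ∈ Finset.range (l+1), |p.coeff k * t^k| := by
          refine (abs_sub _ _).trans ?_
          gcongr; exact Finset.abs_sum_le_sum_abs _ _
      _ ≤ M / δ^(l+1) * t^(l+1) + ∑ k ∈ Finset.range (l+1), |p.coeff k| * δ^k / δ^(l+1) * t^(l+1) := by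
          gcongr with k hk
          · exact (hM t ht).trans h4
          · exact h3 k hk
      _ = (M + ∑ k ∈ Finset.range (l+1), |p.coeff k| * δ^k) / δ^(l+1) * t^(l+1) := by
          rw [← Finset.sum_mul, ← Finset.sum_div]; ring
      _ ≤ _ := by
          gcongr
          linarith [abs_nonneg C]

lemma pow_le_exp_quarter (k : ℕ) : ∃ C, 0 ≤ C ∧ ∀ s : ℝ, 0 ≤ s → s ^ k ≤ C * Real.exp (s / 4) := by
  refine ⟨4^k * k.factorial, by positivity, fun s hs => ?_⟩
  have := Real.pow_div_factorial_le_exp (s/4) (by positivity) k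
  rw [div_le_iff₀ (by positivity), div_pow, div_le_iff₀ (by positivity)] at this
  linarith

/-- good functions -/
def Good (C : ℝ) (ψ : ℝ → ℝ) : Prop := Measurable ψ ∧ ∀ s, 0 ≤ s → |ψ s| ≤ C * Real.exp (s / 4)

lemma AE.scaled {X : Type*} [NormedAddCommGroup X] [NormedSpace ℝ X] (Θ : (ℝ → ℝ) → X) {K : ℝ}
    (hadd : ∀ ψ₁ ψ₂ C₁ C₂, Good C₁ ψ₁ → Good C₂ ψ₂ → Θ (fun s => ψ₁ s + ψ₂ s) = Θ ψ₁ + Θ ψ₂)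
    (hsmul : ∀ (c : ℝ) ψ C, Good C ψ → Θ (fun s => c * ψ s) = c • Θ ψ)
    (hbd : ∀ ψ C, Good C ψ → ‖Θ ψ‖ ≤ K * C)
    {φ : ℝ → ℝ} (hφ : Measurable φ) {M : ℝ} (hM : ∀ t, 0 ≤ t → |φ t| ≤ M) (ha : AnalyticAt ℝ φ 0) :
    AE (fun n : ℕ => Θ (fun s => φ (s / n))) ∧
      Tendsto (fun n : ℕ => Θ (fun s => φ (s / n))) atTop (𝓝 (Θ (fun _ => φ 0))) := by
  have hpow : ∀ k, ∃ C, Good C (fun s => s^k) := by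
    intro k
    obtain ⟨C, hC0, hC⟩ := pow_le_exp_quarter k
    exact ⟨C, by fun_prop, fun s hs => by rw [abs_of_nonneg (by positivity)]; exact hC s hs⟩
  have hsum : ∀ (l : ℕ) (c : ℕ → ℝ), (∃ C, Good C (fun s => ∑ k ∈ Finset.range l, c k * s^k)) ∧
      Θ (fun s => ∑ k ∈ Finset.range l, c k * s^k) = ∑ k ∈ Finset.range l, c k • Θ (fun s => s^k) := by
    intro l c
    induction l with
    | zero =>
      have h0 : Good 0 (fun _ => (0:ℝ)) := ⟨measurable_const, fun s _ => by simp⟩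
      refine ⟨⟨0, by simpa using h0⟩, ?_⟩
      have := hsmul 0 _ _ h0
      simpa using this
    | succ l ih =>
      obtain ⟨⟨C, hC⟩, ih⟩ := ih
      obtain ⟨D, hD⟩ := hpow l
      have hD' : Good (|c l| * D) (fun s => c l * s^l) := by
        refine ⟨by fun_prop, fun s hs => ?_⟩
        rw [abs_mul, mul_assoc]; gcongr; exact hD.2 s hs
      simp only [Finset.sum_range_succ]
      refine ⟨⟨C + |c l| * D, ?_, ?_⟩, ?_⟩
      · exact hC.1.add hD'.1
      · intro s hs
        refine (abs_add_le _ _).trans ?_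
        rw [add_mul]; exact add_le_add (hC.2 s hs) (hD'.2 s hs)
      · rw [hadd _ _ _ _ hC hD', ih, hsmul _ _ _ hD]
  have key : ∀ l, ∃ c : ℕ → ℝ, c 0 = φ 0 ∧
      (fun n : ℕ => Θ (fun s => φ (s / n)) - ∑ k ∈ Finset.range (l+1), (((n:ℝ)⁻¹)^k * c k) • Θ (fun s => s^k))
      =O[atTop] (fun n : ℕ => ((n:ℝ)⁻¹)^(l+1)) := by
    intro l
    obtain ⟨c, hc0, C, hC⟩ := taylor_bound hM ha l
    obtain ⟨D, hD0, hD⟩ := pow_le_exp_quarter (l+1)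
    have hC0 : 0 ≤ C := by
      have := (abs_nonneg _).trans (hC 1 zero_le_one)
      simpa using this
    refine ⟨c, hc0, Asymptotics.IsBigO.of_bound (K * (C * D)) ?_⟩
    filter_upwards [eventually_ge_atTop 1] with n hn
    have hn' : (0:ℝ) < n := by exact_mod_cast hn
    obtain ⟨⟨D1, hD1⟩, h1⟩ := hsum (l+1) (fun k => ((n:ℝ)⁻¹)^k * c k)
    rw [← h1]
    have hφg : Good M (fun s => φ (s / n)) := by
      refine ⟨by fun_prop, fun s hs => (hM _ (by positivity)).trans ?_⟩
      have : 1 ≤ Real.exp (s/4) := Real.one_le_exp (by positivity)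
      have hM0 : 0 ≤ M := (abs_nonneg _).trans (hM 0 le_rfl)
      nlinarith
    have hD1' : Good D1 (fun s => (-1) * ∑ k ∈ Finset.range (l+1), ((n:ℝ)⁻¹)^k * c k * s^k) := by
      refine ⟨hD1.1.const_mul _, fun s hs => ?_⟩
      rw [abs_mul]; simpa using hD1.2 s hs
    have h2 : Θ (fun s => φ (s / n)) - Θ (fun s => ∑ k ∈ Finset.range (l+1), ((n:ℝ)⁻¹)^k * c k * s^k)
        = Θ (fun s => φ (s/n) + (-1) * ∑ k ∈ Finset.range (l+1), ((n:ℝ)⁻¹)^k * c k * s^k) := by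
      rw [hadd _ _ _ _ hφg hD1', hsmul _ _ _ hD1]; simp [sub_eq_add_neg]
    rw [h2]
    have h3 := hbd (fun s => φ (s/n) + (-1) * ∑ k ∈ Finset.range (l+1), ((n:ℝ)⁻¹)^k * c k * s^k)
      (C * D * ((n:ℝ)⁻¹)^(l+1)) ⟨hφg.1.add hD1'.1, ?_⟩
    · refine h3.trans (le_of_eq ?_)
      rw [Real.norm_of_nonneg (by positivity)]; ring
    · intro s hs
      have h4 := hC (s/n) (by positivity)
      have h5 : ∑ k ∈ Finset.range (l+1), ((n:ℝ)⁻¹)^k * c k * s^k = ∑ k ∈ Finset.range (l+1), c k * (s/n)^k := by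
        refine Finset.sum_congr rfl fun k _ => ?_
        rw [div_eq_mul_inv, mul_pow]; ring
      change |φ (s/n) + (-1) * ∑ k ∈ Finset.range (l+1), ((n:ℝ)⁻¹)^k * c k * s^k| ≤ _
      rw [h5, neg_one_mul, ← sub_eq_add_neg]
      refine h4.trans ?_
      rw [div_eq_mul_inv, mul_pow]
      have := hD s hs
      calc C * (s^(l+1) * (n:ℝ)⁻¹^(l+1)) ≤ C * (D * Real.exp (s/4) * (n:ℝ)⁻¹^(l+1)) := by gcongr
        _ = _ := by ring
  have an : ∀ (l : ℕ) (c : ℕ → ℝ), AnalyticAt ℝ (fun x : ℝ => ∑ k ∈ Finset.range (l+1), (x^k * c k) • Θ (fun s => s^k)) 0 := by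
    intro l c
    refine Finset.analyticAt_fun_sum _ fun k _ => ?_
    exact ((analyticAt_id.pow k).mul analyticAt_const).smul analyticAt_const
  refine ⟨fun l => ?_, ?_⟩
  · obtain ⟨c, -, hc⟩ := key l
    exact ⟨_, an l c, hc⟩
  · obtain ⟨c, h0, hc⟩ := key 0
    have h1 := AE.tendsto' (an 0 c) hc
    obtain ⟨D, hD⟩ := hpow 0
    have h2 := hsmul (φ 0) _ _ hD
    simp only [pow_zero, mul_one] at h2
    rw [h2]
    simpa [h0] using h1
end

section
open Topology

lemma int_split {f : ℝ → ℝ} (hf : Integrable f) :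
    ∫ u, f u = (∫ u in Ioi (0:ℝ), f u) + ∫ u in Ioi (0:ℝ), f (-u) := by
  rw [integral_comp_neg_Ioi, neg_zero, add_comm, ← setIntegral_union (Iic_disjoint_Ioi le_rfl) measurableSet_Ioi
    hf.integrableOn hf.integrableOn, Iic_union_Ioi, setIntegral_univ]

/-- Fejer-Riesz type inequality -/
lemma fejer_riesz (s : Finset ℕ) (c : ℕ → ℝ) :
    ∑ j ∈ s, ∑ k ∈ s, c j * c k * ((1 + (-1:ℝ)^(j+k)) / ((j+k:ℕ) + 1 : ℝ)) ≤ Real.pi * ∑ j ∈ s, (c j)^2 := by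
  have h1 : ∀ m : ℕ, ∫ θ in (0:ℝ)..Real.pi, Real.sin ((m + 1 : ℝ) * θ) = (1 + (-1:ℝ)^m) / (m + 1 : ℝ) := by
    intro m
    have hm : ((m:ℝ) + 1) ≠ 0 := by positivity
    rw [intervalIntegral.integral_comp_mul_left _ hm, integral_sin]
    have : Real.cos ((m+1:ℝ) * Real.pi) = (-1)^(m+1) := by
      have := Real.cos_nat_mul_pi (m+1); push_cast at this; exact this
    rw [this]; simp; field_simp; ring
  have h2 : ∀ j k : ℕ, ∫ θ in (0:ℝ)..Real.pi, Real.cos ((j - k : ℝ) * θ) = if j = k then Real.pi else 0 := by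
    intro j k
    split_ifs with h
    · simp [h]
    · have hm : (j:ℝ) - k ≠ 0 := by rw [sub_ne_zero]; exact_mod_cast h
      rw [intervalIntegral.integral_comp_mul_left _ hm, integral_cos]
      have : Real.sin (((j:ℝ) - k) * Real.pi) = 0 := by
        have := Real.sin_int_mul_pi ((j:ℤ) - k); push_cast at this; exact this
      simp [this]
  have hL : ∑ j ∈ s, ∑ k ∈ s, c j * c k * ((1 + (-1:ℝ)^(j+k)) / ((j+k:ℕ) + 1 : ℝ)) =
      ∫ θ in (0:ℝ)..Real.pi, ∑ j ∈ s, ∑ k ∈ s, c j * c k * Real.sin (((j+k:ℕ) + 1 : ℝ) * θ) := by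
    rw [intervalIntegral.integral_finsetSum (fun j _ => Continuous.intervalIntegrable (by fun_prop) _ _)]
    refine Finset.sum_congr rfl fun j _ => ?_
    rw [intervalIntegral.integral_finsetSum (fun j _ => Continuous.intervalIntegrable (by fun_prop) _ _)]
    refine Finset.sum_congr rfl fun k _ => ?_
    rw [intervalIntegral.integral_const_mul, h1]
  have hR : Real.pi * ∑ j ∈ s, (c j)^2 =
      ∫ θ in (0:ℝ)..Real.pi, ∑ j ∈ s, ∑ k ∈ s, c j * c k * Real.cos ((j - k : ℝ) * θ) := by
    rw [intervalIntegral.integral_finsetSum (fun j _ => Continuous.intervalIntegrable (by fun_prop) _ _), Finset.mul_sum]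
    refine Finset.sum_congr rfl fun j hj => ?_
    rw [intervalIntegral.integral_finsetSum (fun j _ => Continuous.intervalIntegrable (by fun_prop) _ _)]
    simp only [intervalIntegral.integral_const_mul, h2]
    simp [hj]; ring
  rw [hL, hR]
  refine intervalIntegral.integral_mono_on Real.pi_pos.le (Continuous.intervalIntegrable (by fun_prop) _ _)
    (Continuous.intervalIntegrable (by fun_prop) _ _) fun θ _ => ?_
  set X := ∑ j ∈ s, c j * Real.cos (j * θ) with hX
  set Y := ∑ j ∈ s, c j * Real.sin (j * θ) with hY
  have e1 : ∑ j ∈ s, ∑ k ∈ s, c j * c k * Real.cos ((j - k : ℝ) * θ) = X * X + Y * Y := by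
    rw [hX, hY, Finset.sum_mul_sum, Finset.sum_mul_sum, ← Finset.sum_add_distrib]
    refine Finset.sum_congr rfl fun j _ => ?_
    rw [← Finset.sum_add_distrib]
    refine Finset.sum_congr rfl fun k _ => ?_
    rw [sub_mul, Real.cos_sub]; ring
  have e2 : ∑ j ∈ s, ∑ k ∈ s, c j * c k * Real.sin (((j+k:ℕ) + 1 : ℝ) * θ) =
      Real.sin θ * (X * X) + Real.cos θ * (X * Y) + Real.cos θ * (Y * X) + (- Real.sin θ) * (Y * Y) := by
    rw [hX, hY, Finset.sum_mul_sum, Finset.sum_mul_sum, Finset.sum_mul_sum, Finset.sum_mul_sum]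
    simp only [Finset.mul_sum]
    simp only [← Finset.sum_add_distrib]
    refine Finset.sum_congr rfl fun j _ => ?_
    refine Finset.sum_congr rfl fun k _ => ?_
    have : ((j+k:ℕ) + 1 : ℝ) * θ = j * θ + k * θ + θ := by push_cast; ring
    rw [this, Real.sin_add, Real.sin_add, Real.cos_add]; ring
  rw [e1, e2]
  have h3 := Real.sin_sq_add_cos_sq θ
  have h4 : X * X + Y * Y - (Real.sin θ * (X * X) + Real.cos θ * (X * Y) + Real.cos θ * (Y * X) + (- Real.sin θ) * (Y * Y)) =
     1/2 * ((X*(1 - Real.sin θ) - Y * Real.cos θ)^2 + (X * Real.cos θ - Y * (1 + Real.sin θ))^2) := by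
     linear_combination (-1/2) * (X^2+Y^2) * h3
  nlinarith [sq_nonneg (X*(1 - Real.sin θ) - Y * Real.cos θ), sq_nonneg (X * Real.cos θ - Y * (1 + Real.sin θ))]

lemma hilbert_ineq (n : ℕ) (hn : 1 ≤ n) (s : Finset ℕ) (c : ℕ → ℝ) :
    ∑ j ∈ s, ∑ k ∈ s, c j * c k * ((1 + (-1:ℝ)^(j+k)) / ((j+k:ℕ) + n : ℝ)) ≤ Real.pi * ∑ j ∈ s, (c j)^2 := by
  refine le_trans ?_ (fejer_riesz s c)
  have key : ∀ N : ℕ, ∑ j ∈ s, ∑ k ∈ s, c j * c k * ((1 + (-1:ℝ)^(j+k)) / ((j+k:ℕ) + N + 1 : ℝ)) =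
      ∫ r in (0:ℝ)..1, r^N * ∑ j ∈ s, ∑ k ∈ s, c j * c k * (1 + (-1:ℝ)^(j+k)) * r^(j+k) := by
    intro N
    simp only [Finset.mul_sum]
    rw [intervalIntegral.integral_finsetSum (fun j _ => Continuous.intervalIntegrable (by fun_prop) _ _)]
    refine Finset.sum_congr rfl fun j _ => ?_
    rw [intervalIntegral.integral_finsetSum (fun j _ => Continuous.intervalIntegrable (by fun_prop) _ _)]
    refine Finset.sum_congr rfl fun k _ => ?_
    have : ∀ r : ℝ, r^N * (c j * c k * (1 + (-1:ℝ)^(j+k)) * r^(j+k)) = (c j * c k * (1 + (-1:ℝ)^(j+k))) * r^(j+k+N) := by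
      intro r; rw [pow_add r (j+k) N]; ring
    simp only [this]
    rw [intervalIntegral.integral_const_mul, integral_pow]
    simp; ring
  have k0 := key 0
  have k1 := key (n-1)
  have hn' : ((n-1:ℕ):ℝ) = n - 1 := by push_cast [hn]; ring
  simp only [hn', Nat.cast_zero] at k0 k1
  have r1 : ∀ x : ℝ, x + ((n:ℝ) - 1) + 1 = x + n := fun x => by ring
  simp only [r1, add_zero] at k0 k1
  rw [k1, k0]
  refine intervalIntegral.integral_mono_on zero_le_one (Continuous.intervalIntegrable (by fun_prop) _ _)
    (Continuous.intervalIntegrable (by fun_prop) _ _) fun r hr => ?_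
  have hq : ∑ j ∈ s, ∑ k ∈ s, c j * c k * (1 + (-1:ℝ)^(j+k)) * r^(j+k) = (∑ j ∈ s, c j * r^j)^2 + (∑ j ∈ s, c j * (-r)^j)^2 := by
    rw [sq, sq, Finset.sum_mul_sum, Finset.sum_mul_sum]
    simp only [← Finset.sum_add_distrib]
    refine Finset.sum_congr rfl fun j _ => ?_
    refine Finset.sum_congr rfl fun k _ => ?_
    rw [neg_pow r j, neg_pow r k, pow_add, pow_add]; ring
  rw [hq]
  rw [pow_zero]
  have h5 : r^(n-1) ≤ 1 := pow_le_one₀ hr.1 hr.2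
  gcongr

def sg (u : ℝ) : ℝ := if 0 < u then 1 else -1

lemma sg_meas : Measurable sg := by
  unfold sg; exact Measurable.ite measurableSet_Ioi measurable_const measurable_const

lemma sg_abs (u : ℝ) : |sg u| = 1 := by unfold sg; split_ifs <;> simp

lemma sg_pos {u : ℝ} (h : 0 < u) : sg u = 1 := by simp [sg, h]
lemma sg_neg' {u : ℝ} (h : 0 < u) : sg (-u) = -1 := by simp [sg, h.le]

def af (n j : ℕ) (u : ℝ) : ℝ := (Real.sqrt n)⁻¹ * Real.exp (-(1/2 * |u|)) * (sg u * Real.exp (-(|u|/n)))^j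

lemma af_meas (n j : ℕ) : Measurable (af n j) := by
  unfold af; have := sg_meas; fun_prop

lemma af_abs (n j : ℕ) (u : ℝ) : |af n j u| = (Real.sqrt n)⁻¹ * Real.exp (-(1/2 * |u|)) * (Real.exp (-(|u|/n)))^j := by
  unfold af
  rw [abs_mul, abs_mul, abs_pow, abs_mul, sg_abs, abs_of_nonneg (by positivity), Real.abs_exp, Real.abs_exp, one_mul]

lemma af_le (n j : ℕ) (u : ℝ) : |af n j u| ≤ (Real.sqrt n)⁻¹ * Real.exp (-(1/2 * |u|)) := by
  rw [af_abs]
  have : (Real.exp (-(|u|/n)))^j ≤ 1 := pow_le_one₀ (by positivity) (by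
    rw [Real.exp_le_one_iff]
    have : 0 ≤ |u|/n := by positivity
    linarith)
  have h2 : 0 ≤ (Real.sqrt n)⁻¹ * Real.exp (-(1/2 * |u|)) := by positivity
  nlinarith

lemma af_memLp (n j : ℕ) : MemLp (af n j) 2 := by
  refine MemLp.of_le_mul (c := (Real.sqrt n)⁻¹) (memLp_exp_abs (c := 1/2) (by norm_num)) (af_meas n j).aestronglyMeasurable
    (Eventually.of_forall fun u => ?_)
  simpa using af_le n j u

def av (n j : ℕ) : LR := (af_memLp n j).toLp _

lemma av_ae (n j : ℕ) : (av n j : ℝ → ℝ) =ᵐ[volume] af n j := MemLp.coeFn_toLp _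

/-- weighted gram matrix -/
lemma af_mul {n : ℕ} (j k : ℕ) (u : ℝ) :
    af n j u * af n k u = (n:ℝ)⁻¹ * Real.exp (-|u|) * (sg u * Real.exp (-(|u|/n)))^(j+k) := by
  unfold af
  have h1 : (Real.sqrt n)⁻¹ * (Real.sqrt n)⁻¹ = (n:ℝ)⁻¹ := by rw [← mul_inv, Real.mul_self_sqrt (by positivity)]
  have h2 : Real.exp (-(1/2 * |u|)) * Real.exp (-(1/2 * |u|)) = Real.exp (-|u|) := by rw [← Real.exp_add]; ring_nf
  rw [← h1, ← h2, pow_add]; ring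

lemma av_gram {n : ℕ} (hn : 1 ≤ n) (j k : ℕ) :
    inner ℝ (av n j) (av n k) = (1 + (-1:ℝ)^(j+k)) / ((j+k:ℕ) + n : ℝ) := by
  have hn' : (0:ℝ) < n := by exact_mod_cast hn
  have hI := LR_integrable_mul (av n j) (av n k)
  have hae : (fun u => av n j u * av n k u) =ᵐ[volume] fun u => af n j u * af n k u := by
    filter_upwards [av_ae n j, av_ae n k] with u h1 h2; rw [h1, h2]
  rw [inner_LR, integral_congr_ae hae, int_split (hI.congr hae)]
  have e1 : ∀ u ∈ Ioi (0:ℝ), af n j u * af n k u = (n:ℝ)⁻¹ * Real.exp (-(1 + (j+k:ℕ)/n) * u) := by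
    intro u hu
    rw [af_mul, sg_pos hu, abs_of_pos hu, one_mul, ← Real.exp_nat_mul, mul_assoc, ← Real.exp_add]
    congr 2; ring
  have e2 : ∀ u ∈ Ioi (0:ℝ), af n j (-u) * af n k (-u) = (-1)^(j+k) * ((n:ℝ)⁻¹ * Real.exp (-(1 + (j+k:ℕ)/n) * u)) := by
    intro u hu
    rw [af_mul, sg_neg' hu, abs_neg, abs_of_pos hu, mul_pow, ← Real.exp_nat_mul]
    have : Real.exp (-(1 + (j+k:ℕ)/n) * u) = Real.exp (-u) * Real.exp ((j+k:ℕ) * (-(u/n))) := by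
      rw [← Real.exp_add]; congr 1; ring
    rw [this]; ring
  have hpos : (0:ℝ) < 1 + (j+k:ℕ)/n := by positivity
  rw [setIntegral_congr_fun measurableSet_Ioi e1, setIntegral_congr_fun measurableSet_Ioi e2, integral_const_mul,
    integral_const_mul, integral_exp_mul_Ioi (by linarith)]
  simp only [mul_zero, Real.exp_zero]
  have h3 : ((j+k:ℕ):ℝ) + n ≠ 0 := by positivity
  have : (n:ℝ)⁻¹ * (-1 / -(1 + ((j+k:ℕ):ℝ)/n)) = 1 / (((j+k:ℕ):ℝ) + n) := by
    rw [neg_div_neg_eq]; field_simp; rw [add_comm]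
  rw [integral_const_mul, integral_exp_mul_Ioi (by linarith)]
  simp only [mul_zero, Real.exp_zero]
  rw [this]; ring

lemma av_bessel {n : ℕ} (hn : 1 ≤ n) (s : Finset ℕ) (c : ℕ → ℝ) :
    ‖∑ j ∈ s, c j • av n j‖ ^ 2 ≤ (Real.sqrt Real.pi) ^ 2 * ∑ j ∈ s, (c j) ^ 2 := by
  rw [Real.sq_sqrt Real.pi_pos.le, ← real_inner_self_eq_norm_sq]
  refine le_trans (le_of_eq ?_) (hilbert_ineq n hn s c)
  simp only [sum_inner, inner_sum, real_inner_smul_left, real_inner_smul_right, av_gram hn]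
  refine Finset.sum_congr rfl fun j _ => ?_
  refine Finset.sum_congr rfl fun k _ => ?_
  ring

open Classical in
def Aop (n : ℕ) : l2 →L[ℝ] LR :=
  if h : 1 ≤ n then (bessel_clm (av n) _ (Real.sqrt_nonneg _) (av_bessel h)).choose else 0

lemma Aop_spec {n : ℕ} (hn : 1 ≤ n) : ‖Aop n‖ ≤ Real.sqrt Real.pi ∧ (∀ j, Aop n (eb j) = av n j) ∧
    ∀ c : l2, HasSum (fun j => c j • av n j) (Aop n c) := by
  rw [Aop, dif_pos hn]
  exact (bessel_clm (av n) _ (Real.sqrt_nonneg _) (av_bessel hn)).choose_spec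

lemma Aop_adj {n : ℕ} (hn : 1 ≤ n) (f : LR) (j : ℕ) :
    ((Aop n).adjoint f : ℕ → ℝ) j = inner ℝ (av n j) f := by
  rw [← inner_eb, ContinuousLinearMap.adjoint_inner_right, (Aop_spec hn).2.1]

/-- K operator -/
def Kop (n : ℕ) : LR →L[ℝ] LR := (Aop n).comp (Aop n).adjoint

lemma Kop_inner {n : ℕ} (hn : 1 ≤ n) (f g : LR) :
    HasSum (fun j => inner ℝ (av n j) f * inner ℝ (av n j) g) (inner ℝ (Kop n f) g) := by
  have h1 := (Aop_spec hn).2.2 ((Aop n).adjoint f)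
  have h2 := h1.mapL (innerSL ℝ g)
  simp only [map_smul, innerSL_apply_apply, smul_eq_mul, Aop_adj hn] at h2
  rw [real_inner_comm]
  refine h2.congr_fun ?_
  intro j
  simp [real_inner_comm]
end

section
open Topology

lemma kerOp_add {r₁ r₂ : ℝ × ℝ → ℝ} (h₁ : Measurable r₁) (h₂ : Measurable r₂) {C₁ C₂ : ℝ}
    (hC₁ : ∀ z, |r₁ z| ≤ C₁ * (Real.exp (-(1/4 * |z.1|)) * Real.exp (-(1/4 * |z.2|))))
    (hC₂ : ∀ z, |r₂ z| ≤ C₂ * (Real.exp (-(1/4 * |z.1|)) * Real.exp (-(1/4 * |z.2|)))) :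
    kerOp (fun z => r₁ z + r₂ z) = kerOp r₁ + kerOp r₂ := by
  ext1 f
  refine ext_inner_right ℝ fun g => ?_
  have hC : ∀ z, |r₁ z + r₂ z| ≤ (C₁ + C₂) * (Real.exp (-(1/4 * |z.1|)) * Real.exp (-(1/4 * |z.2|))) := fun z => by
    rw [add_mul]; exact (abs_add_le _ _).trans (add_le_add (hC₁ z) (hC₂ z))
  rw [inner_kerOp (r := fun z => r₁ z + r₂ z) (h₁.add h₂) hC, add_apply, inner_add_left, inner_kerOp h₁ hC₁,
    inner_kerOp h₂ hC₂, ← integral_add (kerInt r₁ h₁ hC₁ f g).1 (kerInt r₂ h₂ hC₂ f g).1]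
  congr 1; ext z; ring

lemma kerOp_smul {r : ℝ × ℝ → ℝ} (h : Measurable r) {C : ℝ} (c : ℝ)
    (hC : ∀ z, |r z| ≤ C * (Real.exp (-(1/4 * |z.1|)) * Real.exp (-(1/4 * |z.2|)))) :
    kerOp (fun z => c * r z) = c • kerOp r := by
  ext1 f
  refine ext_inner_right ℝ fun g => ?_
  have hC' : ∀ z, |c * r z| ≤ (|c| * C) * (Real.exp (-(1/4 * |z.1|)) * Real.exp (-(1/4 * |z.2|))) := fun z => by
    rw [abs_mul, mul_assoc]; gcongr; exact hC z
  rw [inner_kerOp (r := fun z => c * r z) (h.const_mul c) hC', smul_apply, real_inner_smul_left, inner_kerOp h hC, ← integral_const_mul]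
  congr 1; ext z; ring

/-- the kernel attached to a sector `σ` and function `ψ` -/
def secK (q : Bool) (ψ : ℝ → ℝ) (z : ℝ × ℝ) : ℝ :=
  (if (0 < z.1 ↔ 0 < z.2) ↔ q then 1 else 0) * (Real.exp (-(1/2 * (|z.1| + |z.2|))) * ψ (|z.1| + |z.2|))

lemma secK_meas (q : Bool) {ψ : ℝ → ℝ} (h : Measurable ψ) : Measurable (secK q ψ) := by
  unfold secK
  refine Measurable.mul (Measurable.ite ?_ measurable_const measurable_const) (by fun_prop)
  have h1 : MeasurableSet {z : ℝ × ℝ | 0 < z.1} := measurableSet_lt measurable_const measurable_fst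
  have h2 : MeasurableSet {z : ℝ × ℝ | 0 < z.2} := measurableSet_lt measurable_const measurable_snd
  exact (h1.iff h2).iff (MeasurableSet.const _)

lemma secK_bound (q : Bool) {ψ : ℝ → ℝ} {C : ℝ} (h : Good C ψ) (z : ℝ × ℝ) :
    |secK q ψ z| ≤ C * (Real.exp (-(1/4 * |z.1|)) * Real.exp (-(1/4 * |z.2|))) := by
  have hs : 0 ≤ |z.1| + |z.2| := by positivity
  have hC : 0 ≤ C := by
    have := (abs_nonneg _).trans (h.2 0 le_rfl); simpa using this
  unfold secK
  rw [abs_mul, abs_mul, Real.abs_exp]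
  have h1 : |(if (0 < z.1 ↔ 0 < z.2) ↔ q then (1:ℝ) else 0)| ≤ 1 := by split_ifs <;> simp
  have h2 : Real.exp (-(1/2 * (|z.1| + |z.2|))) * |ψ (|z.1| + |z.2|)| ≤ C * (Real.exp (-(1/4 * |z.1|)) * Real.exp (-(1/4 * |z.2|))) := by
    calc _ ≤ Real.exp (-(1/2 * (|z.1| + |z.2|))) * (C * Real.exp ((|z.1| + |z.2|)/4)) := by gcongr; exact h.2 _ hs
      _ = C * (Real.exp (-(1/2 * (|z.1| + |z.2|))) * Real.exp ((|z.1| + |z.2|)/4)) := by ring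
      _ = _ := by rw [← Real.exp_add, ← Real.exp_add]; congr 2; ring
  calc _ ≤ 1 * (Real.exp (-(1/2 * (|z.1| + |z.2|))) * |ψ (|z.1| + |z.2|)|) := by gcongr
    _ ≤ _ := by rw [one_mul]; exact h2

lemma secOp_AE (q : Bool) {φ : ℝ → ℝ} (hφ : Measurable φ) {M : ℝ} (hM : ∀ t, 0 ≤ t → |φ t| ≤ M) (ha : AnalyticAt ℝ φ 0) :
    AE (fun n : ℕ => kerOp (secK q (fun s => φ (s / n)))) := by
  refine (AE.scaled (fun ψ => kerOp (secK q ψ)) (K := ‖eL (1/4)‖^2) ?_ ?_ ?_ hφ hM ha).1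
  · intro ψ₁ ψ₂ C₁ C₂ h₁ h₂
    rw [← kerOp_add (secK_meas q h₁.1) (secK_meas q h₂.1) (secK_bound q h₁) (secK_bound q h₂)]
    congr 1; ext z; simp only [secK]; ring
  · intro c ψ C h
    rw [← kerOp_smul (secK_meas q h.1) c (secK_bound q h)]
    congr 1; ext z; simp only [secK]; ring
  · intro ψ C h
    rw [mul_comm]; exact kerOp_norm (secK_meas q h.1) (secK_bound q h)

/-- special functions -/
def gS : ℝ → ℝ := dslope (fun y => 1 - Real.exp (-y)) 0
def phiP (y : ℝ) : ℝ := -(dslope gS 0 y) / gS y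
def phiM (y : ℝ) : ℝ := 1 / (1 + Real.exp (-y))

lemma analyticAt_dslope {f : ℝ → ℝ} (h : AnalyticAt ℝ f 0) : AnalyticAt ℝ (dslope f 0) 0 := by
  obtain ⟨p, hp⟩ := h
  exact ⟨_, hp.has_fpower_series_dslope_fslope⟩

lemma gS_an : AnalyticAt ℝ gS 0 := by
  apply analyticAt_dslope; fun_prop

lemma gS_zero : gS 0 = 1 := by
  rw [gS, dslope_same]
  have : HasDerivAt (fun y : ℝ => 1 - Real.exp (-y)) (1) 0 := by
    have := ((hasDerivAt_neg (0:ℝ)).exp).const_sub 1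
    simpa using this
  exact this.deriv

lemma gS_ne {y : ℝ} (h : y ≠ 0) : gS y = (1 - Real.exp (-y)) / y := by
  rw [gS, dslope_of_ne _ h, slope_def_field]; simp

lemma phiP_ne {y : ℝ} (h : 0 < y) : phiP y = 1 / (1 - Real.exp (-y)) - 1 / y := by
  have h1 : 0 < 1 - Real.exp (-y) := by
    have : Real.exp (-y) < 1 := by rw [Real.exp_lt_one_iff]; linarith
    linarith
  rw [phiP, dslope_of_ne _ h.ne', slope_def_field, gS_zero, gS_ne h.ne']
  have h2 := h1.ne'
  have h3 := h.ne'
  generalize Real.exp (-y) = e at *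
  rw [sub_zero]
  field_simp
  ring

lemma phiP_an : AnalyticAt ℝ phiP 0 := by
  unfold phiP
  exact (analyticAt_dslope gS_an).neg.div gS_an (by rw [gS_zero]; norm_num)

lemma phiM_an : AnalyticAt ℝ phiM 0 := by
  unfold phiM
  refine analyticAt_const.div (by fun_prop) (by positivity)

lemma gS_meas : Measurable gS := by
  have : gS = fun y => if y = 0 then 1 else (1 - Real.exp (-y)) / y := by
    ext y; split_ifs with h
    · rw [h, gS_zero]
    · exact gS_ne h
  rw [this]
  exact Measurable.ite (measurableSet_singleton 0) measurable_const (by fun_prop)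

lemma phiP_meas : Measurable phiP := by
  have : (dslope gS 0) = fun y => if y = 0 then dslope gS 0 0 else (gS y - 1) / y := by
    ext y; split_ifs with h
    · rw [h]
    · rw [dslope_of_ne _ h, slope_def_field, gS_zero]; simp
  unfold phiP
  rw [this]
  have := gS_meas
  exact ((Measurable.ite (measurableSet_singleton 0) measurable_const (by fun_prop)).neg).div this

lemma phiP_bd : ∃ M, ∀ t, 0 ≤ t → |phiP t| ≤ M := by
  refine ⟨|phiP 0| + 1, fun t ht => ?_⟩
  rcases ht.eq_or_lt with h | h
  · rw [← h]; linarith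
  · rw [phiP_ne h]
    have h1 : 0 < 1 - Real.exp (-t) := by
      have : Real.exp (-t) < 1 := by rw [Real.exp_lt_one_iff]; linarith
      linarith
    have h2 : 1 - Real.exp (-t) ≤ t := by have := Real.add_one_le_exp (-t); linarith
    have h3 : t ≤ Real.exp t - 1 := by have := Real.add_one_le_exp t; linarith
    have h4 : Real.exp t * Real.exp (-t) = 1 := by rw [← Real.exp_add]; simp
    have h5 : 1 / t ≤ 1 / (1 - Real.exp (-t)) := one_div_le_one_div_of_le h1 h2
    have h6 : 1 / (1 - Real.exp (-t)) ≤ 1 / t + 1 := by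
      rw [div_add_one h.ne', div_le_div_iff₀ h1 h]
      have := Real.exp_pos (-t)
      nlinarith
    rw [abs_of_nonneg (by linarith)]
    linarith [abs_nonneg (phiP 0)]

lemma phiM_bd : ∀ t, 0 ≤ t → |phiM t| ≤ 1 := by
  intro t _
  unfold phiM
  have := Real.exp_pos (-t)
  rw [abs_of_nonneg (by positivity), div_le_one (by positivity)]; linarith

/-- correction operator -/
def Rop (n : ℕ) : LR →L[ℝ] LR := (n:ℝ)⁻¹ • (kerOp (secK true (fun s => phiP (s / n))) + kerOp (secK false (fun s => phiM (s / n))))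

lemma Rop_AE : AE Rop := by
  obtain ⟨M, hM⟩ := phiP_bd
  exact AE.invn.smul ((secOp_AE true phiP_meas hM phiP_an).add (secOp_AE false (by unfold phiM; fun_prop) phiM_bd phiM_an))

/-- The kernels on the cut region -/
def kn (n : ℕ) (z : ℝ × ℝ) : ℝ := (n:ℝ)⁻¹ * Real.exp (-(1/2 * (|z.1| + |z.2|))) / (1 - sg z.1 * sg z.2 * Real.exp (-((|z.1| + |z.2|)/n)))

lemma kn_split {n : ℕ} (hn : 1 ≤ n) {z : ℝ × ℝ} (h1 : z.1 ≠ 0) (h2 : z.2 ≠ 0) :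
    kn n z = secK true (fun s => 1 / s) z + (n:ℝ)⁻¹ * (secK true (fun s => phiP (s / n)) z + secK false (fun s => phiM (s / n)) z) := by
  have hn' : (0:ℝ) < n := by exact_mod_cast hn
  have hs : 0 < |z.1| + |z.2| := by positivity
  have hp := phiP_ne (y := (|z.1| + |z.2|)/n) (by positivity)
  have hd : 0 < 1 - Real.exp (-((|z.1| + |z.2|)/n)) := by
    have : Real.exp (-((|z.1| + |z.2|)/n)) < 1 := by
      rw [Real.exp_lt_one_iff]; have : 0 < (|z.1| + |z.2|)/n := by positivity
      linarith
    linarith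
  by_cases c1 : 0 < z.1 <;> by_cases c2 : 0 < z.2 <;>
    simp only [kn, secK, sg, c1, c2, hp, phiM, if_true, if_false, iff_self, true_iff, false_iff, iff_true, iff_false,
      Bool.false_eq_true, not_true_eq_false, not_false_eq_true, one_mul, zero_mul, mul_one, mul_neg, neg_mul, neg_neg, add_zero, zero_add, sub_neg_eq_add]
  all_goals field_simp
  all_goals ring

def chi (δ : ℝ) (u : ℝ) : ℝ := if δ ≤ |u| then 1 else 0

lemma chi_meas (δ : ℝ) : Measurable (chi δ) := by
  unfold chi
  exact Measurable.ite (measurableSet_le measurable_const (by fun_prop)) measurable_const measurable_const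

lemma chi_abs (δ u : ℝ) : |chi δ u| ≤ 1 := by unfold chi; split_ifs <;> simp

lemma chi_tendsto (f : LR) : Tendsto (fun k : ℕ => mulOp (chi ((k:ℝ)⁻¹)) f) atTop (𝓝 f) := by
  rw [tendsto_iff_norm_sub_tendsto_zero]
  have h1 : ∀ k : ℕ, ‖mulOp (chi ((k:ℝ)⁻¹)) f - f‖^2 = ∫ u, ((chi ((k:ℝ)⁻¹) u - 1) * f u)^2 := by
    intro k
    rw [← real_inner_self_eq_norm_sq, inner_LR]
    apply integral_congr_ae
    filter_upwards [mulOp_ae (chi_meas _) (chi_abs ((k:ℝ)⁻¹)) f, Lp.coeFn_sub (mulOp (chi ((k:ℝ)⁻¹)) f) f] with u e1 e2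
    rw [e2, Pi.sub_apply, e1]; ring
  have h2 : Tendsto (fun k : ℕ => ∫ u, ((chi ((k:ℝ)⁻¹) u - 1) * f u)^2) atTop (𝓝 (∫ u : ℝ, (0:ℝ))) := by
    refine tendsto_integral_of_dominated_convergence (fun u => f u * f u) ?_ (LR_integrable_mul f f) ?_ ?_
    · intro k
      have := (chi_meas ((k:ℝ)⁻¹)).sub_const 1
      exact (this.aestronglyMeasurable.mul (Lp.aestronglyMeasurable f)).pow 2
    · intro k
      refine Eventually.of_forall fun u => ?_
      rw [Real.norm_of_nonneg (by positivity), mul_pow, ← sq]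
      have : (chi ((k:ℝ)⁻¹) u - 1)^2 ≤ 1 := by unfold chi; split_ifs <;> simp
      nlinarith [sq_nonneg (f u)]
    · have : ∀ᵐ u : ℝ, u ≠ 0 := by simp [ae_iff]
      filter_upwards [this] with u hu
      have h3 : ∀ᶠ k : ℕ in atTop, ((k:ℝ)⁻¹) < |u| :=
        (tendsto_inv_atTop_nhds_zero_nat (𝕜 := ℝ)).eventually_lt_const (by positivity)
      refine tendsto_const_nhds.congr' ?_
      filter_upwards [h3] with k hk
      simp [chi, hk.le]
  simp only [← h1, integral_zero] at h2
  have := h2.sqrt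
  simpa using this

lemma Kop_cut {n : ℕ} (hn : 1 ≤ n) {δ : ℝ} (hδ : 0 < δ) (f g : LR) :
    inner ℝ (Kop n (mulOp (chi δ) f)) (mulOp (chi δ) g) =
      ∫ z : ℝ × ℝ, kn n z * (mulOp (chi δ) f z.1 * mulOp (chi δ) g z.2) ∂(volume.prod volume) := by
  have hn' : (0:ℝ) < n := by exact_mod_cast hn
  set f' := mulOp (chi δ) f with hf'
  set g' := mulOp (chi δ) g with hg'
  have aef := mulOp_ae (chi_meas δ) (chi_abs δ) f
  have aeg := mulOp_ae (chi_meas δ) (chi_abs δ) g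
  have h1 := Kop_inner hn f' g'
  have e1 : ∀ (j : ℕ) (f : LR), inner ℝ (av n j) f = ∫ u, af n j u * f u := by
    intro j f
    rw [inner_LR]; apply integral_congr_ae
    filter_upwards [av_ae n j] with u hu; rw [hu]
  have ei : ∀ (j : ℕ) (f : LR), Integrable (fun u => af n j u * f u) := by
    intro j f
    refine (LR_integrable_mul (av n j) f).congr ?_
    filter_upwards [av_ae n j] with u hu; rw [hu]
  have e2 : ∀ j : ℕ, inner ℝ (av n j) f' * inner ℝ (av n j) g' =
      ∫ z : ℝ × ℝ, (af n j z.1 * f' z.1) * (af n j z.2 * g' z.2) ∂(volume.prod volume) := by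
    intro j
    rw [e1, e1, ← integral_prod_mul (fun u => af n j u * f' u) (fun u => af n j u * g' u)]
  set q := Real.exp (-(δ/n)) with hq
  have hq1 : q < 1 := by
    rw [hq, Real.exp_lt_one_iff]; have : 0 < δ/n := by positivity
    linarith
  have hq0 : 0 < q := Real.exp_pos _
  have e3 : ∀ (j : ℕ) (f f' : LR), (f' : ℝ → ℝ) =ᵐ[volume] (fun u => chi δ u * f u) →
      (∫ u, ‖af n j u * f' u‖) ≤ q^j * ((Real.sqrt n)⁻¹ * (‖eL (1/2)‖ * ‖f'‖)) := by
    intro j f f' haf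
    obtain ⟨i1, i2⟩ := exp_mul_int (c := 1/2) (by norm_num) f'
    have : (∫ u, ‖af n j u * f' u‖) ≤ ∫ u, q^j * ((Real.sqrt n)⁻¹ * (Real.exp (-(1/2 * |u|)) * |f' u|)) := by
      refine integral_mono_ae (ei j f').norm ((i1.const_mul _).const_mul _) ?_
      filter_upwards [haf] with u hu
      by_cases hc : δ ≤ |u|
      · rw [norm_mul, Real.norm_eq_abs, Real.norm_eq_abs, af_abs]
        have : Real.exp (-(|u|/n)) ≤ q := by rw [hq]; gcongr
        have h4 : Real.exp (-(|u|/n))^j ≤ q^j := by gcongr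
        calc _ = Real.exp (-(|u|/n))^j * ((Real.sqrt n)⁻¹ * (Real.exp (-(1/2 * |u|)) * |f' u|)) := by ring
          _ ≤ _ := by gcongr
      · rw [hu]; simp [chi, hc]
    refine this.trans ?_
    rw [integral_const_mul, integral_const_mul]
    gcongr
  have h2 : HasSum (fun j => ∫ z : ℝ × ℝ, (af n j z.1 * f' z.1) * (af n j z.2 * g' z.2) ∂(volume.prod volume))
      (∫ z : ℝ × ℝ, ∑' j : ℕ, (af n j z.1 * f' z.1) * (af n j z.2 * g' z.2) ∂(volume.prod volume)) := by
    refine hasSum_integral_of_summable_integral_norm (fun j => (ei j f').mul_prod (ei j g')) ?_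
    have e4 : ∀ j, (∫ z : ℝ × ℝ, ‖(af n j z.1 * f' z.1) * (af n j z.2 * g' z.2)‖ ∂(volume.prod volume)) =
        (∫ u, ‖af n j u * f' u‖) * (∫ u, ‖af n j u * g' u‖) := by
      intro j
      rw [← integral_prod_mul (fun u => ‖af n j u * f' u‖) (fun u => ‖af n j u * g' u‖)]
      simp only [norm_mul]
    simp only [e4]
    have hg : Summable fun j : ℕ => (q*q)^j * (((Real.sqrt n)⁻¹ * (‖eL (1/2)‖ * ‖f'‖)) * ((Real.sqrt n)⁻¹ * (‖eL (1/2)‖ * ‖g'‖))) :=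
      (summable_geometric_of_lt_one (by positivity) (by nlinarith)).mul_right _
    refine Summable.of_nonneg_of_le (fun j => by positivity) (fun j => ?_) hg
    calc _ ≤ (q^j * ((Real.sqrt n)⁻¹ * (‖eL (1/2)‖ * ‖f'‖))) * (q^j * ((Real.sqrt n)⁻¹ * (‖eL (1/2)‖ * ‖g'‖))) := by
          gcongr
          · exact e3 j f f' aef
          · exact e3 j g g' aeg
      _ = _ := by rw [mul_pow]; ring
  simp only [e2] at h1
  rw [h1.unique h2]
  apply integral_congr_ae
  have a1 : ∀ᵐ z : ℝ × ℝ ∂(volume.prod volume), f' z.1 = chi δ z.1 * f z.1 := Measure.quasiMeasurePreserving_fst.ae aef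
  have a2 : ∀ᵐ z : ℝ × ℝ ∂(volume.prod volume), g' z.2 = chi δ z.2 * g z.2 := Measure.quasiMeasurePreserving_snd.ae aeg
  filter_upwards [a1, a2] with z z1 z2
  by_cases hc : δ ≤ |z.1|
  · have e5 : ∀ j : ℕ, (af n j z.1 * f' z.1) * (af n j z.2 * g' z.2) =
        ((n:ℝ)⁻¹ * Real.exp (-(1/2 * (|z.1| + |z.2|))) * (f' z.1 * g' z.2)) * (sg z.1 * sg z.2 * Real.exp (-((|z.1| + |z.2|)/n)))^j := by
      intro j
      unfold af
      have x1 : (Real.sqrt n)⁻¹ * (Real.sqrt n)⁻¹ = (n:ℝ)⁻¹ := by rw [← mul_inv, Real.mul_self_sqrt (by positivity)]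
      have x2 : Real.exp (-(1/2 * |z.1|)) * Real.exp (-(1/2 * |z.2|)) = Real.exp (-(1/2 * (|z.1| + |z.2|))) := by rw [← Real.exp_add]; ring_nf
      have x3 : Real.exp (-(|z.1|/n)) * Real.exp (-(|z.2|/n)) = Real.exp (-((|z.1| + |z.2|)/n)) := by rw [← Real.exp_add]; ring_nf
      rw [← x1, ← x2, ← x3]; simp only [mul_pow]; ring
    simp only [e5]
    rw [tsum_mul_left, tsum_geometric_of_norm_lt_one]
    · simp only [kn]; ring
    · rw [norm_mul, norm_mul, Real.norm_eq_abs, Real.norm_eq_abs, Real.norm_eq_abs, sg_abs, sg_abs, Real.abs_exp, one_mul, one_mul,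
        Real.exp_lt_one_iff]
      have : 0 < (|z.1| + |z.2|)/n := by
        have := abs_nonneg z.2
        apply div_pos _ hn'; linarith
      linarith
  · have : f' z.1 = 0 := by rw [z1]; simp [chi, hc]
    simp [this]

lemma Dop_cut {n : ℕ} (hn : 1 ≤ n) {δ : ℝ} (hδ : 0 < δ) (f g : LR) :
    inner ℝ ((Kop n - Rop n) (mulOp (chi δ) f)) (mulOp (chi δ) g) =
      inner ℝ (kerOp (secK true (fun s => if δ ≤ s then 1 / s else 0)) (mulOp (chi δ) f)) (mulOp (chi δ) g) := by
  have hn' : (0:ℝ) < n := by exact_mod_cast hn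
  have hψ : Good (1/δ) (fun s : ℝ => if δ ≤ s then 1 / s else 0) := by
    refine ⟨Measurable.ite measurableSet_Ici (by fun_prop) measurable_const, fun s hs => ?_⟩
    have h1 : 1 ≤ Real.exp (s/4) := Real.one_le_exp (by positivity)
    have h2 : 0 < 1/δ := by positivity
    beta_reduce
    split_ifs with h
    · rw [abs_of_nonneg (by positivity)]
      have : 1/s ≤ 1/δ := one_div_le_one_div_of_le hδ h
      nlinarith
    · simp only [abs_zero]; positivity
  obtain ⟨M, hM⟩ := phiP_bd
  have hM0 : 0 ≤ M := (abs_nonneg _).trans (hM 0 le_rfl)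
  have g1 : Good M (fun s => phiP (s/n)) := by
    have := phiP_meas
    refine ⟨by fun_prop, fun s hs => (hM _ (by positivity)).trans ?_⟩
    have h1 : 1 ≤ Real.exp (s/4) := Real.one_le_exp (by positivity)
    nlinarith
  have g2 : Good 1 (fun s => phiM (s/n)) := by
    refine ⟨by unfold phiM; fun_prop, fun s hs => (phiM_bd _ (by positivity)).trans ?_⟩
    have h1 : 1 ≤ Real.exp (s/4) := Real.one_le_exp (by positivity)
    linarith
  rw [sub_apply, inner_sub_left, Kop_cut hn hδ]
  set f' := mulOp (chi δ) f with hf'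
  set g' := mulOp (chi δ) g with hg'
  have aef := mulOp_ae (chi_meas δ) (chi_abs δ) f
  have aeg := mulOp_ae (chi_meas δ) (chi_abs δ) g
  rw [Rop, smul_apply, add_apply, real_inner_smul_left, inner_add_left,
    inner_kerOp (secK_meas _ g1.1) (secK_bound _ g1), inner_kerOp (secK_meas _ g2.1) (secK_bound _ g2),
    inner_kerOp (secK_meas _ hψ.1) (secK_bound _ hψ)]
  have i1 := (kerInt _ (secK_meas true g1.1) (secK_bound _ g1) f' g').1
  have i2 := (kerInt _ (secK_meas false g2.1) (secK_bound _ g2) f' g').1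
  have i3 := (kerInt _ (secK_meas true hψ.1) (secK_bound _ hψ) f' g').1
  rw [sub_eq_iff_eq_add, ← integral_add i1 i2, ← integral_const_mul]
  refine Eq.trans ?_ (integral_add i3 ((i1.add i2).const_mul _))
  apply integral_congr_ae
  have a1 : ∀ᵐ z : ℝ × ℝ ∂(volume.prod volume), f' z.1 = chi δ z.1 * f z.1 := Measure.quasiMeasurePreserving_fst.ae aef
  have a2 : ∀ᵐ z : ℝ × ℝ ∂(volume.prod volume), g' z.2 = chi δ z.2 * g z.2 := Measure.quasiMeasurePreserving_snd.ae aeg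
  filter_upwards [a1, a2] with z z1 z2
  by_cases hc : δ ≤ |z.1|
  · by_cases hd : δ ≤ |z.2|
    · have n1 : z.1 ≠ 0 := by intro h; rw [h, abs_zero] at hc; linarith
      have n2 : z.2 ≠ 0 := by intro h; rw [h, abs_zero] at hd; linarith
      rw [kn_split hn n1 n2]
      have : secK true (fun s : ℝ => if δ ≤ s then 1 / s else 0) z = secK true (fun s => 1 / s) z := by
        simp only [secK]
        rw [if_pos (c := δ ≤ |z.1| + |z.2|) (by linarith)]
      rw [this]; ring
    · have : g' z.2 = 0 := by rw [z2]; simp [chi, hd]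
      simp [this]
  · have : f' z.1 = 0 := by rw [z1]; simp [chi, hc]
    simp [this]

lemma Dop_const {n : ℕ} (hn : 1 ≤ n) : Kop n - Rop n = Kop 1 - Rop 1 := by
  ext1 f
  refine ext_inner_right ℝ fun g => ?_
  have key : ∀ n : ℕ, Tendsto (fun k : ℕ => inner ℝ ((Kop n - Rop n) (mulOp (chi ((k:ℝ)⁻¹)) f)) (mulOp (chi ((k:ℝ)⁻¹)) g))
      atTop (𝓝 (inner ℝ ((Kop n - Rop n) f) g)) := by
    intro n
    exact (((Kop n - Rop n).continuous.tendsto f).comp (chi_tendsto f)).inner (chi_tendsto g)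
  refine tendsto_nhds_unique (key n) ((key 1).congr' ?_)
  filter_upwards [eventually_ge_atTop 1] with k hk
  have : (0:ℝ) < (k:ℝ)⁻¹ := by have : (0:ℝ) < k := by exact_mod_cast hk
                               positivity
  rw [Dop_cut le_rfl this, Dop_cut hn this]

/-- the limit of `K` -/
def K0op : LR →L[ℝ] LR := Kop 1 - Rop 1

lemma Kop_AE : AE Kop ∧ Tendsto Kop atTop (𝓝 K0op) := by
  have h : (fun n => K0op + Rop n) =ᶠ[atTop] Kop := by
    filter_upwards [eventually_ge_atTop 1] with n hn
    rw [K0op, ← Dop_const hn]; abel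
  refine ⟨((AE.const K0op).add Rop_AE).congr' h, ?_⟩
  have h1 : Tendsto Rop atTop (𝓝 0) := by
    obtain ⟨M, hM⟩ := phiP_bd
    obtain ⟨L, hL⟩ := ((secOp_AE true phiP_meas hM phiP_an).add (secOp_AE false (by unfold phiM; fun_prop) phiM_bd phiM_an)).exists_tendsto
    have := AE.inv_tendsto.smul hL
    rw [zero_smul] at this
    exact this
  have h2 := (tendsto_const_nhds (x := K0op)).add h1
  rw [add_zero] at h2
  exact h2.congr' h
end

section
open Topology

lemma mulOp_add {m₁ m₂ : ℝ → ℝ} (h₁ : Measurable m₁) (h₂ : Measurable m₂) {C₁ C₂ : ℝ}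
    (hC₁ : ∀ z, |m₁ z| ≤ C₁) (hC₂ : ∀ z, |m₂ z| ≤ C₂) :
    mulOp (fun z => m₁ z + m₂ z) = mulOp m₁ + mulOp m₂ := by
  ext1 f
  apply Lp.ext
  have hC : ∀ z, |m₁ z + m₂ z| ≤ (C₁ + C₂) := fun z => (abs_add_le _ _).trans (add_le_add (hC₁ z) (hC₂ z))
  filter_upwards [mulOp_ae (m := fun z => m₁ z + m₂ z) (h₁.add h₂) hC f, mulOp_ae h₁ hC₁ f, mulOp_ae h₂ hC₂ f, Lp.coeFn_add (mulOp m₁ f) (mulOp m₂ f)] with u e1 e2 e3 e4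
  rw [e1, add_apply, e4, Pi.add_apply, e2, e3]; ring

lemma mulOp_smul {m : ℝ → ℝ} (h : Measurable m) {C : ℝ} (c : ℝ) (hC : ∀ z, |m z| ≤ C) :
    mulOp (fun z => c * m z) = c • mulOp m := by
  ext1 f
  apply Lp.ext
  have hC' : ∀ z, |c * m z| ≤ |c| * C := fun z => by
    rw [abs_mul]; gcongr; exact hC z
  filter_upwards [mulOp_ae (m := fun z => c * m z) (h.const_mul c) hC' f, mulOp_ae h hC f, Lp.coeFn_smul c (mulOp m f)] with u e1 e2 e3
  rw [e1, smul_apply, e3, Pi.smul_apply, e2, smul_eq_mul]; ring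

def secM (q : Bool) (ψ : ℝ → ℝ) (u : ℝ) : ℝ :=
  (if 0 < u ↔ q then 1 else 0) * (Real.exp (-|u|) * ψ |u|)

lemma secM_meas (q : Bool) {ψ : ℝ → ℝ} (h : Measurable ψ) : Measurable (secM q ψ) := by
  unfold secM
  refine Measurable.mul (Measurable.ite ?_ measurable_const measurable_const) (by fun_prop)
  have h1 : MeasurableSet {z : ℝ | 0 < z} := measurableSet_Ioi
  exact h1.iff (MeasurableSet.const _)

lemma secM_bound (q : Bool) {ψ : ℝ → ℝ} {C : ℝ} (h : Good C ψ) (u : ℝ) : |secM q ψ u| ≤ C := by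
  have hC : 0 ≤ C := by
    have := (abs_nonneg _).trans (h.2 0 le_rfl); simpa using this
  unfold secM
  rw [abs_mul, abs_mul, Real.abs_exp]
  have h1 : |(if 0 < u ↔ q then (1:ℝ) else 0)| ≤ 1 := by split_ifs <;> simp
  have h2 := h.2 |u| (abs_nonneg u)
  calc _ ≤ 1 * (Real.exp (-|u|) * (C * Real.exp (|u|/4))) := by gcongr
    _ = C * Real.exp (-(3/4 * |u|)) := by
        rw [one_mul, mul_left_comm, ← Real.exp_add]; congr 2; ring
    _ ≤ C * 1 := by
        gcongr; rw [Real.exp_le_one_iff]; have := abs_nonneg u; linarith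
    _ = C := mul_one C

lemma mulSec_AE (q : Bool) {φ : ℝ → ℝ} (hφ : Measurable φ) {M : ℝ} (hM : ∀ t, 0 ≤ t → |φ t| ≤ M) (ha : AnalyticAt ℝ φ 0) :
    AE (fun n : ℕ => mulOp (secM q (fun s => φ (s / n)))) ∧
    Tendsto (fun n : ℕ => mulOp (secM q (fun s => φ (s / n)))) atTop (𝓝 (mulOp (secM q (fun _ => φ 0)))) := by
  refine AE.scaled (fun ψ => mulOp (secM q ψ)) (K := 1) ?_ ?_ ?_ hφ hM ha
  · intro ψ₁ ψ₂ C₁ C₂ h₁ h₂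
    rw [← mulOp_add (secM_meas q h₁.1) (secM_meas q h₂.1) (secM_bound q h₁) (secM_bound q h₂)]
    congr 1; ext z; simp only [secM]; ring
  · intro c ψ C h
    rw [← mulOp_smul (secM_meas q h.1) c (secM_bound q h)]
    congr 1; ext z; simp only [secM]; ring
  · intro ψ C h
    rw [one_mul]; exact mulOp_norm (secM_meas q h.1) (secM_bound q h)

def T0op (p q : ℝ) : LR →L[ℝ] LR := mulOp (secM true (fun _ => p)) + mulOp (secM false (fun _ => q))

def phiInf (p q : ℝ) : LR := T0op p q (Ring.inverse (1 + K0op * T0op p q) (eL (1/2)))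

/-- admissible densities -/
structure Adm (φ : ℝ → ℝ) (ε τ : ℝ) : Prop where
  meas : Measurable φ
  bd : ∃ M, ∀ t, 0 ≤ t → |φ t| ≤ M
  an : AnalyticAt ℝ φ 0
  low : ∀ t, 0 ≤ t → -((1 - ε) / Real.pi) ≤ φ t
  supp : ∀ t, τ < t → φ t = 0

lemma Adm.good {φ : ℝ → ℝ} {ε τ : ℝ} (h : Adm φ ε τ) : ∃ M, 0 ≤ M ∧ (∀ t, 0 ≤ t → |φ t| ≤ M) ∧ ∀ n : ℕ, Good M (fun s => φ (s / n)) := by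
  obtain ⟨M, hM⟩ := h.bd
  have hM0 : 0 ≤ M := (abs_nonneg _).trans (hM 0 le_rfl)
  refine ⟨M, hM0, hM, fun n => ?_⟩
  have := h.meas
  refine ⟨by fun_prop, fun s hs => (hM _ (by positivity)).trans ?_⟩
  have h1 : 1 ≤ Real.exp (s/4) := Real.one_le_exp (by positivity)
  nlinarith

/-- the multiplier -/
def mT (φp φm : ℝ → ℝ) (n : ℕ) (u : ℝ) : ℝ := secM true (fun s => φp (s/n)) u + secM false (fun s => φm (s/n)) u

lemma mT_pos {φp φm : ℝ → ℝ} {n : ℕ} {u : ℝ} (hu : 0 < u) : mT φp φm n u = Real.exp (-u) * φp (u/n) := by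
  simp [mT, secM, hu, abs_of_pos hu]

lemma mT_neg {φp φm : ℝ → ℝ} {n : ℕ} {u : ℝ} (hu : 0 ≤ u) : mT φp φm n (-u) = Real.exp (-u) * φm (u/n) := by
  have : ¬ (u < 0) := not_lt.mpr hu
  simp [mT, secM, this, abs_of_nonneg hu]

def Tnop (φp φm : ℝ → ℝ) (n : ℕ) : LR →L[ℝ] LR := mulOp (mT φp φm n)

lemma exp_int_nonneg_split {φ : ℝ → ℝ} {ε τ : ℝ} (h : Adm φ ε τ) {n : ℕ} (hn : 1 ≤ n) (hτ : 0 < τ) (m : ℕ) :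
    ∫ u in Ioi (0:ℝ), Real.exp (-u) * φ (u/n) * ((n:ℝ)⁻¹ * Real.exp (-u) * Real.exp (-(u/n))^m) =
      ∫ t in (0:ℝ)..τ, φ t * Real.exp (-((2*n+m:ℕ) * t)) := by
  have hn' : (0:ℝ) < n := by exact_mod_cast hn
  have h1 := integral_comp_mul_right_Ioi' (fun t => φ t * Real.exp (-((2*n+m:ℕ) * t))) 0 (b := (n:ℝ)⁻¹) (by positivity)
  rw [zero_mul] at h1
  have h2 : ∫ t in Ioi (0:ℝ), φ t * Real.exp (-((2*n+m:ℕ) * t)) = ∫ t in (0:ℝ)..τ, φ t * Real.exp (-((2*n+m:ℕ) * t)) := by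
    rw [intervalIntegral.integral_of_le hτ.le]
    refine setIntegral_eq_of_subset_of_forall_diff_eq_zero measurableSet_Ioi Ioc_subset_Ioi_self ?_
    intro x hx
    have : τ < x := by
      by_contra hc; exact hx.2 ⟨hx.1, not_lt.mp hc⟩
    rw [h.supp x this, zero_mul]
  rw [← h2, ← h1, smul_eq_mul, ← integral_const_mul]
  congr 1; ext u
  have : Real.exp (-((2*n+m:ℕ) * (u * (n:ℝ)⁻¹))) = Real.exp (-u) * Real.exp (-u) * Real.exp (-(u/n))^m := by
    rw [← Real.exp_nat_mul, ← Real.exp_add, ← Real.exp_add]; congr 1; push_cast; field_simp; ring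
  rw [this, ← div_eq_mul_inv]; ring

section asm
variable {φp φm : ℝ → ℝ} {ε τ : ℝ}

lemma mT_meas (hp : Adm φp ε τ) (hm : Adm φm ε τ) (n : ℕ) : Measurable (mT φp φm n) := by
  obtain ⟨M, -, -, g1⟩ := hp.good
  obtain ⟨M', -, -, g2⟩ := hm.good
  exact (secM_meas true (g1 n).1).add (secM_meas false (g2 n).1)

lemma mT_bd (hp : Adm φp ε τ) (hm : Adm φm ε τ) : ∃ M, 0 ≤ M ∧ ∀ n u, |mT φp φm n u| ≤ M := by
  obtain ⟨M, hM, -, g1⟩ := hp.good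
  obtain ⟨M', hM', -, g2⟩ := hm.good
  exact ⟨M + M', by positivity, fun n u => (abs_add_le _ _).trans (add_le_add (secM_bound _ (g1 n) u) (secM_bound _ (g2 n) u))⟩

lemma mT_low (hp : Adm φp ε τ) (hm : Adm φm ε τ) (hε : ε < 1) (n : ℕ) (u : ℝ) : -((1 - ε) / Real.pi) ≤ mT φp φm n u := by
  have hpi : 0 < (1 - ε)/Real.pi := div_pos (by linarith) Real.pi_pos
  have key : ∀ v x : ℝ, 0 ≤ v → -((1 - ε) / Real.pi) ≤ x → -((1 - ε) / Real.pi) ≤ Real.exp (-v) * x := by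
    intro v x hv hx
    have h1 : Real.exp (-v) ≤ 1 := by rw [Real.exp_le_one_iff]; linarith
    have h2 := Real.exp_pos (-v)
    nlinarith
  rcases lt_or_ge 0 u with h | h
  · rw [mT_pos h]; exact key _ _ h.le (hp.low _ (by positivity))
  · have : u = -(-u) := by ring
    rw [this, mT_neg (by linarith)]
    exact key _ _ (by linarith) (hm.low _ (div_nonneg (by linarith) (by positivity)))

lemma Tnop_AE (hp : Adm φp ε τ) (hm : Adm φm ε τ) :
    AE (Tnop φp φm) ∧ Tendsto (Tnop φp φm) atTop (𝓝 (T0op (φp 0) (φm 0))) := by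
  obtain ⟨M, hM, bM, g1⟩ := hp.good
  obtain ⟨M', hM', bM', g2⟩ := hm.good
  have e : Tnop φp φm = fun n : ℕ => mulOp (secM true (fun s => φp (s / n))) + mulOp (secM false (fun s => φm (s / n))) := by
    ext1 n
    rw [← mulOp_add (secM_meas true (g1 n).1) (secM_meas false (g2 n).1) (secM_bound _ (g1 n)) (secM_bound _ (g2 n))]
    rfl
  obtain ⟨a1, b1⟩ := mulSec_AE true hp.meas bM hp.an
  obtain ⟨a2, b2⟩ := mulSec_AE false hm.meas bM' hm.an
  rw [e]
  exact ⟨a1.add a2, b1.add b2⟩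

lemma Tnop_entries (hp : Adm φp ε τ) (hm : Adm φm ε τ) (hτ : 0 < τ) {n : ℕ} (hn : 1 ≤ n) (j k : ℕ) :
    inner ℝ (Tnop φp φm n (av n k)) (av n j) = (∫ t in (0:ℝ)..τ, φp t * Real.exp (-((2*n+(j+k):ℕ) * t))) +
      (-1)^(j+k) * ∫ t in (0:ℝ)..τ, φm t * Real.exp (-((2*n+(j+k):ℕ) * t)) := by
  obtain ⟨M, hM, bM⟩ := mT_bd hp hm
  have hae : (fun u => mT φp φm n u * av n k u * av n j u) =ᵐ[volume] fun u => mT φp φm n u * (af n j u * af n k u) := by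
    filter_upwards [av_ae n j, av_ae n k] with u h1 h2; rw [h1, h2]; ring
  have hI : Integrable (fun u => mT φp φm n u * (af n j u * af n k u)) := by
    have := LR_integrable_mul (mulOp (mT φp φm n) (av n k)) (av n j)
    refine this.congr ?_
    filter_upwards [mulOp_ae (mT_meas hp hm n) (bM n) (av n k), hae] with u h1 h2
    rw [h1, ← h2]
  rw [Tnop, inner_mulOp (mT_meas hp hm n) (bM n), integral_congr_ae hae, int_split hI]
  rw [← exp_int_nonneg_split hp hn hτ, ← exp_int_nonneg_split hm hn hτ, ← integral_const_mul]
  congr 1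
  · refine setIntegral_congr_fun measurableSet_Ioi fun u hu => ?_
    have hu' : 0 < u := hu
    beta_reduce
    rw [mT_pos hu', af_mul, sg_pos hu', abs_of_pos hu', one_mul]
  · refine setIntegral_congr_fun measurableSet_Ioi fun u hu => ?_
    have hu' : 0 < u := hu
    beta_reduce
    rw [mT_neg hu'.le, af_mul, sg_neg' hu', abs_neg, abs_of_pos hu', mul_pow]; ring

lemma Tnop_coercive (hp : Adm φp ε τ) (hm : Adm φm ε τ) (hε1 : ε < 1) {n : ℕ} (hn : 1 ≤ n) (c : l2) :
    ε * ‖c‖^2 ≤ inner ℝ (((1 : l2 →L[ℝ] l2) + (Aop n).adjoint ∘L (Tnop φp φm n) ∘L (Aop n)) c) c := by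
  obtain ⟨M, hM, bM⟩ := mT_bd hp hm
  rw [add_apply, inner_add_left]
  simp only [ContinuousLinearMap.one_apply, ContinuousLinearMap.comp_apply, ContinuousLinearMap.adjoint_inner_left, real_inner_self_eq_norm_sq]
  set f := Aop n c with hf
  have h1 : ‖f‖^2 ≤ Real.pi * ‖c‖^2 := by
    have : ‖f‖ ≤ Real.sqrt Real.pi * ‖c‖ := (Aop n).le_of_opNorm_le (Aop_spec hn).1 c
    calc ‖f‖^2 ≤ (Real.sqrt Real.pi * ‖c‖)^2 := by gcongr
      _ = _ := by rw [mul_pow, Real.sq_sqrt Real.pi_pos.le]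
  have h2 : -((1 - ε)/Real.pi) * ‖f‖^2 ≤ inner ℝ (Tnop φp φm n f) f := by
    rw [Tnop, inner_mulOp (mT_meas hp hm n) (bM n), ← real_inner_self_eq_norm_sq, inner_LR, ← integral_const_mul]
    refine integral_mono ((LR_integrable_mul f f).const_mul _) ?_ fun u => ?_
    · refine (LR_integrable_mul (mulOp (mT φp φm n) f) f).congr ?_
      filter_upwards [mulOp_ae (mT_meas hp hm n) (bM n) f] with u h1
      rw [h1]
    · beta_reduce
      rw [mul_assoc (mT φp φm n u)]
      exact mul_le_mul_of_nonneg_right (mT_low hp hm hε1 n u) (mul_self_nonneg _)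
  have h3 : ((1 - ε)/Real.pi) * ‖f‖^2 ≤ (1 - ε) * ‖c‖^2 := by
    calc ((1 - ε)/Real.pi) * ‖f‖^2 ≤ ((1 - ε)/Real.pi) * (Real.pi * ‖c‖^2) := by
          have : 0 ≤ (1 - ε)/Real.pi := div_nonneg (by linarith) Real.pi_pos.le
          gcongr
      _ = _ := by field_simp
  linarith

end asm
end

section
open Topology

lemma exp_small {E : Type*} [NormedAddCommGroup E] {f : ℕ → E} {C τ : ℝ} (hτ : 0 < τ)
    (h : ∀ᶠ n : ℕ in atTop, ‖f n‖ ≤ C * (n * Real.exp (-(τ * n)))) (l : ℕ) :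
    f =O[atTop] (fun n : ℕ => ((n:ℝ)⁻¹) ^ (l+1)) := by
  refine Asymptotics.IsBigO.of_bound (|C| * ((l+2).factorial / τ^(l+2))) ?_
  filter_upwards [h, eventually_ge_atTop 1] with n hn h1
  have hn' : (0:ℝ) < n := by exact_mod_cast h1
  refine hn.trans ?_
  rw [Real.norm_of_nonneg (by positivity), mul_assoc]
  have h2 := Real.pow_div_factorial_le_exp (τ * n) (by positivity) (l+2)
  have h3 : n * Real.exp (-(τ * n)) ≤ (l+2).factorial / τ^(l+2) * (n:ℝ)⁻¹^(l+1) := by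
    rw [Real.exp_neg, ← div_eq_mul_inv, div_le_iff₀ (by positivity)]
    calc (n:ℝ) = ((l+2).factorial / τ^(l+2) * (n:ℝ)⁻¹^(l+1)) * ((τ * n)^(l+2) / (l+2).factorial) := by
          rw [inv_pow]; field_simp; ring
      _ ≤ _ := by gcongr
  calc C * (n * Real.exp (-(τ * n))) ≤ |C| * (n * Real.exp (-(τ * n))) := by gcongr; exact le_abs_self C
    _ ≤ _ := by gcongr

theorem asm {φp φm : ℝ → ℝ} {ε τ : ℝ} (hp : Adm φp ε τ) (hm : Adm φm ε τ) (hε : 0 < ε) (hε1 : ε < 1) (hτ : 0 < τ)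
    (H : ℕ → l2 →L[ℝ] l2) {C : ℝ}
    (hH : ∀ n j k : ℕ, |inner ℝ (eb j) (H n (eb k)) - ((∫ t in (0:ℝ)..τ, φp t * Real.exp (-((2*n+(j+k):ℕ) * t))) +
      (-1)^(j+k) * ∫ t in (0:ℝ)..τ, φm t * Real.exp (-((2*n+(j+k):ℕ) * t)))| ≤ C * Real.exp (-(τ * (2*n+(j+k):ℕ)))) :
    ∃ (c : ℕ → l2) (φt : ℕ → LR) (C' : ℝ), (∀ᶠ n in atTop, ((1 : l2 →L[ℝ] l2) + H n) (c n) = eb 0) ∧ AE φt ∧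
      Tendsto φt atTop (𝓝 (phiInf (φp 0) (φm 0))) ∧
      (∀ n : ℕ, 1 ≤ n → ∀ᵐ u : ℝ, τ * n < |u| → φt n u = 0) ∧
      ∀ᶠ n : ℕ in atTop, ∀ j : ℕ, |c n j - ((if j = 0 then 1 else 0) - (Real.sqrt n)⁻¹ * inner ℝ (av n j) (φt n))|
        ≤ C' * Real.exp (-(τ * (2 * n + j))) := by
  have hC0 : 0 ≤ C := by
    have := (abs_nonneg _).trans (hH 0 0 0)
    simpa using this
  obtain ⟨M, hM, bM⟩ := mT_bd hp hm
  set T := Tnop φp φm with hT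
  have hTn : ∀ n, ‖T n‖ ≤ M := fun n => mulOp_norm (mT_meas hp hm n) (bM n)
  let G : ℕ → l2 →L[ℝ] l2 := fun n => (Aop n).adjoint ∘L (T n) ∘L (Aop n)
  let E : ℕ → l2 →L[ℝ] l2 := fun n => H n - G n
  set q := Real.exp (-τ) with hq
  have hq0 : 0 < q := Real.exp_pos _
  have hq1 : q < 1 := by rw [hq, Real.exp_lt_one_iff]; linarith
  have hEe : ∀ n, 1 ≤ n → ∀ j k, |inner ℝ (eb j) (E n (eb k))| ≤ (C * Real.exp (-(τ * (2 * n)))) * q^(j+k) := by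
    intro n hn j k
    have h1 : inner ℝ (eb j) (G n (eb k)) = inner ℝ (T n (av n k)) (av n j) := by
      simp only [G, ContinuousLinearMap.comp_apply, ContinuousLinearMap.adjoint_inner_right, (Aop_spec hn).2.1]
      exact real_inner_comm _ _
    simp only [E, sub_apply, inner_sub_right]
    rw [h1, hT, Tnop_entries hp hm hτ hn]
    refine (hH n j k).trans (le_of_eq ?_)
    rw [hq, ← Real.exp_nat_mul, mul_assoc, ← Real.exp_add]; congr 2; push_cast; ring
  have hEb : ∀ n, 1 ≤ n → ∀ c : l2, (∀ j, |(E n c) j| ≤ (C * Real.exp (-(τ * (2 * n)))) / (1 - q) * q ^ j * ‖c‖) ∧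
      ‖E n c‖ ≤ (C * Real.exp (-(τ * (2 * n)))) / (1 - q)^2 * ‖c‖ := fun n hn c =>
    norm_le_of_entries (E n) (by positivity) hq0.le hq1 (hEe n hn) c
  have hsm : Tendsto (fun n : ℕ => (C * Real.exp (-(τ * (2 * n)))) / (1 - q)^2) atTop (𝓝 0) := by
    have h1 : Tendsto (fun n : ℕ => -(τ * (2 * (n:ℝ)))) atTop atBot := by
      have : Tendsto (fun n : ℕ => (τ * 2) * (n:ℝ)) atTop atTop := tendsto_natCast_atTop_atTop.const_mul_atTop (by positivity)
      refine (tendsto_neg_atTop_atBot.comp this).congr fun n => ?_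
      simp; ring
    have := ((Real.tendsto_exp_atBot.comp h1).const_mul C).div_const ((1-q)^2)
    simpa using this
  -- inverse of 1 + H
  have hex : ∀ᶠ n : ℕ in atTop, ∃ c : l2, ((1 : l2 →L[ℝ] l2) + H n) c = eb 0 ∧ ‖c‖ ≤ (ε/2)⁻¹ := by
    filter_upwards [eventually_ge_atTop 1, hsm.eventually_lt_const (half_pos hε)] with n hn hn2
    obtain ⟨N, h1, h2, h3⟩ := coercive_inv ((1 : l2 →L[ℝ] l2) + H n) (half_pos hε) (by
      intro c
      have h4 := Tnop_coercive hp hm hε1 hn c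
      have h5 : (1 : l2 →L[ℝ] l2) + H n = ((1 : l2 →L[ℝ] l2) + G n) + E n := by simp [E]
      rw [h5, add_apply, inner_add_left]
      have h6 := (abs_le.mp (abs_real_inner_le_norm (E n c) c)).1
      have h7 : ‖E n c‖ * ‖c‖ ≤ ε/2 * ‖c‖^2 := by
        calc ‖E n c‖ * ‖c‖ ≤ ((C * Real.exp (-(τ * (2 * n)))) / (1 - q)^2 * ‖c‖) * ‖c‖ := by gcongr; exact (hEb n hn c).2
          _ = ((C * Real.exp (-(τ * (2 * n)))) / (1 - q)^2) * ‖c‖^2 := by ring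
          _ ≤ _ := by gcongr
      simp only [G] at *
      linarith)
    refine ⟨N (eb 0), ?_, ?_⟩
    · have := congrArg (fun L : l2 →L[ℝ] l2 => L (eb 0)) h1
      simpa using this
    · have := N.le_of_opNorm_le h3 (eb 0)
      rwa [norm_eb, mul_one] at this
  have hex' : ∀ n : ℕ, ∃ c : l2, (∃ c : l2, ((1 : l2 →L[ℝ] l2) + H n) c = eb 0 ∧ ‖c‖ ≤ (ε/2)⁻¹) →
      ((1 : l2 →L[ℝ] l2) + H n) c = eb 0 ∧ ‖c‖ ≤ (ε/2)⁻¹ := by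
    intro n
    by_cases h : ∃ c : l2, ((1 : l2 →L[ℝ] l2) + H n) c = eb 0 ∧ ‖c‖ ≤ (ε/2)⁻¹
    · exact ⟨h.choose, fun _ => h.choose_spec⟩
    · exact ⟨0, fun h' => absurd h' h⟩
  choose c hc using hex'
  have hcc : ∀ᶠ n : ℕ in atTop, ((1 : l2 →L[ℝ] l2) + H n) (c n) = eb 0 ∧ ‖c n‖ ≤ (ε/2)⁻¹ :=
    hex.mono fun n h => hc n h
  obtain ⟨hTA, hTl⟩ := Tnop_AE hp hm
  obtain ⟨hKA, hKl⟩ := Kop_AE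
  -- 1 + KT
  let Q : ℕ → LR →L[ℝ] LR := fun n => 1 + Kop n * T n
  have hQA : AE Q := (AE.const 1).add (hKA.mul hTA)
  have hQl : Tendsto Q atTop (𝓝 (1 + K0op * T0op (φp 0) (φm 0))) := tendsto_const_nhds.add (hKl.mul hTl)
  have hNex : ∀ n, ∃ N : LR →L[ℝ] LR, 1 ≤ n → Q n * N = 1 ∧ N * Q n = 1 ∧ ‖N‖ ≤ 1 + Real.sqrt Real.pi * (ε⁻¹ * (Real.sqrt Real.pi * M)) := by
    intro n
    by_cases hn : 1 ≤ n
    swap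
    · exact ⟨0, fun h => absurd h hn⟩
    obtain ⟨N, h1, h2, h3⟩ := coercive_inv ((1 : l2 →L[ℝ] l2) + G n) hε (Tnop_coercive hp hm hε1 hn)
    refine ⟨1 - (Aop n) ∘L N ∘L (Aop n).adjoint ∘L (T n), fun _ => ⟨?_, ?_, ?_⟩⟩
    · ext1 f
      have e1 := congrArg (fun L : l2 →L[ℝ] l2 => Aop n (L ((Aop n).adjoint (T n f)))) h1
      simp only [ContinuousLinearMap.mul_apply, add_apply, ContinuousLinearMap.one_apply, G, ContinuousLinearMap.comp_apply, map_add] at e1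
      simp only [Q, Kop, ContinuousLinearMap.mul_apply, add_apply, sub_apply, ContinuousLinearMap.one_apply, ContinuousLinearMap.comp_apply, map_sub]
      rw [← e1]; abel
    · ext1 f
      have e1 := congrArg (fun L : l2 →L[ℝ] l2 => Aop n (L ((Aop n).adjoint (T n f)))) h2
      simp only [ContinuousLinearMap.mul_apply, add_apply, ContinuousLinearMap.one_apply, G, ContinuousLinearMap.comp_apply, map_add] at e1
      simp only [Q, Kop, ContinuousLinearMap.mul_apply, add_apply, sub_apply, ContinuousLinearMap.one_apply, ContinuousLinearMap.comp_apply, map_add]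
      have e2 := sub_eq_zero.mpr e1
      rw [← sub_eq_zero, ← neg_eq_zero, ← e2]; abel
    · refine (norm_sub_le _ _).trans ?_
      have n1 : ‖(1 : LR →L[ℝ] LR)‖ ≤ 1 := ContinuousLinearMap.norm_id_le
      have hA := (Aop_spec hn).1
      have hA' : ‖(Aop n).adjoint‖ ≤ Real.sqrt Real.pi := by
        rw [LinearIsometryEquiv.norm_map]; exact hA
      have n2 : ‖(Aop n) ∘L N ∘L (Aop n).adjoint ∘L (T n)‖ ≤ Real.sqrt Real.pi * (ε⁻¹ * (Real.sqrt Real.pi * M)) := by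
        refine (ContinuousLinearMap.opNorm_comp_le _ _).trans ?_
        gcongr
        refine (ContinuousLinearMap.opNorm_comp_le _ _).trans ?_
        gcongr
        refine (ContinuousLinearMap.opNorm_comp_le _ _).trans ?_
        gcongr
        exact hTn n
      linarith
  choose N hN using hNex
  have hU : IsUnit (1 + K0op * T0op (φp 0) (φm 0)) :=
    isUnit_of_tendsto (N := N) hQl ((eventually_ge_atTop 1).mono fun n h => (hN n h).1)
      ((eventually_ge_atTop 1).mono fun n h => (hN n h).2.1) ((eventually_ge_atTop 1).mono fun n h => (hN n h).2.2)
  have hinv : AnalyticAt ℝ (Ring.inverse : (LR →L[ℝ] LR) → _) (1 + K0op * T0op (φp 0) (φm 0)) := by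
    obtain ⟨z, hz⟩ := hU
    rw [← hz]; exact analyticAt_inverse z
  have hIA : AE (fun n => Ring.inverse (Q n)) := hQA.comp hQl hinv
  have hIl : Tendsto (fun n => Ring.inverse (Q n)) atTop (𝓝 (Ring.inverse (1 + K0op * T0op (φp 0) (φm 0)))) :=
    (hinv.continuousAt.tendsto).comp hQl
  -- the error vector
  let e : ℕ → LR := fun n => Real.sqrt n • Aop n (E n (c n))
  have hez : ∀ᶠ n : ℕ in atTop, ‖e n‖ ≤ (Real.sqrt Real.pi * (C / (1 - q)^2 * (ε/2)⁻¹)) * (n * Real.exp (-((2 * τ) * n))) := by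
    filter_upwards [hcc, eventually_ge_atTop 1] with n h1 hn
    have hn' : (1:ℝ) ≤ n := by exact_mod_cast hn
    simp only [e]
    rw [norm_smul, Real.norm_of_nonneg (Real.sqrt_nonneg _)]
    have hs : Real.sqrt n ≤ n := by
      rw [Real.sqrt_le_left (by positivity)]; nlinarith
    have h2 : ‖Aop n (E n (c n))‖ ≤ Real.sqrt Real.pi * ((C * Real.exp (-(τ * (2 * n)))) / (1 - q)^2 * (ε/2)⁻¹) := by
      refine ((Aop n).le_of_opNorm_le (Aop_spec hn).1 _).trans ?_
      gcongr
      refine ((hEb n hn (c n)).2).trans ?_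
      gcongr; exact h1.2
    calc _ ≤ n * (Real.sqrt Real.pi * ((C * Real.exp (-(τ * (2 * n)))) / (1 - q)^2 * (ε/2)⁻¹)) := by gcongr
      _ = _ := by rw [show -(τ * (2 * (n:ℝ))) = -((2 * τ) * n) by ring]; ring
  have hesm := exp_small (f := e) (by positivity : 0 < 2 * τ) hez
  have heA : AE e := AE.of_small hesm
  have hel : Tendsto e atTop (𝓝 0) := by
    have := (hesm 0).trans_tendsto (AE.pow_tendsto 0)
    exact this
  let φt : ℕ → LR := fun n => T n (Ring.inverse (Q n) (eL (1/2) - e n))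
  have happ : ∀ {f : ℕ → LR →L[ℝ] LR} {g : ℕ → LR}, AE f → AE g → AE (fun n => f n (g n)) := by
    intro f g hf hg
    exact AE.bilin (ContinuousLinearMap.id ℝ (LR →L[ℝ] LR)) hf hg
  have happl : ∀ {f : ℕ → LR →L[ℝ] LR} {g : ℕ → LR} {L : LR →L[ℝ] LR} {x : LR}, Tendsto f atTop (𝓝 L) → Tendsto g atTop (𝓝 x) →
      Tendsto (fun n => f n (g n)) atTop (𝓝 (L x)) := by
    intro f g L x hf hg; exact (isBoundedBilinearMap_apply (𝕜 := ℝ) (E := LR) (F := LR)).continuous.tendsto (L, x) |>.comp (hf.prodMk_nhds hg)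
  have hφtA : AE φt := happ hTA (happ hIA ((AE.const _).sub heA))
  have hφtl : Tendsto φt atTop (𝓝 (phiInf (φp 0) (φm 0))) := by
    have := happl hTl (happl hIl ((tendsto_const_nhds (x := eL (1/2))).sub hel))
    rw [sub_zero] at this
    exact this
  refine ⟨c, φt, C / (1 - q) * (ε/2)⁻¹, hcc.mono fun n h => h.1, hφtA, hφtl, ?_, ?_⟩
  · intro n hn
    have hn' : (0:ℝ) < n := by exact_mod_cast hn
    filter_upwards [mulOp_ae (mT_meas hp hm n) (bM n) (Ring.inverse (Q n) (eL (1/2) - e n))] with u hu h1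
    change (mulOp (mT φp φm n) (Ring.inverse (Q n) (eL (1/2) - e n))) u = 0
    rw [hu]
    have h2 : τ < |u|/n := by rwa [lt_div_iff₀ hn']
    simp [mT, secM, hp.supp _ h2, hm.supp _ h2]
  · filter_upwards [hcc, eventually_ge_atTop 1] with n h1 hn j
    have hn' : (0:ℝ) < n := by exact_mod_cast hn
    have hsn : (0:ℝ) < Real.sqrt n := Real.sqrt_pos.mpr hn'
    have hc1 : c n = eb 0 - G n (c n) - E n (c n) := by
      have := h1.1
      simp only [add_apply, ContinuousLinearMap.one_apply] at this
      rw [← this]; simp only [E, sub_apply]; abel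
    have hφ0 : Real.sqrt n • av n 0 = eL (1/2) := by
      apply Lp.ext
      filter_upwards [Lp.coeFn_smul (Real.sqrt n) (av n 0), av_ae n 0, eL_ae (c := 1/2) (by norm_num)] with u x1 x2 x3
      rw [x1, Pi.smul_apply, x2, x3, af, smul_eq_mul, pow_zero, mul_one, ← mul_assoc, mul_inv_cancel₀ hsn.ne', one_mul]
    have hQf : Q n (Real.sqrt n • Aop n (c n)) = eL (1/2) - e n := by
      have x1 : Aop n (c n) = av n 0 - Kop n (T n (Aop n (c n))) - Aop n (E n (c n)) := by
        conv_lhs => rw [hc1]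
        rw [map_sub, map_sub, (Aop_spec hn).2.1]
        rfl
      simp only [Q, e, add_apply, ContinuousLinearMap.mul_apply, ContinuousLinearMap.one_apply, map_smul]
      rw [← hφ0, ← smul_sub]; congr 1
      have x2 := eq_sub_iff_add_eq.mp x1
      have x3 := eq_sub_iff_add_eq.mp x2
      rw [← x3]; abel
    have hφt : φt n = Real.sqrt n • T n (Aop n (c n)) := by
      have hQu : IsUnit (Q n) := ⟨⟨Q n, N n, (hN n hn).1, (hN n hn).2.1⟩, rfl⟩
      simp only [φt]
      rw [← hQf]
      have := Ring.inverse_mul_cancel (Q n) hQu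
      have h5 := congrArg (fun L : LR →L[ℝ] LR => L (Real.sqrt n • Aop n (c n))) this
      have h6 : Ring.inverse (Q n) (Q n (Real.sqrt n • Aop n (c n))) = Real.sqrt n • Aop n (c n) := h5
      rw [h6, map_smul]
    have hcj : c n j = (if j = 0 then 1 else 0) - (Real.sqrt n)⁻¹ * inner ℝ (av n j) (φt n) - (E n (c n)) j := by
      conv_lhs => rw [hc1]
      rw [lp.coeFn_sub, lp.coeFn_sub, Pi.sub_apply, Pi.sub_apply, eb_apply, hφt, real_inner_smul_right, ← mul_assoc, inv_mul_cancel₀ hsn.ne', one_mul]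
      congr 2
      exact Aop_adj hn _ j
    rw [hcj, sub_sub_cancel_left, abs_neg]
    refine ((hEb n hn (c n)).1 j).trans ?_
    calc _ ≤ (C * Real.exp (-(τ * (2 * n)))) / (1 - q) * q ^ j * (ε/2)⁻¹ := by
          have : 0 < 1 - q := by linarith
          gcongr; exact h1.2
      _ = _ := by
          rw [hq, ← Real.exp_nat_mul, show -(τ * (2 * (n:ℝ) + j)) = -(τ * (2 * n)) + j * -τ by ring, Real.exp_add]; ring
end

section
open Topology

lemma re_half {f : ℂ → ℂ} {r : ℝ} (hr : 0 < r) (hr1 : r < 1) (hf : DifferentiableOn ℂ f (Metric.ball 0 1))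
    (hc : ∀ z ∈ Metric.ball (0:ℂ) 1, f (starRingEnd ℂ z) = starRingEnd ℂ (f z)) :
    (∫ θ in (0:ℝ)..Real.pi, (f (r * cexp (I * θ))).re) = Real.pi * (f 0).re := by
  have hmem : ∀ θ : ℝ, (r * cexp (I * θ) : ℂ) ∈ Metric.ball (0:ℂ) 1 := by
    intro θ
    rw [mem_ball_zero_iff, norm_mul, mul_comm I, Complex.norm_exp_ofReal_mul_I]
    simpa [abs_of_pos hr] using hr1
  have hd : DiffContOnCl ℂ f (Metric.ball 0 |r|) := by
    rw [abs_of_pos hr]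
    refine (hf.mono ?_).diffContOnCl_ball (le_refl _) |> fun h => h
    exact Metric.closedBall_subset_ball hr1
  have h1 := hd.circleAverage
  rw [Real.circleAverage_def] at h1
  have hcont : Continuous (fun θ : ℝ => f (r * cexp (I * θ))) := by
    refine hf.continuousOn.comp_continuous (by fun_prop) hmem
  have h2 : ∀ θ : ℝ, f (circleMap 0 r θ) = f (r * cexp (I * θ)) := by
    intro θ; rw [circleMap]; congr 1; rw [zero_add, mul_comm I]
  simp only [h2] at h1
  have h3 := congrArg Complex.re h1
  rw [Complex.smul_re] at h3
  have h4 : (∫ θ in (0:ℝ)..2 * Real.pi, f (r * cexp (I * θ))).re = ∫ θ in (0:ℝ)..2 * Real.pi, (f (r * cexp (I * θ))).re := by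
    have := (Complex.reCLM.intervalIntegral_comp_comm (hcont.intervalIntegrable (μ := volume) 0 (2 * Real.pi)))
    exact this.symm
  have hcr : Continuous (fun θ : ℝ => (f (r * cexp (I * θ))).re) := Complex.continuous_re.comp hcont
  rw [h4, ← intervalIntegral.integral_add_adjacent_intervals (hcr.intervalIntegrable 0 Real.pi) (hcr.intervalIntegrable _ _)] at h3
  have h5 : (∫ θ in Real.pi..2 * Real.pi, (f (r * cexp (I * θ))).re) = ∫ θ in (0:ℝ)..Real.pi, (f (r * cexp (I * θ))).re := by
    have e := intervalIntegral.integral_comp_sub_left (a := 0) (b := Real.pi) (fun θ : ℝ => (f (r * cexp (I * θ))).re) (2 * Real.pi)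
    rw [show 2 * Real.pi - Real.pi = Real.pi by ring, sub_zero] at e
    rw [← e]
    refine intervalIntegral.integral_congr fun θ _ => ?_
    have e2 : (r * cexp (I * ((2 * Real.pi - θ : ℝ) : ℂ)) : ℂ) = starRingEnd ℂ (r * cexp (I * θ)) := by
      rw [map_mul, ← Complex.exp_conj, map_mul, Complex.conj_I, Complex.conj_ofReal, Complex.conj_ofReal]
      congr 1
      rw [show I * ((2 * Real.pi - θ : ℝ) : ℂ) = -I * θ + 2 * Real.pi * I by push_cast; ring, Complex.exp_add, Complex.exp_two_pi_mul_I, mul_one]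
    beta_reduce
    rw [e2, hc _ (hmem θ), Complex.conj_re]
  rw [h5] at h3
  have hpi := Real.pi_pos
  rw [smul_eq_mul] at h3
  field_simp at h3
  linarith

lemma exp_I_norm (θ : ℝ) : ‖cexp (I * θ)‖ = 1 := by
  rw [mul_comm, Complex.norm_exp_ofReal_mul_I]

lemma radial {f : ℂ → ℂ} {z : ℂ} (h : ContinuousAt f z) :
    Tendsto (fun r : ℝ => f (r * z)) (𝓝[<] 1) (𝓝 (f z)) := by
  have h1 : Tendsto (fun r : ℝ => (r:ℂ) * z) (𝓝[<] 1) (𝓝 z) := by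
    have : Continuous (fun r : ℝ => (r:ℂ) * z) := by fun_prop
    have h2 := this.tendsto 1
    simp only [Complex.ofReal_one, one_mul] at h2
    exact h2.mono_left nhdsWithin_le_nhds
  exact h.tendsto.comp h1

lemma ev_r : ∀ᶠ r : ℝ in 𝓝[<] 1, 0 < r ∧ r < 1 := by
  filter_upwards [self_mem_nhdsWithin, mem_nhdsWithin_of_mem_nhds (lt_mem_nhds (zero_lt_one (α := ℝ)))] with r h1 h2
  exact ⟨h2, h1⟩

lemma mean_half {f : ℂ → ℂ} {D : ℝ → ℝ} (hf : DifferentiableOn ℂ f (Metric.ball 0 1))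
    (hc : ∀ z ∈ Metric.ball (0:ℂ) 1, f (starRingEnd ℂ z) = starRingEnd ℂ (f z))
    (hcont : ∀ θ ∈ Ioo (0:ℝ) Real.pi, ContinuousAt f (cexp (I * θ)))
    (hD : IntervalIntegrable D volume 0 Real.pi)
    (hb : ∀ r : ℝ, 0 < r → r < 1 → ∀ θ ∈ Ioo (0:ℝ) Real.pi, ‖f (r * cexp (I * θ))‖ ≤ D θ) :
    (∫ θ in (0:ℝ)..Real.pi, (f (cexp (I * θ))).re) = Real.pi * (f 0).re := by
  have key : Tendsto (fun r : ℝ => ∫ θ in (0:ℝ)..Real.pi, (f (r * cexp (I * θ))).re) (𝓝[<] 1)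
      (𝓝 (∫ θ in (0:ℝ)..Real.pi, (f (cexp (I * θ))).re)) := by
    have hae : ∀ᵐ θ : ℝ, θ ≠ Real.pi := by
      simp [ae_iff, measure_singleton]
    refine intervalIntegral.tendsto_integral_filter_of_dominated_convergence D ?_ ?_ hD ?_
    · filter_upwards [ev_r] with r hr
      have : Continuous (fun θ : ℝ => (f (r * cexp (I * θ))).re) := by
        refine Complex.continuous_re.comp (hf.continuousOn.comp_continuous (by fun_prop) fun θ => ?_)
        rw [mem_ball_zero_iff, norm_mul, exp_I_norm, mul_one]
        simpa [abs_of_pos hr.1] using hr.2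
      exact this.aestronglyMeasurable
    · filter_upwards [ev_r] with r hr
      filter_upwards [hae] with θ h1 h2
      rw [uIoc_of_le Real.pi_pos.le] at h2
      refine (Complex.abs_re_le_norm _).trans (hb r hr.1 hr.2 θ ⟨h2.1, lt_of_le_of_ne h2.2 h1⟩)
    · filter_upwards [hae] with θ h1 h2
      rw [uIoc_of_le Real.pi_pos.le] at h2
      exact (Complex.continuous_re.tendsto _).comp (radial (hcont θ ⟨h2.1, lt_of_le_of_ne h2.2 h1⟩))
  have hconst : Tendsto (fun r : ℝ => ∫ θ in (0:ℝ)..Real.pi, (f (r * cexp (I * θ))).re) (𝓝[<] 1) (𝓝 (Real.pi * (f 0).re)) := by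
    refine tendsto_const_nhds.congr' ?_
    filter_upwards [ev_r] with r hr
    exact (re_half hr.1 hr.2 hf hc).symm
  exact tendsto_nhds_unique key hconst

lemma Y_test {Y : ℝ → ℂ} {g : ℂ → ℂ} {M : ℝ} (hY : IntervalIntegrable Y volume 0 Real.pi)
    (h0 : ∀ k : ℕ, (∫ θ in (0:ℝ)..Real.pi, Y θ * cexp (I * θ) ^ k).re = 0)
    (hf : DifferentiableOn ℂ g (Metric.ball 0 1))
    (hc : ∀ z ∈ Metric.ball (0:ℂ) 1, g (starRingEnd ℂ z) = starRingEnd ℂ (g z))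
    (hcont : ∀ θ ∈ Ioo (0:ℝ) Real.pi, ContinuousAt g (cexp (I * θ)))
    (hb : ∀ r : ℝ, 0 < r → r < 1 → ∀ θ ∈ Ioo (0:ℝ) Real.pi, ‖g (r * cexp (I * θ))‖ ≤ M) :
    (∫ θ in (0:ℝ)..Real.pi, Y θ * g (cexp (I * θ))).re = 0 := by
  have hae : ∀ᵐ θ : ℝ, θ ≠ Real.pi := by
    simp [ae_iff, measure_singleton]
  have hYm : AEStronglyMeasurable Y (volume.restrict (Set.uIoc 0 Real.pi)) := by
    rw [uIoc_of_le Real.pi_pos.le]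
    exact ((intervalIntegrable_iff_integrableOn_Ioc_of_le Real.pi_pos.le).mp hY).1
  have hmem : ∀ r : ℝ, 0 < r → r < 1 → ∀ θ : ℝ, (r * cexp (I * θ) : ℂ) ∈ Metric.ball (0:ℂ) 1 := by
    intro r h1 h2 θ
    rw [mem_ball_zero_iff, norm_mul, exp_I_norm, mul_one]
    simpa [abs_of_pos h1] using h2
  have hgc : ∀ r : ℝ, 0 < r → r < 1 → Continuous (fun θ : ℝ => g (r * cexp (I * θ))) := fun r h1 h2 =>
    hf.continuousOn.comp_continuous (by fun_prop) (hmem r h1 h2)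
  have key : Tendsto (fun r : ℝ => ∫ θ in (0:ℝ)..Real.pi, Y θ * g (r * cexp (I * θ))) (𝓝[<] 1)
      (𝓝 (∫ θ in (0:ℝ)..Real.pi, Y θ * g (cexp (I * θ)))) := by
    refine intervalIntegral.tendsto_integral_filter_of_dominated_convergence (fun θ => ‖Y θ‖ * M) ?_ ?_ (hY.norm.mul_const M) ?_
    · filter_upwards [ev_r] with r hr
      exact hYm.mul (hgc r hr.1 hr.2).aestronglyMeasurable
    · filter_upwards [ev_r] with r hr
      filter_upwards [hae] with θ h1 h2
      rw [uIoc_of_le Real.pi_pos.le] at h2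
      rw [norm_mul]
      exact mul_le_mul_of_nonneg_left (hb r hr.1 hr.2 θ ⟨h2.1, lt_of_le_of_ne h2.2 h1⟩) (norm_nonneg _)
    · filter_upwards [hae] with θ h1 h2
      rw [uIoc_of_le Real.pi_pos.le] at h2
      exact tendsto_const_nhds.mul (radial (hcont θ ⟨h2.1, lt_of_le_of_ne h2.2 h1⟩))
  have hz : ∀ r : ℝ, 0 < r → r < 1 → (∫ θ in (0:ℝ)..Real.pi, Y θ * g (r * cexp (I * θ))).re = 0 := by
    intro r hr0 hr1
    let t : ℕ → ℂ := fun k => ((k.factorial : ℂ))⁻¹ * iteratedDeriv k g 0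
    have hsum : ∀ z ∈ Metric.ball (0:ℂ) 1, HasSum (fun k => t k * z ^ k) (g z) := by
      intro z hz
      have := Complex.hasSum_taylorSeries_on_ball hf hz
      refine this.congr_fun (fun k => ?_)
      simp only [t, smul_eq_mul, sub_zero]; ring
    have hsum2 : ∀ z ∈ Metric.ball (0:ℂ) 1, HasSum (fun k => ((t k).re : ℂ) * z ^ k) (g z) := by
      intro z hz
      have hz' : starRingEnd ℂ z ∈ Metric.ball (0:ℂ) 1 := by simpa using hz
      have h1 := (hsum _ hz').map (starRingEnd ℂ) Complex.continuous_conj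
      rw [hc z hz, Complex.conj_conj] at h1
      have h2 := ((hsum z hz).add h1).mul_left (1/2)
      rw [show (1/2 : ℂ) * (g z + g z) = g z by ring] at h2
      refine h2.congr_fun (fun k => ?_)
      rw [Function.comp_apply, map_mul, map_pow, Complex.conj_conj, ← add_mul, Complex.add_conj]
      push_cast; ring
    have hs : Summable (fun k => |(t k).re| * r ^ k) := by
      have h1 := (hsum2 (r:ℂ) (by simpa [abs_of_pos hr0] using hr1)).summable.norm
      refine h1.congr fun k => ?_
      rw [norm_mul, norm_pow, Complex.norm_real, Complex.norm_real, Real.norm_eq_abs, Real.norm_eq_abs, abs_of_pos hr0]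
    have hI := intervalIntegral.hasSum_integral_of_dominated_convergence (μ := volume) (a := 0) (b := Real.pi)
      (F := fun (k : ℕ) (θ : ℝ) => Y θ * (((t k).re : ℂ) * (r * cexp (I * θ)) ^ k)) (f := fun θ : ℝ => Y θ * g (r * cexp (I * θ)))
      (fun k θ => ‖Y θ‖ * (|(t k).re| * r ^ k))
      (fun k => hYm.mul (by fun_prop))
      (fun k => Eventually.of_forall fun θ _ => by
        rw [norm_mul, norm_mul, norm_pow, norm_mul, exp_I_norm, mul_one, Complex.norm_real, Complex.norm_real, Real.norm_eq_abs, Real.norm_eq_abs, abs_of_pos hr0])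
      (Eventually.of_forall fun θ _ => hs.mul_left _)
      (by
        simp_rw [tsum_mul_left]
        exact hY.norm.mul_const _)
      (Eventually.of_forall fun θ _ => (hsum2 _ (hmem r hr0 hr1 θ)).mul_left _)
    have h3 := Complex.hasSum_re hI
    refine (h3.unique ?_)
    convert hasSum_zero (α := ℝ) (β := ℕ) using 2 with k
    have : (∫ θ in (0:ℝ)..Real.pi, Y θ * (((t k).re : ℂ) * (r * cexp (I * θ)) ^ k)) =
        (((t k).re * r ^ k : ℝ) : ℂ) * ∫ θ in (0:ℝ)..Real.pi, Y θ * cexp (I * θ) ^ k := by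
      rw [← intervalIntegral.integral_const_mul]
      refine intervalIntegral.integral_congr fun θ _ => ?_
      beta_reduce; push_cast; ring
    rw [this, Complex.re_ofReal_mul, h0 k, mul_zero]
  have k2 := (Complex.continuous_re.tendsto _).comp key
  refine tendsto_nhds_unique k2 (tendsto_const_nhds.congr' ?_)
  filter_upwards [ev_r] with r hr
  exact (hz r hr.1 hr.2).symm
end

def Fd (a b : ℝ) (S : ℂ → ℂ) (z : ℂ) : ℂ := (1 - z) ^ (a:ℂ) * (1 + z) ^ (b:ℂ) * cexp (S z)

section
open Topology
variable {S : ℂ → ℂ} {R : ℝ} {a b : ℝ}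

lemma slit_sub {z : ℂ} (h : |z.re| < 1) : 1 - z ∈ Complex.slitPlane := by
  left; simp; linarith [(abs_lt.mp h).2]
lemma slit_add {z : ℂ} (h : |z.re| < 1) : 1 + z ∈ Complex.slitPlane := by
  left; simp; linarith [(abs_lt.mp h).1]

lemma Fd_diffAt (hS : SData S R) {z : ℂ} (h : |z.re| < 1) (hz : ‖z‖ < R) : DifferentiableAt ℂ (Fd a b S) z := by
  have h1 : DifferentiableAt ℂ S z := (hS.diff z (by simpa using hz)).differentiableAt (Metric.isOpen_ball.mem_nhds (by simpa using hz))
  unfold Fd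
  exact (((differentiableAt_const _).sub differentiableAt_id).cpow_const (slit_sub h)).mul
    (((differentiableAt_const _).add differentiableAt_id).cpow_const (slit_add h)) |>.mul h1.cexp

lemma Fd_conj (hS : SData S R) {z : ℂ} (h : |z.re| < 1) (hz : ‖z‖ < R) :
    Fd a b S (starRingEnd ℂ z) = starRingEnd ℂ (Fd a b S z) := by
  unfold Fd
  rw [map_mul, map_mul, ← Complex.exp_conj, hS.conj z (by simpa using hz)]
  have e1 := Complex.cpow_conj (1 - z) (a:ℂ) (Complex.slitPlane_arg_ne_pi (slit_sub h))
  have e2 := Complex.cpow_conj (1 + z) (b:ℂ) (Complex.slitPlane_arg_ne_pi (slit_add h))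
  rw [Complex.conj_ofReal] at e1 e2
  rw [e1, e2, Complex.conj_conj, Complex.conj_conj]
  simp only [map_sub, map_add, map_one]

lemma Fd_ne {z : ℂ} (h : |z.re| < 1) : Fd a b S z ≠ 0 := by
  unfold Fd
  refine mul_ne_zero (mul_ne_zero ?_ ?_) (Complex.exp_ne_zero _)
  · rw [Complex.cpow_def_of_ne_zero (Complex.slitPlane_ne_zero (slit_sub h))]; exact Complex.exp_ne_zero _
  · rw [Complex.cpow_def_of_ne_zero (Complex.slitPlane_ne_zero (slit_add h))]; exact Complex.exp_ne_zero _

lemma Fd_norm {z : ℂ} : ‖Fd a b S z‖ = ‖1 - z‖ ^ a * ‖1 + z‖ ^ b * Real.exp (S z).re := by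
  unfold Fd
  rw [norm_mul, norm_mul, Complex.norm_cpow_real, Complex.norm_cpow_real, Complex.norm_exp]

lemma Fd_mul {z : ℂ} (h : |z.re| < 1) : Fd (1 - a) (1 - b) (fun z => - S z) z * Fd a b S z = 1 - z ^ 2 := by
  unfold Fd
  have h1 := Complex.slitPlane_ne_zero (slit_sub h)
  have h2 := Complex.slitPlane_ne_zero (slit_add h)
  have e1 : (1 - z) ^ ((1 - a : ℝ):ℂ) * (1 - z) ^ (a:ℂ) = 1 - z := by
    rw [← Complex.cpow_add _ _ h1]; push_cast; rw [sub_add_cancel, Complex.cpow_one]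
  have e2 : (1 + z) ^ ((1 - b : ℝ):ℂ) * (1 + z) ^ (b:ℂ) = 1 + z := by
    rw [← Complex.cpow_add _ _ h2]; push_cast; rw [sub_add_cancel, Complex.cpow_one]
  have e3 : cexp (-S z) * cexp (S z) = 1 := by rw [← Complex.exp_add]; simp
  calc _ = ((1 - z) ^ ((1 - a : ℝ):ℂ) * (1 - z) ^ (a:ℂ)) * ((1 + z) ^ ((1 - b : ℝ):ℂ) * (1 + z) ^ (b:ℂ)) * (cexp (-S z) * cexp (S z)) := by ring
    _ = _ := by rw [e1, e2, e3]; ring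

lemma SData.negS (h : SData S R) : SData (fun z => - S z) R where
  one_lt := h.one_lt
  diff := h.diff.neg
  conj := fun z hz => by rw [h.conj z hz, map_neg]

lemma arc_re {θ : ℝ} (h : θ ∈ Ioo 0 Real.pi) : |(cexp (I * θ)).re| < 1 := by
  rw [mul_comm, Complex.exp_ofReal_mul_I_re]
  have h1 := Real.sin_pos_of_mem_Ioo h
  have h2 := Real.sin_sq_add_cos_sq θ
  rw [abs_lt]; constructor <;> nlinarith

lemma arc_sub {θ : ℝ} (h : θ ∈ Ioo 0 Real.pi) : Complex.log (1 - cexp (I * θ)) = Real.log (2 * Real.sin (θ/2)) + ((θ - Real.pi)/2 : ℝ) * I := by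
  have hs : 0 < 2 * Real.sin (θ/2) := by
    have := Real.sin_pos_of_pos_of_lt_pi (x := θ/2) (by linarith [h.1]) (by linarith [h.2, h.1, Real.pi_pos]); linarith
  have e : 1 - cexp (I * θ) = (2 * Real.sin (θ/2) : ℝ) * cexp (((θ - Real.pi)/2 : ℝ) * I) := by
    apply Complex.ext
    · rw [Complex.re_ofReal_mul, Complex.exp_ofReal_mul_I_re, Complex.sub_re, mul_comm I, Complex.exp_ofReal_mul_I_re, Complex.one_re,
        show (θ - Real.pi)/2 = θ/2 - Real.pi/2 by ring, Real.cos_sub_pi_div_two]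
      have := Real.cos_two_mul (θ/2)
      rw [show 2 * (θ/2) = θ by ring] at this
      have h2 := Real.sin_sq_add_cos_sq (θ/2)
      rw [this]; nlinarith
    · rw [Complex.im_ofReal_mul, Complex.exp_ofReal_mul_I_im, Complex.sub_im, mul_comm I, Complex.exp_ofReal_mul_I_im, Complex.one_im,
        show (θ - Real.pi)/2 = θ/2 - Real.pi/2 by ring, Real.sin_sub_pi_div_two]
      have := Real.sin_two_mul (θ/2)
      rw [show 2 * (θ/2) = θ by ring] at this
      rw [this]; ring
  rw [e, Complex.log_ofReal_mul hs (Complex.exp_ne_zero _), Complex.log_exp]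
  · simp; linarith [h.1, Real.pi_pos]
  · simp; linarith [h.2, Real.pi_pos]

lemma arc_add {θ : ℝ} (h : θ ∈ Ioo 0 Real.pi) : Complex.log (1 + cexp (I * θ)) = Real.log (2 * Real.cos (θ/2)) + (θ/2 : ℝ) * I := by
  have hs : 0 < 2 * Real.cos (θ/2) := by
    have := Real.cos_pos_of_mem_Ioo (x := θ/2) ⟨by linarith [h.1, Real.pi_pos], by linarith [h.2]⟩; linarith
  have e : 1 + cexp (I * θ) = (2 * Real.cos (θ/2) : ℝ) * cexp ((θ/2 : ℝ) * I) := by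
    apply Complex.ext
    · rw [Complex.re_ofReal_mul, Complex.exp_ofReal_mul_I_re, Complex.add_re, mul_comm I, Complex.exp_ofReal_mul_I_re, Complex.one_re]
      have := Real.cos_two_mul (θ/2)
      rw [show 2 * (θ/2) = θ by ring] at this
      rw [this]; ring
    · rw [Complex.im_ofReal_mul, Complex.exp_ofReal_mul_I_im, Complex.add_im, mul_comm I, Complex.exp_ofReal_mul_I_im, Complex.one_im]
      have := Real.sin_two_mul (θ/2)
      rw [show 2 * (θ/2) = θ by ring] at this
      rw [this]; ring
  rw [e, Complex.log_ofReal_mul hs (Complex.exp_ne_zero _), Complex.log_exp]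
  · simp; linarith [h.1, Real.pi_pos]
  · simp; linarith [h.2, Real.pi_pos]

lemma Fd_b (hS : SData S R) {θ : ℝ} (h : θ ∈ Ioo 0 Real.pi) :
    Fd a b S (cexp (I * θ)) = bfun a b S θ * starRingEnd ℂ (Fd a b S (cexp (I * θ))) := by
  have h1 := Complex.slitPlane_ne_zero (slit_sub (arc_re h))
  have h2 := Complex.slitPlane_ne_zero (slit_add (arc_re h))
  have hc : starRingEnd ℂ (S (cexp (I * θ))) = S (cexp (-(I * θ))) := by
    rw [← hS.conj, ← Complex.exp_conj]
    · congr 2; simp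
    · rw [mem_ball_zero_iff, exp_I_norm]; exact hS.one_lt
  unfold Fd bfun
  rw [Complex.cpow_def_of_ne_zero h1, Complex.cpow_def_of_ne_zero h2, arc_sub h, arc_add h, map_mul, map_mul, ← Complex.exp_conj, ← Complex.exp_conj,
    ← Complex.exp_conj, hc]
  simp only [map_mul, map_add, Complex.conj_ofReal, Complex.conj_I]
  simp only [← Complex.exp_add]
  congr 1
  push_cast
  ring

lemma bfun_norm (hS : SData S R) (θ : ℝ) : ‖bfun a b S θ‖ = 1 := by
  have hc : starRingEnd ℂ (S (cexp (I * θ))) = S (cexp (-(I * θ))) := by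
    rw [← hS.conj, ← Complex.exp_conj]
    · congr 2; simp
    · rw [mem_ball_zero_iff, exp_I_norm]; exact hS.one_lt
  rw [bfun, Complex.norm_exp, ← hc]
  simp

lemma bfun_cont (hS : SData S R) : Continuous (bfun a b S) := by
  unfold bfun
  have h1 : Continuous (fun θ : ℝ => S (cexp (I * θ))) := hS.cont.comp_continuous (by fun_prop) (fun θ => by
    rw [mem_ball_zero_iff, exp_I_norm]; exact hS.one_lt)
  have h2 : Continuous (fun θ : ℝ => S (cexp (-(I * θ)))) := hS.cont.comp_continuous (by fun_prop) (fun θ => by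
    rw [mem_ball_zero_iff, show -(I * (θ:ℂ)) = I * ((-θ : ℝ):ℂ) by push_cast; ring, exp_I_norm]; exact hS.one_lt)
  exact (Continuous.add (by fun_prop) (h1.sub h2)).cexp

lemma norm_half {z : ℂ} (hz : ‖z‖ = 1) {r : ℝ} (h0 : 0 ≤ r) (h1 : r ≤ 1) : ‖1 - z‖ / 2 ≤ ‖1 - r * z‖ := by
  have e1 : 1 - z = (1 - r * z) - (1 - r : ℝ) * z := by push_cast; ring
  have e2 : ‖1 - z‖ ≤ ‖1 - r * z‖ + (1 - r) := by
    calc ‖1 - z‖ ≤ ‖1 - r * z‖ + ‖((1 - r : ℝ) : ℂ) * z‖ := by rw [e1]; exact norm_sub_le _ _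
      _ = _ := by rw [norm_mul, hz, mul_one, Complex.norm_real, Real.norm_of_nonneg (by linarith)]
  have e3 : 1 - r ≤ ‖1 - r * z‖ := by
    have := norm_sub_norm_le (1:ℂ) (r * z)
    rw [norm_one, norm_mul, hz, mul_one, Complex.norm_real, Real.norm_of_nonneg h0] at this
    exact this
  linarith

lemma rpow_bd {x y a s : ℝ} (hy : 0 < y) (hx : y / 2 ≤ x) (hx2 : x ≤ 2) (hs : 0 ≤ s) (ha : -s ≤ a) :
    x ^ a ≤ 2 ^ a * (y / 4) ^ (-s) := by
  have hx0 : 0 < x := by linarith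
  have e : x ^ a = 2 ^ a * (x / 2) ^ a := by
    rw [← Real.mul_rpow (by norm_num) (by positivity)]; congr 1; ring
  rw [e]
  gcongr
  calc (x/2)^a ≤ (x/2)^(-s) := Real.rpow_le_rpow_of_exponent_ge (by positivity) (by linarith) ha
    _ ≤ (y/4)^(-s) := Real.rpow_le_rpow_of_nonpos (by positivity) (by linarith) (by linarith)

lemma Fd_bound (hS : SData S R) {s : ℝ} (hs : 0 ≤ s) (ha : -s ≤ a) (hb : -s ≤ b) :
    ∃ C, 0 ≤ C ∧ ∀ r : ℝ, 0 ≤ r → r ≤ 1 → ∀ θ ∈ Ioo (0:ℝ) Real.pi, ‖Fd a b S (r * cexp (I * θ))‖ ≤ C * (Real.sin θ) ^ (-s) := by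
  obtain ⟨M, hM⟩ := (isCompact_closedBall (0:ℂ) 1).exists_bound_of_continuousOn (hS.cont.mono (Metric.closedBall_subset_ball hS.one_lt))
  refine ⟨2 ^ a * 2 ^ b * (1/8) ^ (-s) * Real.exp M, by positivity, fun r h0 h1 θ hθ => ?_⟩
  set z := cexp (I * θ) with hz
  have nz : ‖z‖ = 1 := exp_I_norm θ
  have hsin := Real.sin_pos_of_mem_Ioo hθ
  have hprod : ‖1 - z‖ * ‖1 + z‖ = 2 * Real.sin θ := by
    rw [← norm_mul, show (1 - z) * (1 + z) = (-(2 * Real.sin θ) : ℝ) * (I * z) by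
      have e : z = Real.cos θ + Real.sin θ * I := by
        rw [hz, mul_comm, Complex.exp_mul_I]; push_cast; rfl
      have h2 : (Real.sin θ : ℂ)^2 + (Real.cos θ : ℂ)^2 = 1 := by exact_mod_cast Real.sin_sq_add_cos_sq θ
      rw [e]; push_cast; push_cast at h2
      linear_combination (- (Complex.sin θ)^2) * Complex.I_sq * 1 - h2 + 2 * (Complex.sin θ)^2 * Complex.I_sq]
    rw [norm_mul, norm_mul, nz, Complex.norm_I, Complex.norm_real, norm_neg, Real.norm_of_nonneg (by positivity)]; ring
  have p1 : 0 < ‖1 - z‖ := norm_pos_iff.mpr (Complex.slitPlane_ne_zero (slit_sub (arc_re hθ)))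
  have p2 : 0 < ‖1 + z‖ := norm_pos_iff.mpr (Complex.slitPlane_ne_zero (slit_add (arc_re hθ)))
  have nr : ‖(r:ℂ) * z‖ ≤ 1 := by rw [norm_mul, nz, mul_one, Complex.norm_real, Real.norm_of_nonneg h0]; exact h1
  have u1 : ‖1 - r * z‖ ≤ 2 := by
    refine (norm_sub_le _ _).trans ?_; rw [norm_one]; linarith
  have u2 : ‖1 + r * z‖ ≤ 2 := by
    refine (norm_add_le _ _).trans ?_; rw [norm_one]; linarith
  have l2 : ‖1 + z‖ / 2 ≤ ‖1 + r * z‖ := by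
    have := norm_half (z := -z) (by rw [norm_neg]; exact nz) h0 h1
    simpa using this
  have b1 := rpow_bd p1 (norm_half nz h0 h1) u1 hs ha
  have b2 := rpow_bd p2 l2 u2 hs hb
  have b3 : Real.exp (S (r * z)).re ≤ Real.exp M := by
    apply Real.exp_le_exp.mpr
    refine (Complex.re_le_norm _).trans (hM _ (by simpa using nr))
  rw [Fd_norm]
  calc _ ≤ (2 ^ a * (‖1 - z‖ / 4) ^ (-s)) * (2 ^ b * (‖1 + z‖ / 4) ^ (-s)) * Real.exp M := by gcongr
    _ = 2 ^ a * 2 ^ b * ((‖1 - z‖ / 4) ^ (-s) * (‖1 + z‖ / 4) ^ (-s)) * Real.exp M := by ring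
    _ = 2 ^ a * 2 ^ b * (1/8) ^ (-s) * Real.exp M * Real.sin θ ^ (-s) := by
      rw [← Real.mul_rpow (by positivity) (by positivity), show ‖1 - z‖ / 4 * (‖1 + z‖ / 4) = (1/8) * Real.sin θ by
        linear_combination (1/16) * hprod, Real.mul_rpow (by norm_num) hsin.le]; ring

lemma sin_int {p : ℝ} (h0 : 0 ≤ p) (h1 : p < 1) : IntervalIntegrable (fun θ => Real.sin θ ^ (-p)) volume 0 Real.pi := by
  have hA : IntervalIntegrable (fun θ : ℝ => θ ^ (-p)) volume 0 Real.pi := intervalIntegral.intervalIntegrable_rpow' (by linarith)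
  have hB : IntervalIntegrable (fun θ : ℝ => (Real.pi - θ) ^ (-p)) volume 0 Real.pi := by
    have := hA.comp_sub_left Real.pi
    simpa using this.symm
  have hC := (hA.add hB).const_mul ((2/Real.pi) ^ (-p))
  refine hC.mono_fun' (by
    refine Measurable.aestronglyMeasurable ?_
    exact Real.measurable_sin.pow_const _) ?_
  rw [uIoc_of_le Real.pi_pos.le]
  have hae : ∀ᵐ θ : ℝ, θ ≠ Real.pi := by
    simp [ae_iff, measure_singleton]
  filter_upwards [ae_restrict_mem measurableSet_Ioc, ae_restrict_of_ae hae] with θ hθ hne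
  have hlt : θ < Real.pi := lt_of_le_of_ne hθ.2 hne
  have hsin := Real.sin_pos_of_mem_Ioo ⟨hθ.1, hlt⟩
  have hpi := Real.pi_pos
  rw [Real.norm_of_nonneg (by positivity)]
  have hp1 : (0:ℝ) < Real.pi - θ := by linarith
  have hq : (0:ℝ) < 2/Real.pi := by positivity
  rcases le_total θ (Real.pi/2) with h | h
  · have := Real.mul_le_sin hθ.1.le h
    calc Real.sin θ ^ (-p) ≤ (2/Real.pi * θ) ^ (-p) := Real.rpow_le_rpow_of_nonpos (mul_pos hq hθ.1) this (by linarith)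
      _ = (2/Real.pi) ^ (-p) * θ ^ (-p) := Real.mul_rpow hq.le hθ.1.le
      _ ≤ _ := by
        have : 0 ≤ (Real.pi - θ) ^ (-p) := by positivity
        gcongr; linarith
  · have := Real.mul_le_sin hp1.le (by linarith)
    rw [Real.sin_pi_sub] at this
    calc Real.sin θ ^ (-p) ≤ (2/Real.pi * (Real.pi - θ)) ^ (-p) := Real.rpow_le_rpow_of_nonpos (mul_pos hq hp1) this (by linarith)
      _ = (2/Real.pi) ^ (-p) * (Real.pi - θ) ^ (-p) := Real.mul_rpow hq.le hp1.le
      _ ≤ _ := by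
        have : 0 ≤ θ ^ (-p) := Real.rpow_nonneg hθ.1.le _
        gcongr; linarith
end

section
open Topology

lemma cos_complete {f : ℝ → ℝ} (hf : IntegrableOn f (Ioo 0 Real.pi))
    (h : ∀ m : ℕ, ∫ θ in Ioo 0 Real.pi, f θ * Real.cos θ ^ m = 0) : ∀ᵐ θ : ℝ, θ ∈ Ioo 0 Real.pi → f θ = 0 := by
  refine isOpen_Ioo.ae_eq_zero_of_integral_contDiff_smul_eq_zero hf.locallyIntegrableOn ?_
  intro g hg _ hsupp
  have hp : ∀ p : Polynomial ℝ, ∫ θ in Ioo 0 Real.pi, f θ * p.eval (Real.cos θ) = 0 := by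
    intro p
    induction p using Polynomial.induction_on' with
    | add p q hp hq =>
      have hi : ∀ p : Polynomial ℝ, IntegrableOn (fun θ => f θ * p.eval (Real.cos θ)) (Ioo 0 Real.pi) := by
        intro p
        have hc : Continuous (fun θ : ℝ => p.eval (Real.cos θ)) := by fun_prop
        obtain ⟨M, hM⟩ := isCompact_Icc.exists_bound_of_continuousOn (s := Icc 0 Real.pi) hc.continuousOn
        refine Integrable.mul_bdd (c := M) hf hc.aestronglyMeasurable ?_
        filter_upwards [ae_restrict_mem measurableSet_Ioo] with θ hθ
        exact hM θ (Ioo_subset_Icc_self hθ)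
      simp only [Polynomial.eval_add, mul_add]
      rw [integral_add (hi p) (hi q), hp, hq, add_zero]
    | monomial m c =>
      have := h m
      simp only [Polynomial.eval_monomial]
      calc _ = ∫ θ in Ioo 0 Real.pi, c * (f θ * Real.cos θ ^ m) := by congr 1; ext θ; ring
        _ = 0 := by rw [integral_const_mul, this, mul_zero]
  have e1 : ∫ θ, g θ • f θ = ∫ θ in Ioo 0 Real.pi, f θ * g θ := by
    rw [← integral_indicator measurableSet_Ioo]
    congr 1; ext θ
    by_cases hθ : θ ∈ Ioo 0 Real.pi
    · rw [indicator_of_mem hθ, smul_eq_mul, mul_comm]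
    · rw [indicator_of_notMem hθ, image_eq_zero_of_notMem_tsupport (fun h => hθ (hsupp h)), zero_smul]
  rw [e1]
  have hgb : ∃ M, ∀ θ ∈ Icc 0 Real.pi, ‖g θ‖ ≤ M := isCompact_Icc.exists_bound_of_continuousOn hg.continuous.continuousOn
  obtain ⟨M, hM⟩ := hgb
  have hfg : IntegrableOn (fun θ => f θ * g θ) (Ioo 0 Real.pi) := by
    refine Integrable.mul_bdd (c := M) hf hg.continuous.aestronglyMeasurable ?_
    filter_upwards [ae_restrict_mem measurableSet_Ioo] with θ hθ
    exact hM θ (Ioo_subset_Icc_self hθ)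
  have key : ∀ ε > 0, ‖∫ θ in Ioo 0 Real.pi, f θ * g θ‖ ≤ ε * ∫ θ in Ioo 0 Real.pi, ‖f θ‖ := by
    intro ε hε
    obtain ⟨p, hp'⟩ := exists_polynomial_near_of_continuousOn (-1) 1 (fun x => g (Real.arccos x))
      (hg.continuous.comp Real.continuous_arccos).continuousOn ε hε
    have hc : Continuous (fun θ : ℝ => p.eval (Real.cos θ)) := by fun_prop
    obtain ⟨M', hM'⟩ := isCompact_Icc.exists_bound_of_continuousOn (s := Icc 0 Real.pi) hc.continuousOn
    have hfp : IntegrableOn (fun θ => f θ * p.eval (Real.cos θ)) (Ioo 0 Real.pi) := by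
      refine Integrable.mul_bdd (c := M') hf hc.aestronglyMeasurable ?_
      filter_upwards [ae_restrict_mem measurableSet_Ioo] with θ hθ
      exact hM' θ (Ioo_subset_Icc_self hθ)
    have : ∫ θ in Ioo 0 Real.pi, f θ * g θ = ∫ θ in Ioo 0 Real.pi, (f θ * g θ - f θ * p.eval (Real.cos θ)) := by
      rw [integral_sub hfg hfp, hp p, sub_zero]
    rw [this, ← integral_const_mul]
    refine norm_integral_le_of_norm_le (hf.norm.const_mul ε) ?_
    filter_upwards [ae_restrict_mem measurableSet_Ioo] with θ hθ
    rw [← mul_sub, norm_mul, mul_comm]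
    gcongr
    have := hp' (Real.cos θ) ⟨Real.neg_one_le_cos θ, Real.cos_le_one θ⟩
    rw [Real.arccos_cos hθ.1.le hθ.2.le] at this
    rw [Real.norm_eq_abs, abs_sub_comm]; exact this.le
  have h0 : Tendsto (fun ε : ℝ => ε * ∫ θ in Ioo 0 Real.pi, ‖f θ‖) (𝓝[>] 0) (𝓝 0) := by
    have : Continuous (fun ε : ℝ => ε * ∫ θ in Ioo 0 Real.pi, ‖f θ‖) := by fun_prop
    have h2 := this.tendsto 0
    rw [zero_mul] at h2
    exact h2.mono_left nhdsWithin_le_nhds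
  have := ge_of_tendsto h0 (by filter_upwards [self_mem_nhdsWithin] with ε hε using key ε hε)
  exact norm_le_zero_iff.mp this

lemma bdd_mul_int {f g : ℝ → ℝ} (hf : IntegrableOn f (Ioo 0 Real.pi)) (hg : Continuous g) :
    IntegrableOn (fun θ => f θ * g θ) (Ioo 0 Real.pi) := by
  obtain ⟨M, hM⟩ := isCompact_Icc.exists_bound_of_continuousOn (s := Icc 0 Real.pi) hg.continuousOn
  refine Integrable.mul_bdd (c := M) hf hg.aestronglyMeasurable ?_
  filter_upwards [ae_restrict_mem measurableSet_Ioo] with θ hθ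
  exact hM θ (Ioo_subset_Icc_self hθ)

lemma sin_complete {f : ℝ → ℝ} (hf : IntegrableOn f (Ioo 0 Real.pi))
    (h : ∀ k : ℕ, ∫ θ in Ioo 0 Real.pi, f θ * Real.sin (k * θ) = 0) : ∀ᵐ θ : ℝ, θ ∈ Ioo 0 Real.pi → f θ = 0 := by
  have h1 : ∀ m : ℕ, ∀ k : ℕ, ∫ θ in Ioo 0 Real.pi, f θ * (Real.sin (k * θ) * Real.cos θ ^ m) = 0 := by
    intro m
    induction m with
    | zero => intro k; simpa using h k
    | succ m ih =>
      intro k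
      rcases k with _ | k
      · simp
      · have e : ∀ θ : ℝ, f θ * (Real.sin ((k+1:ℕ) * θ) * Real.cos θ ^ (m+1)) =
            (1/2) * (f θ * (Real.sin ((k+2:ℕ) * θ) * Real.cos θ ^ m)) + (1/2) * (f θ * (Real.sin ((k:ℕ) * θ) * Real.cos θ ^ m)) := by
          intro θ
          have a1 : Real.sin ((k+2:ℕ) * θ) = Real.sin ((k+1:ℕ) * θ) * Real.cos θ + Real.cos ((k+1:ℕ) * θ) * Real.sin θ := by
            rw [← Real.sin_add]; congr 1; push_cast; ring
          have a2 : Real.sin ((k:ℕ) * θ) = Real.sin ((k+1:ℕ) * θ) * Real.cos θ - Real.cos ((k+1:ℕ) * θ) * Real.sin θ := by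
            rw [← Real.sin_sub]; congr 1; push_cast; ring
          rw [a1, a2, pow_succ]; ring
        simp_rw [e]
        rw [integral_add ((bdd_mul_int hf (by fun_prop)).const_mul _) ((bdd_mul_int hf (by fun_prop)).const_mul _),
          integral_const_mul, integral_const_mul, ih, ih]; simp
  have h2 := cos_complete (f := fun θ => f θ * Real.sin θ) (bdd_mul_int hf Real.continuous_sin) (fun m => by
    have := h1 m 1
    simp only [Nat.cast_one, one_mul] at this
    refine Eq.trans ?_ this; congr 1; ext θ; ring)
  filter_upwards [h2] with θ hθ hm
  have := hθ hm
  rcases mul_eq_zero.mp this with h | h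
  · exact h
  · exact absurd h (Real.sin_pos_of_mem_Ioo hm).ne'

abbrev LA := Lp ℂ 2 (volume.restrict (Ioo (0:ℝ) Real.pi))

lemma inner_LA (f g : LA) : inner ℝ f g = ∫ θ in Ioo (0:ℝ) Real.pi, (starRingEnd ℂ (f θ) * g θ).re := by
  rw [L2.inner_def]; congr 1; ext u; rw [Complex.inner, mul_comm]

lemma Jop_exists (u : ℝ → ℂ) (hu : Continuous u) (h1 : ∀ θ, ‖u θ‖ = 1) :
    ∃ J : LA →L[ℝ] LA, ∀ f : LA, (J f : ℝ → ℂ) =ᵐ[volume.restrict (Ioo (0:ℝ) Real.pi)] fun θ => u θ * starRingEnd ℂ (f θ) := by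
  have hmem : ∀ f : LA, MemLp (fun θ => u θ * starRingEnd ℂ (f θ)) 2 (volume.restrict (Ioo (0:ℝ) Real.pi)) := by
    intro f
    refine MemLp.of_le_mul (c := 1) (Lp.memLp f) (hu.aestronglyMeasurable.mul
      (Complex.continuous_conj.comp_aestronglyMeasurable (Lp.aestronglyMeasurable f))) ?_
    refine Eventually.of_forall fun θ => ?_
    rw [norm_mul, h1, RCLike.norm_conj]
  let T0 : LA →ₗ[ℝ] LA :=
    { toFun := fun f => (hmem f).toLp _
      map_add' := fun f g => by
        rw [← MemLp.toLp_add]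
        apply MemLp.toLp_congr
        filter_upwards [Lp.coeFn_add f g] with u hu
        rw [hu]; simp only [Pi.add_apply, mul_add, map_add]
      map_smul' := fun r f => by
        simp only [RingHom.id_apply]
        rw [← MemLp.toLp_const_smul]
        apply MemLp.toLp_congr
        filter_upwards [Lp.coeFn_smul r f] with u hu
        rw [hu]; simp only [Pi.smul_apply, Complex.real_smul, map_mul, Complex.conj_ofReal]; ring }
  have hb : ∀ f, ‖T0 f‖ ≤ 1 * ‖f‖ := by
    intro f
    refine Lp.norm_le_mul_norm_of_ae_le_mul ?_
    filter_upwards [MemLp.coeFn_toLp (hmem f)] with θ hθ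
    change ‖((hmem f).toLp _ : ℝ → ℂ) θ‖ ≤ _
    rw [hθ, norm_mul, h1, RCLike.norm_conj]
  exact ⟨T0.mkContinuous 1 hb, fun f => MemLp.coeFn_toLp (hmem f)⟩

open Classical in
def Jop (u : ℝ → ℂ) : LA →L[ℝ] LA :=
  if h : ∃ J : LA →L[ℝ] LA, ∀ f : LA, (J f : ℝ → ℂ) =ᵐ[volume.restrict (Ioo (0:ℝ) Real.pi)] fun θ => u θ * starRingEnd ℂ (f θ)
  then h.choose else 0

lemma Jop_ae {u : ℝ → ℂ} (hu : Continuous u) (h1 : ∀ θ, ‖u θ‖ = 1) (f : LA) :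
    (Jop u f : ℝ → ℂ) =ᵐ[volume.restrict (Ioo (0:ℝ) Real.pi)] fun θ => u θ * starRingEnd ℂ (f θ) := by
  have h := Jop_exists u hu h1
  rw [Jop, dif_pos h]
  exact h.choose_spec f

lemma Jop_symm {u : ℝ → ℂ} (hu : Continuous u) (h1 : ∀ θ, ‖u θ‖ = 1) (f g : LA) :
    inner ℝ (Jop u f) g = inner ℝ f (Jop u g) := by
  rw [inner_LA, inner_LA]
  refine integral_congr_ae ?_
  filter_upwards [Jop_ae hu h1 f, Jop_ae hu h1 g] with θ e1 e2
  rw [e1, e2, ← Complex.conj_re]; congr 1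
  simp only [map_mul, Complex.conj_conj]; ring

lemma Jop_sq {u : ℝ → ℂ} (hu : Continuous u) (h1 : ∀ θ, ‖u θ‖ = 1) (f : LA) : Jop u (Jop u f) = f := by
  apply Lp.ext
  filter_upwards [Jop_ae hu h1 f, Jop_ae hu h1 (Jop u f)] with θ e1 e2
  rw [e2, e1, map_mul, Complex.conj_conj, ← mul_assoc, Complex.mul_conj, Complex.normSq_eq_norm_sq, h1]; simp

lemma vA_mem (k : ℕ) : MemLp (fun θ : ℝ => ((Real.sqrt Real.pi)⁻¹ : ℂ) * cexp (-(I * θ)) ^ k) 2 (volume.restrict (Ioo (0:ℝ) Real.pi)) := by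
  refine MemLp.of_bound (C := (Real.sqrt Real.pi)⁻¹) (Continuous.aestronglyMeasurable (by fun_prop)) (Eventually.of_forall fun θ => ?_)
  rw [norm_mul, norm_pow, show -(I * (θ:ℂ)) = I * ((-θ : ℝ):ℂ) by push_cast; ring, exp_I_norm]
  simp [abs_of_nonneg (Real.sqrt_nonneg _)]

def vA (k : ℕ) : LA := (vA_mem k).toLp _

lemma vA_ae (k : ℕ) : (vA k : ℝ → ℂ) =ᵐ[volume.restrict (Ioo (0:ℝ) Real.pi)] fun θ : ℝ => ((Real.sqrt Real.pi)⁻¹ : ℂ) * cexp (-(I * θ)) ^ k :=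
  MemLp.coeFn_toLp _

lemma conj_exp (θ : ℝ) : starRingEnd ℂ (cexp (-(I * θ))) = cexp (I * θ) := by
  rw [← Complex.exp_conj]; congr 1; simp

lemma inner_vA (k : ℕ) (f : LA) : inner ℝ (vA k) f = (Real.sqrt Real.pi)⁻¹ * ∫ θ in Ioo (0:ℝ) Real.pi, (f θ * cexp (I * θ) ^ k).re := by
  rw [inner_LA, ← integral_const_mul]
  refine integral_congr_ae ?_
  filter_upwards [vA_ae k] with θ e1
  rw [e1, map_mul, map_pow, conj_exp, map_inv₀, Complex.conj_ofReal, ← Complex.ofReal_inv, mul_assoc, Complex.re_ofReal_mul]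
  congr 2; ring

lemma cos_int (m : ℤ) (hm : m ≠ 0) : ∫ θ in (0:ℝ)..Real.pi, Real.cos (m * θ) = 0 := by
  have hm' : (m:ℝ) ≠ 0 := by exact_mod_cast hm
  rw [intervalIntegral.integral_comp_mul_left (fun x => Real.cos x) hm', integral_cos]
  simp [Real.sin_int_mul_pi]

lemma vA_orth : Orthonormal ℝ vA := by
  rw [orthonormal_iff_ite]
  intro j k
  rw [inner_vA]
  have : ∫ θ in Ioo (0:ℝ) Real.pi, ((vA k : ℝ → ℂ) θ * cexp (I * θ) ^ j).re =
      ∫ θ in Ioo (0:ℝ) Real.pi, (Real.sqrt Real.pi)⁻¹ * Real.cos (((j:ℤ) - (k:ℤ) : ℤ) * θ) := by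
    refine integral_congr_ae ?_
    filter_upwards [vA_ae k] with θ e1
    rw [e1, ← Complex.ofReal_inv, mul_assoc, Complex.re_ofReal_mul, ← Complex.exp_nat_mul, ← Complex.exp_nat_mul, ← Complex.exp_add]
    congr 1
    rw [show (k:ℂ) * -(I * (θ:ℂ)) + j * (I * θ) = ((((j:ℤ) - (k:ℤ) : ℤ) * θ : ℝ) : ℂ) * I by push_cast; ring, Complex.exp_ofReal_mul_I_re]
  rw [this, integral_const_mul, ← integral_Ioc_eq_integral_Ioo, ← intervalIntegral.integral_of_le Real.pi_pos.le]
  split_ifs with h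
  · subst h
    simp only [sub_self, Int.cast_zero, zero_mul, Real.cos_zero, intervalIntegral.integral_const, smul_eq_mul, sub_zero, mul_one]
    rw [← mul_assoc, ← mul_inv, Real.mul_self_sqrt Real.pi_pos.le, inv_mul_cancel₀ Real.pi_pos.ne']
  · rw [cos_int _ (by omega)]; simp

lemma Psi_exists : ∃ T : l2 →L[ℝ] LA, ‖T‖ ≤ 1 ∧ (∀ j, T (eb j) = vA j) ∧ ∀ c : l2, HasSum (fun j => c j • vA j) (T c) := by
  refine bessel_clm vA 1 zero_le_one fun s c => ?_
  have := vA_orth.inner_sum c c s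
  rw [real_inner_self_eq_norm_sq] at this
  rw [this]; simp [sq]

def Psi : l2 →L[ℝ] LA := Psi_exists.choose
lemma Psi_eb (j : ℕ) : Psi (eb j) = vA j := Psi_exists.choose_spec.2.1 j
lemma Psi_hasSum (c : l2) : HasSum (fun j => c j • vA j) (Psi c) := Psi_exists.choose_spec.2.2 c

lemma inner_vA_Psi (j : ℕ) (c : l2) : inner ℝ (vA j) (Psi c) = c j := by
  have h := (Psi_hasSum c).mapL (innerSL ℝ (vA j))
  refine h.unique ?_
  have : (fun i => innerSL ℝ (vA j) (c i • vA i)) = fun i => if i = j then c j else 0 := by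
    ext i
    rw [innerSL_apply_apply, real_inner_smul_right, orthonormal_iff_ite.mp vA_orth]
    by_cases h : j = i
    · subst h; simp
    · rw [if_neg h, if_neg (fun h' => h h'.symm), mul_zero]
  rw [this]
  exact hasSum_ite_eq j (c j)

lemma Psi_inner (c : l2) (f : LA) (h : ∀ k, k ≠ 0 → inner ℝ (vA k) f = 0) : inner ℝ (Psi c) f = c 0 * inner ℝ (vA 0) f := by
  have h1 := (Psi_hasSum c).mapL (innerSL ℝ f)
  rw [real_inner_comm]
  refine h1.unique ?_
  have : (fun i => innerSL ℝ f (c i • vA i)) = fun i => if i = 0 then c 0 * inner ℝ (vA 0) f else 0 := by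
    ext i
    rw [innerSL_apply_apply, real_inner_smul_right, real_inner_comm]
    split_ifs with hi
    · subst hi; rfl
    · rw [h i hi, mul_zero]
  rw [this]
  exact hasSum_ite_eq 0 _

def uS (a b : ℝ) (S : ℂ → ℂ) (n : ℕ) (θ : ℝ) : ℂ := cexp (I * θ) ^ (2 * n) * bfun a b S θ

def Hop (a b : ℝ) (S : ℂ → ℂ) (n : ℕ) : l2 →L[ℝ] l2 := Psi.adjoint ∘L (Jop (uS a b S n)) ∘L Psi

variable {S : ℂ → ℂ} {R : ℝ} {a b : ℝ}

lemma uS_cont (hS : SData S R) (n : ℕ) : Continuous (uS a b S n) := by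
  have := bfun_cont (a := a) (b := b) hS
  unfold uS; fun_prop
lemma uS_norm (hS : SData S R) (n : ℕ) (θ : ℝ) : ‖uS a b S n θ‖ = 1 := by
  rw [uS, norm_mul, norm_pow, exp_I_norm, bfun_norm hS]; simp

lemma Hop_entries (hS : SData S R) (n j k : ℕ) :
    inner ℝ (eb j) (Hop a b S n (eb k)) = bhat a b S (2 * n + (j + k)) := by
  simp only [Hop, ContinuousLinearMap.comp_apply, ContinuousLinearMap.adjoint_inner_right, Psi_eb]
  rw [inner_vA]
  have hpi := Real.pi_pos
  have e : ∫ θ in Ioo (0:ℝ) Real.pi, ((Jop (uS a b S n) (vA k) : ℝ → ℂ) θ * cexp (I * θ) ^ j).re =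
      ∫ θ in Ioo (0:ℝ) Real.pi, (Real.sqrt Real.pi)⁻¹ * (bfun a b S θ * cexp (I * (2 * n + (j + k) : ℕ) * θ)).re := by
    refine integral_congr_ae ?_
    filter_upwards [vA_ae k, Jop_ae (uS_cont hS n) (uS_norm hS n) (vA k)] with θ e1 e2
    rw [e2, e1, map_mul, map_pow, conj_exp, map_inv₀, Complex.conj_ofReal, ← Complex.ofReal_inv, ← Complex.re_ofReal_mul, uS]
    congr 1
    rw [show I * ((2 * n + (j + k) : ℕ):ℂ) * θ = ((2 * n + (j + k) : ℕ):ℂ) * (I * θ) by ring, Complex.exp_nat_mul, pow_add, pow_add]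
    ring
  have hc : Continuous (fun θ : ℝ => bfun a b S θ * cexp (I * (2 * n + (j + k) : ℕ) * θ)) := by
    have := bfun_cont (a := a) (b := b) hS
    fun_prop
  rw [e, integral_const_mul, ← mul_assoc, ← mul_inv, Real.mul_self_sqrt hpi.le, bhat, one_div, ← integral_Ioc_eq_integral_Ioo,
    ← intervalIntegral.integral_of_le hpi.le]
  congr 1
  exact Complex.reCLM.intervalIntegral_comp_comm (hc.intervalIntegrable (μ := volume) 0 Real.pi)
end

section
open Topology

def Rz (n : ℕ) (Q : Polynomial ℝ) (z : ℂ) : ℂ :=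
  ∑ j ∈ Finset.range (n+1), (Q.coeff j : ℂ) * (2⁻¹ : ℂ) ^ j * z ^ (n - j) * (z ^ 2 + 1) ^ j

lemma exp_sq_add_one (θ : ℝ) : cexp (I * θ) ^ 2 + 1 = 2 * cexp (I * θ) * (Real.cos θ : ℝ) := by
  rw [Complex.ofReal_cos, Complex.cos, ← mul_comm I (θ:ℂ), show -(θ:ℂ) * I = -(I * θ) by ring, Complex.exp_neg]
  have := Complex.exp_ne_zero (I * θ)
  field_simp

lemma Rz_arc {n : ℕ} {Q : Polynomial ℝ} (hQ : Q.natDegree ≤ n) (θ : ℝ) :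
    Rz n Q (cexp (I * θ)) = (Q.eval (Real.cos θ) : ℝ) * cexp (I * θ) ^ n := by
  rw [Q.eval_eq_sum_range' (Nat.lt_succ_of_le hQ), Rz, Complex.ofReal_sum, Finset.sum_mul]
  refine Finset.sum_congr rfl fun j hj => ?_
  have hj' : j ≤ n := Nat.lt_succ_iff.mp (Finset.mem_range.mp hj)
  rw [exp_sq_add_one, mul_pow, mul_pow]
  have e : cexp (I * θ) ^ n = cexp (I * θ) ^ (n - j) * cexp (I * θ) ^ j := by rw [← pow_add]; congr 1; omega
  have e2 : (2⁻¹ : ℂ) ^ j * 2 ^ j = 1 := by rw [← mul_pow]; norm_num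
  rw [e]; push_cast
  linear_combination (Q.coeff j : ℂ) * cexp (I * θ) ^ (n - j) * cexp (I * θ) ^ j * (Complex.cos θ) ^ j * e2

lemma Rz_zero (n : ℕ) (Q : Polynomial ℝ) : Rz n Q 0 = (Q.coeff n : ℂ) * (2⁻¹ : ℂ) ^ n := by
  rw [Rz, Finset.sum_range_succ, Finset.sum_eq_zero]
  · simp
  · intro j hj
    have : n - j ≠ 0 := by have := Finset.mem_range.mp hj; omega
    simp [this]

lemma Rz_conj (n : ℕ) (Q : Polynomial ℝ) (z : ℂ) : Rz n Q (starRingEnd ℂ z) = starRingEnd ℂ (Rz n Q z) := by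
  simp only [Rz, map_sum, map_mul, map_pow, map_add, map_one, Complex.conj_ofReal, map_inv₀, map_ofNat]

lemma Rz_diff (n : ℕ) (Q : Polynomial ℝ) : Differentiable ℂ (Rz n Q) := by
  unfold Rz; fun_prop

variable {S : ℂ → ℂ} {R : ℝ} {a b : ℝ}

def XQ (a b : ℝ) (S : ℂ → ℂ) (n : ℕ) (Q : Polynomial ℝ) (θ : ℝ) : ℂ :=
  (Q.eval (Real.cos θ) : ℝ) * cexp (I * θ) ^ n * Fd a b S (cexp (I * θ))

lemma ball_re {z : ℂ} (h : z ∈ Metric.ball (0:ℂ) 1) : |z.re| < 1 :=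
  lt_of_le_of_lt (Complex.abs_re_le_norm z) (by simpa using h)

lemma Fd_contArc (hS : SData S R) {θ : ℝ} (h : θ ∈ Ioo 0 Real.pi) : ContinuousAt (Fd a b S) (cexp (I * θ)) :=
  (Fd_diffAt hS (arc_re h) (by rw [exp_I_norm]; exact hS.one_lt)).continuousAt

lemma Fd_diffBall (hS : SData S R) : DifferentiableOn ℂ (Fd a b S) (Metric.ball 0 1) := fun z hz =>
  (Fd_diffAt hS (ball_re hz) (lt_trans (by simpa using hz) hS.one_lt)).differentiableWithinAt

lemma Fd_conjBall (hS : SData S R) : ∀ z ∈ Metric.ball (0:ℂ) 1, Fd a b S (starRingEnd ℂ z) = starRingEnd ℂ (Fd a b S z) := fun z hz =>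
  Fd_conj hS (ball_re hz) (lt_trans (by simpa using hz) hS.one_lt)

lemma Fd_arc_cont (hS : SData S R) : ContinuousOn (fun θ : ℝ => Fd a b S (cexp (I * θ))) (Ioo 0 Real.pi) := fun θ hθ =>
  (ContinuousAt.comp (f := fun θ : ℝ => cexp (I * θ)) (Fd_contArc hS hθ) (by fun_prop)).continuousWithinAt

lemma ex_s (ha : -(1/2) < a) (hb : -(1/2) < b) : ∃ s : ℝ, 0 ≤ s ∧ s < 1/2 ∧ -s ≤ a ∧ -s ≤ b := by
  refine ⟨max 0 (max (-a) (-b)), le_max_left _ _, ?_, ?_, ?_⟩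
  · simp only [max_lt_iff]; exact ⟨by norm_num, by linarith, by linarith⟩
  · have : -a ≤ max 0 (max (-a) (-b)) := (le_max_left _ _).trans (le_max_right _ _)
    linarith
  · have : -b ≤ max 0 (max (-a) (-b)) := (le_max_right _ _).trans (le_max_right _ _)
    linarith

lemma Fd_sq_int (hS : SData S R) (ha : -(1/2) < a) (hb : -(1/2) < b) {g : ℝ → ℝ} (hg : Continuous g) :
    IntegrableOn (fun θ : ℝ => g θ * ‖Fd a b S (cexp (I * θ))‖ ^ 2) (Ioo 0 Real.pi) := by
  obtain ⟨s, s0, s1, sa, sb⟩ := ex_s ha hb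
  obtain ⟨C, C0, hC⟩ := Fd_bound hS s0 sa sb
  have h2 : IntegrableOn (fun θ : ℝ => ‖Fd a b S (cexp (I * θ))‖ ^ 2) (Ioo 0 Real.pi) := by
    have hi := (sin_int (p := 2 * s) (by linarith) (by linarith)).const_mul (C ^ 2)
    rw [intervalIntegrable_iff_integrableOn_Ioo_of_le Real.pi_pos.le] at hi
    refine Integrable.mono' hi (((Fd_arc_cont hS).norm.pow 2).aestronglyMeasurable measurableSet_Ioo) ?_
    filter_upwards [ae_restrict_mem measurableSet_Ioo] with θ hθ
    have h1 := hC 1 zero_le_one le_rfl θ hθ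
    simp only [Complex.ofReal_one, one_mul] at h1
    have hs := Real.sin_pos_of_mem_Ioo hθ
    rw [Real.norm_of_nonneg (by positivity)]
    calc _ ≤ (C * Real.sin θ ^ (-s)) ^ 2 := by gcongr
      _ = _ := by rw [mul_pow, ← Real.rpow_natCast (Real.sin θ ^ (-s)), ← Real.rpow_mul hs.le]; congr 2; push_cast; ring
  have := bdd_mul_int h2 hg
  refine this.congr (Eventually.of_forall fun θ => ?_)
  simp only []; ring

lemma XQ_cont (hS : SData S R) (n : ℕ) (Q : Polynomial ℝ) : ContinuousOn (XQ a b S n Q) (Ioo 0 Real.pi) := by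
  have h := Fd_arc_cont (a := a) (b := b) hS
  unfold XQ
  have : Continuous fun θ : ℝ => ((Q.eval (Real.cos θ) : ℝ) : ℂ) * cexp (I * θ) ^ n := by fun_prop
  exact this.continuousOn.mul h

lemma XQ_normsq (n : ℕ) (Q : Polynomial ℝ) (θ : ℝ) : ‖XQ a b S n Q θ‖ ^ 2 = Q.eval (Real.cos θ) ^ 2 * ‖Fd a b S (cexp (I * θ))‖ ^ 2 := by
  rw [XQ, norm_mul, norm_mul, norm_pow, exp_I_norm, one_pow, mul_one, mul_pow, Complex.norm_real, Real.norm_eq_abs, sq_abs]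

lemma XQ_mem (hS : SData S R) (ha : -(1/2) < a) (hb : -(1/2) < b) (n : ℕ) (Q : Polynomial ℝ) :
    MemLp (XQ a b S n Q) 2 (volume.restrict (Ioo 0 Real.pi)) := by
  rw [memLp_two_iff_integrable_sq_norm ((XQ_cont hS n Q).aestronglyMeasurable measurableSet_Ioo)]
  refine (Fd_sq_int hS ha hb (g := fun θ => Q.eval (Real.cos θ) ^ 2) (by fun_prop)).congr (Eventually.of_forall fun θ => ?_)
  exact (XQ_normsq n Q θ).symm

open Classical in
def XL (a b : ℝ) (S : ℂ → ℂ) (n : ℕ) (Q : Polynomial ℝ) : LA :=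
  if h : MemLp (XQ a b S n Q) 2 (volume.restrict (Ioo 0 Real.pi)) then h.toLp _ else 0

lemma XL_ae (hS : SData S R) (ha : -(1/2) < a) (hb : -(1/2) < b) (n : ℕ) (Q : Polynomial ℝ) :
    (XL a b S n Q : ℝ → ℂ) =ᵐ[volume.restrict (Ioo 0 Real.pi)] XQ a b S n Q := by
  have h := XQ_mem hS ha hb n Q
  rw [XL, dif_pos h]
  exact MemLp.coeFn_toLp h

lemma XL_inner (hS : SData S R) (ha : -(1/2) < a) (hb : -(1/2) < b) (n : ℕ) (Q Q' : Polynomial ℝ) :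
    inner ℝ (XL a b S n Q) (XL a b S n Q') = ∫ θ in Ioo 0 Real.pi, Q.eval (Real.cos θ) * Q'.eval (Real.cos θ) * ‖Fd a b S (cexp (I * θ))‖ ^ 2 := by
  rw [inner_LA]
  refine integral_congr_ae ?_
  filter_upwards [XL_ae hS ha hb n Q, XL_ae hS ha hb n Q'] with θ e1 e2
  rw [e1, e2, XQ, XQ]
  simp only [map_mul, Complex.conj_ofReal, map_pow]
  set z := cexp (I * θ) with hz
  have hzz : starRingEnd ℂ z * z = 1 := by
    rw [mul_comm, Complex.mul_conj, Complex.normSq_eq_norm_sq, hz, exp_I_norm]; simp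
  have hff : starRingEnd ℂ (Fd a b S z) * Fd a b S z = ((‖Fd a b S z‖ ^ 2 : ℝ) : ℂ) := by
    rw [mul_comm, Complex.mul_conj, Complex.normSq_eq_norm_sq]
  rw [show ((Q.eval (Real.cos θ) : ℝ) : ℂ) * (starRingEnd ℂ) z ^ n * (starRingEnd ℂ) (Fd a b S z) *
      (((Q'.eval (Real.cos θ) : ℝ) : ℂ) * z ^ n * Fd a b S z) = ((Q.eval (Real.cos θ) : ℝ) : ℂ) * ((Q'.eval (Real.cos θ) : ℝ) : ℂ) *
      (starRingEnd ℂ z * z) ^ n * (starRingEnd ℂ (Fd a b S z) * Fd a b S z) by rw [mul_pow]; ring, hzz, hff, one_pow, mul_one]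
  norm_cast

lemma XL_J (hS : SData S R) (ha : -(1/2) < a) (hb : -(1/2) < b) (n : ℕ) (Q : Polynomial ℝ) :
    Jop (uS a b S n) (XL a b S n Q) = XL a b S n Q := by
  apply Lp.ext
  filter_upwards [Jop_ae (uS_cont hS n) (uS_norm hS n) (XL a b S n Q), XL_ae hS ha hb n Q, ae_restrict_mem measurableSet_Ioo] with θ e1 e2 hθ
  rw [e1, e2, XQ, uS]
  simp only [map_mul, Complex.conj_ofReal, map_pow]
  conv_rhs => rw [Fd_b hS hθ]
  set z := cexp (I * θ) with hz
  have hzz : z * starRingEnd ℂ z = 1 := by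
    rw [Complex.mul_conj, Complex.normSq_eq_norm_sq, hz, exp_I_norm]; simp
  have : z ^ (2 * n) * starRingEnd ℂ z ^ n = z ^ n := by
    rw [two_mul, pow_add, mul_assoc, ← mul_pow, hzz, one_pow, mul_one]
  linear_combination (bfun a b S θ * ((Q.eval (Real.cos θ) : ℝ) : ℂ) * starRingEnd ℂ (Fd a b S z)) * this

lemma XL_vA (hS : SData S R) (ha : -(1/2) < a) (hb : -(1/2) < b) {n : ℕ} {Q : Polynomial ℝ} (hQ : Q.natDegree ≤ n) (k : ℕ) :
    inner ℝ (vA k) (XL a b S n Q) = if k = 0 then Real.sqrt Real.pi * (Q.coeff n * (2⁻¹) ^ n * Real.exp (S 0).re) else 0 := by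
  rw [inner_vA]
  obtain ⟨s, s0, s1, sa, sb⟩ := ex_s ha hb
  obtain ⟨C, C0, hC⟩ := Fd_bound hS s0 sa sb
  obtain ⟨M, hM⟩ := (isCompact_closedBall (0:ℂ) 1).exists_bound_of_continuousOn (f := fun z => z ^ k * Rz n Q z)
    (((continuous_pow k).mul (Rz_diff n Q).continuous).continuousOn)
  have key := mean_half (f := fun z => z ^ k * Rz n Q z * Fd a b S z) (D := fun θ => M * C * Real.sin θ ^ (-s))
    (by
      have h1 : Differentiable ℂ (fun z : ℂ => z ^ k * Rz n Q z) := (differentiable_pow k).mul (Rz_diff n Q)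
      exact h1.differentiableOn.mul (Fd_diffBall hS))
    (fun z hz => by
      simp only [map_mul, map_pow, Rz_conj, Fd_conjBall hS z hz])
    (fun θ hθ => by
      have h1 : Continuous (fun z : ℂ => z ^ k * Rz n Q z) := (continuous_pow k).mul (Rz_diff n Q).continuous
      exact h1.continuousAt.mul (Fd_contArc hS hθ))
    ((sin_int s0 (by linarith)).const_mul _)
    (fun r r0 r1 θ hθ => by
      rw [norm_mul, mul_assoc]
      have hn : ‖(r:ℂ) * cexp (I * θ)‖ ≤ 1 := by
        rw [norm_mul, exp_I_norm, mul_one, Complex.norm_real, Real.norm_of_nonneg r0.le]; exact r1.le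
      have hz := hM (r * cexp (I * θ)) (by simpa using hn)
      have h2 := hC r r0.le r1.le θ hθ
      exact mul_le_mul hz h2 (norm_nonneg _) ((norm_nonneg _).trans hz))
  have e : ∫ θ in Ioo (0:ℝ) Real.pi, ((XL a b S n Q : ℝ → ℂ) θ * cexp (I * θ) ^ k).re = ∫ θ in (0:ℝ)..Real.pi, (cexp (I * θ) ^ k * Rz n Q (cexp (I * θ)) * Fd a b S (cexp (I * θ))).re := by
    rw [intervalIntegral.integral_of_le Real.pi_pos.le, integral_Ioc_eq_integral_Ioo]
    refine integral_congr_ae ?_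
    filter_upwards [XL_ae hS ha hb n Q] with θ e1
    rw [e1, XQ, Rz_arc hQ]; congr 1; ring
  rw [e, key, Rz_zero]
  have hF0 : Fd a b S 0 = (Real.exp (S 0).re : ℝ) := by
    have him := hS.im_real (x := 0) (by simpa using lt_trans one_pos hS.one_lt)
    rw [Complex.ofReal_zero] at him
    have : S 0 = ((S 0).re : ℂ) := by apply Complex.ext <;> simp [him]
    simp only [Fd, sub_zero, add_zero, Complex.one_cpow, one_mul]
    rw [this]; simp
  split_ifs with hk
  · subst hk
    rw [hF0, pow_zero, one_mul, ← mul_assoc]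
    have e3 : (Real.sqrt Real.pi)⁻¹ * Real.pi = Real.sqrt Real.pi := by
      rw [inv_mul_eq_div, Real.div_sqrt]
    rw [e3, show (Q.coeff n : ℂ) * 2⁻¹ ^ n * ((Real.exp (S 0).re : ℝ) : ℂ) = ((Q.coeff n * (2⁻¹) ^ n * Real.exp (S 0).re : ℝ) : ℂ) by push_cast; ring, Complex.ofReal_re]
  · simp [hk]
end

section
open Topology
variable {S : ℂ → ℂ} {R : ℝ} {a b : ℝ}

lemma sin_orth (j k : ℕ) (hj : j ≠ 0) : ∫ θ in Ioo (0:ℝ) Real.pi, Real.sin (j * θ) * Real.sin (k * θ) = if j = k then Real.pi / 2 else 0 := by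
  have e : ∀ θ : ℝ, Real.sin (j * θ) * Real.sin (k * θ) = (1/2) * Real.cos (((j:ℤ) - k : ℤ) * θ) - (1/2) * Real.cos (((j:ℤ) + k : ℤ) * θ) := by
    intro θ; push_cast
    rw [sub_mul, add_mul, Real.cos_sub, Real.cos_add]; ring
  simp_rw [e]
  rw [← integral_Ioc_eq_integral_Ioo, ← intervalIntegral.integral_of_le Real.pi_pos.le,
    intervalIntegral.integral_sub (Continuous.intervalIntegrable (by fun_prop) _ _) (Continuous.intervalIntegrable (by fun_prop) _ _),
    intervalIntegral.integral_const_mul, intervalIntegral.integral_const_mul, cos_int ((j:ℤ) + k) (by omega)]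
  split_ifs with h
  · subst h; simp; ring
  · rw [cos_int _ (by omega)]; simp

lemma LA_integrable (Y : LA) : IntegrableOn (Y : ℝ → ℂ) (Ioo 0 Real.pi) :=
  (Lp.memLp Y).integrable (by norm_num)

lemma Y_zero (hS : SData S R) (ha : -(1/2) < a) (hb : -(1/2) < b) (ha1 : a ≤ 1) (hb1 : b ≤ 1) {n : ℕ} {Y : LA}
    (hJ : Jop (uS a b S n) Y = Y) (hv : ∀ k, inner ℝ (vA k) Y = 0)
    (ho : ∀ Q : Polynomial ℝ, Q.degree < n → inner ℝ Y (XL a b S n Q) = 0) : Y = 0 := by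
  have hpi := Real.pi_pos
  set r : ℝ → ℝ := fun θ => (Y θ / (cexp (I * θ) ^ n * Fd a b S (cexp (I * θ)))).re with hr
  have hYr : ∀ᵐ θ ∂(volume.restrict (Ioo (0:ℝ) Real.pi)), Y θ = r θ * cexp (I * θ) ^ n * Fd a b S (cexp (I * θ)) := by
    have hJ' := Jop_ae (uS_cont (a := a) (b := b) hS n) (uS_norm hS n) Y
    rw [hJ] at hJ'
    filter_upwards [hJ', ae_restrict_mem measurableSet_Ioo] with θ e1 hθ
    have hF : Fd a b S (cexp (I * θ)) ≠ 0 := Fd_ne (arc_re hθ)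
    have hz : cexp (I * θ) ≠ 0 := Complex.exp_ne_zero _
    have hFb := Fd_b (a := a) (b := b) hS hθ
    have hreal : starRingEnd ℂ (Y θ / (cexp (I * θ) ^ n * Fd a b S (cexp (I * θ)))) = Y θ / (cexp (I * θ) ^ n * Fd a b S (cexp (I * θ))) := by
      rw [map_div₀, map_mul, map_pow]
      have hF' : starRingEnd ℂ (Fd a b S (cexp (I * θ))) ≠ 0 := by simpa using hF
      have hz' : starRingEnd ℂ (cexp (I * θ)) ≠ 0 := by simpa using hz
      rw [div_eq_div_iff (mul_ne_zero (pow_ne_zero _ hz') hF') (mul_ne_zero (pow_ne_zero _ hz) hF)]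
      conv_lhs => rw [hFb]
      conv_rhs => rw [e1, uS]
      have hzz : cexp (I * θ) * starRingEnd ℂ (cexp (I * θ)) = 1 := by
        rw [Complex.mul_conj, Complex.normSq_eq_norm_sq, exp_I_norm]; simp
      have : cexp (I * θ) ^ (2 * n) * starRingEnd ℂ (cexp (I * θ)) ^ n = cexp (I * θ) ^ n := by
        rw [two_mul, pow_add, mul_assoc, ← mul_pow, hzz, one_pow, mul_one]
      linear_combination -(bfun a b S θ * (starRingEnd ℂ) (Y θ) * (starRingEnd ℂ) (Fd a b S (cexp (I * θ)))) * this
    have := Complex.conj_eq_iff_re.mp hreal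
    rw [hr]; beta_reduce
    rw [this]; field_simp
  obtain ⟨C, C0, hC⟩ := Fd_bound (a := 1 - a) (b := 1 - b) hS.negS (s := 0) le_rfl (by linarith) (by linarith)
  have hYG : ∀ᵐ θ ∂(volume.restrict (Ioo (0:ℝ) Real.pi)), ∀ j : ℕ,
      (Y θ * (cexp (I * θ) ^ j * Fd (1 - a) (1 - b) (fun z => - S z) (cexp (I * θ)))) = (-2 * I) * (r θ * Real.sin θ : ℝ) * cexp (I * θ) ^ (n + 1 + j) := by
    filter_upwards [hYr, ae_restrict_mem measurableSet_Ioo] with θ e1 hθ j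
    rw [e1]
    have hm := Fd_mul (a := a) (b := b) (S := S) (arc_re hθ)
    have hs : 1 - cexp (I * θ) ^ 2 = (-2 * I) * (Real.sin θ : ℝ) * cexp (I * θ) := by
      rw [Complex.ofReal_sin, Complex.sin, ← mul_comm I (θ:ℂ), show -(θ:ℂ) * I = -(I * θ) by ring, Complex.exp_neg]
      have := Complex.exp_ne_zero (I * θ)
      field_simp
      rw [Complex.I_sq]; ring
    rw [pow_add, pow_add, pow_one]; push_cast at hs ⊢
    linear_combination ((r θ : ℂ) * cexp (I * θ) ^ n * cexp (I * θ) ^ j) * (hm.trans hs)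
  have hYint := LA_integrable Y
  have hYii : IntervalIntegrable (Y : ℝ → ℂ) volume 0 Real.pi := by
    rw [intervalIntegrable_iff_integrableOn_Ioo_of_le hpi.le]; exact hYint
  have hGb : ∀ ρ : ℝ, 0 ≤ ρ → ρ ≤ 1 → ∀ θ ∈ Ioo (0:ℝ) Real.pi, ‖Fd (1 - a) (1 - b) (fun z => - S z) (ρ * cexp (I * θ))‖ ≤ C := by
    intro ρ h0 h1 θ hθ
    have := hC ρ h0 h1 θ hθ
    simpa using this
  have htest : ∀ j : ℕ, ∫ θ in Ioo (0:ℝ) Real.pi, (r θ * Real.sin θ) * Real.sin ((n + 1 + j : ℕ) * θ) = 0 := by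
    intro j
    have h := Y_test (Y := (Y : ℝ → ℂ)) (g := fun z => z ^ j * Fd (1 - a) (1 - b) (fun z => - S z) z) (M := C) hYii
      (fun k => by
        have h1 := hv k
        rw [inner_vA] at h1
        have h2 := (mul_eq_zero.mp h1).resolve_left (by positivity)
        have hi : IntegrableOn (fun θ : ℝ => (Y : ℝ → ℂ) θ * cexp (I * θ) ^ k) (Ioo 0 Real.pi) := by
          refine Integrable.mul_bdd (c := 1) hYint (Continuous.aestronglyMeasurable (by fun_prop)) (Eventually.of_forall fun θ => ?_)
          rw [norm_pow, exp_I_norm, one_pow]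
        rw [intervalIntegral.integral_of_le hpi.le, integral_Ioc_eq_integral_Ioo]
        exact (Complex.reCLM.integral_comp_comm hi).symm.trans h2)
      ((differentiable_pow j).differentiableOn.mul (Fd_diffBall hS.negS))
      (fun z hz => by simp only [map_mul, map_pow, Fd_conjBall hS.negS z hz])
      (fun θ hθ => (continuous_pow j).continuousAt.mul (Fd_contArc hS.negS hθ))
      (fun ρ r0 r1 θ hθ => by
        have hn : ‖(ρ:ℂ) * cexp (I * θ)‖ ≤ 1 := by
          rw [norm_mul, exp_I_norm, mul_one, Complex.norm_real, Real.norm_of_nonneg r0.le]; exact r1.le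
        rw [norm_mul, norm_pow]
        calc _ ≤ 1 * C := mul_le_mul (pow_le_one₀ (norm_nonneg _) hn) (hGb ρ r0.le r1.le θ hθ) (norm_nonneg _) zero_le_one
          _ = C := one_mul C)
    rw [intervalIntegral.integral_of_le hpi.le, integral_Ioc_eq_integral_Ioo] at h
    have hi : IntegrableOn (fun θ : ℝ => (Y : ℝ → ℂ) θ * (cexp (I * θ) ^ j * Fd (1 - a) (1 - b) (fun z => - S z) (cexp (I * θ)))) (Ioo 0 Real.pi) := by
      refine Integrable.mul_bdd (c := C) hYint ?_ ?_
      · refine ContinuousOn.aestronglyMeasurable ?_ measurableSet_Ioo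
        exact (Continuous.continuousOn (by fun_prop)).mul (Fd_arc_cont hS.negS)
      · filter_upwards [ae_restrict_mem measurableSet_Ioo] with θ hθ
        have := hGb 1 zero_le_one le_rfl θ hθ
        rw [norm_mul, norm_pow, exp_I_norm, one_pow, one_mul]
        simpa using this
    have h2 : ∫ θ in Ioo (0:ℝ) Real.pi, ((Y : ℝ → ℂ) θ * (cexp (I * θ) ^ j * Fd (1 - a) (1 - b) (fun z => - S z) (cexp (I * θ)))).re = 0 := by
      exact (Complex.reCLM.integral_comp_comm hi).trans h
    have h3 : ∫ θ in Ioo (0:ℝ) Real.pi, ((Y : ℝ → ℂ) θ * (cexp (I * θ) ^ j * Fd (1 - a) (1 - b) (fun z => - S z) (cexp (I * θ)))).re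
        = ∫ θ in Ioo (0:ℝ) Real.pi, 2 * ((r θ * Real.sin θ) * Real.sin ((n + 1 + j : ℕ) * θ)) := by
      refine integral_congr_ae ?_
      filter_upwards [hYG] with θ e1
      rw [e1 j, ← Complex.exp_nat_mul, show ((n + 1 + j : ℕ):ℂ) * (I * θ) = (((n + 1 + j : ℕ) * θ : ℝ) : ℂ) * I by push_cast; ring,
        Complex.exp_mul_I, ← Complex.ofReal_cos, ← Complex.ofReal_sin]
      rw [show -2 * I * ((r θ * Real.sin θ : ℝ) : ℂ) * (((Real.cos ((n + 1 + j : ℕ) * θ) : ℝ) : ℂ) + ((Real.sin ((n + 1 + j : ℕ) * θ) : ℝ) : ℂ) * I) = ((2 * (r θ * Real.sin θ * Real.sin ((n + 1 + j : ℕ) * θ)) : ℝ) : ℂ) + ((-2 * (r θ * Real.sin θ) * Real.cos ((n + 1 + j : ℕ) * θ) : ℝ) : ℂ) * I by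
        apply Complex.ext <;> simp [-Complex.ofReal_sin, -Complex.ofReal_cos] <;> ring]
      simp [-Complex.ofReal_sin, -Complex.ofReal_cos, -Complex.ofReal_mul]
    rw [h3, integral_const_mul] at h2
    linarith
  have hfint : IntegrableOn (fun θ => r θ * Real.sin θ) (Ioo 0 Real.pi) := by
    have hi : IntegrableOn (fun θ : ℝ => (Y : ℝ → ℂ) θ * (cexp (I * θ) ^ 0 * Fd (1 - a) (1 - b) (fun z => - S z) (cexp (I * θ)))) (Ioo 0 Real.pi) := by
      refine Integrable.mul_bdd (c := C) hYint ?_ ?_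
      · refine ContinuousOn.aestronglyMeasurable ?_ measurableSet_Ioo
        exact (Continuous.continuousOn (by fun_prop)).mul (Fd_arc_cont hS.negS)
      · filter_upwards [ae_restrict_mem measurableSet_Ioo] with θ hθ
        have := hGb 1 zero_le_one le_rfl θ hθ
        rw [norm_mul, norm_pow, exp_I_norm, one_pow, one_mul]
        simpa using this
    have hi2 : IntegrableOn (fun θ : ℝ => ((Y : ℝ → ℂ) θ * (cexp (I * θ) ^ 0 * Fd (1 - a) (1 - b) (fun z => - S z) (cexp (I * θ)))) * (I/2 * cexp (-(I*θ)) ^ (n+1))) (Ioo 0 Real.pi) := by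
      refine Integrable.mul_bdd (c := 1) hi (Continuous.aestronglyMeasurable (by fun_prop)) (Eventually.of_forall fun θ => ?_)
      rw [norm_mul, norm_pow, show -(I * (θ:ℂ)) = I * ((-θ : ℝ):ℂ) by push_cast; ring, exp_I_norm]; simp; norm_num
    refine hi2.re.congr ?_
    filter_upwards [hYG] with θ e1
    rw [e1 0]
    have : cexp (I * θ) ^ (n+1+0) * cexp (-(I*θ)) ^ (n+1) = 1 := by
      rw [add_zero, ← mul_pow, ← Complex.exp_add]; simp
    rw [show -2 * I * ((r θ * Real.sin θ : ℝ) : ℂ) * cexp (I * θ) ^ (n + 1 + 0) * (I / 2 * cexp (-(I * θ)) ^ (n + 1)) =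
      (-(I * I)) * ((r θ * Real.sin θ : ℝ) : ℂ) * (cexp (I * θ) ^ (n+1+0) * cexp (-(I*θ)) ^ (n+1)) by ring, this, Complex.I_mul_I]
    simp [-Complex.ofReal_mul]
  set sk : ℕ → ℝ := fun k => (2 / Real.pi) * ∫ θ in Ioo (0:ℝ) Real.pi, (r θ * Real.sin θ) * Real.sin (k * θ) with hsk
  set d : Polynomial ℝ := ∑ k ∈ Finset.range n, Polynomial.C (sk (k+1)) * Polynomial.Chebyshev.U ℝ (k:ℤ) with hd
  have hdeg : d.degree < n := by
    rw [← Polynomial.mem_degreeLT]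
    refine Submodule.sum_mem _ fun k hk => ?_
    rw [Polynomial.mem_degreeLT]
    refine lt_of_le_of_lt ((Polynomial.degree_mul_le _ _).trans (add_le_add_left Polynomial.degree_C_le _)) ?_
    rw [Polynomial.Chebyshev.degree_U_natCast, zero_add]
    exact_mod_cast Finset.mem_range.mp hk
  have hdsin : ∀ θ : ℝ, d.eval (Real.cos θ) * Real.sin θ = ∑ k ∈ Finset.range n, sk (k+1) * Real.sin ((k+1:ℕ) * θ) := by
    intro θ
    rw [hd, Polynomial.eval_finset_sum, Finset.sum_mul]
    refine Finset.sum_congr rfl fun k _ => ?_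
    rw [Polynomial.eval_mul, Polynomial.eval_C, mul_assoc, Polynomial.Chebyshev.U_real_cos]; push_cast; rfl
  have hz := sin_complete (f := fun θ => r θ * Real.sin θ - d.eval (Real.cos θ) * Real.sin θ)
    (hfint.sub ((Continuous.integrableOn_Icc (by fun_prop)).mono_set Ioo_subset_Icc_self)) (fun k => by
      have e : ∀ θ : ℝ, (r θ * Real.sin θ - d.eval (Real.cos θ) * Real.sin θ) * Real.sin (k * θ) =
          (r θ * Real.sin θ) * Real.sin (k * θ) - ∑ i ∈ Finset.range n, sk (i+1) * (Real.sin ((i+1:ℕ) * θ) * Real.sin (k * θ)) := by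
        intro θ; rw [sub_mul, hdsin, Finset.sum_mul]; congr 1
        exact Finset.sum_congr rfl fun i _ => by ring
      simp_rw [e]
      have hci : ∀ i : ℕ, IntegrableOn (fun θ : ℝ => sk (i+1) * (Real.sin ((i+1:ℕ) * θ) * Real.sin (k * θ))) (Ioo 0 Real.pi) := fun i =>
        (Continuous.integrableOn_Icc (by fun_prop)).mono_set Ioo_subset_Icc_self
      rw [integral_sub (bdd_mul_int hfint (by fun_prop)) (integrable_finset_sum _ fun i _ => hci i), integral_finset_sum _ fun i _ => hci i]
      simp_rw [integral_const_mul, sin_orth _ k (Nat.succ_ne_zero _)]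
      by_cases hk0 : k = 0
      · subst hk0
        simp
      by_cases hkn : k ≤ n
      · rw [Finset.sum_eq_single (k-1)]
        · rw [show k - 1 + 1 = k by omega, if_pos (by omega), hsk]; beta_reduce
          field_simp; ring
        · intro i _ hi; rw [if_neg (by omega), mul_zero]
        · intro h; exact absurd (Finset.mem_range.mpr (by omega)) h
      · rw [Finset.sum_eq_zero (fun i hi => by have := Finset.mem_range.mp hi; rw [if_neg (by omega), mul_zero]), sub_zero]
        have := htest (k - (n+1))
        rwa [show n + 1 + (k - (n+1)) = k by omega] at this)
  have hYX : Y = XL a b S n d := by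
    apply Lp.ext
    filter_upwards [XL_ae hS ha hb n d, hYr, ae_restrict_of_ae hz, ae_restrict_mem measurableSet_Ioo] with θ e1 e2 e3 hθ
    have hs := Real.sin_pos_of_mem_Ioo hθ
    have h3 := e3 hθ
    have : r θ = d.eval (Real.cos θ) := by
      have : (r θ - d.eval (Real.cos θ)) * Real.sin θ = 0 := by rw [sub_mul]; exact h3
      linarith [(mul_eq_zero.mp this).resolve_right hs.ne']
    rw [e1, e2, XQ, this]
  have := ho d hdeg
  rw [← hYX] at this
  exact inner_self_eq_zero.mp this

lemma exact_thm (hS : SData S R) (ha : -(1/2) < a) (hb : -(1/2) < b) (ha1 : a ≤ 1) (hb1 : b ≤ 1) {n : ℕ} {P : Polynomial ℝ}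
    (hP : P.Monic) (hPn : P.natDegree = n)
    (ho : ∀ Q : Polynomial ℝ, Q.degree < n → ∫ θ in Ioo 0 Real.pi, P.eval (Real.cos θ) * Q.eval (Real.cos θ) * ‖Fd a b S (cexp (I * θ))‖ ^ 2 = 0)
    {c : l2} (hc : (1 + Hop a b S n) c = eb 0) :
    XL a b S n P = (Real.sqrt Real.pi * ((2⁻¹) ^ n * Real.exp (S 0).re)) • (Psi c + Jop (uS a b S n) (Psi c)) ∧
    ∫ θ in Ioo 0 Real.pi, P.eval (Real.cos θ) ^ 2 * ‖Fd a b S (cexp (I * θ))‖ ^ 2 = 2 * Real.pi * ((2⁻¹) ^ n * Real.exp (S 0).re) ^ 2 * c 0 := by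
  set x0 : ℝ := Real.sqrt Real.pi * ((2⁻¹) ^ n * Real.exp (S 0).re) with hx0
  have hcoef : P.coeff n = 1 := by rw [← hPn]; exact hP
  have hXv : ∀ k, inner ℝ (vA k) (XL a b S n P) = if k = 0 then x0 else 0 := by
    intro k; rw [XL_vA hS ha hb hPn.le k, hcoef, one_mul]
  have hVv : ∀ k, inner ℝ (vA k) (Psi c + Jop (uS a b S n) (Psi c)) = if k = 0 then 1 else 0 := by
    intro k
    have h1 : inner ℝ (eb k) (Hop a b S n c) = inner ℝ (vA k) (Jop (uS a b S n) (Psi c)) := by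
      simp only [Hop, ContinuousLinearMap.comp_apply, ContinuousLinearMap.adjoint_inner_right, Psi_eb]
    rw [inner_add_right, ← h1, inner_vA_Psi]
    have h2 : inner ℝ (eb k) ((1 + Hop a b S n) c) = inner ℝ (eb k) (eb 0) := by rw [hc]
    rw [add_apply, ContinuousLinearMap.one_apply, inner_add_right, inner_eb (c := c), inner_eb (c := eb 0), eb_apply] at h2
    rw [h2]
  have hVQ : ∀ Q, inner ℝ (Psi c + Jop (uS a b S n) (Psi c)) (XL a b S n Q) = 2 * inner ℝ (Psi c) (XL a b S n Q) := by
    intro Q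
    rw [inner_add_left, Jop_symm (uS_cont hS n) (uS_norm hS n), XL_J hS ha hb]; ring
  have hVQ2 : ∀ Q : Polynomial ℝ, Q.natDegree ≤ n → inner ℝ (Psi c + Jop (uS a b S n) (Psi c)) (XL a b S n Q) =
      2 * (c 0 * (Real.sqrt Real.pi * (Q.coeff n * (2⁻¹) ^ n * Real.exp (S 0).re))) := by
    intro Q hQ
    rw [hVQ, Psi_inner c _ (fun k hk => by rw [XL_vA hS ha hb hQ, if_neg hk]), XL_vA hS ha hb hQ, if_pos rfl]
  have hmain : XL a b S n P = x0 • (Psi c + Jop (uS a b S n) (Psi c)) := by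
    rw [← sub_eq_zero]
    refine Y_zero hS ha hb ha1 hb1 (n := n) ?_ ?_ ?_
    · rw [map_sub, XL_J hS ha hb, map_smul, map_add, Jop_sq (uS_cont hS n) (uS_norm hS n), add_comm (Psi c)]
    · intro k
      rw [inner_sub_right, hXv, real_inner_smul_right, hVv]; split_ifs <;> simp
    · intro Q hQ
      have hQn : Q.natDegree ≤ n := Polynomial.natDegree_le_of_degree_le hQ.le
      rw [inner_sub_left, XL_inner hS ha hb, ho Q hQ, real_inner_smul_left, hVQ2 Q hQn, Polynomial.coeff_eq_zero_of_degree_lt hQ]; ring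
  refine ⟨hmain, ?_⟩
  have e := XL_inner hS ha hb n P P
  rw [show inner ℝ (XL a b S n P) (XL a b S n P) = inner ℝ (x0 • (Psi c + Jop (uS a b S n) (Psi c))) (XL a b S n P) by rw [← hmain], real_inner_smul_left, hVQ2 P hPn.le, hcoef] at e
  have e2 : ∫ θ in Ioo 0 Real.pi, P.eval (Real.cos θ) ^ 2 * ‖Fd a b S (cexp (I * θ))‖ ^ 2 =
      ∫ θ in Ioo 0 Real.pi, P.eval (Real.cos θ) * P.eval (Real.cos θ) * ‖Fd a b S (cexp (I * θ))‖ ^ 2 := by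
    simp_rw [sq (P.eval _)]
  rw [e2, ← e, hx0]
  have := Real.mul_self_sqrt Real.pi_pos.le
  linear_combination (2 * c 0 * ((2⁻¹) ^ n * Real.exp (S 0).re) ^ 2) * this
end

section
open Topology
variable {S : ℂ → ℂ} {R : ℝ} {a b : ℝ}

lemma rhoP_an (hS : SData S R) : AnalyticAt ℝ (rhoP a b S) 0 := by
  have hS1 : AnalyticAt ℂ S 1 := hS.diff.analyticAt (Metric.isOpen_ball.mem_nhds (by simpa using hS.one_lt))
  have h1 : ∀ s : ℝ, AnalyticAt ℝ (fun t : ℝ => (S ((Real.exp (s * t) : ℝ) : ℂ)).re) 0 := by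
    intro s
    have hexp : AnalyticAt ℝ (fun t : ℝ => ((Real.exp (s * t) : ℝ) : ℂ)) 0 := by
      have : AnalyticAt ℝ (fun t : ℝ => Real.exp (s * t)) 0 := by fun_prop
      exact (Complex.ofRealCLM.analyticAt _).fun_comp this
    have h2 : AnalyticAt ℝ S ((fun t : ℝ => ((Real.exp (s * t) : ℝ) : ℂ)) 0) := by
      simpa using hS1.restrictScalars (𝕜 := ℝ)
    exact (Complex.reCLM.analyticAt _).fun_comp (AnalyticAt.fun_comp (g := S) (f := fun t : ℝ => ((Real.exp (s * t) : ℝ) : ℂ)) h2 hexp)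
  have h2 := h1 (-1)
  have h3 := h1 1
  simp only [neg_mul, one_mul] at h2 h3
  unfold rhoP
  have h4 : AnalyticAt ℝ (fun t : ℝ => Real.sin (Real.pi * a) / Real.pi * Real.exp (-t * (a + b))) 0 := by fun_prop
  exact h4.mul ((h2.sub h3).rexp)

lemma rhoP_contOn (hS : SData S R) {τ : ℝ} (hτR : Real.exp τ < R) : ContinuousOn (rhoP a b S) (Icc (-τ) τ) := by
  have h1 : ContinuousOn (fun t : ℝ => S ((Real.exp t : ℝ) : ℂ)) (Icc (-τ) τ) := by
    refine hS.cont.comp (Continuous.continuousOn (by fun_prop)) fun t ht => ?_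
    rw [mem_ball_zero_iff, Complex.norm_real, Real.norm_of_nonneg (Real.exp_pos _).le]
    exact lt_of_le_of_lt (Real.exp_le_exp.mpr ht.2) hτR
  have h2 : ContinuousOn (fun t : ℝ => S ((Real.exp (-t) : ℝ) : ℂ)) (Icc (-τ) τ) := by
    refine hS.cont.comp (Continuous.continuousOn (by fun_prop)) fun t ht => ?_
    rw [mem_ball_zero_iff, Complex.norm_real, Real.norm_of_nonneg (Real.exp_pos _).le]
    exact lt_of_le_of_lt (Real.exp_le_exp.mpr (by linarith [ht.1])) hτR
  unfold rhoP
  exact (Continuous.continuousOn (by fun_prop)).mul (Real.continuous_exp.comp_continuousOn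
    ((Complex.continuous_re.comp_continuousOn h2).sub (Complex.continuous_re.comp_continuousOn h1)))

def cutR (a b : ℝ) (S : ℂ → ℂ) (τ t : ℝ) : ℝ := (Icc (-τ) τ).indicator (rhoP a b S) t

lemma rhoP_zero : rhoP a b S 0 = Real.sin (Real.pi * a) / Real.pi := by simp [rhoP]

lemma cutR_zero {τ : ℝ} (hτ : 0 < τ) : cutR a b S τ 0 = Real.sin (Real.pi * a) / Real.pi := by
  rw [cutR, indicator_of_mem (show (0:ℝ) ∈ Icc (-τ) τ from ⟨by linarith, by linarith⟩), rhoP_zero]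

lemma cutR_adm (hS : SData S R) {τ ε : ℝ} (hτ : 0 < τ) (hτR : Real.exp τ < R) (hε1 : ε < 1)
    (hlow : ∀ t ∈ Icc 0 τ, -((1 - ε) / Real.pi) ≤ rhoP a b S t) : Adm (cutR a b S τ) ε τ := by
  have hc := rhoP_contOn (a := a) (b := b) hS hτR
  refine ⟨?_, ?_, ?_, ?_, ?_⟩
  · classical
    have := hc.measurable_piecewise (g := fun _ => (0:ℝ)) continuousOn_const measurableSet_Icc
    have e : (Icc (-τ) τ).piecewise (rhoP a b S) (fun _ => (0:ℝ)) = cutR a b S τ := by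
      ext t; simp [cutR, Set.piecewise, Set.indicator]
    rwa [e] at this
  · obtain ⟨M, hM⟩ := isCompact_Icc.exists_bound_of_continuousOn hc
    refine ⟨M, fun t ht => ?_⟩
    unfold cutR
    by_cases h : t ∈ Icc (-τ) τ
    · rw [indicator_of_mem h]; exact hM t h
    · rw [indicator_of_notMem h, abs_zero]; exact (norm_nonneg _).trans (hM 0 ⟨by linarith, by linarith⟩)
  · refine (rhoP_an (a := a) (b := b) hS).congr ?_
    filter_upwards [Icc_mem_nhds (show -τ < 0 by linarith) hτ] with t ht
    rw [cutR, indicator_of_mem ht]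
  · intro t ht
    unfold cutR
    by_cases h : t ∈ Icc (-τ) τ
    · rw [indicator_of_mem h]; exact hlow t ⟨ht, h.2⟩
    · rw [indicator_of_notMem h]
      have : 0 ≤ (1 - ε) / Real.pi := div_nonneg (by linarith) Real.pi_pos.le
      linarith
  · intro t ht
    rw [cutR, indicator_of_notMem (fun h => absurd h.2 (not_le.mpr ht))]

lemma cutR_int {τ : ℝ} (hτ : 0 < τ) (g : ℝ → ℝ) : ∫ t in (0:ℝ)..τ, cutR a b S τ t * g t = ∫ t in (0:ℝ)..τ, rhoP a b S t * g t := by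
  refine intervalIntegral.integral_congr fun t ht => ?_
  rw [uIcc_of_le hτ.le] at ht
  simp only [cutR]
  rw [indicator_of_mem (show t ∈ Icc (-τ) τ from ⟨by linarith [ht.1], ht.2⟩)]

lemma sin_gt {a : ℝ} (h0 : -(1/2) < a) (h1 : a ≤ 1) : -1 < Real.sin (Real.pi * a) := by
  have hpi := Real.pi_pos
  by_cases h : a ≤ 1/2
  · have := Real.strictMonoOn_sin (a := -(Real.pi/2)) (b := Real.pi * a) ⟨le_rfl, by linarith⟩ ⟨by nlinarith, by nlinarith⟩ (by nlinarith)
    simpa using this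
  · have : 0 ≤ Real.sin (Real.pi * a) := Real.sin_nonneg_of_nonneg_of_le_pi (by nlinarith) (by nlinarith)
    linarith

def PhiI (a b : ℝ) : LR := phiInf (Real.sin (Real.pi * a) / Real.pi) (Real.sin (Real.pi * b) / Real.pi)

theorem base_c (hS : SData S R) (ha : -(1/2) < a) (hb : -(1/2) < b) (ha1 : a ≤ 1) (hb1 : b ≤ 1) :
    ∃ (τ : ℝ) (c : ℕ → l2) (φt : ℕ → LR) (C' : ℝ), 0 < τ ∧ τ ≤ 1/2 ∧ Real.exp τ < R ∧ (∀ᶠ n in atTop, (1 + Hop a b S n) (c n) = eb 0) ∧ AE φt ∧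
      Tendsto φt atTop (𝓝 (PhiI a b)) ∧
      (∀ n : ℕ, 1 ≤ n → ∀ᵐ u : ℝ, τ * n < |u| → φt n u = 0) ∧
      ∀ᶠ n : ℕ in atTop, ∀ j : ℕ, |c n j - ((if j = 0 then 1 else 0) - (Real.sqrt n)⁻¹ * inner ℝ (av n j) (φt n))|
        ≤ C' * Real.exp (-(τ * (2 * n + j))) := by
  have hpi := Real.pi_pos
  obtain ⟨ε, hε, hε1, hsa, hsb⟩ : ∃ ε : ℝ, 0 < ε ∧ ε < 1 ∧ -(1 - ε) < Real.sin (Real.pi * a) ∧ -(1 - ε) < Real.sin (Real.pi * b) := by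
    have h1 := sin_gt ha ha1
    have h2 := sin_gt hb hb1
    refine ⟨min (1/2) (min ((1 + Real.sin (Real.pi * a))/2) ((1 + Real.sin (Real.pi * b))/2)), ?_, ?_, ?_, ?_⟩
    · simp only [lt_min_iff]; exact ⟨by norm_num, by linarith, by linarith⟩
    · exact lt_of_le_of_lt (min_le_left _ _) (by norm_num)
    · have := (min_le_right (1/2) (min ((1 + Real.sin (Real.pi * a))/2) ((1 + Real.sin (Real.pi * b))/2))).trans (min_le_left _ _)
      linarith
    · have := (min_le_right (1/2) (min ((1 + Real.sin (Real.pi * a))/2) ((1 + Real.sin (Real.pi * b))/2))).trans (min_le_right _ _)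
      linarith
  have ev : ∀ (a b : ℝ) (S : ℂ → ℂ), SData S R → -(1 - ε) < Real.sin (Real.pi * a) → ∀ᶠ t in 𝓝 (0:ℝ), -((1 - ε) / Real.pi) < rhoP a b S t := by
    intro a b S hS h
    refine (rhoP_an hS).continuousAt.eventually_const_lt ?_
    rw [rhoP_zero, ← neg_div]; gcongr
  have evR : ∀ᶠ t in 𝓝 (0:ℝ), Real.exp t < R :=
    Real.continuous_exp.continuousAt.eventually_lt_const (by simpa using hS.one_lt)
  obtain ⟨δ, hδ, hall⟩ := Metric.eventually_nhds_iff.mp ((ev a b S hS hsa).and ((ev b a _ hS.neg hsb).and evR))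
  set τ := min (1/2) (δ / 2) with hτd
  have hτ : 0 < τ := lt_min (by norm_num) (by linarith)
  have hτδ : τ < δ := lt_of_le_of_lt (min_le_right _ _) (by linarith)
  have hd : ∀ t ∈ Icc 0 τ, dist t 0 < δ := fun t ht => by
    rw [dist_zero_right, Real.norm_of_nonneg ht.1]; linarith [ht.2]
  have hτR : Real.exp τ < R := (hall (hd τ ⟨hτ.le, le_rfl⟩)).2.2
  obtain ⟨C, hC⟩ := hS.bhat_eq a b hτ hτR
  have A := cutR_adm (a := a) (b := b) hS hτ hτR hε1 (fun t ht => (hall (hd t ht)).1.le)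
  have B := cutR_adm (a := b) (b := a) hS.neg hτ hτR hε1 (fun t ht => (hall (hd t ht)).2.1.le)
  obtain ⟨c, φt, C', r1, r2, r3, r4, r5⟩ := asm A B hε hε1 hτ (Hop a b S) (C := C) (fun n j k => by
    have := hC (2 * n + (j + k))
    rw [Hop_entries hS, cutR_int hτ, cutR_int hτ]
    have e : (-1 : ℝ) ^ (2 * n + (j + k)) = (-1) ^ (j + k) := by rw [pow_add, pow_mul]; simp
    rwa [e] at this)
  rw [cutR_zero hτ, cutR_zero hτ] at r3
  exact ⟨τ, c, φt, C', hτ, min_le_left _ _, hτR, r1, r2, r3, r4, r5⟩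
end

section
open Topology

lemma norm_one_sub_ge {z : ℂ} (r : ℝ) (hz : z.im ≠ 0) : |z.im| / ‖z‖ ≤ ‖1 - (r:ℂ) * z‖ := by
  have hz0 : 0 < ‖z‖ := norm_pos_iff.mpr (by rintro rfl; simp at hz)
  rw [div_le_iff₀ hz0]
  have e : ‖1 - (r:ℂ) * z‖ * ‖z‖ = ‖(1 - (r:ℂ) * z) * starRingEnd ℂ z‖ := by simp
  rw [e]
  have e2 : |z.im| = |((1 - (r:ℂ) * z) * starRingEnd ℂ z).im| := by
    rw [← abs_neg]; congr 1; simp; ring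
  rw [e2]; exact Complex.abs_im_le_norm _

lemma one_sub_ne {z : ℂ} (r : ℝ) (hz : z.im ≠ 0) : 1 - (r:ℂ) * z ≠ 0 := by
  have h := norm_one_sub_ge r hz
  have hz0 : 0 < ‖z‖ := norm_pos_iff.mpr (by rintro rfl; simp at hz)
  have : 0 < |z.im| / ‖z‖ := div_pos (abs_pos.mpr hz) hz0
  exact norm_pos_iff.mp (this.trans_le h)

def rw' (n : ℕ) (w : ℝ) : ℝ := sg w * Real.exp (-(|w|/n))
lemma rw'_meas (n : ℕ) : Measurable (rw' n) := sg_meas.mul (by fun_prop)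
lemma rw'_le (n : ℕ) (w : ℝ) : |rw' n w| ≤ 1 := by
  rw [rw', abs_mul, sg_abs, one_mul, abs_of_pos (Real.exp_pos _), Real.exp_le_one_iff]
  have : 0 ≤ |w| / n := by positivity
  linarith
lemma rw'_lt {n : ℕ} (hn : 1 ≤ n) {w : ℝ} (hw : w ≠ 0) : |rw' n w| < 1 := by
  rw [rw', abs_mul, sg_abs, one_mul, abs_of_pos (Real.exp_pos _), Real.exp_lt_one_iff]
  have : 0 < |w| / n := div_pos (abs_pos.mpr hw) (by exact_mod_cast hn)
  linarith

/-- the weighted function entering all integrals -/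
def gf (f : LR) (n : ℕ) (w : ℝ) : ℝ := (n:ℝ)⁻¹ * Real.exp (-(1/2 * |w|)) * f w

lemma gf_int (f : LR) (n : ℕ) : Integrable (gf f n) := by
  have h := (exp_mul_int (c := 1/2) (by norm_num) f).1
  have h2 : Integrable (fun w => (n:ℝ)⁻¹ * (Real.exp (-(1/2 * |w|)) * |f w|)) := h.const_mul _
  refine h2.mono (((by fun_prop : Measurable fun w : ℝ => (n:ℝ)⁻¹ * Real.exp (-(1/2 * |w|))).aestronglyMeasurable).mul (Lp.aestronglyMeasurable f)) (Eventually.of_forall fun w => ?_)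
  simp only [gf, norm_mul, Real.norm_eq_abs, abs_abs]
  rw [mul_assoc]

def Ef (f : LR) (n : ℕ) (z : ℂ) : ℂ := ∫ w, (gf f n w : ℂ) / (1 - (rw' n w : ℂ) * z)

lemma gf_meas (f : LR) (n : ℕ) : AEStronglyMeasurable (fun w => (gf f n w : ℂ)) volume :=
  Complex.continuous_ofReal.comp_aestronglyMeasurable (gf_int f n).1

lemma inv_meas (n : ℕ) (z : ℂ) : Measurable (fun w => (1 - (rw' n w : ℂ) * z)) :=
  measurable_const.sub ((Complex.measurable_ofReal.comp (rw'_meas n)).mul_const _)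

lemma coeff_eq {n : ℕ} (f : LR) (j : ℕ) :
    (Real.sqrt n)⁻¹ * inner ℝ (av n j) f = ∫ w, gf f n w * rw' n w ^ j := by
  rw [inner_LR, ← integral_const_mul]
  refine integral_congr_ae ?_
  filter_upwards [av_ae n j] with w e
  rw [e, af, gf, rw']
  have : (Real.sqrt n)⁻¹ * (Real.sqrt n)⁻¹ = (n:ℝ)⁻¹ := by
    rw [← mul_inv, Real.mul_self_sqrt (Nat.cast_nonneg n)]
  rw [← this]; ring

lemma Ef_partial {n : ℕ} (hn : 1 ≤ n) (f : LR) {z : ℂ} (hz : z.im ≠ 0) (hz1 : ‖z‖ ≤ 1) :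
    Tendsto (fun N => ∑ j ∈ Finset.range N, (((Real.sqrt n)⁻¹ * inner ℝ (av n j) f : ℝ) : ℂ) * z ^ j) atTop (𝓝 (Ef f n z)) := by
  have hitg : ∀ j, Integrable (fun w => (gf f n w : ℂ) * ((rw' n w : ℂ) * z) ^ j) := by
    intro j
    refine (gf_int f n).norm.mono ((gf_meas f n).mul ((((Complex.measurable_ofReal.comp (rw'_meas n)).mul_const z).pow_const j).aestronglyMeasurable)) (Eventually.of_forall fun w => ?_)
    rw [norm_mul, norm_pow, norm_mul, Complex.norm_real, Complex.norm_real, norm_norm]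
    refine mul_le_of_le_one_right (norm_nonneg _) (pow_le_one₀ (by positivity) ?_)
    exact mul_le_one₀ (rw'_le n w) (norm_nonneg _) hz1
  have e1 : ∀ N, ∑ j ∈ Finset.range N, (((Real.sqrt n)⁻¹ * inner ℝ (av n j) f : ℝ) : ℂ) * z ^ j
      = ∫ w, (gf f n w : ℂ) * ∑ j ∈ Finset.range N, ((rw' n w : ℂ) * z) ^ j := by
    intro N
    simp_rw [Finset.mul_sum]
    rw [integral_finsetSum _ (fun j _ => hitg j)]
    refine Finset.sum_congr rfl fun j _ => ?_
    rw [coeff_eq, ← integral_complex_ofReal, ← integral_mul_const]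
    congr 1; ext w; push_cast; rw [mul_pow]; ring
  simp_rw [e1]
  have hz0 : 0 < ‖z‖ := norm_pos_iff.mpr (by rintro rfl; simp at hz)
  set δ := |z.im| / ‖z‖
  have hδ : 0 < δ := div_pos (abs_pos.mpr hz) hz0
  have hgeo : ∀ N w, ∑ j ∈ Finset.range N, ((rw' n w : ℂ) * z) ^ j = (1 - ((rw' n w : ℂ) * z) ^ N) / (1 - (rw' n w : ℂ) * z) := by
    intro N w
    have h0 := one_sub_ne (rw' n w) hz
    rw [eq_div_iff h0, mul_comm, mul_neg_geom_sum]
  refine tendsto_integral_of_dominated_convergence (fun w => ‖gf f n w‖ * (2 / δ)) ?_ ((gf_int f n).norm.mul_const _) ?_ ?_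
  · intro N
    refine (gf_meas f n).mul (Finset.measurable_sum _ fun j _ => ?_).aestronglyMeasurable
    exact ((Complex.measurable_ofReal.comp (rw'_meas n)).mul_const z).pow_const j
  · intro N
    refine Eventually.of_forall fun w => ?_
    rw [norm_mul, Complex.norm_real, hgeo, norm_div]
    gcongr
    · refine (norm_sub_le _ _).trans ?_
      rw [norm_one, norm_pow, norm_mul, Complex.norm_real]
      have : (‖rw' n w‖ * ‖z‖) ^ N ≤ 1 := pow_le_one₀ (by positivity) (mul_le_one₀ (rw'_le n w) (norm_nonneg _) hz1)
      linarith
    · exact norm_one_sub_ge _ hz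
  · have h0 : ∀ᵐ w : ℝ, w ≠ 0 := by simp [ae_iff]
    filter_upwards [h0] with w hw
    simp_rw [hgeo]
    have ht : Tendsto (fun N => ((rw' n w : ℂ) * z) ^ N) atTop (𝓝 0) := by
      apply tendsto_pow_atTop_nhds_zero_of_norm_lt_one
      rw [norm_mul, Complex.norm_real]
      calc _ ≤ ‖rw' n w‖ * 1 := by gcongr
        _ < 1 := by rw [mul_one]; exact rw'_lt hn hw
    have := ((tendsto_const_nhds (x := (1:ℂ))).sub ht).div_const (1 - (rw' n w : ℂ) * z) |>.const_mul (gf f n w : ℂ)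
    rw [sub_zero] at this
    rw [div_eq_mul_one_div]; exact this

lemma Ef_diff (f : LR) (n : ℕ) {z₀ : ℂ} (hz : z₀.im ≠ 0) : DifferentiableAt ℂ (Ef f n) z₀ := by
  have him : 0 < |z₀.im| := abs_pos.mpr hz
  have hb : ∀ z ∈ Metric.ball z₀ (|z₀.im|/2), |z₀.im|/2 ≤ |z.im| ∧ ‖z‖ ≤ ‖z₀‖ + |z₀.im|/2 := by
    intro z hz
    rw [Metric.mem_ball, dist_eq_norm] at hz
    have h1 := (Complex.abs_im_le_norm (z - z₀)).trans hz.le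
    rw [Complex.sub_im] at h1
    have h2 := abs_sub_abs_le_abs_sub z₀.im z.im
    rw [abs_sub_comm] at h2
    refine ⟨by linarith, ?_⟩
    have := norm_add_le z₀ (z - z₀)
    rw [add_sub_cancel] at this; linarith
  have hne : ∀ z ∈ Metric.ball z₀ (|z₀.im|/2), z.im ≠ 0 := fun z hz => abs_pos.mp (lt_of_lt_of_le (by linarith) (hb z hz).1)
  set δ := (|z₀.im|/2) / (‖z₀‖ + |z₀.im|/2) with hδ
  have hδ0 : 0 < δ := by positivity
  have hlow : ∀ z ∈ Metric.ball z₀ (|z₀.im|/2), ∀ r : ℝ, δ ≤ ‖1 - (r:ℂ) * z‖ := by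
    intro z hz r
    refine le_trans ?_ (norm_one_sub_ge r (hne z hz))
    have hz0 : 0 < ‖z‖ := norm_pos_iff.mpr (by rintro rfl; exact hne _ hz (by simp))
    rw [hδ]; gcongr
    · exact (hb z hz).1
    · exact (hb z hz).2
  have hs : Metric.ball z₀ (|z₀.im|/2) ∈ 𝓝 z₀ := Metric.ball_mem_nhds _ (by linarith)
  have hm : ∀ z, AEStronglyMeasurable (fun w => (gf f n w : ℂ) / (1 - (rw' n w : ℂ) * z)) volume := by
    intro z
    simp_rw [div_eq_mul_inv]
    exact (gf_meas f n).mul ((inv_meas n z).inv.aestronglyMeasurable)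
  have key := hasDerivAt_integral_of_dominated_loc_of_deriv_le (μ := volume) (𝕜 := ℂ)
    (F := fun z w => (gf f n w : ℂ) / (1 - (rw' n w : ℂ) * z))
    (F' := fun z w => (gf f n w : ℂ) * ((rw' n w : ℂ) / (1 - (rw' n w : ℂ) * z) ^ 2)) (bound := fun w => ‖gf f n w‖ * (1 / δ ^ 2))
    hs (Eventually.of_forall hm) ?_ ?_ ?_ ((gf_int f n).norm.mul_const _) ?_
  · exact key.2.differentiableAt
  · refine ((gf_int f n).norm.mul_const (1/δ)).mono (hm z₀) (Eventually.of_forall fun w => ?_)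
    rw [norm_div, Complex.norm_real, norm_mul, norm_norm, div_eq_mul_one_div]
    rw [Real.norm_of_nonneg (by positivity : 0 ≤ 1/δ)]
    gcongr
    exact hlow z₀ (Metric.mem_ball_self (by linarith)) _
  · refine (gf_meas f n).mul ?_
    exact ((Complex.measurable_ofReal.comp (rw'_meas n)).div ((inv_meas n z₀).pow_const 2)).aestronglyMeasurable
  · refine Eventually.of_forall fun w z hz => ?_
    rw [norm_mul, Complex.norm_real, norm_div, norm_pow, Complex.norm_real]
    gcongr
    · exact rw'_le n w
    · exact hlow z hz _
  · refine Eventually.of_forall fun w z hz => ?_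
    have h0 := one_sub_ne (rw' n w) (hne z hz)
    have h1 : HasDerivAt (fun z : ℂ => 1 - (rw' n w : ℂ) * z) (-(rw' n w : ℂ)) z := by
      simpa using ((hasDerivAt_id z).const_mul (rw' n w : ℂ)).const_sub 1
    have := (h1.inv h0).const_mul (gf f n w : ℂ)
    simpa [div_eq_mul_inv] using this

lemma Ef_conj (f : LR) (n : ℕ) (z : ℂ) : Ef f n (starRingEnd ℂ z) = starRingEnd ℂ (Ef f n z) := by
  rw [Ef, Ef, ← integral_conj]
  congr 1; ext w; simp

/-- exponentially small power series -/
def Ez (η : ℕ → ℝ) (z : ℂ) : ℂ := ∑' j, (η j : ℂ) * z ^ j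

lemma Ez_term {η : ℕ → ℝ} {K τ : ℝ} (hη : ∀ j, |η j| ≤ K * Real.exp (-(τ * j))) {r : ℝ} {z : ℂ} (hz : ‖z‖ ≤ r) (j : ℕ) :
    ‖(η j : ℂ) * z ^ j‖ ≤ K * (Real.exp (-τ) * r) ^ j := by
  have hK : 0 ≤ K * Real.exp (-(τ * j)) := (abs_nonneg _).trans (hη j)
  rw [norm_mul, norm_pow, Complex.norm_real, mul_pow, ← Real.exp_nat_mul, ← mul_assoc]
  have e : (j:ℝ) * -τ = -(τ * j) := by ring
  rw [e]
  exact mul_le_mul (hη j) (pow_le_pow_left₀ (norm_nonneg _) hz j) (by positivity) hK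

lemma Ez_geo {η : ℕ → ℝ} {K τ : ℝ} (hη : ∀ j, |η j| ≤ K * Real.exp (-(τ * j))) {r : ℝ} (hr0 : 0 ≤ r) (hr : r < Real.exp τ) : Real.exp (-τ) * r < 1 := by
  rw [Real.exp_neg, inv_mul_lt_iff₀ (Real.exp_pos _), mul_one]; exact hr

lemma Ez_summable {η : ℕ → ℝ} {K τ : ℝ} (hη : ∀ j, |η j| ≤ K * Real.exp (-(τ * j))) {z : ℂ} (hz : ‖z‖ < Real.exp τ) : Summable (fun j => (η j : ℂ) * z ^ j) :=
  Summable.of_norm_bounded ((summable_geometric_of_lt_one (by positivity) (Ez_geo hη (norm_nonneg z) hz)).mul_left K)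
    (Ez_term hη le_rfl)

lemma Ez_norm {η : ℕ → ℝ} {K τ : ℝ} (hη : ∀ j, |η j| ≤ K * Real.exp (-(τ * j))) {r : ℝ} (hr : r < Real.exp τ) {z : ℂ} (hz : ‖z‖ ≤ r) : ‖Ez η z‖ ≤ K * (1 - Real.exp (-τ) * r)⁻¹ := by
  have hr0 := (norm_nonneg z).trans hz
  exact tsum_of_norm_bounded ((hasSum_geometric_of_lt_one (by positivity) (Ez_geo hη hr0 hr)).mul_left K) (Ez_term hη hz)

lemma Ez_diff {η : ℕ → ℝ} {K τ : ℝ} (hη : ∀ j, |η j| ≤ K * Real.exp (-(τ * j))) {z : ℂ} (hz : ‖z‖ < Real.exp τ) : DifferentiableAt ℂ (Ez η) z := by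
  obtain ⟨r, h1, h2⟩ := exists_between hz
  have hr0 := (norm_nonneg z).trans h1.le
  have := Complex.differentiableOn_tsum_of_summable_norm (U := Metric.ball (0:ℂ) r) (F := fun j z => (η j : ℂ) * z ^ j)
    ((summable_geometric_of_lt_one (by positivity) (Ez_geo hη hr0 h2)).mul_left K) (fun j => by fun_prop) Metric.isOpen_ball
    (fun j w hw => Ez_term hη (by simpa using (Metric.mem_ball.mp hw).le) j)
  exact (this z (by simpa using h1)).differentiableAt (Metric.isOpen_ball.mem_nhds (by simpa using h1))

lemma Ez_conj (η : ℕ → ℝ) (z : ℂ) : Ez η (starRingEnd ℂ z) = starRingEnd ℂ (Ez η z) := by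
  rw [Ez, Ez, Complex.conj_tsum]; congr 1; ext j; simp

def Bz (f : LR) (n : ℕ) (η : ℕ → ℝ) (z : ℂ) : ℂ := 1 - Ef f n z + Ez η z

lemma Bz_conj (f : LR) (n : ℕ) (η : ℕ → ℝ) (z : ℂ) : Bz f n η (starRingEnd ℂ z) = starRingEnd ℂ (Bz f n η z) := by
  rw [Bz, Bz, Ef_conj, Ez_conj]; simp

lemma Bz_arc {n : ℕ} (hn : 1 ≤ n) (f : LR) {η : ℕ → ℝ} {K τ : ℝ} (hτ : 0 < τ) (hη : ∀ j, |η j| ≤ K * Real.exp (-(τ * j)))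
    (c : l2) (hc : ∀ j, c j = (if j = 0 then 1 else 0) - (Real.sqrt n)⁻¹ * inner ℝ (av n j) f + η j) :
    (Psi c : ℝ → ℂ) =ᵐ[volume.restrict (Ioo (0:ℝ) Real.pi)] fun θ => ((Real.sqrt Real.pi)⁻¹ : ℂ) * Bz f n η (cexp (-(I * θ))) := by
  have h1 := (Psi_hasSum c).tendsto_sum_nat
  have h2 := tendstoInMeasure_of_tendsto_Lp h1
  obtain ⟨ns, hns, h3⟩ := h2.exists_seq_tendsto_ae
  have h4 : ∀ N, ((∑ j ∈ Finset.range N, c j • vA j : LA) : ℝ → ℂ) =ᵐ[volume.restrict (Ioo (0:ℝ) Real.pi)]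
      fun θ => ∑ j ∈ Finset.range N, (c j : ℂ) * (((Real.sqrt Real.pi)⁻¹ : ℂ) * cexp (-(I * θ)) ^ j) := by
    intro N
    induction N with
    | zero => simp only [Finset.range_zero, Finset.sum_empty]; exact Lp.coeFn_zero ℂ 2 _
    | succ N ih =>
      rw [Finset.sum_range_succ]
      filter_upwards [Lp.coeFn_add (∑ j ∈ Finset.range N, c j • vA j) (c N • vA N), ih, Lp.coeFn_smul (c N) (vA N), vA_ae N] with θ e1 e2 e3 e4
      rw [e1, Pi.add_apply, e2, e3, Pi.smul_apply, e4, Finset.sum_range_succ, Complex.real_smul]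
  filter_upwards [h3, ae_all_iff.mpr h4, ae_restrict_mem measurableSet_Ioo] with θ t3 t4 hθ
  refine tendsto_nhds_unique t3 ?_
  simp_rw [t4]
  set z := cexp (-(I * θ)) with hz
  have hz1 : ‖z‖ = 1 := by rw [hz, show -(I * (θ:ℂ)) = I * ((-θ : ℝ):ℂ) by push_cast; ring, exp_I_norm]
  have hzi : z.im ≠ 0 := by
    rw [hz, show -(I * (θ:ℂ)) = ((-θ : ℝ):ℂ) * I by push_cast; ring, Complex.exp_ofReal_mul_I_im, Real.sin_neg]
    exact neg_ne_zero.mpr (Real.sin_pos_of_mem_Ioo hθ).ne'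
  have t5 := Ef_partial hn f hzi hz1.le
  have t6 := (Ez_summable hη (z := z) (by rw [hz1]; exact Real.one_lt_exp_iff.mpr hτ)).hasSum.tendsto_sum_nat
  have t7 : Tendsto (fun N => ∑ j ∈ Finset.range N, ((if j = 0 then 1 else 0 : ℝ) : ℂ) * z ^ j) atTop (𝓝 1) := by
    refine tendsto_const_nhds.congr' ?_
    filter_upwards [eventually_ge_atTop 1] with N hN
    rw [Finset.sum_eq_single 0]
    · simp
    · intro j _ hj; simp [hj]
    · intro h; simp at h; omega
  have t8 := (((t7.sub t5).add t6).const_mul ((Real.sqrt Real.pi)⁻¹ : ℂ)).comp hns.tendsto_atTop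
  refine t8.congr fun i => ?_
  simp only [Function.comp]
  rw [← Finset.sum_sub_distrib, ← Finset.sum_add_distrib, Finset.mul_sum]
  refine Finset.sum_congr rfl fun j _ => ?_
  rw [hc j]; push_cast; ring

end

section
open Topology
variable {S : ℂ → ℂ} {R : ℝ} {a b : ℝ}

lemma aeval_re (P : Polynomial ℝ) (x : ℝ) : Polynomial.aeval (x:ℂ) P = ((P.eval x : ℝ) : ℂ) := Polynomial.aeval_ofReal P x

lemma slit_sub' {z : ℂ} (h : z.im ≠ 0) : 1 - z ∈ Complex.slitPlane := by
  right; simpa using h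
lemma slit_add' {z : ℂ} (h : z.im ≠ 0) : 1 + z ∈ Complex.slitPlane := by
  right; simpa using h

lemma Fd_diffAt' (hS : SData S R) {z : ℂ} (h : z.im ≠ 0) (hz : ‖z‖ < R) : DifferentiableAt ℂ (Fd a b S) z := by
  have h1 : DifferentiableAt ℂ S z := (hS.diff z (by simpa using hz)).differentiableAt (Metric.isOpen_ball.mem_nhds (by simpa using hz))
  unfold Fd
  exact (((differentiableAt_const _).sub differentiableAt_id).cpow_const (slit_sub' h)).mul
    (((differentiableAt_const _).add differentiableAt_id).cpow_const (slit_add' h)) |>.mul h1.cexp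

lemma Fd_conj' (hS : SData S R) {z : ℂ} (h : z.im ≠ 0) (hz : ‖z‖ < R) :
    Fd a b S (starRingEnd ℂ z) = starRingEnd ℂ (Fd a b S z) := by
  unfold Fd
  rw [map_mul, map_mul, ← Complex.exp_conj, hS.conj z (by simpa using hz)]
  have e1 := Complex.cpow_conj (1 - z) (a:ℂ) (Complex.slitPlane_arg_ne_pi (slit_sub' h))
  have e2 := Complex.cpow_conj (1 + z) (b:ℂ) (Complex.slitPlane_arg_ne_pi (slit_add' h))
  rw [Complex.conj_ofReal] at e1 e2
  rw [e1, e2, Complex.conj_conj, Complex.conj_conj]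
  simp only [map_sub, map_add, map_one]

lemma Fd_ne' {z : ℂ} (h : z.im ≠ 0) : Fd a b S z ≠ 0 := by
  unfold Fd
  refine mul_ne_zero (mul_ne_zero ?_ ?_) (Complex.exp_ne_zero _)
  · rw [Complex.cpow_def_of_ne_zero (Complex.slitPlane_ne_zero (slit_sub' h))]; exact Complex.exp_ne_zero _
  · rw [Complex.cpow_def_of_ne_zero (Complex.slitPlane_ne_zero (slit_add' h))]; exact Complex.exp_ne_zero _

/-- half of the polynomial near the endpoint -/
def Wf (a b : ℝ) (S : ℂ → ℂ) (f : LR) (n : ℕ) (η : ℕ → ℝ) (u : ℂ) : ℂ :=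
  cexp (-u) * Bz f n η (cexp (-(u / n))) / Fd a b S (cexp (u / n))

lemma exp_div_im {n : ℕ} (hn : 1 ≤ n) {u : ℂ} (hu : u.im ≠ 0) (hu2 : ‖u‖ < 2) : (cexp (u / n)).im ≠ 0 := by
  have hn' : (1:ℝ) ≤ n := by exact_mod_cast hn
  have e : (u / n).im = u.im / n := by
    rw [show u / (n:ℂ) = u / ((n:ℝ):ℂ) by push_cast; rfl, Complex.div_ofReal_im]
  rw [Complex.exp_im, e]
  have h1 := (Complex.abs_im_le_norm u).trans_lt hu2
  refine mul_ne_zero (Real.exp_pos _).ne' ?_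
  have h2 : |u.im / n| < Real.pi := by
    rw [abs_div, Nat.abs_cast]
    calc |u.im| / n ≤ |u.im| / 1 := by gcongr
      _ < Real.pi := by linarith [Real.pi_gt_three]
  intro h0
  have := (Real.sin_eq_zero_iff_of_lt_of_lt (abs_lt.mp h2).1 (abs_lt.mp h2).2).mp h0
  rw [div_eq_zero_iff] at this
  rcases this with h | h
  · exact hu h
  · linarith

lemma exp_div_norm {n : ℕ} (hn : 1 ≤ n) {τ : ℝ} (hnτ : 2 / n < τ) {u : ℂ} (hu2 : ‖u‖ < 2) : ‖cexp (u / n)‖ < Real.exp τ := by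
  have hn' : (0:ℝ) < n := by exact_mod_cast hn
  rw [Complex.norm_exp, Real.exp_lt_exp, show u / (n:ℂ) = u / ((n:ℝ):ℂ) by push_cast; rfl, Complex.div_ofReal_re]
  refine lt_of_le_of_lt ?_ hnτ
  gcongr
  exact (Complex.re_le_norm u).trans hu2.le

lemma Wf_diff (hS : SData S R) {n : ℕ} (hn : 1 ≤ n) (f : LR) {η : ℕ → ℝ} {K τ : ℝ} (hτR : Real.exp τ < R) (hnτ : 2 / n < τ)
    (hη : ∀ j, |η j| ≤ K * Real.exp (-(τ * j))) {u : ℂ} (hu : u.im ≠ 0) (hu2 : ‖u‖ < 2) :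
    DifferentiableAt ℂ (Wf a b S f n η) u := by
  have i1 := exp_div_im hn hu hu2
  have n1 := exp_div_norm hn hnτ hu2
  have i2 := exp_div_im hn (u := -u) (by simpa using hu) (by simpa using hu2)
  have n2 := exp_div_norm hn hnτ (u := -u) (by simpa using hu2)
  have hB : DifferentiableAt ℂ (Bz f n η) (cexp (-u / n)) := by
    unfold Bz
    exact ((differentiableAt_const _).sub (Ef_diff f n i2)).add (Ez_diff hη n2)
  have hF := Fd_diffAt' (a := a) (b := b) hS i1 (n1.trans hτR)
  unfold Wf
  have d1 : DifferentiableAt ℂ (fun u : ℂ => cexp (-u / n)) u := by fun_prop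
  have d2 : DifferentiableAt ℂ (fun u : ℂ => cexp (u / n)) u := by fun_prop
  have hB2 := DifferentiableAt.comp (f := fun u : ℂ => cexp (-u / n)) u hB d1
  have hF2 := DifferentiableAt.comp (f := fun u : ℂ => cexp (u / n)) u hF d2
  simp only [← neg_div]
  exact (((differentiableAt_id.neg).cexp.mul hB2).div hF2 (Fd_ne' i1))

lemma Wf_conj (hS : SData S R) {n : ℕ} (hn : 1 ≤ n) (f : LR) {η : ℕ → ℝ} {τ : ℝ} (hτR : Real.exp τ < R) (hnτ : 2 / n < τ)
    {u : ℂ} (hu : u.im ≠ 0) (hu2 : ‖u‖ < 2) :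
    Wf a b S f n η (starRingEnd ℂ u) = starRingEnd ℂ (Wf a b S f n η u) := by
  have i1 := exp_div_im hn hu hu2
  have n1 := exp_div_norm hn hnτ hu2
  have e1 : cexp (starRingEnd ℂ u / n) = starRingEnd ℂ (cexp (u / n)) := by rw [← Complex.exp_conj]; simp
  have e2 : cexp (-(starRingEnd ℂ u / n)) = starRingEnd ℂ (cexp (-(u / n))) := by rw [← Complex.exp_conj]; simp
  have e3 : cexp (-(starRingEnd ℂ u)) = starRingEnd ℂ (cexp (-u)) := by rw [← Complex.exp_conj]; simp
  rw [Wf, Wf, e1, e2, e3, Bz_conj, Fd_conj' hS i1 (n1.trans hτR), map_div₀, map_mul]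

theorem P_formula (hS : SData S R) (ha : -(1/2) < a) (hb : -(1/2) < b) (ha1 : a ≤ 1) (hb1 : b ≤ 1)
    {n : ℕ} (hn : 1 ≤ n) {P : Polynomial ℝ} (hP : P.Monic) (hPn : P.natDegree = n)
    (ho : ∀ Q : Polynomial ℝ, Q.degree < n → ∫ θ in Ioo 0 Real.pi, P.eval (Real.cos θ) * Q.eval (Real.cos θ) * ‖Fd a b S (cexp (I * θ))‖ ^ 2 = 0)
    {c : l2} (hc : (1 + Hop a b S n) c = eb 0)
    (f : LR) {η : ℕ → ℝ} {K τ : ℝ} (hτ : 0 < τ) (hτR : Real.exp τ < R) (hnτ : 2 / n < τ) (hη : ∀ j, |η j| ≤ K * Real.exp (-(τ * j)))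
    (hcj : ∀ j, c j = (if j = 0 then 1 else 0) - (Real.sqrt n)⁻¹ * inner ℝ (av n j) f + η j)
    {u : ℂ} (hu : 0 < u.im) (hu2 : ‖u‖ < 2) :
    Polynomial.aeval (Complex.cosh (u / n)) P = (((2⁻¹:ℝ)^n * Real.exp (S 0).re : ℝ) : ℂ) * (Wf a b S f n η u + Wf a b S f n η (-u)) := by
  have hn0 : (0:ℝ) < n := by exact_mod_cast hn
  have hnc : (n:ℂ) ≠ 0 := by exact_mod_cast hn0.ne'
  set Ω : Set ℂ := {u | 0 < u.im} ∩ Metric.ball 0 2 with hΩ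
  have hΩo : IsOpen Ω := (isOpen_lt continuous_const Complex.continuous_im).inter Metric.isOpen_ball
  have hΩc : IsPreconnected Ω := ((convex_halfSpace_im_gt 0).inter (convex_ball 0 2)).isPreconnected
  set C : ℝ := (2⁻¹:ℝ)^n * Real.exp (S 0).re with hC
  have hmem : ∀ u ∈ Ω, u.im ≠ 0 ∧ ‖u‖ < 2 := fun u hu => ⟨(hu.1 : 0 < u.im).ne', by simpa using hu.2⟩
  have d1 : DifferentiableOn ℂ (fun u : ℂ => Polynomial.aeval (Complex.cosh (u / n)) P) Ω := by
    intro u _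
    have : DifferentiableAt ℂ (fun z : ℂ => Polynomial.aeval z P) (Complex.cosh (u / n)) := P.differentiable_aeval _
    exact (DifferentiableAt.comp (f := fun u : ℂ => Complex.cosh (u / n)) u this (by fun_prop)).differentiableWithinAt
  have d2 : DifferentiableOn ℂ (fun u : ℂ => (C:ℂ) * (Wf a b S f n η u + Wf a b S f n η (-u))) Ω := by
    intro u hu
    obtain ⟨i, m⟩ := hmem u hu
    have w1 := Wf_diff (a := a) (b := b) hS hn f hτR hnτ hη i m
    have w2 := Wf_diff (a := a) (b := b) hS hn f hτR hnτ hη (u := -u) (by simpa using i) (by simpa using m)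
    exact ((w1.add (DifferentiableAt.comp (f := fun u : ℂ => -u) u w2 differentiableAt_id.neg)).const_mul _).differentiableWithinAt
  -- the identity on the arc
  have hsmall : (2:ℝ)/n ≤ 2 := by
    rw [div_le_iff₀ hn0]; have : (1:ℝ) ≤ n := by exact_mod_cast hn
    linarith
  have harc : ∀ θ ∈ Ioo (0:ℝ) (2/n), ((n * θ : ℝ):ℂ) * I ∈ Ω := by
    intro θ hθ
    have hp : 0 < n * θ := mul_pos hn0 hθ.1
    refine ⟨?_, ?_⟩
    · change 0 < (((n * θ : ℝ):ℂ) * I).im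
      simpa using hp
    · simp only [Metric.mem_ball, dist_zero_right]
      rw [norm_mul, Complex.norm_I, mul_one]
      rw [show ‖(((n * θ : ℝ)):ℂ)‖ = n * θ by rw [Complex.norm_real, Real.norm_eq_abs, abs_of_pos hp]]
      have := (lt_div_iff₀ hn0).mp hθ.2
      linarith
  have hsub : Ioo (0:ℝ) (2/n) ⊆ Ioo 0 Real.pi := Ioo_subset_Ioo_right (by linarith [Real.pi_gt_three])
  have hcontinuous : Continuous (fun θ : ℝ => ((n * θ : ℝ):ℂ) * I) := by fun_prop
  have hae : (fun θ : ℝ => Polynomial.aeval (Complex.cosh (((n * θ : ℝ):ℂ) * I / n)) P) =ᵐ[volume.restrict (Ioo (0:ℝ) (2/n))]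
      fun θ : ℝ => (C:ℂ) * (Wf a b S f n η (((n * θ : ℝ):ℂ) * I) + Wf a b S f n η (-(((n * θ : ℝ):ℂ) * I))) := by
    apply ae_restrict_of_ae_restrict_of_subset hsub
    have hX := (exact_thm hS ha hb ha1 hb1 hP hPn ho hc).1
    have s1 := Lp.coeFn_smul (Real.sqrt Real.pi * C) (Psi c + Jop (uS a b S n) (Psi c))
    have s2 := Lp.coeFn_add (Psi c) (Jop (uS a b S n) (Psi c))
    have s3 := Jop_ae (uS_cont (a := a) (b := b) hS n) (uS_norm hS n) (Psi c)
    have s4 := XL_ae hS ha hb n P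
    have s5 := Bz_arc hn f hτ hη c hcj
    rw [hX] at s4
    filter_upwards [s1, s2, s3, s4, s5, ae_restrict_mem measurableSet_Ioo] with θ e1 e2 e3 e4 e5 hθ
    rw [e1, Pi.smul_apply, e2, Pi.add_apply, e3, e5, uS, XQ] at e4
    have hFn : Fd a b S (cexp (I * θ)) ≠ 0 := Fd_ne (arc_re hθ)
    have hb' := Fd_b (a := a) (b := b) hS hθ
    have hconjF := Fd_conj (a := a) (b := b) hS (arc_re hθ) (by rw [exp_I_norm]; exact hS.one_lt)
    have q1 : ((n * θ : ℝ):ℂ) * I / n = θ * I := by push_cast; field_simp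
    have q2 : cexp (-(((n * θ : ℝ):ℂ) * I)) = (cexp (I * θ) ^ n)⁻¹ := by
      rw [← Complex.exp_nat_mul, ← Complex.exp_neg]; congr 1; push_cast; ring
    have q3 : cexp (((n * θ : ℝ):ℂ) * I) = cexp (I * θ) ^ n := by
      rw [← Complex.exp_nat_mul]; congr 1; push_cast; ring
    have q4 : cexp (-(I * θ)) = starRingEnd ℂ (cexp (I * θ)) := by rw [← conj_exp, Complex.conj_conj]
    have q5 : cexp (-((θ:ℂ) * I)) = starRingEnd ℂ (cexp (I * θ)) := by rw [← q4, mul_comm]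
    rw [q4, Bz_conj, map_mul, Complex.conj_conj, map_inv₀, Complex.conj_ofReal] at e4
    simp only [Wf, q1, q2, q3, neg_div, neg_neg, q4, mul_comm (θ:ℂ) I]
    rw [hconjF, mul_comm I (θ:ℂ), Complex.cosh_mul_I, ← Complex.ofReal_cos, aeval_re, Bz_conj, mul_comm (θ:ℂ) I]
    set F := Fd a b S (cexp (I * θ))
    set z := cexp (I * θ) with hz
    have hz0 : z ≠ 0 := Complex.exp_ne_zero _
    have hFc : starRingEnd ℂ F ≠ 0 := by simpa using hFn
    set B := Bz f n η z
    have hsp : (Real.sqrt Real.pi : ℂ) ≠ 0 := by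
      exact_mod_cast (Real.sqrt_pos.mpr Real.pi_pos).ne'
    have e6 : ((P.eval (Real.cos θ) : ℝ) : ℂ) * z ^ n * F = C * (starRingEnd ℂ B + z ^ (2 * n) * bfun a b S θ * B) := by
      rw [← e4, Complex.real_smul]; push_cast; field_simp
    have e7 : ((P.eval (Real.cos θ) : ℝ) : ℂ) = C * (starRingEnd ℂ B + z ^ (2 * n) * bfun a b S θ * B) / (z ^ n * F) := by
      rw [eq_div_iff (mul_ne_zero (pow_ne_zero _ hz0) hFn), ← e6, mul_assoc]
    change ((P.eval (Real.cos θ) : ℝ) : ℂ) = _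
    rw [e7]
    have e8 : bfun a b S θ / F = 1 / starRingEnd ℂ F := by
      rw [div_eq_div_iff hFn hFc, one_mul, ← hb']
    have e9 : C * (starRingEnd ℂ B + z ^ (2 * n) * bfun a b S θ * B) / (z ^ n * F) =
       C * ((z ^ n)⁻¹ * starRingEnd ℂ B / F + z ^ n * B * (bfun a b S θ / F)) := by
      field_simp; ring
    rw [e9, e8]; ring
  have heq := Measure.eqOn_open_of_ae_eq hae isOpen_Ioo
    (d1.continuousOn.comp hcontinuous.continuousOn harc) (d2.continuousOn.comp hcontinuous.continuousOn harc)
  have hI : I ∈ Ω := ⟨by simp, by simp⟩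
  have hfr : ∃ᶠ z in 𝓝[≠] I, Polynomial.aeval (Complex.cosh (z / n)) P = (C:ℂ) * (Wf a b S f n η z + Wf a b S f n η (-z)) := by
    have ht : Tendsto (fun k : ℕ => ((n * (1/(n:ℝ) + 1/(n:ℝ) * (1/((k:ℝ)+2))) : ℝ):ℂ) * I) atTop (𝓝[≠] I) := by
      rw [tendsto_nhdsWithin_iff]
      constructor
      · have h0 : Tendsto (fun k : ℕ => 1/((k:ℝ)+2)) atTop (𝓝 0) := by
          have := tendsto_one_div_add_atTop_nhds_zero_nat (𝕜 := ℝ)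
          have h2 := this.comp (tendsto_add_atTop_nat 1)
          refine h2.congr fun k => ?_
          simp only [Function.comp]; push_cast; ring_nf
        have h1 := ((h0.const_mul (1/(n:ℝ))).const_add (1/(n:ℝ))).const_mul (n:ℝ)
        have h2 := (Complex.continuous_ofReal.tendsto _).comp h1
        have h3 := h2.mul_const I
        have e : ((((n:ℝ) * (1 / (n:ℝ) + 1 / (n:ℝ) * 0) : ℝ)):ℂ) * I = I := by
          rw [mul_zero, add_zero, mul_one_div_cancel hn0.ne']; simp
        rw [e] at h3
        exact h3
      · refine Eventually.of_forall fun k h => ?_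
        have h1 := congrArg Complex.im h
        simp only [Complex.mul_I_im, Complex.ofReal_re, Complex.I_im] at h1
        have h2 : (n:ℝ) * (1/(n:ℝ) + 1/(n:ℝ) * (1/((k:ℝ)+2))) = 1 + 1/((k:ℝ)+2) := by field_simp
        rw [h2] at h1
        have : 0 < 1/((k:ℝ)+2) := by positivity
        linarith
    refine ht.frequently (Eventually.frequently (Eventually.of_forall fun k => ?_))
    refine heq ⟨by positivity, ?_⟩
    have h3 : 1/((k:ℝ)+2) < 1 := by rw [div_lt_one (by positivity)]; linarith [(Nat.cast_nonneg k : (0:ℝ) ≤ k)]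
    have h4 : 1/(n:ℝ) * (1/((k:ℝ)+2)) < 1/(n:ℝ) * 1 := mul_lt_mul_of_pos_left h3 (by positivity)
    have : (2:ℝ)/n = 1/(n:ℝ) + 1/(n:ℝ) := by ring
    linarith
  exact (d1.analyticOnNhd hΩo).eqOn_of_preconnected_of_frequently_eq (d2.analyticOnNhd hΩo) hΩc hI hfr ⟨hu, by simpa using hu2⟩
end

section
open Topology

lemma coshPow_exists (m : ℕ) : ∃ c : ℕ → ℝ, (∀ i < m, c i = 0) ∧ c m = (2⁻¹) ^ m ∧
    ∀ v : ℂ, HasSum (fun i => (c i : ℂ) * v ^ (2 * i)) ((Complex.cosh v - 1) ^ m) := by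
  induction m with
  | zero =>
    refine ⟨fun i => if i = 0 then 1 else 0, by simp, by simp, fun v => ?_⟩
    have := hasSum_single (f := fun i : ℕ => (((if i = 0 then 1 else 0 : ℝ)) : ℂ) * v ^ (2 * i)) 0 (fun i hi => by simp [hi])
    simpa using this
  | succ m ih =>
    obtain ⟨c, c0, cm, hc⟩ := ih
    let d : ℕ → ℝ := fun i => if i = 0 then 0 else ((2 * i).factorial : ℝ)⁻¹
    have hd : ∀ v : ℂ, HasSum (fun i => (d i : ℂ) * v ^ (2 * i)) (Complex.cosh v - 1) := by
      intro v
      have h1 := (Complex.hasSum_cosh v).sub (hasSum_single (f := fun i : ℕ => if i = 0 then (1:ℂ) else 0) 0 (fun i hi => by simp [hi]))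
      simp only [if_true] at h1
      refine h1.congr_fun ?_
      intro i
      by_cases hi : i = 0
      · simp [d, hi]
      · simp [d, hi, div_eq_mul_inv, mul_comm]
    refine ⟨fun i => ∑ kl ∈ Finset.HasAntidiagonal.antidiagonal i, c kl.1 * d kl.2, ?_, ?_, ?_⟩
    · intro i hi
      refine Finset.sum_eq_zero fun kl hkl => ?_
      rw [Finset.HasAntidiagonal.mem_antidiagonal] at hkl
      by_cases h : kl.2 = 0
      · simp [d, h]
      · rw [c0 kl.1 (by omega), zero_mul]
    · beta_reduce; rw [Finset.sum_eq_single (m, 1)]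
      · rw [cm]; simp [d]; rw [pow_succ, mul_inv]
      · intro kl hkl hne
        rw [Finset.HasAntidiagonal.mem_antidiagonal] at hkl
        by_cases h : kl.2 = 0
        · simp [d, h]
        · by_cases h' : kl.1 < m
          · rw [c0 kl.1 h', zero_mul]
          · exact absurd (Prod.ext (by simp; omega) (by simp; omega)) hne
      · intro h; simp at h
    · intro v
      have s1 := (hc v).summable.norm
      have s2 := (hd v).summable.norm
      have e := tsum_mul_tsum_eq_tsum_sum_antidiagonal_of_summable_norm s1 s2
      have s3 := (summable_norm_sum_mul_antidiagonal_of_summable_norm s1 s2).of_norm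
      rw [(hc v).tsum_eq, (hd v).tsum_eq] at e
      rw [pow_succ, e]
      refine s3.hasSum.congr_fun ?_
      intro i
      push_cast
      rw [Finset.sum_mul]
      refine Finset.sum_congr rfl fun kl hkl => ?_
      rw [Finset.HasAntidiagonal.mem_antidiagonal] at hkl
      rw [← hkl]; ring

def coshC (m : ℕ) : ℕ → ℝ := (coshPow_exists m).choose
lemma coshC_lt {m i : ℕ} (h : i < m) : coshC m i = 0 := (coshPow_exists m).choose_spec.1 i h
lemma coshC_diag (m : ℕ) : coshC m m = (2⁻¹) ^ m := (coshPow_exists m).choose_spec.2.1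
lemma coshC_sum (m : ℕ) (v : ℂ) : HasSum (fun i => (coshC m i : ℂ) * v ^ (2 * i)) ((Complex.cosh v - 1) ^ m) :=
  (coshPow_exists m).choose_spec.2.2 v

/-- Taylor coefficients at 1 -/
def Dc (P : Polynomial ℝ) (m : ℕ) : ℝ := (Polynomial.taylor 1 P).coeff m

/-- coefficients of `P (cosh v)` in powers of `v^2` -/
def gC (P : Polynomial ℝ) (i : ℕ) : ℝ := ∑ m ∈ Finset.range (i+1), coshC m i * Dc P m

lemma gC_sum (P : Polynomial ℝ) (v : ℂ) : HasSum (fun i => (gC P i : ℂ) * v ^ (2 * i)) (Polynomial.aeval (Complex.cosh v) P) := by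
  have e : Polynomial.aeval (Complex.cosh v) P = ∑ m ∈ Finset.range (P.natDegree + 1), (Dc P m : ℂ) * (Complex.cosh v - 1) ^ m := by
    have h1 : Polynomial.aeval (Complex.cosh v - 1) (Polynomial.taylor 1 P) = Polynomial.aeval (Complex.cosh v) P := by
      rw [Polynomial.taylor_apply, Polynomial.aeval_comp]; simp
    rw [← h1, Polynomial.aeval_eq_sum_range, Polynomial.natDegree_taylor]
    refine Finset.sum_congr rfl fun m _ => ?_
    rw [Complex.real_smul]; rfl
  rw [e]
  have h := hasSum_sum (s := Finset.range (P.natDegree + 1)) (fun m _ => (coshC_sum m v).mul_left (Dc P m : ℂ))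
  refine h.congr_fun ?_
  intro i
  have e2 : gC P i = ∑ m ∈ Finset.range (P.natDegree + 1), coshC m i * Dc P m := by
    rcases le_total i P.natDegree with hi | hi
    · refine Finset.sum_subset (Finset.range_subset_range.mpr (by omega)) fun m _ hm => ?_
      rw [Finset.mem_range] at hm
      rw [coshC_lt (by omega), zero_mul]
    · symm
      refine Finset.sum_subset (Finset.range_subset_range.mpr (by omega)) fun m _ hm => ?_
      rw [Finset.mem_range] at hm
      rw [Dc, Polynomial.coeff_eq_zero_of_natDegree_lt (by rw [Polynomial.natDegree_taylor]; omega), mul_zero]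
  rw [e2]; push_cast; rw [Finset.sum_mul]
  refine Finset.sum_congr rfl fun m _ => ?_
  ring

def LJ (j : ℕ) (g : ℂ → ℂ) : ℝ :=
  Real.pi⁻¹ * ∫ ψ in Ioo 0 Real.pi, ((cexp (I * ψ) ^ 2 - 1) * (cexp (I * ψ) ^ (2 * j))⁻¹ * g (cexp (I * ψ))).re

lemma exp_re_int (i j : ℕ) (ψ : ℝ) : ((cexp (I * ψ) ^ 2 - 1) * (cexp (I * ψ) ^ (2 * j))⁻¹ * cexp (I * ψ) ^ (2 * i)).re
    = Real.cos (((2 * (i + 1 - j) : ℤ) : ℝ) * ψ) - Real.cos (((2 * (i - j) : ℤ):ℝ) * ψ) := by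
  have e : (cexp (I * ψ) ^ 2 - 1) * (cexp (I * ψ) ^ (2 * j))⁻¹ * cexp (I * ψ) ^ (2 * i) =
    cexp (((((2 * (i + 1 - j) : ℤ) : ℝ) * ψ : ℝ):ℂ) * I) - cexp (((((2 * (i - j) : ℤ) : ℝ) * ψ : ℝ):ℂ) * I) := by
    simp only [← Complex.exp_nat_mul, ← Complex.exp_neg, sub_mul, one_mul, ← Complex.exp_add]
    congr 1 <;> congr 1 <;> push_cast <;> ring
  rw [e, Complex.sub_re, Complex.exp_ofReal_mul_I_re, Complex.exp_ofReal_mul_I_re]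

lemma cos_mean (k : ℤ) : Real.pi⁻¹ * ∫ ψ in Ioo 0 Real.pi, Real.cos (((2 * k : ℤ):ℝ) * ψ) = if k = 0 then 1 else 0 := by
  rw [← integral_Ioc_eq_integral_Ioo, ← intervalIntegral.integral_of_le Real.pi_pos.le]
  split_ifs with h
  · subst h; simp [Real.pi_ne_zero]
  · rw [cos_int _ (by omega), mul_zero]

lemma LJ_series (j : ℕ) {g : ℂ → ℂ} {k : ℕ → ℝ} (hk : ∀ v, HasSum (fun i => (k i : ℂ) * v ^ (2 * i)) (g v)) (ε : ℝ) :
    LJ j (fun u => g (ε * u)) = (if j = 0 then 0 else k (j-1) * ε ^ (2 * (j-1))) - k j * ε ^ (2 * j) := by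
  have hs : Summable (fun i => |k i * ε ^ (2 * i)|) := by
    have := (hk (ε:ℂ)).summable.norm
    refine this.congr fun i => ?_
    rw [norm_mul, norm_pow, Complex.norm_real, Complex.norm_real, abs_mul, abs_pow]; rfl
  set F : ℕ → ℝ → ℝ := fun i ψ => k i * ε ^ (2 * i) * (Real.cos (((2 * (i + 1 - j) : ℤ) : ℝ) * ψ) - Real.cos (((2 * (i - j) : ℤ):ℝ) * ψ)) with hF
  have hFc : ∀ i, Continuous (F i) := fun i => by rw [hF]; fun_prop
  have hFb : ∀ i ψ, ‖F i ψ‖ ≤ |k i * ε ^ (2 * i)| * 2 := by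
    intro i ψ
    rw [hF, norm_mul, Real.norm_eq_abs, Real.norm_eq_abs]
    gcongr
    have h1 := Real.abs_cos_le_one (((2 * (i + 1 - j) : ℤ) : ℝ) * ψ)
    have h2 := Real.abs_cos_le_one (((2 * (i - j) : ℤ) : ℝ) * ψ)
    exact (abs_sub _ _).trans (by linarith)
  have hFi : ∀ i, IntegrableOn (F i) (Ioo 0 Real.pi) := fun i => ((hFc i).integrableOn_Icc).mono_set Ioo_subset_Icc_self
  have h1 := hasSum_integral_of_summable_integral_norm (μ := volume.restrict (Ioo 0 Real.pi)) hFi (by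
    refine Summable.of_nonneg_of_le (fun i => integral_nonneg fun _ => norm_nonneg _) (fun i => ?_) (hs.mul_right (2 * Real.pi))
    calc ∫ ψ in Ioo 0 Real.pi, ‖F i ψ‖ ≤ ∫ ψ in Ioo 0 Real.pi, |k i * ε ^ (2 * i)| * 2 :=
          integral_mono (hFi i).norm (integrable_const _) (fun ψ => hFb i ψ)
      _ = _ := by simp [Real.pi_pos.le]; ring)
  have h2 := h1.mul_left Real.pi⁻¹
  have e1 : LJ j (fun u => g (ε * u)) = Real.pi⁻¹ * ∫ ψ in Ioo 0 Real.pi, ∑' i, F i ψ := by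
    rw [LJ]; congr 2; ext ψ
    have h3 := (hk (ε * cexp (I * ψ))).mul_left ((cexp (I * ψ) ^ 2 - 1) * (cexp (I * ψ) ^ (2 * j))⁻¹)
    have h4 := Complex.hasSum_re h3
    rw [← h4.tsum_eq]
    congr 1; ext i
    rw [hF]; beta_reduce; rw [← exp_re_int, mul_pow, ← Complex.re_ofReal_mul]
    congr 1; push_cast; ring
  rw [e1]
  refine h2.unique ?_
  have e2 : ∀ i, Real.pi⁻¹ * ∫ ψ in Ioo 0 Real.pi, F i ψ = (if i + 1 = j then k i * ε ^ (2 * i) else 0) - (if i = j then k i * ε ^ (2 * i) else 0) := by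
    intro i
    rw [hF, integral_const_mul, integral_sub, ← mul_assoc, mul_comm Real.pi⁻¹, mul_assoc, mul_sub, cos_mean, cos_mean]
    · have a1 : ((i:ℤ) + 1 - j = 0) ↔ i + 1 = j := by omega
      have a2 : ((i:ℤ) - j = 0) ↔ i = j := by omega
      simp only [a1, a2]
      split_ifs <;> ring
    · exact ((by fun_prop : Continuous fun ψ : ℝ => Real.cos (((2 * (i + 1 - j) : ℤ) : ℝ) * ψ)).integrableOn_Icc).mono_set Ioo_subset_Icc_self
    · exact ((by fun_prop : Continuous fun ψ : ℝ => Real.cos (((2 * (i - j) : ℤ) : ℝ) * ψ)).integrableOn_Icc).mono_set Ioo_subset_Icc_self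
  simp_rw [e2]
  refine HasSum.sub ?_ ?_
  · rcases j with _ | j
    · simpa using hasSum_zero
    · have := hasSum_single (f := fun i : ℕ => if i + 1 = j + 1 then k i * ε ^ (2 * i) else 0) j (fun i hi => by simp [hi])
      simpa using this
  · have := hasSum_single (f := fun i : ℕ => if i = j then k i * ε ^ (2 * i) else 0) j (fun i hi => by simp [hi])
    simpa using this

lemma LJ_poly (j : ℕ) (P : Polynomial ℝ) (n : ℕ) :
    LJ j (fun u => Polynomial.aeval (Complex.cosh (u / n)) P) =
      (if j = 0 then 0 else gC P (j-1) * ((n:ℝ)⁻¹) ^ (2 * (j-1))) - gC P j * ((n:ℝ)⁻¹) ^ (2 * j) := by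
  rw [← LJ_series j (gC_sum P)]
  congr 1; ext u; congr 2; push_cast; rw [div_eq_inv_mul]

/-- from the functionals to the derivatives at 1 -/
theorem Dc_AE {P : ℕ → Polynomial ℝ} {s : ℕ → ℝ} {lam : ℕ → ℝ}
    (h : ∀ j, AE (fun n => s n * LJ j (fun u => Polynomial.aeval (Complex.cosh (u / n)) (P n))))
    (hl : ∀ j, Tendsto (fun n => s n * LJ j (fun u => Polynomial.aeval (Complex.cosh (u / n)) (P n))) atTop (𝓝 (lam j))) (m : ℕ) :
    AE (fun n => s n * (((n:ℝ)⁻¹) ^ (2 * m) * Dc (P n) m)) ∧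
    Tendsto (fun n => s n * (((n:ℝ)⁻¹) ^ (2 * m) * Dc (P n) m)) atTop (𝓝 (-(2 ^ m * ∑ i ∈ Finset.range (m+1), lam i))) := by
  have hX : ∀ j, AE (fun n => s n * (gC (P n) j * ((n:ℝ)⁻¹) ^ (2 * j))) ∧
      Tendsto (fun n => s n * (gC (P n) j * ((n:ℝ)⁻¹) ^ (2 * j))) atTop (𝓝 (-(∑ i ∈ Finset.range (j+1), lam i))) := by
    intro j
    induction j with
    | zero =>
      have e : ∀ n, -(s n * LJ 0 (fun u => Polynomial.aeval (Complex.cosh (u / n)) (P n))) = s n * (gC (P n) 0 * ((n:ℝ)⁻¹) ^ (2 * 0)) := by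
        intro n; rw [LJ_poly]; simp
      constructor
      · exact (h 0).neg.congr' (Eventually.of_forall e)
      · simpa using ((hl 0).neg.congr e)
    | succ j ih =>
      have e : ∀ n, s n * (gC (P n) j * ((n:ℝ)⁻¹) ^ (2 * j)) - (s n * LJ (j+1) (fun u => Polynomial.aeval (Complex.cosh (u / n)) (P n))) = s n * (gC (P n) (j+1) * ((n:ℝ)⁻¹) ^ (2 * (j+1))) := by
        intro n; rw [LJ_poly]; simp; ring
      constructor
      · exact (ih.1.sub (h (j+1))).congr' (Eventually.of_forall e)
      · have := (ih.2.sub (hl (j+1))).congr e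
        rw [Finset.sum_range_succ, neg_add]; exact this
  induction m using Nat.strong_induction_on with
  | _ m ih =>
    have e : ∀ᶠ n : ℕ in atTop, 2 ^ m * (s n * (gC (P n) m * ((n:ℝ)⁻¹) ^ (2 * m)) - ∑ i ∈ Finset.range m, (coshC i m * ((n:ℝ)⁻¹) ^ (2 * (m - i))) * (s n * (((n:ℝ)⁻¹) ^ (2 * i) * Dc (P n) i)))
        = s n * (((n:ℝ)⁻¹) ^ (2 * m) * Dc (P n) m) := by
      refine Eventually.of_forall fun n => ?_
      have e1 : ∑ i ∈ Finset.range m, (coshC i m * ((n:ℝ)⁻¹) ^ (2 * (m - i))) * (s n * (((n:ℝ)⁻¹) ^ (2 * i) * Dc (P n) i)) =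
          s n * ((∑ i ∈ Finset.range m, coshC i m * Dc (P n) i) * ((n:ℝ)⁻¹) ^ (2 * m)) := by
        rw [Finset.sum_mul, Finset.mul_sum]
        refine Finset.sum_congr rfl fun i hi => ?_
        rw [Finset.mem_range] at hi
        rw [show 2 * m = 2 * (m - i) + 2 * i by omega, pow_add]; ring_nf
      rw [e1, gC, Finset.sum_range_succ, coshC_diag]
      have : (2:ℝ) ^ m * (2⁻¹) ^ m = 1 := by rw [← mul_pow]; norm_num
      linear_combination (s n * (((n:ℝ)⁻¹) ^ (2 * m) * Dc (P n) m)) * this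
    have hA : AE (fun n : ℕ => ∑ i ∈ Finset.range m, (coshC i m * ((n:ℝ)⁻¹) ^ (2 * (m - i))) * (s n * (((n:ℝ)⁻¹) ^ (2 * i) * Dc (P n) i))) := by
      refine AE.sum _ fun i hi => ?_
      exact ((AE.const _).mul (AE.invn.pow _)).mul (ih i (Finset.mem_range.mp hi)).1
    have hT : Tendsto (fun n : ℕ => ∑ i ∈ Finset.range m, (coshC i m * ((n:ℝ)⁻¹) ^ (2 * (m - i))) * (s n * (((n:ℝ)⁻¹) ^ (2 * i) * Dc (P n) i))) atTop (𝓝 0) := by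
      rw [← Finset.sum_const_zero (s := Finset.range m)]
      refine tendsto_finsetSum _ fun i hi => ?_
      rw [Finset.mem_range] at hi
      have h0 := ((AE.inv_tendsto.pow (2 * (m - i))).const_mul (coshC i m)).mul (ih i hi).2
      rw [zero_pow (by omega), mul_zero, zero_mul] at h0
      exact h0
    constructor
    · exact ((AE.const (2 ^ m)).mul ((hX m).1.sub hA)).congr' e
    · have := (((hX m).2.sub hT).const_mul (2 ^ m)).congr' e
      rw [sub_zero, mul_neg] at this
      exact this
end

section
open Topology

/-- the vector in `LR` attached to a kernel on `ℝ × (0,π)` -/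
def VK (K : ℝ × ℝ → ℂ) (w : ℝ) : ℝ := Real.exp (-(1/2 * |w|)) * ∫ ψ in Ioo 0 Real.pi, (K (w, ψ)).re

def GK (C : ℝ) (K : ℝ × ℝ → ℂ) : Prop := Measurable K ∧ ∀ w ψ, ‖K (w, ψ)‖ ≤ C * Real.exp (|w| / 4)

open Classical in
def Vec (K : ℝ × ℝ → ℂ) : LR := if h : MemLp (VK K) 2 then h.toLp _ else 0

variable {K K' : ℝ × ℝ → ℂ} {C C' : ℝ}

lemma GK.intOn (h : GK C K) (w : ℝ) : IntegrableOn (fun ψ => K (w, ψ)) (Ioo 0 Real.pi) := by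
  refine Integrable.mono' (integrable_const (C * Real.exp (|w| / 4))) ?_ (Eventually.of_forall fun ψ => h.2 w ψ)
  exact (h.1.comp measurable_prodMk_left).aestronglyMeasurable

lemma GK.intOn_re (h : GK C K) (w : ℝ) : IntegrableOn (fun ψ => (K (w, ψ)).re) (Ioo 0 Real.pi) := (h.intOn w).re

lemma VK_le (h : GK C K) (w : ℝ) : |VK K w| ≤ C * Real.pi * Real.exp (-(1/4 * |w|)) := by
  have h1 : ‖∫ ψ in Ioo 0 Real.pi, (K (w, ψ)).re‖ ≤ C * Real.exp (|w| / 4) * Real.pi := by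
    have := norm_setIntegral_le_of_norm_le_const (μ := volume) (s := Ioo 0 Real.pi) (f := fun ψ => (K (w, ψ)).re)
      (C := C * Real.exp (|w| / 4)) (by simp) (fun ψ _ => by
        rw [Real.norm_eq_abs]; exact (Complex.abs_re_le_norm _).trans (h.2 w ψ))
    simpa [Real.pi_pos.le] using this
  rw [VK, abs_mul, abs_of_pos (Real.exp_pos _), ← Real.norm_eq_abs (∫ ψ in _, _)]
  calc _ ≤ Real.exp (-(1/2 * |w|)) * (C * Real.exp (|w| / 4) * Real.pi) := by gcongr
    _ = C * Real.pi * (Real.exp (-(1/2 * |w|)) * Real.exp (|w| / 4)) := by ring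
    _ = _ := by rw [← Real.exp_add]; congr 2; ring

lemma VK_meas (h : GK C K) : Measurable (VK K) := by
  have h1 : StronglyMeasurable (fun p : ℝ × ℝ => (K p).re) := (Complex.measurable_re.comp h.1).stronglyMeasurable
  exact (by fun_prop : Measurable fun w : ℝ => Real.exp (-(1/2 * |w|))).mul
    (h1.integral_prod_right' (ν := volume.restrict (Ioo 0 Real.pi))).measurable

lemma VK_memLp (h : GK C K) : MemLp (VK K) 2 := by
  refine ((memLp_exp_abs (c := 1/4) (by norm_num)).const_mul (C * Real.pi)).mono (VK_meas h).aestronglyMeasurable (Eventually.of_forall fun w => ?_)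
  rw [Real.norm_eq_abs]
  exact (VK_le h w).trans (le_abs_self _)

lemma Vec_ae (h : GK C K) : (Vec K : ℝ → ℝ) =ᵐ[volume] VK K := by
  rw [Vec, dif_pos (VK_memLp h)]; exact MemLp.coeFn_toLp _

lemma Vec_norm (h : GK C K) : ‖Vec K‖ ≤ C * Real.pi * ‖eL (1/4)‖ := by
  refine Lp.norm_le_mul_norm_of_ae_le_mul ?_
  filter_upwards [Vec_ae h, eL_ae (c := 1/4) (by norm_num)] with w h1 h2
  rw [h1, h2, Real.norm_eq_abs, Real.norm_eq_abs, abs_of_pos (Real.exp_pos _)]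
  exact VK_le h w

lemma GK.add (h : GK C K) (h' : GK C' K') : GK (C + C') (fun p => K p + K' p) :=
  ⟨h.1.add h'.1, fun w ψ => (norm_add_le _ _).trans (by rw [add_mul]; exact add_le_add (h.2 w ψ) (h'.2 w ψ))⟩

lemma GK.rmul (h : GK C K) (r : ℝ) : GK (|r| * C) (fun p => (r:ℂ) * K p) :=
  ⟨h.1.const_mul _, fun w ψ => by
    rw [norm_mul, Complex.norm_real, Real.norm_eq_abs, mul_assoc]; gcongr; exact h.2 w ψ⟩

lemma Vec_add (h : GK C K) (h' : GK C' K') : Vec (fun p => K p + K' p) = Vec K + Vec K' := by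
  refine Lp.ext ?_
  filter_upwards [Vec_ae (h.add h'), Vec_ae h, Vec_ae h', Lp.coeFn_add (Vec K) (Vec K')] with w h1 h2 h3 h4
  rw [h1, h4, Pi.add_apply, h2, h3, VK, VK, VK, ← mul_add]
  congr 1
  simp only [Complex.add_re]
  exact integral_add (h.intOn_re w) (h'.intOn_re w)

lemma Vec_rmul (h : GK C K) (r : ℝ) : Vec (fun p => (r:ℂ) * K p) = r • Vec K := by
  refine Lp.ext ?_
  filter_upwards [Vec_ae (h.rmul r), Vec_ae h, Lp.coeFn_smul r (Vec K)] with w h1 h2 h4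
  rw [h1, h4, Pi.smul_apply, h2, VK, VK, smul_eq_mul]
  simp only [Complex.re_ofReal_mul]
  rw [integral_const_mul]; ring

lemma Vec_sub (h : GK C K) (h' : GK C' K') : Vec (fun p => K p - K' p) = Vec K - Vec K' := by
  have := Vec_add h (h'.rmul (-1))
  rw [Vec_rmul h'] at this
  rw [sub_eq_add_neg, ← neg_one_smul ℝ (Vec K'), ← this]
  congr 1; ext p; push_cast; ring

lemma Vec_sum {A : ℕ → ℝ × ℝ → ℂ} {D : ℕ → ℝ} (hA : ∀ i, GK (D i) (A i)) (c : ℕ → ℝ) (l : ℕ) :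
    GK (∑ i ∈ Finset.range l, |c i| * D i) (fun p => ∑ i ∈ Finset.range l, (c i : ℂ) * A i p) ∧
    Vec (fun p => ∑ i ∈ Finset.range l, (c i : ℂ) * A i p) = ∑ i ∈ Finset.range l, c i • Vec (A i) := by
  induction l with
  | zero =>
    have h0 : GK 0 (fun _ => 0) := ⟨measurable_const, fun w ψ => by simp⟩
    refine ⟨by simpa using h0, ?_⟩
    have := Vec_rmul h0 0
    simpa using this
  | succ l ih =>
    simp only [Finset.sum_range_succ]
    exact ⟨ih.1.add ((hA l).rmul _), by rw [Vec_add ih.1 ((hA l).rmul _), ih.2, Vec_rmul (hA l)]⟩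

lemma Vec_pair (h : GK C K) (f : LR) :
    IntegrableOn (fun ψ => ∫ w, K (w, ψ) * ((Real.exp (-(1/2 * |w|)) * f w : ℝ) : ℂ)) (Ioo 0 Real.pi) ∧
    inner ℝ (Vec K) f = ∫ ψ in Ioo 0 Real.pi, (∫ w, K (w, ψ) * ((Real.exp (-(1/2 * |w|)) * f w : ℝ) : ℂ)).re := by
  have hC0 : 0 ≤ C := by have := (norm_nonneg _).trans (h.2 0 0); simpa using this
  have hg : AEStronglyMeasurable (fun w => ((Real.exp (-(1/2 * |w|)) * f w : ℝ) : ℂ)) volume :=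
    Complex.continuous_ofReal.comp_aestronglyMeasurable (((by fun_prop : Measurable fun w : ℝ => Real.exp (-(1/2 * |w|))).aestronglyMeasurable).mul (Lp.aestronglyMeasurable f))
  have hi : Integrable (fun p : ℝ × ℝ => K p * ((Real.exp (-(1/2 * |p.1|)) * f p.1 : ℝ) : ℂ)) (volume.prod (volume.restrict (Ioo 0 Real.pi))) := by
    have h1 := ((exp_mul_int (c := 1/4) (by norm_num) f).1.const_mul C).mul_prod (integrable_const (1:ℝ) (μ := volume.restrict (Ioo 0 Real.pi)))
    refine h1.mono' (h.1.aestronglyMeasurable.mul hg.comp_fst) (Eventually.of_forall fun p => ?_)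
    rw [norm_mul, Complex.norm_real, norm_mul, Real.norm_eq_abs, Real.norm_eq_abs, abs_of_pos (Real.exp_pos _), mul_one]
    calc _ ≤ C * Real.exp (|p.1| / 4) * (Real.exp (-(1/2 * |p.1|)) * |f p.1|) := by
          gcongr; exact h.2 p.1 p.2
      _ = C * (Real.exp (|p.1| / 4) * Real.exp (-(1/2 * |p.1|)) * |f p.1|) := by ring
      _ = _ := by rw [← Real.exp_add]; ring_nf
  refine ⟨hi.integral_prod_right, ?_⟩
  rw [inner_LR]
  have e1 : ∫ w, Vec K w * f w = ∫ w, (∫ ψ in Ioo 0 Real.pi, K (w, ψ) * ((Real.exp (-(1/2 * |w|)) * f w : ℝ) : ℂ)).re := by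
    refine integral_congr_ae ?_
    filter_upwards [Vec_ae h] with w hw
    rw [hw, VK, integral_mul_const, Complex.re_mul_ofReal]
    have : (∫ ψ in Ioo 0 Real.pi, (K (w, ψ)).re) = (∫ ψ in Ioo 0 Real.pi, K (w, ψ)).re := integral_re (h.intOn w)
    rw [this]; ring
  have h2 : ∫ w, (∫ ψ in Ioo 0 Real.pi, K (w, ψ) * ((Real.exp (-(1/2 * |w|)) * f w : ℝ) : ℂ)).re
      = (∫ w, ∫ ψ in Ioo 0 Real.pi, K (w, ψ) * ((Real.exp (-(1/2 * |w|)) * f w : ℝ) : ℂ)).re := integral_re hi.integral_prod_left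
  have h3 : ∫ ψ in Ioo 0 Real.pi, (∫ w, K (w, ψ) * ((Real.exp (-(1/2 * |w|)) * f w : ℝ) : ℂ)).re
      = (∫ ψ in Ioo 0 Real.pi, ∫ w, K (w, ψ) * ((Real.exp (-(1/2 * |w|)) * f w : ℝ) : ℂ)).re := integral_re hi.integral_prod_right
  rw [e1, h2, h3]
  congr 1
  exact integral_integral_swap (f := fun w ψ => K (w, ψ) * ((Real.exp (-(1/2 * |w|)) * f w : ℝ) : ℂ)) hi

lemma taylor2 {E : Type*} [NormedAddCommGroup E] [NormedSpace ℝ E] {Φ : E → ℂ} {p : FormalMultilinearSeries ℝ E ℂ}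
    (hp : HasFPowerSeriesAt Φ p 0) (M : ℝ) (hM : 0 ≤ M) (l : ℕ) :
    ∃ C, 0 ≤ C ∧ ∀ (Y : E) (T : ℝ), ‖Y‖ ≤ T → ‖Φ Y‖ ≤ M → ‖Φ Y - p.partialSum (l+1) Y‖ ≤ C * T ^ (l+1) := by
  have h1 := hp.isBigO_sub_partialSum_pow (l+1)
  obtain ⟨c, hc0, hc⟩ := h1.exists_nonneg
  rw [Asymptotics.isBigOWith_iff] at hc
  obtain ⟨r, hr, hr'⟩ := Metric.eventually_nhds_iff.mp hc
  set r' := min r 1 with hr1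
  have hr0 : 0 < r' := lt_min hr one_pos
  set N := ∑ i ∈ Finset.range (l+1), ‖p i‖
  have hN : 0 ≤ N := Finset.sum_nonneg fun i _ => norm_nonneg _
  refine ⟨c + (M + N) / r' ^ (l+1), by positivity, fun Y T hY hΦ => ?_⟩
  have hT : 0 ≤ T := (norm_nonneg _).trans hY
  rw [add_mul]
  by_cases h : ‖Y‖ < r
  · have := hr' (y := Y) (by simpa using h)
    rw [zero_add, norm_pow, norm_norm] at this
    have h2 : c * ‖Y‖ ^ (l+1) ≤ c * T ^ (l+1) := by gcongr
    have h3 : 0 ≤ (M + N) / r' ^ (l+1) * T ^ (l+1) := by positivity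
    linarith
  · push Not at h
    have hTr : 1 ≤ T / r' := by rw [le_div_iff₀ hr0]; linarith [min_le_left r 1]
    have h4 : ‖p.partialSum (l+1) Y‖ ≤ N * (T / r') ^ (l+1) := by
      rw [FormalMultilinearSeries.partialSum, Finset.sum_mul]
      refine (norm_sum_le _ _).trans (Finset.sum_le_sum fun i hi => ?_)
      refine ((p i).le_opNorm _).trans ?_
      simp only [Finset.prod_const, Finset.card_univ, Fintype.card_fin]
      gcongr
      calc ‖Y‖ ^ i ≤ (T / r') ^ i := by
            gcongr; refine hY.trans ((le_div_iff₀ hr0).mpr ?_); nlinarith [min_le_right r 1]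
        _ ≤ _ := pow_le_pow_right₀ hTr (by rw [Finset.mem_range] at hi; omega)
    have h5 : M ≤ M * (T / r') ^ (l+1) := le_mul_of_one_le_right hM (one_le_pow₀ hTr)
    have h6 : (M + N) / r' ^ (l+1) * T ^ (l+1) = M * (T / r') ^ (l+1) + N * (T / r') ^ (l+1) := by
      rw [div_pow]; ring
    have h7 : 0 ≤ c * T ^ (l+1) := by positivity
    have := norm_sub_le (Φ Y) (p.partialSum (l+1) Y)
    linarith

/-- scaled point -/
def Yp (ε : ℝ) (p : ℝ × ℝ) : ℝ × ℂ := ε • ((|p.1| : ℝ), cexp (I * p.2))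

lemma Yp_cont (ε : ℝ) : Continuous (Yp ε) := by unfold Yp; fun_prop

lemma AE.scaledV {κ : ℝ × ℝ → ℂ} {C₀ : ℝ} (hκm : Measurable κ) (hκ : ∀ p, ‖κ p‖ ≤ C₀)
    {Φ : ℝ × ℂ → ℂ} (hΦm : Measurable Φ) {M : ℝ} (hM : ∀ s v, ‖Φ (s, v)‖ ≤ M) (hΦ : AnalyticAt ℝ Φ 0) :
    (∀ n : ℕ, GK (C₀ * M) (fun p => κ p * Φ (Yp (n:ℝ)⁻¹ p))) ∧
    AE (fun n : ℕ => Vec (fun p => κ p * Φ (Yp (n:ℝ)⁻¹ p))) ∧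
    Tendsto (fun n : ℕ => Vec (fun p => κ p * Φ (Yp (n:ℝ)⁻¹ p))) atTop (𝓝 (Vec (fun p => κ p * Φ 0))) := by
  obtain ⟨P, hP⟩ := hΦ
  have hM0 : 0 ≤ M := (norm_nonneg _).trans (hM 0 0)
  have hC0 : 0 ≤ C₀ := (norm_nonneg _).trans (hκ 0)
  have hG : ∀ n : ℕ, GK (C₀ * M) (fun p => κ p * Φ (Yp (n:ℝ)⁻¹ p)) := by
    refine fun n => ⟨hκm.mul (hΦm.comp (Yp_cont _).measurable), fun w ψ => ?_⟩
    rw [norm_mul]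
    have h1 : (1:ℝ) ≤ Real.exp (|w| / 4) := Real.one_le_exp (by positivity)
    calc _ ≤ C₀ * M := mul_le_mul (hκ _) (hM _ _) (norm_nonneg _) hC0
      _ ≤ _ := le_mul_of_one_le_right (by positivity) h1
  set A : ℕ → ℝ × ℝ → ℂ := fun i p => κ p * P i (fun _ => Yp 1 p) with hA
  have hY1 : ∀ (ε : ℝ) (p : ℝ × ℝ), Yp ε p = ε • Yp 1 p := by intro ε p; simp [Yp]
  have hYn : ∀ p : ℝ × ℝ, ‖Yp 1 p‖ ≤ 1 + |p.1| := by
    intro p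
    rw [Yp, one_smul, Prod.norm_mk, Real.norm_eq_abs, abs_abs, mul_comm I, Complex.norm_exp_ofReal_mul_I]
    exact max_le (by linarith) (by linarith [abs_nonneg p.1])
  have hpw : ∀ k, ∃ D, 0 ≤ D ∧ ∀ w : ℝ, (1 + |w|) ^ k ≤ D * Real.exp (|w| / 4) := by
    intro k
    obtain ⟨D, hD0, hD⟩ := pow_le_exp_quarter k
    refine ⟨D * Real.exp (1/4), by positivity, fun w => (hD _ (by positivity)).trans (le_of_eq ?_)⟩
    rw [mul_assoc, ← Real.exp_add]; ring_nf
  have hAG : ∀ i, ∃ D, GK D (A i) := by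
    intro i
    obtain ⟨D, hD0, hD⟩ := hpw i
    refine ⟨C₀ * ‖P i‖ * D, hκm.mul (((P i).cont.comp (continuous_pi fun _ => Yp_cont 1)).measurable), fun w ψ => ?_⟩
    rw [hA, norm_mul, mul_assoc, mul_assoc]
    refine mul_le_mul (hκ _) (((P i).le_opNorm _).trans ?_) (norm_nonneg _) hC0
    simp only [Finset.prod_const, Finset.card_univ, Fintype.card_fin]
    gcongr
    exact (pow_le_pow_left₀ (norm_nonneg _) (hYn _) _).trans (hD w)
  choose D hD using hAG
  have key : ∀ l, (fun n : ℕ => Vec (fun p => κ p * Φ (Yp (n:ℝ)⁻¹ p)) - ∑ i ∈ Finset.range (l+1), ((n:ℝ)⁻¹)^i • Vec (A i))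
      =O[atTop] (fun n : ℕ => ((n:ℝ)⁻¹)^(l+1)) := by
    intro l
    obtain ⟨c, hc0, hc⟩ := taylor2 hP M hM0 l
    obtain ⟨B, hB0, hB⟩ := hpw (l+1)
    refine Asymptotics.IsBigO.of_bound (C₀ * (c * B) * Real.pi * ‖eL (1/4)‖) (Eventually.of_forall fun n => ?_)
    have hs := Vec_sum hD (fun i => ((n:ℝ)⁻¹)^i) (l+1)
    rw [← hs.2, ← Vec_sub (hG n) hs.1]
    have hg : GK (C₀ * (c * B) * ((n:ℝ)⁻¹)^(l+1)) (fun p => κ p * Φ (Yp (n:ℝ)⁻¹ p) - ∑ i ∈ Finset.range (l+1), ((((n:ℝ)⁻¹)^i : ℝ) : ℂ) * A i p) := by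
      refine ⟨(hG n).1.sub hs.1.1, fun w ψ => ?_⟩
      have e1 : ∑ i ∈ Finset.range (l+1), ((((n:ℝ)⁻¹)^i : ℝ) : ℂ) * A i (w, ψ) = κ (w, ψ) * P.partialSum (l+1) (Yp (n:ℝ)⁻¹ (w, ψ)) := by
        rw [FormalMultilinearSeries.partialSum, Finset.mul_sum]
        refine Finset.sum_congr rfl fun i _ => ?_
        rw [hY1, (P i).map_smul_univ (fun _ => (n:ℝ)⁻¹) (fun _ => Yp 1 (w, ψ))]
        simp [hA]; ring
      beta_reduce; rw [e1, ← mul_sub, norm_mul]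
      have h1 := hc (Yp (n:ℝ)⁻¹ (w, ψ)) ((n:ℝ)⁻¹ * (1 + |w|)) (by
        rw [hY1, norm_smul, Real.norm_eq_abs, abs_of_nonneg (by positivity)]; gcongr; exact hYn _) (hM _ _)
      calc _ ≤ C₀ * (c * ((n:ℝ)⁻¹ * (1 + |w|)) ^ (l+1)) := mul_le_mul (hκ _) h1 (norm_nonneg _) hC0
        _ = C₀ * c * ((n:ℝ)⁻¹) ^ (l+1) * (1 + |w|) ^ (l+1) := by rw [mul_pow]; ring
        _ ≤ C₀ * c * ((n:ℝ)⁻¹) ^ (l+1) * (B * Real.exp (|w| / 4)) := by gcongr; exact hB w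
        _ = _ := by ring
    refine (Vec_norm hg).trans (le_of_eq ?_)
    rw [norm_pow, Real.norm_eq_abs, abs_of_nonneg (by positivity : (0:ℝ) ≤ (n:ℝ)⁻¹)]; ring
  refine ⟨hG, fun l => ⟨fun x => ∑ i ∈ Finset.range (l+1), x ^ i • Vec (A i), ?_, key l⟩, ?_⟩
  · exact Finset.analyticAt_fun_sum _ fun i _ => (analyticAt_id.pow i).smul analyticAt_const
  · have h1 := (key 0).trans_tendsto (by simpa using inv_tendsto)
    have e : A 0 = fun p => κ p * Φ 0 := by
      ext p; simp only [hA]; rw [hP.coeff_zero]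
    simp only [zero_add, Finset.sum_range_one, pow_zero, one_smul, e] at h1
    have := h1.add_const (Vec fun p => κ p * Φ 0)
    simpa using this
end

section
open Topology

/-- `(e^v - 1)/v` -/
def EE (v : ℂ) : ℂ := dslope cexp 0 v

lemma EE_spec (v : ℂ) : v * EE v = cexp v - 1 := by
  have := sub_smul_dslope cexp 0 v
  simpa [EE] using this

lemma EE_diff : Differentiable ℂ EE := by
  have h : DifferentiableOn ℂ (dslope cexp 0) univ := (Complex.differentiableOn_dslope univ_mem).mpr Complex.differentiable_exp.differentiableOn
  exact fun v => (h v (mem_univ _)).differentiableAt univ_mem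

lemma EE_near {v : ℂ} (hv : ‖v‖ ≤ 1) : ‖EE v - 1‖ ≤ ‖v‖ := by
  by_cases h0 : v = 0
  · rw [h0, EE, dslope_same]; simp
  · have h1 := Complex.norm_exp_sub_one_sub_id_le hv
    rw [← EE_spec, show v * EE v - v = v * (EE v - 1) by ring, norm_mul, sq] at h1
    exact le_of_mul_le_mul_left h1 (norm_pos_iff.mpr h0)

lemma EE_re {v : ℂ} (hv : ‖v‖ < 1) : 0 < (EE v).re := by
  have h1 := (Complex.abs_re_le_norm (EE v - 1)).trans (EE_near hv.le)
  rw [Complex.sub_re, Complex.one_re] at h1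
  have := (abs_le.mp h1).1
  linarith

lemma EE_ne {v : ℂ} (hv : ‖v‖ < 1) : EE v ≠ 0 := fun h => by
  have := EE_re hv; rw [h] at this; simp at this

lemma one_add_exp_re {v : ℂ} (hv : ‖v‖ < 1) : 0 < (1 + cexp v).re := by
  rw [Complex.add_re, Complex.one_re, Complex.exp_re]
  have h1 := (Complex.abs_im_le_norm v).trans_lt hv
  have h2 : 0 < Real.cos v.im := Real.cos_pos_of_mem_Ioo ⟨by linarith [(abs_lt.mp h1).1, Real.pi_gt_three], by linarith [(abs_lt.mp h1).2, Real.pi_gt_three]⟩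
  positivity

/-- regular factor -/
def Ph (a b : ℝ) (S : ℂ → ℂ) (v : ℂ) : ℂ := EE v ^ (-(a:ℂ)) * (1 + cexp v) ^ (-(b:ℂ)) * cexp (-S (cexp v))

variable {S : ℂ → ℂ} {R a b : ℝ}

lemma Ph_diff (hS : SData S R) {v : ℂ} (hv : ‖v‖ < 1) (hR : Real.exp ‖v‖ < R) : DifferentiableAt ℂ (Ph a b S) v := by
  have h1 : DifferentiableAt ℂ S (cexp v) := hS.diff.differentiableAt (Metric.isOpen_ball.mem_nhds (by
    rw [Metric.mem_ball, dist_zero_right, Complex.norm_exp]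
    exact lt_of_le_of_lt (Real.exp_le_exp.mpr (Complex.re_le_norm v)) hR))
  refine DifferentiableAt.mul (DifferentiableAt.mul ?_ ?_) ?_
  · exact (EE_diff v).cpow (differentiableAt_const _) (Or.inl (EE_re hv))
  · exact ((differentiableAt_const _).add Complex.differentiable_exp.differentiableAt).cpow (differentiableAt_const _) (Or.inl (one_add_exp_re hv))
  · exact (h1.comp v Complex.differentiable_exp.differentiableAt).neg.cexp

lemma Ph_zero (hS : SData S R) : Ph a b S 0 = ((2 ^ (-b) * Real.exp (-(S 1).re) : ℝ) : ℂ) := by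
  have h0 : EE 0 = 1 := by rw [EE, dslope_same]; simp
  have h1 : ((S 1).re : ℂ) = S 1 := by
    have := hS.im_real (x := 1) (by rw [abs_one]; exact hS.one_lt)
    apply Complex.ext <;> simp [this]
    simpa using this.symm
  rw [Ph, h0, Complex.one_cpow, Complex.exp_zero, one_mul]
  push_cast
  rw [h1, Complex.ofReal_cpow (by norm_num)]
  norm_num

lemma log_mul' {x y : ℂ} (hx : x.im < 0) (hy : 0 < y.re) (hxy : (x * y).im < 0) : Complex.log (x * y) = Complex.log x + Complex.log y := by
  have hx0 : x ≠ 0 := fun h => by simp [h] at hx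
  have hy0 : y ≠ 0 := fun h => by simp [h] at hy
  refine Complex.log_mul hx0 hy0 ?_
  have h1 := Complex.arg_mul_coe_angle hx0 hy0
  rw [← Real.Angle.coe_add, Real.Angle.angle_eq_iff_two_pi_dvd_sub] at h1
  obtain ⟨k, hk⟩ := h1
  have a1 := Complex.arg_neg_iff.mpr hxy
  have a2 := Complex.neg_pi_lt_arg (x * y)
  have a3 := Complex.arg_neg_iff.mpr hx
  have a4 := Complex.neg_pi_lt_arg x
  have a5 := abs_lt.mp (Complex.abs_arg_lt_pi_div_two_iff.mpr (Or.inl hy))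
  have hp := Real.pi_pos
  have k1 : (k:ℝ) < 1 := by nlinarith
  have k2 : (-1:ℝ) < k := by nlinarith
  have k3 : k = 0 := by
    have : k < 1 := by exact_mod_cast k1
    have : -1 < k := by exact_mod_cast k2
    omega
  rw [k3] at hk
  simp only [Int.cast_zero, mul_zero, sub_eq_zero] at hk
  rw [← hk]
  exact ⟨a2, by linarith⟩

lemma Fd_id {n : ℕ} (hn : 2 ≤ n) {u : ℂ} (hu : 0 < u.im) (hu1 : ‖u‖ = 1) :
    (((n:ℝ) ^ (-a) : ℝ) : ℂ) / Fd a b S (cexp (u / n)) = (-u) ^ (-(a:ℂ)) * Ph a b S (u / n) := by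
  have hn0 : (0:ℝ) < n := by exact_mod_cast (by omega : 0 < n)
  have hn2 : (2:ℝ) ≤ n := by exact_mod_cast hn
  have hnc : (n:ℂ) ≠ 0 := by exact_mod_cast hn0.ne'
  set v := u / (n:ℂ) with hv
  have hv' : v = ((n:ℝ)⁻¹ : ℝ) * u := by rw [hv]; push_cast; ring
  have hvn : ‖v‖ < 1 := by
    rw [hv, norm_div, hu1, Complex.norm_natCast, div_lt_one hn0]; linarith
  have e1 : 1 - cexp v = ((n:ℝ)⁻¹ : ℝ) * (-u * EE v) := by
    have := EE_spec v
    rw [← neg_sub, ← this]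
    nth_rewrite 1 [hv']; ring
  have him : (1 - cexp v).im < 0 := by
    rw [Complex.sub_im, Complex.one_im, Complex.exp_im]
    have h1 : v.im = (n:ℝ)⁻¹ * u.im := by rw [hv', Complex.im_ofReal_mul]
    have h2 : 0 < v.im := by rw [h1]; positivity
    have h3 := (Complex.abs_im_le_norm v).trans_lt hvn
    have h4 := Real.sin_pos_of_pos_of_lt_pi h2 (by linarith [(abs_lt.mp h3).2, Real.pi_gt_three])
    have := mul_pos (Real.exp_pos v.re) h4
    linarith
  have hu0 : -u ≠ 0 := fun h => by rw [neg_eq_zero.mp h] at hu; simp at hu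
  have hE := EE_ne hvn
  have him2 : (-u * EE v).im < 0 := by
    rw [e1, Complex.im_ofReal_mul] at him
    by_contra h
    push Not at h
    have : 0 ≤ (n:ℝ)⁻¹ * (-u * EE v).im := by positivity
    linarith
  have e2 : (1 - cexp v) ^ (a:ℂ) = (((n:ℝ) ^ (-a) : ℝ) : ℂ) * ((-u) ^ (a:ℂ) * EE v ^ (a:ℂ)) := by
    rw [e1, Complex.cpow_def_of_ne_zero (mul_ne_zero (by push_cast; exact inv_ne_zero hnc) (mul_ne_zero hu0 hE)),
      Complex.log_ofReal_mul (by positivity) (mul_ne_zero hu0 hE), log_mul' (by simpa using hu) (EE_re hvn) him2,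
      Complex.cpow_def_of_ne_zero hu0, Complex.cpow_def_of_ne_zero hE, Real.rpow_def_of_pos hn0, Real.log_inv]
    push_cast
    rw [← Complex.exp_add, ← Complex.exp_add]; ring_nf
  rw [Fd, e2, Ph, Complex.cpow_neg, Complex.cpow_neg, Complex.cpow_neg, Complex.exp_neg]
  have h5 : (((n:ℝ) ^ (-a) : ℝ) : ℂ) ≠ 0 := by exact_mod_cast (Real.rpow_pos_of_pos hn0 _).ne'
  rw [mul_assoc, mul_assoc, div_mul_eq_div_div, div_self h5]
  simp only [one_div, mul_inv]; ring

/-! cut-off kernels -/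
def Qs (δ : ℝ) : Set (ℝ × ℂ) := Icc (-(1/2)) (1/2) ×ˢ Metric.closedBall (0:ℂ) δ

lemma cut_spec {g : ℝ × ℂ → ℂ} {δ : ℝ} (hδ : 0 < δ) (hg : ∀ p ∈ Qs δ, AnalyticAt ℝ g p) :
    Measurable ((Qs δ).indicator g) ∧ (∃ M, ∀ s v, ‖(Qs δ).indicator g (s, v)‖ ≤ M) ∧
      AnalyticAt ℝ ((Qs δ).indicator g) 0 ∧ (Qs δ).indicator g 0 = g 0 := by
  have hc : IsCompact (Qs δ) := isCompact_Icc.prod (isCompact_closedBall 0 δ)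
  have hco : ContinuousOn g (Qs δ) := fun p hp => (hg p hp).continuousAt.continuousWithinAt
  have hn : Qs δ ∈ 𝓝 (0 : ℝ × ℂ) := prod_mem_nhds (Icc_mem_nhds (by norm_num) (by norm_num)) (Metric.closedBall_mem_nhds _ hδ)
  refine ⟨?_, ?_, ?_, ?_⟩
  · classical
    rw [← Set.piecewise_eq_indicator]
    exact ContinuousOn.measurable_piecewise hco continuousOn_const hc.isClosed.measurableSet
  · obtain ⟨M, hM⟩ := hc.exists_bound_of_continuousOn hco
    refine ⟨max M 0, fun s v => ?_⟩
    by_cases h : (s, v) ∈ Qs δ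
    · rw [indicator_of_mem h]; exact (hM _ h).trans (le_max_left _ _)
    · rw [indicator_of_notMem h]; simp
  · refine (hg 0 (mem_of_mem_nhds hn)).congr ?_
    filter_upwards [hn] with p hp
    rw [indicator_of_mem hp]
  · rw [indicator_of_mem (mem_of_mem_nhds hn)]

def gk (a b : ℝ) (S : ℂ → ℂ) (i : ℕ) (p : ℝ × ℂ) : ℂ :=
  (if i = 0 then 1 else if i = 1 then (EE (-((p.1:ℂ) + p.2)))⁻¹ else (1 + cexp (-((p.1:ℂ) + p.2)))⁻¹) * Ph a b S p.2

lemma gk_an (hS : SData S R) {δ : ℝ} (hδ : δ ≤ 1/4) (hR : Real.exp δ < R) (i : ℕ) : ∀ p ∈ Qs δ, AnalyticAt ℝ (gk a b S i) p := by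
  rintro ⟨s, v⟩ ⟨hs, hv⟩
  rw [mem_closedBall_zero_iff] at hv
  simp only at hs hv
  have hv1 : ‖v‖ < 1 := by linarith
  have a2 : AnalyticAt ℝ (fun p : ℝ × ℂ => p.2) (s, v) := analyticAt_snd
  have a1 : AnalyticAt ℝ (fun p : ℝ × ℂ => -((p.1:ℂ) + p.2)) (s, v) :=
    ((Complex.ofRealCLM.analyticAt s).fun_comp (g := Complex.ofRealCLM) (f := fun p : ℝ × ℂ => p.1) (x := (s, v)) analyticAt_fst |>.add a2).neg
  have hx : ‖-((s:ℂ) + v)‖ < 1 := by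
    rw [norm_neg]
    refine (norm_add_le _ _).trans_lt ?_
    rw [Complex.norm_real, Real.norm_eq_abs]
    have := abs_le.mpr hs
    linarith
  have an : ∀ {f : ℂ → ℂ} {z : ℂ}, (∀ᶠ y in 𝓝 z, DifferentiableAt ℂ f y) → AnalyticAt ℝ f z := by
    intro f z h
    exact (Complex.analyticAt_iff_eventually_differentiableAt.mpr h).restrictScalars
  have hP : AnalyticAt ℝ (fun p : ℝ × ℂ => Ph a b S p.2) (s, v) := by
    refine AnalyticAt.fun_comp (g := Ph a b S) (f := fun p : ℝ × ℂ => p.2) (x := (s, v)) (an ?_) a2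
    have h1 : ∀ᶠ y : ℂ in 𝓝 v, ‖y‖ < 1 := continuous_norm.continuousAt.eventually_lt_const hv1
    have h2 : ∀ᶠ y : ℂ in 𝓝 v, Real.exp ‖y‖ < R := (Real.continuous_exp.comp continuous_norm).continuousAt.eventually_lt_const
      (lt_of_le_of_lt (Real.exp_le_exp.mpr hv) hR)
    filter_upwards [h1, h2] with y h1 h2 using Ph_diff hS h1 h2
  unfold gk
  split_ifs
  · exact analyticAt_const.mul hP
  · refine (AnalyticAt.fun_inv (AnalyticAt.fun_comp (g := EE) (f := fun p : ℝ × ℂ => -((p.1:ℂ) + p.2)) (x := (s, v)) (an (Eventually.of_forall fun y => EE_diff y)) a1) (EE_ne hx)).mul hP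
  · refine (AnalyticAt.fun_inv (analyticAt_const.add (AnalyticAt.fun_comp (g := cexp) (f := fun p : ℝ × ℂ => -((p.1:ℂ) + p.2)) (x := (s, v)) (an (Eventually.of_forall fun y => Complex.differentiable_exp y)) a1)) ?_).mul hP
    intro h
    have := one_add_exp_re hx
    rw [Pi.add_apply] at h
    rw [h] at this; simp at this

/-- angular weight -/
def ka (a : ℝ) (j : ℕ) (ψ : ℝ) : ℂ := (cexp (I * ψ) ^ (2 * j))⁻¹ * cexp (-cexp (I * ψ)) * (-cexp (I * ψ)) ^ (-(a:ℂ))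

def kk (a : ℝ) (j i : ℕ) (p : ℝ × ℝ) : ℂ := ka a j p.2 * ((cexp (I * p.2) ^ 2 - 1) *
  (if i = 0 then (if p.1 ∈ Ioc (0:ℝ) (1/2) then ((2 * Real.exp p.1 : ℝ) : ℂ) else 0)
   else if i = 1 then (if 0 < p.1 then ((p.1:ℂ) + cexp (I * p.2))⁻¹ else 0) else (if 0 < p.1 then 0 else 1)))

lemma ka_norm (a : ℝ) (j : ℕ) (ψ : ℝ) : ‖ka a j ψ‖ ≤ Real.exp 1 := by
  have hu : ‖cexp (I * ψ)‖ = 1 := by rw [mul_comm, Complex.norm_exp_ofReal_mul_I]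
  have h0 : -cexp (I * ψ) ≠ 0 := neg_ne_zero.mpr (Complex.exp_ne_zero _)
  rw [ka, norm_mul, norm_mul, norm_inv, norm_pow, hu, ← Complex.ofReal_neg, Complex.norm_cpow_real, norm_neg, hu, Complex.norm_exp]
  simp only [one_pow, inv_one, one_mul, Real.one_rpow, mul_one]
  rw [Real.exp_le_exp, Complex.neg_re]
  have := (abs_le.mp (Complex.abs_re_le_norm (cexp (I * ψ)))).1
  rw [hu] at this; linarith

lemma ka_meas (a : ℝ) (j : ℕ) : Measurable (ka a j) := by
  unfold ka
  have h : Measurable (fun ψ : ℝ => cexp (I * ψ)) := by fun_prop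
  exact (((h.pow_const _).inv).mul (Complex.measurable_exp.comp h.neg)).mul (h.neg.pow_const _)

lemma kk_meas (a : ℝ) (j i : ℕ) : Measurable (kk a j i) := by
  unfold kk
  refine ((ka_meas a j).comp measurable_snd).mul ((by fun_prop : Measurable fun p : ℝ × ℝ => (cexp (I * p.2) ^ 2 - 1)).mul ?_)
  have m1 : MeasurableSet {p : ℝ × ℝ | 0 < p.1} := measurableSet_lt measurable_const measurable_fst
  split_ifs
  · refine Measurable.ite (measurable_fst measurableSet_Ioc) (by fun_prop) measurable_const
  · exact Measurable.ite m1 (by fun_prop) measurable_const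
  · exact Measurable.ite m1 measurable_const measurable_const

lemma kk_norm (a : ℝ) (j i : ℕ) (p : ℝ × ℝ) : ‖kk a j i p‖ ≤ Real.exp 1 * (4 * Real.exp 1) := by
  have hu : ‖cexp (I * p.2)‖ = 1 := by rw [mul_comm, Complex.norm_exp_ofReal_mul_I]
  rw [kk, norm_mul]
  refine mul_le_mul (ka_norm _ _ _) ?_ (norm_nonneg _) (Real.exp_pos _).le
  set u := cexp (I * p.2) with hudef
  have h2 : ‖u ^ 2 - 1‖ ≤ 2 := by
    refine (norm_sub_le _ _).trans ?_
    rw [norm_pow, hu]; norm_num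
  have he : (1:ℝ) ≤ Real.exp 1 := Real.one_le_exp (by norm_num)
  rw [norm_mul]
  split_ifs with h0 h1 h3 h4 h5
  · rw [Complex.norm_real, Real.norm_eq_abs, abs_of_pos (by positivity)]
    have : Real.exp p.1 ≤ Real.exp 1 := Real.exp_le_exp.mpr (by linarith [h1.2])
    nlinarith [norm_nonneg (u ^ 2 - 1), Real.exp_pos p.1]
  · simp; positivity
  · -- `|u^2-1| = 2|sin| ≤ 2 |p+u|`
    have e1 : ‖u ^ 2 - 1‖ ≤ 2 * |u.im| := by
      have : u ^ 2 - 1 = u * (2 * I * u.im) := by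
        have h5 : u * (starRingEnd ℂ) u = 1 := by rw [Complex.mul_conj, Complex.normSq_eq_norm_sq, hu]; norm_num
        have h6 : (2 * I * u.im : ℂ) = u - (starRingEnd ℂ) u := by
          rw [Complex.sub_conj]; push_cast; ring
        rw [h6, mul_sub, h5]; ring
      rw [this, norm_mul, hu]; simp
    have e2 : |u.im| ≤ ‖(p.1:ℂ) + u‖ := by
      have := Complex.abs_im_le_norm ((p.1:ℂ) + u)
      simpa using this
    rw [norm_inv]
    have : ‖u ^ 2 - 1‖ * ‖(p.1:ℂ) + u‖⁻¹ ≤ 2 := by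
      by_cases hz : ‖(p.1:ℂ) + u‖ = 0
      · rw [hz]; simp
      · rw [← div_eq_mul_inv, div_le_iff₀ (lt_of_le_of_ne (norm_nonneg _) (Ne.symm hz))]; linarith
    linarith
  · simp; positivity
  · simp; positivity
  · rw [norm_one, mul_one]; linarith
end

section
open Topology

variable {S : ℂ → ℂ} {R a b : ℝ}

lemma sym_int {g W : ℂ → ℂ} (hg : ∀ u, g (-(starRingEnd ℂ u)) = starRingEnd ℂ (g u))
    (hW : ∀ ψ ∈ Ioo 0 Real.pi, W (-cexp (I * (ψ:ℝ))) = starRingEnd ℂ (W (-starRingEnd ℂ (cexp (I * (ψ:ℝ))))))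
    (hi : IntegrableOn (fun ψ : ℝ => g (cexp (I * ψ)) * W (cexp (I * ψ))) (Ioo 0 Real.pi)) :
    ∫ ψ in Ioo 0 Real.pi, (g (cexp (I * ψ)) * (W (cexp (I * ψ)) + W (-cexp (I * ψ)))).re
      = 2 * ∫ ψ in Ioo 0 Real.pi, (g (cexp (I * ψ)) * W (cexp (I * ψ))).re := by
  set X : ℝ → ℝ := fun ψ => (g (cexp (I * ψ)) * W (cexp (I * ψ))).re with hX
  have hXi : IntegrableOn X (Ioo 0 Real.pi) := hi.re
  have hp := Real.pi_pos.le
  have h1 : ∀ ψ ∈ Ioo 0 Real.pi, (g (cexp (I * ψ)) * (W (cexp (I * ψ)) + W (-cexp (I * ψ)))).re = X ψ + X (Real.pi - ψ) := by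
    intro ψ hψ
    have e1 : cexp (I * ((Real.pi - ψ : ℝ) : ℂ)) = -starRingEnd ℂ (cexp (I * ψ)) := by
      rw [← Complex.exp_conj, map_mul, Complex.conj_I, Complex.conj_ofReal]
      push_cast
      rw [mul_sub, sub_eq_add_neg, Complex.exp_add, mul_comm I, Complex.exp_pi_mul_I]; ring_nf
    rw [mul_add, Complex.add_re, hX]
    simp only
    congr 1
    rw [e1, hg, hW ψ hψ, ← Complex.conj_re, map_mul, Complex.conj_conj]
  have hIi : IntervalIntegrable X volume 0 Real.pi := (intervalIntegrable_iff_integrableOn_Ioo_of_le hp).mpr hXi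
  have hI2 : IntegrableOn (fun ψ => X (Real.pi - ψ)) (Ioo 0 Real.pi) := by
    have := (hIi.comp_sub_left Real.pi).symm
    rw [sub_self, sub_zero] at this
    exact (intervalIntegrable_iff_integrableOn_Ioo_of_le hp).mp this
  have h3 : ∫ ψ in Ioo 0 Real.pi, X (Real.pi - ψ) = ∫ ψ in Ioo 0 Real.pi, X ψ := by
    have := intervalIntegral.integral_comp_sub_left (a := 0) (b := Real.pi) X Real.pi
    rwa [sub_self, sub_zero, intervalIntegral.integral_of_le hp, integral_Ioc_eq_integral_Ioo, intervalIntegral.integral_of_le hp, integral_Ioc_eq_integral_Ioo] at this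
  rw [setIntegral_congr_fun measurableSet_Ioo h1, integral_add hXi hI2, h3]; ring

def KN (a b : ℝ) (S : ℂ → ℂ) (δ : ℝ) (j i n : ℕ) (p : ℝ × ℝ) : ℂ := kk a j i p * (Qs δ).indicator (gk a b S i) (Yp (n:ℝ)⁻¹ p)

lemma KN_spec (hS : SData S R) {δ : ℝ} (hδ0 : 0 < δ) (hδ : δ ≤ 1/4) (hR : Real.exp δ < R) (j i : ℕ) :
    (∃ C, ∀ n, GK C (KN a b S δ j i n)) ∧ AE (fun n => Vec (KN a b S δ j i n)) ∧
    (i < 2 → Tendsto (fun n => Vec (KN a b S δ j i n)) atTop (𝓝 ((2 ^ (-b) * Real.exp (-(S 1).re)) • Vec (kk a j i)))) := by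
  obtain ⟨h1, ⟨M, h2⟩, h3, h4⟩ := cut_spec hδ0 (gk_an (a := a) (b := b) hS hδ hR i)
  obtain ⟨g1, g2, g3⟩ := AE.scaledV (kk_meas a j i) (kk_norm a j i) h1 h2 h3
  refine ⟨⟨_, g1⟩, g2, fun hi => ?_⟩
  have e : gk a b S i 0 = ((2 ^ (-b) * Real.exp (-(S 1).re) : ℝ) : ℂ) := by
    rw [← Ph_zero hS (a := a), gk]
    have h0 : EE 0 = 1 := by rw [EE, dslope_same]; simp
    rcases i with _ | i
    · simp
    · have : i = 0 := by omega
      simp [this, h0]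
  have hG : GK (Real.exp 1 * (4 * Real.exp 1)) (kk a j i) := ⟨kk_meas a j i, fun w ψ => (kk_norm a j i _).trans
    (le_mul_of_one_le_right (by positivity) (Real.one_le_exp (by positivity)))⟩
  rw [h4, e] at g3
  rw [← Vec_rmul hG]
  simp only [mul_comm _ (kk a j i _)]
  exact g3

lemma Qs_mem {n : ℕ} {δ w ψ : ℝ} (hnδ : (n:ℝ)⁻¹ ≤ δ) (hw : (n:ℝ)⁻¹ * |w| ≤ 1/2) :
    Yp (n:ℝ)⁻¹ (w, ψ) = ((n:ℝ)⁻¹ * |w|, cexp (I * ψ) / n) ∧ Yp (n:ℝ)⁻¹ (w, ψ) ∈ Qs δ := by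
  have e : Yp (n:ℝ)⁻¹ (w, ψ) = ((n:ℝ)⁻¹ * |w|, cexp (I * ψ) / n) := by
    rw [Yp, Prod.smul_mk, smul_eq_mul, Complex.real_smul]; push_cast; rw [div_eq_inv_mul]
  refine ⟨e, ?_⟩
  rw [e]
  have h0 : 0 ≤ (n:ℝ)⁻¹ * |w| := by positivity
  refine ⟨⟨by simp only; linarith, hw⟩, ?_⟩
  rw [mem_closedBall_zero_iff]
  simp only [norm_div, Complex.norm_natCast]
  rw [mul_comm I, Complex.norm_exp_ofReal_mul_I, one_div]; exact hnδ

lemma KN0_int {n : ℕ} (hn : 2 ≤ n) {δ : ℝ} (hnδ : (n:ℝ)⁻¹ ≤ δ) (j : ℕ) (ψ : ℝ) :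
    ∫ w, KN a b S δ j 0 n (w, ψ) * ((Real.exp (-(1/2 * |w|)) * eL (1/2) w : ℝ) : ℂ)
      = ka a j ψ * ((cexp (I * ψ) ^ 2 - 1) * Ph a b S (cexp (I * ψ) / n)) := by
  have hn0 : (1:ℝ) ≤ n := by exact_mod_cast (by omega : 1 ≤ n)
  set Z := ka a j ψ * ((cexp (I * ψ) ^ 2 - 1) * Ph a b S (cexp (I * ψ) / n)) with hZ
  have e : ∫ w, KN a b S δ j 0 n (w, ψ) * ((Real.exp (-(1/2 * |w|)) * eL (1/2) w : ℝ) : ℂ)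
      = ∫ w, (Ioc (0:ℝ) (1/2)).indicator (fun _ => 2 * Z) w := by
    refine integral_congr_ae ?_
    filter_upwards [eL_ae (c := 1/2) (by norm_num)] with w hw
    rw [hw, KN, kk]
    by_cases h : w ∈ Ioc (0:ℝ) (1/2)
    · have hq := Qs_mem (ψ := ψ) hnδ (w := w) (by
        rw [abs_of_pos h.1]
        calc (n:ℝ)⁻¹ * w ≤ 1 * w := by gcongr; exacts [h.1.le, inv_le_one_of_one_le₀ hn0]
          _ ≤ _ := by linarith [h.2])
      rw [indicator_of_mem h, indicator_of_mem hq.2, hq.1, gk, ← Real.exp_add, abs_of_pos h.1]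
      simp only [if_true, if_pos h]
      have e2 : ((2 * Real.exp w : ℝ) : ℂ) * ((Real.exp (-(1/2 * w) + -(1/2 * w)) : ℝ) : ℂ) = 2 := by
        rw [← Complex.ofReal_mul, mul_assoc, ← Real.exp_add]; ring_nf; simp
      rw [hZ]
      linear_combination (ka a j ψ * (cexp (I * ψ) ^ 2 - 1) * Ph a b S (cexp (I * ψ) / n)) * e2
    · rw [indicator_of_notMem h]; simp only [if_true, if_neg h]; simp
  rw [e, integral_indicator measurableSet_Ioc, setIntegral_const]
  simp [Measure.real]

lemma KN12_int {n : ℕ} (hn : 2 ≤ n) {δ τ : ℝ} (hnδ : (n:ℝ)⁻¹ ≤ δ) (hτ : τ ≤ 1/2) (j : ℕ) {ψ : ℝ} {f : LR}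
    (hf : ∀ᵐ w : ℝ, τ * n < |w| → f w = 0) :
    ∫ w, (KN a b S δ j 1 n (w, ψ) + (((n:ℝ)⁻¹ : ℝ) : ℂ) * KN a b S δ j 2 n (w, ψ)) * ((Real.exp (-(1/2 * |w|)) * f w : ℝ) : ℂ)
      = ka a j ψ * ((cexp (I * ψ) ^ 2 - 1) * Ph a b S (cexp (I * ψ) / n)) * Ef f n (cexp (-(cexp (I * ψ) / n))) := by
  have hn0 : (0:ℝ) < n := by exact_mod_cast (by omega : 0 < n)
  have hnc : (n:ℂ) ≠ 0 := by exact_mod_cast hn0.ne'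
  rw [Ef, ← integral_const_mul]
  refine integral_congr_ae ?_
  filter_upwards [hf] with w hw
  by_cases hwn : τ * n < |w|
  · simp [gf, hw hwn]
  · push Not at hwn
    have hq := Qs_mem (ψ := ψ) hnδ (w := w) (by
      rw [inv_mul_le_iff₀ hn0]; nlinarith)
    rw [KN, KN, indicator_of_mem hq.2, indicator_of_mem hq.2, hq.1, gk, gk, kk, kk, gf, rw']
    simp only [one_ne_zero, if_false, if_true, OfNat.ofNat_ne_zero, OfNat.ofNat_ne_one]
    set u := cexp (I * ψ)
    have hE := EE_spec (-((((n:ℝ)⁻¹ * |w| : ℝ) : ℂ) + u / n))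
    have e1 : cexp (-((((n:ℝ)⁻¹ * |w| : ℝ) : ℂ) + u / n)) = ((Real.exp (-(|w|/n)) : ℝ) : ℂ) * cexp (-(u / n)) := by
      push_cast; rw [← Complex.exp_add]; ring_nf
    rcases lt_or_ge 0 w with h | h
    · rw [sg_pos h, if_pos h, if_pos h]
      have e2 : (1 - ((1 * Real.exp (-(|w|/n)) : ℝ) : ℂ) * cexp (-(u / n))) = (n:ℂ)⁻¹ * ((w:ℂ) + u) * EE (-((((n:ℝ)⁻¹ * |w| : ℝ) : ℂ) + u / n)) := by
        rw [one_mul, ← e1]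
        have : (n:ℂ)⁻¹ * ((w:ℂ) + u) = ((((n:ℝ)⁻¹ * |w| : ℝ) : ℂ) + u / n) := by rw [abs_of_pos h]; push_cast; field_simp
        rw [this]; linear_combination hE
      rw [e2]
      push_cast
      clear hE e1 e2 hq
      generalize u / (n:ℂ) = t
      generalize cexp (-(1 / 2 * ((|w|:ℝ):ℂ))) = q
      rw [div_eq_mul_inv, mul_inv, mul_inv, inv_inv]
      have e3 : (n:ℂ)⁻¹ * n = 1 := inv_mul_cancel₀ hnc
      simp only [mul_zero, zero_mul, add_zero]
      linear_combination (-(ka a j ψ * ((u ^ 2 - 1) * Ph a b S t) * (q * (f w:ℂ)) * (((w:ℂ) + u)⁻¹ * (EE (-(((n:ℂ)⁻¹ * ((|w|:ℝ):ℂ)) + t)))⁻¹))) * e3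
    · have hs : sg w = -1 := by simp [sg, h.not_gt]
      rw [hs, if_neg h.not_gt, if_neg h.not_gt]
      have e2 : (1 - ((-1 * Real.exp (-(|w|/n)) : ℝ) : ℂ) * cexp (-(u / n))) = 1 + cexp (-((((n:ℝ)⁻¹ * |w| : ℝ) : ℂ) + u / n)) := by
        rw [e1]; push_cast; ring
      rw [e2]
      push_cast
      ring

lemma X_formula (f : LR) (η : ℕ → ℝ) {n : ℕ} (hn : 2 ≤ n) (j : ℕ) {ψ : ℝ} (hψ : ψ ∈ Ioo 0 Real.pi) :
    (((n:ℝ) ^ (-a) : ℝ) : ℂ) * ((cexp (I * ψ) ^ 2 - 1) * (cexp (I * ψ) ^ (2 * j))⁻¹ * Wf a b S f n η (cexp (I * ψ)))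
      = ka a j ψ * ((cexp (I * ψ) ^ 2 - 1) * Ph a b S (cexp (I * ψ) / n)) * Bz f n η (cexp (-(cexp (I * ψ) / n))) := by
  have hu1 : ‖cexp (I * ψ)‖ = 1 := by rw [mul_comm, Complex.norm_exp_ofReal_mul_I]
  have hu : 0 < (cexp (I * ψ)).im := by
    rw [mul_comm, Complex.exp_ofReal_mul_I_im]; exact Real.sin_pos_of_mem_Ioo hψ
  have h1 := Fd_id (a := a) (b := b) (S := S) hn hu hu1
  rw [Wf, ka]
  rw [div_eq_mul_inv] at h1 ⊢
  linear_combination ((cexp (I * ψ) ^ 2 - 1) * (cexp (I * ψ) ^ (2 * j))⁻¹ * cexp (-cexp (I * ψ)) * Bz f n η (cexp (-(cexp (I * ψ) / n)))) * h1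

lemma LJ_formula (hS : SData S R) {δ τ : ℝ} (hδ0 : 0 < δ) (hδ : δ ≤ 1/4) (hR : Real.exp δ < R) (hτ : τ ≤ 1/2)
    (hτ0 : 0 < τ) (hτR : Real.exp τ < R) (j : ℕ) :
    ∃ C, ∀ (n : ℕ) (f : LR) (η : ℕ → ℝ) (K : ℝ), 2 ≤ n → (n:ℝ)⁻¹ ≤ δ → 4 / n ≤ τ → (∀ᵐ w : ℝ, τ * n < |w| → f w = 0) →
      (∀ j, |η j| ≤ K * Real.exp (-(τ * j))) →
      |(n:ℝ) ^ (-a) * LJ j (fun u => Wf a b S f n η u + Wf a b S f n η (-u)) -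
        2 / Real.pi * (inner ℝ (Vec (KN a b S δ j 0 n)) (eL (1/2)) - inner ℝ (Vec (KN a b S δ j 1 n) + (n:ℝ)⁻¹ • Vec (KN a b S δ j 2 n)) f)| ≤ C * K := by
  obtain ⟨⟨C0, hG0⟩, -, -⟩ := KN_spec (a := a) (b := b) hS hδ0 hδ hR j 0
  obtain ⟨⟨C1, hG1⟩, -, -⟩ := KN_spec (a := a) (b := b) hS hδ0 hδ hR j 1
  obtain ⟨⟨C2, hG2⟩, -, -⟩ := KN_spec (a := a) (b := b) hS hδ0 hδ hR j 2
  obtain ⟨hm, ⟨M, hM⟩, -, -⟩ := cut_spec hδ0 (gk_an (a := a) (b := b) hS hδ hR 0)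
  have hM0 : 0 ≤ M := (norm_nonneg _).trans (hM 0 0)
  set B := (1 - Real.exp (-τ) * Real.exp (τ/2))⁻¹ with hB
  have hB0 : 0 ≤ B := by
    rw [hB, ← Real.exp_add]
    have : Real.exp (-τ + τ/2) < 1 := Real.exp_lt_one_iff.mpr (by linarith)
    exact inv_nonneg.mpr (by linarith)
  refine ⟨2 / Real.pi * (Real.exp 1 * (2 * M) * B * Real.pi), fun n f η K hn hnδ hnτ hf hη => ?_⟩
  have hn0 : (0:ℝ) < n := by exact_mod_cast (by omega : 0 < n)
  have hK0 : 0 ≤ K := by have := (abs_nonneg _).trans (hη 0); simpa using this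
  have hnτ' : 2 / (n:ℝ) < τ := lt_of_lt_of_le (by gcongr; norm_num) hnτ
  set u : ℝ → ℂ := fun ψ => cexp (I * ψ) with hu
  have hu1 : ∀ ψ, ‖u ψ‖ = 1 := fun ψ => by rw [hu]; simp only; rw [mul_comm, Complex.norm_exp_ofReal_mul_I]
  have huc : Continuous u := by rw [hu]; fun_prop
  set Z : ℝ → ℂ := fun ψ => ka a j ψ * ((u ψ ^ 2 - 1) * Ph a b S (u ψ / n)) with hZ
  -- part 0
  have p0 := Vec_pair (hG0 n) (eL (1/2))
  have i0 : ∀ ψ : ℝ, ∫ w, KN a b S δ j 0 n (w, ψ) * ((Real.exp (-(1/2 * |w|)) * eL (1/2) w : ℝ) : ℂ) = Z ψ := fun ψ => KN0_int hn hnδ j ψ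
  simp only [i0] at p0
  -- part 1
  have hG := (hG1 n).add ((hG2 n).rmul (n:ℝ)⁻¹)
  have p1 := Vec_pair hG f
  have i1 : ∀ ψ : ℝ, ∫ w, (KN a b S δ j 1 n (w, ψ) + (((n:ℝ)⁻¹ : ℝ) : ℂ) * KN a b S δ j 2 n (w, ψ)) * ((Real.exp (-(1/2 * |w|)) * f w : ℝ) : ℂ)
      = Z ψ * Ef f n (cexp (-(u ψ / n))) := fun ψ => KN12_int hn hnδ hτ j hf
  simp only [i1] at p1
  rw [Vec_add (hG1 n) ((hG2 n).rmul _), Vec_rmul (hG2 n)] at p1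
  -- part 2
  have hzn : ∀ ψ, ‖cexp (-(u ψ / n))‖ ≤ Real.exp (τ/2) := by
    intro ψ
    rw [Complex.norm_exp]
    refine Real.exp_le_exp.mpr ((Complex.re_le_norm _).trans ?_)
    rw [norm_neg, norm_div, hu1, Complex.norm_natCast]
    have : 4 / (n:ℝ) = 4 * (1 / n) := by ring
    linarith [div_nonneg zero_le_one hn0.le]
  have hrt : Real.exp (τ/2) < Real.exp τ := Real.exp_lt_exp.mpr (by linarith)
  have hEc : Continuous (fun ψ => Ez η (cexp (-(u ψ / n)))) := by
    refine continuous_iff_continuousAt.mpr fun ψ => ?_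
    exact ContinuousAt.comp (f := fun ψ => cexp (-(u ψ / n))) (Ez_diff hη ((hzn ψ).trans_lt hrt)).continuousAt (by fun_prop)
  have hZb : ∀ ψ, ‖Z ψ‖ ≤ Real.exp 1 * (2 * M) := by
    intro ψ
    have hq := Qs_mem (n := n) (ψ := ψ) hnδ (w := 0) (by simp)
    have h1 := hM ((n:ℝ)⁻¹ * |0|) (u ψ / n)
    rw [← hq.1, indicator_of_mem hq.2, hq.1, gk] at h1
    simp only [if_true, one_mul] at h1
    rw [hZ]; simp only
    rw [norm_mul, norm_mul]
    have h2 : ‖u ψ ^ 2 - 1‖ ≤ 2 := (norm_sub_le _ _).trans (by rw [norm_pow, hu1]; norm_num)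
    exact mul_le_mul (ka_norm _ _ _) (mul_le_mul h2 h1 (norm_nonneg _) (by norm_num)) (by positivity) (Real.exp_pos _).le
  have hZE : ∀ ψ, ‖Z ψ * Ez η (cexp (-(u ψ / n)))‖ ≤ Real.exp 1 * (2 * M) * (K * B) := by
    intro ψ
    rw [norm_mul]
    exact mul_le_mul (hZb ψ) (Ez_norm hη hrt (hzn ψ)) (norm_nonneg _) (by positivity)
  have p2 : IntegrableOn (fun ψ => Z ψ * Ez η (cexp (-(u ψ / n)))) (Ioo 0 Real.pi) :=
    Integrable.mono' (integrable_const _) (p0.1.aestronglyMeasurable.mul hEc.aestronglyMeasurable) (Eventually.of_forall hZE)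
  have hX : ∀ ψ ∈ Ioo 0 Real.pi, (((n:ℝ) ^ (-a) : ℝ) : ℂ) * ((u ψ ^ 2 - 1) * (u ψ ^ (2 * j))⁻¹ * Wf a b S f n η (u ψ))
      = Z ψ - Z ψ * Ef f n (cexp (-(u ψ / n))) + Z ψ * Ez η (cexp (-(u ψ / n))) := by
    intro ψ hψ
    rw [X_formula f η hn j hψ, Bz]; simp only [hZ]; ring
  have hna : (((n:ℝ) ^ (-a) : ℝ) : ℂ) ≠ 0 := by exact_mod_cast (Real.rpow_pos_of_pos hn0 _).ne'
  have hXi : IntegrableOn (fun ψ : ℝ => ((u ψ ^ 2 - 1) * (u ψ ^ (2 * j))⁻¹) * Wf a b S f n η (u ψ)) (Ioo 0 Real.pi) := by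
    have h1 := ((p0.1.sub p1.1).add p2).const_mul (((n:ℝ) ^ (-a) : ℝ) : ℂ)⁻¹
    refine IntegrableOn.congr_fun h1 (fun ψ hψ => ?_) measurableSet_Ioo
    simp only [Pi.add_apply, Pi.sub_apply]
    rw [← hX ψ hψ, ← mul_assoc, inv_mul_cancel₀ hna, one_mul]
  have hs := sym_int (g := fun u => (u ^ 2 - 1) * (u ^ (2 * j))⁻¹) (W := Wf a b S f n η) (by
      intro u; simp only [map_mul, map_inv₀, map_sub, map_pow, map_one]
      rw [pow_mul, neg_sq, pow_mul]) (by
      intro ψ hψ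
      have him : 0 < (cexp (I * ψ)).im := by
        rw [mul_comm, Complex.exp_ofReal_mul_I_im]; exact Real.sin_pos_of_mem_Ioo hψ
      have h1 := Wf_conj (a := a) (b := b) hS (by omega : 1 ≤ n) f (η := η) hτR hnτ' (u := -cexp (I * ψ)) (by simpa using him.ne') (by
        rw [norm_neg]; have := hu1 ψ; simp only [hu] at this; rw [this]; norm_num)
      rw [map_neg] at h1
      rw [h1, Complex.conj_conj]) hXi
  have e1 : (n:ℝ) ^ (-a) * ∫ ψ in Ioo 0 Real.pi, ((u ψ ^ 2 - 1) * (u ψ ^ (2 * j))⁻¹ * Wf a b S f n η (u ψ)).re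
      = inner ℝ (Vec (KN a b S δ j 0 n)) (eL (1/2)) - inner ℝ (Vec (KN a b S δ j 1 n) + (n:ℝ)⁻¹ • Vec (KN a b S δ j 2 n)) f
        + ∫ ψ in Ioo 0 Real.pi, (Z ψ * Ez η (cexp (-(u ψ / n)))).re := by
    have q0 := p0.1.re
    have q1 := p1.1.re
    have q2 := p2.re
    simp only [RCLike.re_eq_complex_re] at q0 q1 q2
    rw [← integral_const_mul, p0.2, p1.2, ← integral_sub q0 q1, ← integral_add (q0.sub' q1) q2]
    refine setIntegral_congr_fun measurableSet_Ioo fun ψ hψ => ?_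
    have := congrArg Complex.re (hX ψ hψ)
    rw [Complex.re_ofReal_mul] at this
    rw [this, Complex.add_re, Complex.sub_re]
  rw [LJ, hs]
  have e2 : (n:ℝ) ^ (-a) * (Real.pi⁻¹ * (2 * ∫ ψ in Ioo 0 Real.pi, ((u ψ ^ 2 - 1) * (u ψ ^ (2 * j))⁻¹ * Wf a b S f n η (u ψ)).re))
      = 2 / Real.pi * ((n:ℝ) ^ (-a) * ∫ ψ in Ioo 0 Real.pi, ((u ψ ^ 2 - 1) * (u ψ ^ (2 * j))⁻¹ * Wf a b S f n η (u ψ)).re) := by ring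
  rw [e2, e1, ← mul_sub, add_sub_cancel_left, abs_mul, abs_of_pos (by positivity : 0 < 2 / Real.pi), mul_assoc]
  gcongr
  have := norm_setIntegral_le_of_norm_le_const (μ := volume) (s := Ioo 0 Real.pi) (f := fun ψ => (Z ψ * Ez η (cexp (-(u ψ / n)))).re)
      (C := Real.exp 1 * (2 * M) * (K * B)) (by simp) (fun ψ _ => by
        rw [Real.norm_eq_abs]; exact (Complex.abs_re_le_norm _).trans (hZE ψ))
  rw [Real.norm_eq_abs] at this
  refine this.trans (le_of_eq ?_)
  simp [Measure.real, Real.pi_pos.le]; ring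
end

section
open Topology

variable {S : ℂ → ℂ} {R a b : ℝ}

/-- universal limits (independent of `S`) -/
def EL (a b : ℝ) (j : ℕ) : ℝ :=
  2 / Real.pi * (inner ℝ (Vec (kk a j 0)) (eL (1/2)) - inner ℝ (Vec (kk a j 1)) (PhiI a b))

def EU (a b : ℝ) (m : ℕ) : ℝ := -(2 ^ m * ∑ i ∈ Finset.range (m+1), EL a b i)

lemma sqrt_av {n : ℕ} (hn : 1 ≤ n) : av n 0 = (Real.sqrt n)⁻¹ • eL (1/2) := by
  refine Lp.ext ?_
  filter_upwards [av_ae n 0, eL_ae (by norm_num : (0:ℝ) < 1/2), Lp.coeFn_smul ((Real.sqrt n)⁻¹) (eL (1/2))] with u h1 h2 h3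
  rw [h1, h3, Pi.smul_apply, h2, af]; simp

theorem base_all (hS : SData S R) (ha : -(1/2) < a) (hb : -(1/2) < b) (ha1 : a ≤ 1) (hb1 : b ≤ 1)
    {P : ℕ → Polynomial ℝ} (hP : ∀ n, (P n).Monic) (hPn : ∀ n, (P n).natDegree = n)
    (ho : ∀ n : ℕ, ∀ Q : Polynomial ℝ, Q.degree < n → ∫ θ in Ioo 0 Real.pi, (P n).eval (Real.cos θ) * Q.eval (Real.cos θ) * ‖Fd a b S (cexp (I * θ))‖ ^ 2 = 0) :
    ∃ κ : ℕ → ℝ, (∀ᶠ n in atTop, ∫ θ in Ioo 0 Real.pi, (P n).eval (Real.cos θ) ^ 2 * ‖Fd a b S (cexp (I * θ))‖ ^ 2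
        = 2 * Real.pi * ((2⁻¹) ^ n * Real.exp (S 0).re) ^ 2 * κ n) ∧
      AE κ ∧ Tendsto κ atTop (𝓝 1) ∧ Tendsto (fun n : ℕ => (n:ℝ) * (κ n - 1)) atTop (𝓝 (-inner ℝ (eL (1/2)) (PhiI a b))) ∧
      ∀ m, AE (fun n : ℕ => 2 ^ n * (n:ℝ) ^ (-a) * (((n:ℝ)⁻¹) ^ (2 * m) * Dc (P n) m)) ∧
        Tendsto (fun n : ℕ => 2 ^ n * (n:ℝ) ^ (-a) * (((n:ℝ)⁻¹) ^ (2 * m) * Dc (P n) m)) atTop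
          (𝓝 (Real.exp (S 0).re * (2 ^ (-b) * Real.exp (-(S 1).re)) * EU a b m)) := by
  obtain ⟨τ, c, φ, C', hτ, hτ2, hτR, hc, hφ, hφl, hφs, hcφ⟩ := base_c hS ha hb ha1 hb1
  set η : ℕ → ℕ → ℝ := fun n j => c n j - ((if j = 0 then 1 else 0) - (Real.sqrt n)⁻¹ * inner ℝ (av n j) (φ n)) with hη
  have hηb : ∀ᶠ n : ℕ in atTop, ∀ j : ℕ, |η n j| ≤ (C' * Real.exp (-(2 * τ * n))) * Real.exp (-(τ * j)) := by
    filter_upwards [hcφ] with n hn j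
    rw [mul_assoc, ← Real.exp_add]
    convert hn j using 3; ring
  have hsm : ∀ {f : ℕ → ℝ} {C : ℝ}, (∀ᶠ n : ℕ in atTop, |f n| ≤ C * (C' * Real.exp (-(2 * τ * n)))) →
      ∀ l : ℕ, f =O[atTop] (fun n : ℕ => ((n:ℝ)⁻¹) ^ (l+1)) := by
    intro f C hf
    refine exp_small (C := |C * C'|) (by positivity : 0 < 2 * τ) ?_
    filter_upwards [hf, eventually_ge_atTop 1] with n hn h1
    have h1' : (1:ℝ) ≤ n := by exact_mod_cast h1
    rw [Real.norm_eq_abs]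
    calc |f n| ≤ C * C' * Real.exp (-(2 * τ * n)) := by rw [mul_assoc]; exact hn
      _ ≤ |C * C'| * (1 * Real.exp (-(2 * τ * n))) := by rw [one_mul]; gcongr; exact le_abs_self _
      _ ≤ _ := by gcongr
  have hto : ∀ {f : ℕ → ℝ}, (∀ l : ℕ, f =O[atTop] (fun n : ℕ => ((n:ℝ)⁻¹) ^ (l+1))) → Tendsto f atTop (𝓝 0) :=
    fun h => (h 0).trans_tendsto (AE.pow_tendsto 0)
  have hη0 := hsm (f := fun n => η n 0) (C := 1) (by
    filter_upwards [hηb] with n hn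
    simpa using hn 0)
  have hnη : Tendsto (fun n : ℕ => (n:ℝ) * η n 0) atTop (𝓝 0) := by
    have h2 := (Asymptotics.isBigO_refl (fun n : ℕ => (n:ℝ)) atTop).mul (hη0 1)
    refine h2.trans_tendsto ?_
    refine (AE.pow_tendsto 0).congr' ?_
    filter_upwards [eventually_ge_atTop 1] with n hn
    have : (n:ℝ) ≠ 0 := by exact_mod_cast (by omega : n ≠ 0)
    simp only [zero_add, pow_one]
    rw [pow_two, mul_inv_cancel_left₀ this]
  have hin : AE (fun n => inner ℝ (eL (1/2)) (φ n)) := hφ.clm (innerSL ℝ (eL (1/2)))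
  have hinl : Tendsto (fun n => inner ℝ (eL (1/2)) (φ n)) atTop (𝓝 (inner ℝ (eL (1/2)) (PhiI a b))) :=
    tendsto_const_nhds.inner hφl
  have hcn : ∀ᶠ n : ℕ in atTop, 1 - (n:ℝ)⁻¹ * inner ℝ (eL (1/2)) (φ n) + η n 0 = c n 0 := by
    filter_upwards [eventually_ge_atTop 1] with n hn
    have hn0 : (0:ℝ) < n := by exact_mod_cast hn
    simp only [hη, if_true, sqrt_av hn, inner_smul_left, ← mul_assoc]
    simp only [RCLike.conj_to_real, ← mul_inv, Real.mul_self_sqrt hn0.le]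
    ring
  have hL := fun j => LJ_formula (a := a) (b := b) hS (δ := min (1/4) τ) (by positivity) (min_le_left _ _)
    ((Real.exp_le_exp.mpr (min_le_right _ _)).trans_lt hτR) hτ2 hτ hτR j
  have hK := fun j i => KN_spec (a := a) (b := b) hS (δ := min (1/4) τ) (by positivity) (min_le_left _ _)
    ((Real.exp_le_exp.mpr (min_le_right _ _)).trans_lt hτR) j i
  set δ := min (1/4) τ with hδ
  have hδ0 : 0 < δ := by positivity
  set E0 := Real.exp (S 0).re with hE0
  set E1 := 2 ^ (-b) * Real.exp (-(S 1).re) with hE1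
  have hev : ∀ᶠ n : ℕ in atTop, 2 ≤ n ∧ (n:ℝ)⁻¹ ≤ δ ∧ 4 / n ≤ τ ∧ 2 / n < τ := by
    have h1 := AE.inv_tendsto.eventually (gt_mem_nhds hδ0)
    have h2 := AE.inv_tendsto.eventually (gt_mem_nhds (by positivity : 0 < τ / 4))
    filter_upwards [h1, h2, eventually_ge_atTop 2] with n g1 g2 g3
    refine ⟨g3, g1.le, ?_, ?_⟩ <;> rw [div_eq_mul_inv] <;> linarith
  have hj : ∀ j, AE (fun n : ℕ => 2 ^ n * (n:ℝ) ^ (-a) * LJ j (fun u => Polynomial.aeval (Complex.cosh (u / n)) (P n))) ∧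
      Tendsto (fun n : ℕ => 2 ^ n * (n:ℝ) ^ (-a) * LJ j (fun u => Polynomial.aeval (Complex.cosh (u / n)) (P n))) atTop (𝓝 (E0 * E1 * EL a b j)) := by
    intro j
    obtain ⟨C, hC⟩ := hL j
    set M : ℕ → ℝ := fun n => 2 / Real.pi * (inner ℝ (Vec (KN a b S δ j 0 n)) (eL (1/2)) - inner ℝ (Vec (KN a b S δ j 1 n) + (n:ℝ)⁻¹ • Vec (KN a b S δ j 2 n)) (φ n)) with hM
    have hv : AE (fun n => Vec (KN a b S δ j 1 n) + (n:ℝ)⁻¹ • Vec (KN a b S δ j 2 n)) := (hK j 1).2.1.add (AE.invn.smul (hK j 2).2.1)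
    have hvl : Tendsto (fun n => Vec (KN a b S δ j 1 n) + (n:ℝ)⁻¹ • Vec (KN a b S δ j 2 n)) atTop (𝓝 (E1 • Vec (kk a j 1))) := by
      obtain ⟨L, hL⟩ := (hK j 2).2.1.exists_tendsto
      have := ((hK j 1).2.2 (by norm_num)).add (AE.inv_tendsto.smul hL)
      simpa only [zero_smul, add_zero] using this
    have hMA : AE M := (AE.const (2 / Real.pi)).mul
      (((hK j 0).2.1.bilin (innerSL ℝ) (AE.const (eL (1/2)))).sub (hv.bilin (innerSL ℝ) hφ))
    have hMl : Tendsto M atTop (𝓝 (E1 * EL a b j)) := by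
      have := ((((hK j 0).2.2 (by norm_num)).inner (tendsto_const_nhds (x := eL (1/2)) )).sub (hvl.inner hφl)).const_mul (2 / Real.pi)
      convert this using 2
      rw [inner_smul_left, inner_smul_left, EL]; simp only [RCLike.conj_to_real]; ring
    set r : ℕ → ℝ := fun n => (n:ℝ) ^ (-a) * LJ j (fun u => Wf a b S (φ n) n (η n) u + Wf a b S (φ n) n (η n) (-u)) - M n with hr
    have hrs := hsm (f := r) (C := C) (by
      filter_upwards [hev, hηb] with n h1 h2
      exact hC n (φ n) (η n) _ h1.1 h1.2.1 h1.2.2.1 (hφs n (by omega)) h2)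
    have heq : ∀ᶠ n : ℕ in atTop, E0 * (M n + r n) = 2 ^ n * (n:ℝ) ^ (-a) * LJ j (fun u => Polynomial.aeval (Complex.cosh (u / n)) (P n)) := by
      filter_upwards [hev, hηb, hc] with n h1 h2 h3
      have e1 : LJ j (fun u => Polynomial.aeval (Complex.cosh (u / n)) (P n))
          = ((2⁻¹:ℝ)^n * E0) * LJ j (fun u => Wf a b S (φ n) n (η n) u + Wf a b S (φ n) n (η n) (-u)) := by
        rw [LJ, LJ, mul_left_comm, ← integral_const_mul (2⁻¹ ^ n * E0)]
        congr 1
        refine setIntegral_congr_fun measurableSet_Ioo fun ψ hψ => ?_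
        beta_reduce
        rw [P_formula hS ha hb ha1 hb1 (by omega) (hP n) (hPn n) (ho n) h3 (φ n) hτ hτR h1.2.2.2 h2 (fun j => by simp only [hη]; ring)
          (u := cexp (I * ψ)) (by rw [mul_comm, Complex.exp_ofReal_mul_I_im]; exact Real.sin_pos_of_mem_Ioo hψ)
          (by rw [mul_comm, Complex.norm_exp_ofReal_mul_I]; norm_num), mul_left_comm, Complex.re_ofReal_mul]
      have e2 : (2:ℝ) ^ n * (2⁻¹)^n = 1 := by rw [← mul_pow]; norm_num
      rw [e1, hr]; simp only
      linear_combination (-(E0 * (n:ℝ) ^ (-a) * LJ j (fun u => Wf a b S (φ n) n (η n) u + Wf a b S (φ n) n (η n) (-u)))) * e2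
    constructor
    · exact ((AE.const E0).mul (hMA.add (AE.of_small hrs))).congr' heq
    · refine Tendsto.congr' heq ?_
      have := (hMl.add (hto hrs)).const_mul E0
      rwa [add_zero, ← mul_assoc] at this
  refine ⟨fun n => c n 0, ?_, ?_, ?_, ?_, fun m => ?_⟩
  · filter_upwards [hc] with n hn
    exact (exact_thm hS ha hb ha1 hb1 (hP n) (hPn n) (ho n) hn).2
  · exact (((AE.const 1).sub (AE.invn.mul hin)).add (AE.of_small hη0)).congr' hcn
  · refine Tendsto.congr' hcn ?_
    have := ((tendsto_const_nhds (x := (1:ℝ))).sub (AE.inv_tendsto.mul hinl)).add (hto hη0)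
    simpa only [zero_mul, sub_zero, add_zero] using this
  · have := hinl.neg.add hnη
    rw [add_zero] at this
    refine this.congr' ?_
    filter_upwards [hcn, eventually_ge_atTop 1] with n hn h1
    have : (n:ℝ) ≠ 0 := by exact_mod_cast (by omega : n ≠ 0)
    rw [← hn]; field_simp; ring
  · obtain ⟨h1, h2⟩ := Dc_AE (fun j => (hj j).1) (fun j => (hj j).2) m
    refine ⟨h1, ?_⟩
    convert h2 using 2
    rw [EU, ← Finset.mul_sum]; ring
end

section
open Topology Polynomial

variable {S : ℂ → ℂ} {R a b : ℝ}

/-- positive definite functionals and their monic orthogonal polynomials -/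
def PF (L : ℝ[X] →ₗ[ℝ] ℝ) : Prop := ∀ p : ℝ[X], p ≠ 0 → 0 < L (p * p)

def OP (L : ℝ[X] →ₗ[ℝ] ℝ) (P : ℕ → ℝ[X]) : Prop :=
  ∀ n, (P n).Monic ∧ (P n).natDegree = n ∧ ∀ Q : ℝ[X], Q.degree < n → L (P n * Q) = 0

lemma degm {p q : ℝ[X]} {n : ℕ} (hp : p.Monic) (hq : q.Monic) (h1 : p.natDegree = n) (h2 : q.natDegree = n) : (p - q).degree < n := by
  have e1 : p.degree = n := by rw [degree_eq_natDegree hp.ne_zero, h1]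
  rw [← e1]
  refine degree_sub_lt (by rw [e1, degree_eq_natDegree hq.ne_zero, h2]) hp.ne_zero (by rw [hp.leadingCoeff, hq.leadingCoeff])

lemma op_unique {L : ℝ[X] →ₗ[ℝ] ℝ} (hL : PF L) {n : ℕ} {p q : ℝ[X]} (hp : p.Monic) (hq : q.Monic)
    (h1 : p.natDegree = n) (h2 : q.natDegree = n) (op : ∀ Q : ℝ[X], Q.degree < n → L (p * Q) = 0)
    (oq : ∀ Q : ℝ[X], Q.degree < n → L (q * Q) = 0) : p = q := by
  by_contra h
  have hd := degm hp hq h1 h2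
  have := hL _ (sub_ne_zero.mpr h)
  rw [sub_mul, map_sub, op _ hd, oq _ hd] at this
  simp at this

lemma op_exists {L : ℝ[X] →ₗ[ℝ] ℝ} (hL : PF L) : ∃ P, OP L P := by
  have : ∀ n : ℕ, ∃ p : ℝ[X], p.Monic ∧ p.natDegree = n ∧ ∀ Q : ℝ[X], Q.degree < n → L (p * Q) = 0 := by
    intro n
    haveI : FiniteDimensional ℝ (degreeLT ℝ n) := (degreeLTEquiv ℝ n).symm.finiteDimensional
    let B : ℝ[X] →ₗ[ℝ] Module.Dual ℝ (degreeLT ℝ n) := (LinearMap.mul ℝ ℝ[X]).compr₂ L |>.compl₂ (degreeLT ℝ n).subtype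
    have hB : ∀ p (q : degreeLT ℝ n), B p q = L (p * q) := fun p q => rfl
    let T := B.comp (degreeLT ℝ n).subtype
    have hinj : Function.Injective T := by
      rw [← LinearMap.ker_eq_bot, LinearMap.ker_eq_bot']
      intro q hq
      by_contra h
      have h1 := hL q (by simpa using h)
      have h2 : T q q = L (q * q) := rfl
      rw [hq] at h2
      simp [← h2] at h1
    obtain ⟨q, hq⟩ := (LinearMap.injective_iff_surjective_of_finrank_eq_finrank Subspace.dual_finrank_eq.symm).mp hinj (B (X ^ n))
    have hqd : (q : ℝ[X]).degree < n := mem_degreeLT.mp q.2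
    refine ⟨X ^ n - (q : ℝ[X]), monic_X_pow_sub hqd, ?_, fun Q hQ => ?_⟩
    · exact natDegree_eq_of_degree_eq_some (by rw [degree_sub_eq_left_of_degree_lt (by rwa [degree_X_pow]), degree_X_pow])
    · have h1 : T q ⟨Q, mem_degreeLT.mpr hQ⟩ = L (q * Q) := rfl
      have h2 : B (X ^ n) ⟨Q, mem_degreeLT.mpr hQ⟩ = L (X ^ n * Q) := rfl
      rw [sub_mul, map_sub, ← h1, ← h2, hq, sub_self]
  choose P hP using this
  exact ⟨P, hP⟩

open Classical in
/-- the concrete functional -/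
def LW (a b : ℝ) (S : ℂ → ℂ) : ℝ[X] →ₗ[ℝ] ℝ where
  toFun p := if IntegrableOn (fun θ : ℝ => ‖Fd a b S (cexp (I * θ))‖ ^ 2) (Ioo 0 Real.pi) then
    ∫ θ in Ioo 0 Real.pi, p.eval (Real.cos θ) * ‖Fd a b S (cexp (I * θ))‖ ^ 2 else 0
  map_add' p q := by
    split_ifs with h
    · have h1 : ∀ p : ℝ[X], IntegrableOn (fun θ : ℝ => p.eval (Real.cos θ) * ‖Fd a b S (cexp (I * θ))‖ ^ 2) (Ioo 0 Real.pi) := fun p => by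
        simpa only [mul_comm] using bdd_mul_int h (g := fun θ => p.eval (Real.cos θ)) (by fun_prop)
      rw [← integral_add (h1 p) (h1 q)]
      simp only [eval_add, add_mul]
    · simp
  map_smul' c p := by
    split_ifs with h
    · rw [smul_eq_mul, RingHom.id_apply, ← integral_const_mul]
      simp only [eval_smul, smul_eq_mul, mul_assoc]
    · simp

lemma LW_int (hS : SData S R) (ha : -(1/2) < a) (hb : -(1/2) < b) (p : ℝ[X]) :
    IntegrableOn (fun θ : ℝ => p.eval (Real.cos θ) * ‖Fd a b S (cexp (I * θ))‖ ^ 2) (Ioo 0 Real.pi) :=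
  Fd_sq_int hS ha hb (by fun_prop)

lemma LW_apply (hS : SData S R) (ha : -(1/2) < a) (hb : -(1/2) < b) (p : ℝ[X]) :
    LW a b S p = ∫ θ in Ioo 0 Real.pi, p.eval (Real.cos θ) * ‖Fd a b S (cexp (I * θ))‖ ^ 2 := by
  have := LW_int hS ha hb 1
  simp only [eval_one, one_mul] at this
  simp [LW, this]

lemma LW_PF (hS : SData S R) (ha : -(1/2) < a) (hb : -(1/2) < b) : PF (LW a b S) := by
  intro p hp
  rw [LW_apply hS ha hb]
  rw [setIntegral_pos_iff_support_of_nonneg_ae (Eventually.of_forall fun θ => by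
    simp only [eval_mul]; exact mul_nonneg (mul_self_nonneg _) (sq_nonneg _)) (LW_int hS ha hb _)]
  have hsub : Ioo 0 Real.pi \ {θ | θ ∈ Ioo 0 Real.pi ∧ p.eval (Real.cos θ) = 0} ⊆
      (Function.support fun θ : ℝ => (p * p).eval (Real.cos θ) * ‖Fd a b S (cexp (I * θ))‖ ^ 2) ∩ Ioo 0 Real.pi := by
    rintro θ ⟨h1, h2⟩
    refine ⟨?_, h1⟩
    have h3 : p.eval (Real.cos θ) ≠ 0 := fun h => h2 ⟨h1, h⟩
    have hF : Fd a b S (cexp (I * θ)) ≠ 0 := Fd_ne (arc_re h1)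
    simp [h3, hF]
  have hfin : {θ | θ ∈ Ioo 0 Real.pi ∧ p.eval (Real.cos θ) = 0}.Finite := by
    refine Set.Finite.of_finite_image (f := Real.cos) ?_ ?_
    · refine (p.roots.toFinset.finite_toSet).subset ?_
      rintro _ ⟨θ, hθ, rfl⟩
      simpa [hp] using hθ.2
    · intro x hx y hy
      exact fun h => Real.injOn_cos (Ioo_subset_Icc_self hx.1) (Ioo_subset_Icc_self hy.1) h
  refine lt_of_lt_of_le ?_ (measure_mono hsub)
  rw [measure_sdiff_null (hfin.measure_zero _)]
  simp [Real.pi_pos]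

lemma LW_shift (hS : SData S R) (ha : -(1/2) < a) (hb : -(1/2) < b) (p : ℝ[X]) :
    LW (a+1) b S p = 2 * LW a b S ((1 - X) * p) := by
  rw [LW_apply hS ha hb, LW_apply hS (by linarith) hb, ← integral_const_mul]
  refine setIntegral_congr_fun measurableSet_Ioo fun θ hθ => ?_
  have h1 : ‖1 - cexp (I * θ)‖ ^ 2 = 2 * (1 - Real.cos θ) := by
    rw [mul_comm, Complex.exp_mul_I, ← Complex.ofReal_cos, ← Complex.ofReal_sin, ← Complex.normSq_eq_norm_sq, Complex.normSq_apply]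
    simp only [Complex.sub_re, Complex.sub_im, Complex.add_re, Complex.add_im, Complex.one_re, Complex.one_im, Complex.ofReal_re, Complex.ofReal_im, Complex.mul_re, Complex.mul_im, Complex.I_re, Complex.I_im]
    linear_combination Real.sin_sq_add_cos_sq θ
  have h2 : ‖1 - cexp (I * θ)‖ ≠ 0 := by
    intro h
    have hc : Real.cos θ < 1 := by
      rw [← Real.cos_zero]; exact Real.cos_lt_cos_of_nonneg_of_le_pi le_rfl hθ.2.le hθ.1
    rw [h] at h1; nlinarith
  beta_reduce
  rw [Fd_norm, Fd_norm, Real.rpow_add_one h2, eval_mul, eval_sub, eval_one, eval_X]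
  linear_combination (p.eval (Real.cos θ) * (‖1 - cexp (I * θ)‖ ^ a * ‖1 + cexp (I * θ)‖ ^ b * Real.exp (S (cexp (I * θ))).re) ^ 2) * h1

lemma LW_refl (hS : SData S R) (hS' : SData (fun z => S (-z)) R) (ha : -(1/2) < a) (hb : -(1/2) < b) (p : ℝ[X]) :
    LW b a (fun z => S (-z)) p = LW a b S (p.comp (-X)) := by
  rw [LW_apply hS ha hb, LW_apply hS' hb ha, ← integral_Ioc_eq_integral_Ioo, ← integral_Ioc_eq_integral_Ioo,
    ← intervalIntegral.integral_of_le Real.pi_pos.le, ← intervalIntegral.integral_of_le Real.pi_pos.le]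
  have := intervalIntegral.integral_comp_sub_left (a := 0) (b := Real.pi) (fun θ : ℝ => (p.comp (-X)).eval (Real.cos θ) * ‖Fd a b S (cexp (I * θ))‖ ^ 2) Real.pi
  rw [sub_self, sub_zero] at this
  rw [← this]
  refine intervalIntegral.integral_congr fun θ _ => ?_
  have e1 : cexp (I * ((Real.pi - θ : ℝ) : ℂ)) = -starRingEnd ℂ (cexp (I * θ)) := by
    rw [← Complex.exp_conj, map_mul, Complex.conj_I, Complex.conj_ofReal, Complex.ofReal_sub, mul_sub, Complex.exp_sub, mul_comm I, Complex.exp_pi_mul_I,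
      neg_mul, Complex.exp_neg, neg_div, one_div]
  have hz : ‖cexp (I * θ)‖ = 1 := by rw [mul_comm, Complex.norm_exp_ofReal_mul_I]
  have h1 : ∀ z : ℂ, ‖1 + starRingEnd ℂ z‖ = ‖1 + z‖ := fun z => by rw [← Complex.norm_conj (1 + z), map_add, map_one]
  have h2 : ∀ z : ℂ, ‖1 - starRingEnd ℂ z‖ = ‖1 - z‖ := fun z => by rw [← Complex.norm_conj (1 - z), map_sub, map_one]
  beta_reduce
  rw [e1, Fd_norm, Fd_norm, ← map_neg, hS.conj _ (by simp [hz, hS.one_lt]), Complex.conj_re, h1, h2, sub_neg_eq_add, ← sub_eq_add_neg,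
    Real.cos_pi_sub, eval_comp, eval_neg, eval_X, neg_neg, mul_comm (‖1 - cexp (I * θ)‖ ^ b)]
end

section
open Topology Polynomial

/-- scaled Taylor coefficients at `1` -/
def sA (a : ℝ) (P : ℕ → ℝ[X]) (m n : ℕ) : ℝ := 2 ^ n * (n:ℝ) ^ (-a) * (((n:ℝ)⁻¹) ^ (2 * m) * Dc (P n) m)

def TA (a : ℝ) (P : ℕ → ℝ[X]) : Prop := ∀ m, ∃ c, c ≠ 0 ∧ AE (sA a P m) ∧ Tendsto (sA a P m) atTop (𝓝 c)

def rf (P : ℕ → ℝ[X]) (n : ℕ) : ℝ[X] := C ((-1) ^ n) * (P n).comp (-X)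

lemma nat_ev : ∀ᶠ n : ℕ in atTop, (0:ℝ) < n := by
  filter_upwards [eventually_ge_atTop 1] with n hn; exact_mod_cast hn

lemma diff_lim {f : ℕ → ℝ} (hf : AE f) : Tendsto (fun n : ℕ => (n:ℝ) * (f (n+1) - f n)) atTop (𝓝 0) := by
  obtain ⟨L, hL⟩ := hf.exists_tendsto
  obtain ⟨d, hd⟩ := (hf.mul_n hL).exists_tendsto
  have h1 : Tendsto (fun n : ℕ => 1 - ((n+1 : ℕ) : ℝ)⁻¹) atTop (𝓝 (1 - 0)) :=
    tendsto_const_nhds.sub (AE.inv_tendsto.comp (tendsto_add_atTop_nat 1))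
  have := (h1.mul (hd.comp (tendsto_add_atTop_nat 1))).sub hd
  rw [sub_zero, one_mul, sub_self] at this
  refine this.congr fun n => ?_
  have : (n:ℝ) + 1 ≠ 0 := by positivity
  simp only [Function.comp, smul_eq_mul]; push_cast; field_simp; ring

lemma inv_rpow (s : ℝ) : AE (fun n : ℕ => (1 + (n:ℝ)⁻¹) ^ s) ∧ Tendsto (fun n : ℕ => (1 + (n:ℝ)⁻¹) ^ s) atTop (𝓝 1) ∧
    Tendsto (fun n : ℕ => (n:ℝ) * ((1 + (n:ℝ)⁻¹) ^ s - 1)) atTop (𝓝 s) := by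
  have h1 : Tendsto (fun n : ℕ => 1 + (n:ℝ)⁻¹) atTop (𝓝 1) := by simpa using (tendsto_const_nhds (x := (1:ℝ))).add AE.inv_tendsto
  refine ⟨((AE.const 1).add AE.invn).rpow h1 one_pos s, ?_, ?_⟩
  · simpa using h1.rpow_const (p := s) (Or.inl one_ne_zero)
  · have hd : HasDerivAt (fun x : ℝ => x ^ s) s 1 := by simpa using Real.hasDerivAt_rpow_const (x := 1) (p := s) (Or.inl one_ne_zero)
    have h2 := (hasDerivAt_iff_tendsto_slope_zero.mp hd).comp (tendsto_nhdsWithin_iff.mpr ⟨AE.inv_tendsto, by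
      filter_upwards [nat_ev] with n hn; simpa using hn.ne'⟩)
    refine h2.congr fun n => ?_
    simp

lemma comb_lim (s : ℝ) {a c : ℝ} {f r : ℕ → ℝ} (hf : AE f) (hc : Tendsto f atTop (𝓝 c)) (hr : AE r) (hr1 : Tendsto r atTop (𝓝 1))
    (hra : Tendsto (fun n : ℕ => (n:ℝ) * (r n - 1)) atTop (𝓝 a)) :
    AE (fun n : ℕ => (n:ℝ) * ((1 + (n:ℝ)⁻¹) ^ s * f (n+1) - r n * f n)) ∧
    Tendsto (fun n : ℕ => (n:ℝ) * ((1 + (n:ℝ)⁻¹) ^ s * f (n+1) - r n * f n)) atTop (𝓝 ((s - a) * c)) := by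
  obtain ⟨i1, i2, i3⟩ := inv_rpow s
  have hc' := hc.comp (tendsto_add_atTop_nat 1)
  constructor
  · have h := ((i1.mul hf.shift).sub (hr.mul hf)).mul_n (L := 0) (by simpa using (i2.mul hc').sub (hr1.mul hc))
    simpa using h
  · have h := ((i3.mul hc').add (diff_lim hf)).sub (hra.mul hc)
    rw [add_zero, ← sub_mul] at h
    refine h.congr fun n => ?_
    simp only [Function.comp]; ring

lemma rpow_shift {n : ℕ} (hn : (0:ℝ) < n) (s : ℝ) : ((n+1 : ℕ) : ℝ) ^ s = (n:ℝ) ^ s * (1 + (n:ℝ)⁻¹) ^ s := by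
  rw [← Real.mul_rpow hn.le (by positivity)]; congr 1; push_cast; field_simp

/-- unscaled form -/
lemma sA_eq {a : ℝ} {P : ℕ → ℝ[X]} {m n : ℕ} (hn : (0:ℝ) < n) : 2 ^ n * Dc (P n) m = (n:ℝ) ^ (a + 2 * m) * sA a P m n := by
  have e : (n:ℝ) ^ (a + 2 * m) * ((n:ℝ) ^ (-a) * ((n:ℝ)⁻¹) ^ (2 * m)) = 1 := by
    rw [Real.rpow_add hn, Real.rpow_neg hn.le, inv_pow]
    have : (n:ℝ) ^ (2 * (m:ℝ)) = (n:ℝ) ^ (2 * m) := by rw [← Real.rpow_natCast]; push_cast; rfl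
    rw [this]; field_simp
  rw [sA]; linear_combination (-(2 ^ n * Dc (P n) m)) * e

lemma ratio_lim {a : ℝ} {P : ℕ → ℝ[X]} (hT : TA a P) : ∃ ρ : ℕ → ℝ, (∀ᶠ n in atTop, (P n).eval 1 ≠ 0 ∧ ρ n = (P (n+1)).eval 1 / (P n).eval 1) ∧
    AE (fun n => 2 * ρ n) ∧ Tendsto (fun n => 2 * ρ n) atTop (𝓝 1) ∧ Tendsto (fun n : ℕ => (n:ℝ) * (2 * ρ n - 1)) atTop (𝓝 a) := by
  obtain ⟨c, c0, hf, hc⟩ := hT 0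
  have hD : ∀ n, Dc (P n) 0 = (P n).eval 1 := fun n => by rw [Dc, taylor_coeff_zero]
  obtain ⟨i1, i2, i3⟩ := inv_rpow a
  have hc' := hc.comp (tendsto_add_atTop_nat 1)
  have hne : ∀ᶠ n in atTop, sA a P 0 n ≠ 0 := hc.eventually_ne c0
  have heq : ∀ᶠ n : ℕ in atTop, (1 + (n:ℝ)⁻¹) ^ a * sA a P 0 (n+1) / sA a P 0 n = 2 * ((P (n+1)).eval 1 / (P n).eval 1) := by
    filter_upwards [hne, nat_ev] with n h1 hn
    have e1 := sA_eq (a := a) (P := P) (m := 0) hn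
    have e2 := sA_eq (a := a) (P := P) (m := 0) (n := n+1) (by positivity)
    rw [hD, Nat.cast_zero, mul_zero, add_zero] at e1 e2
    rw [rpow_shift hn] at e2
    have hp : (n:ℝ) ^ a ≠ 0 := (Real.rpow_pos_of_pos hn _).ne'
    have h3 : (P n).eval 1 ≠ 0 := by
      intro h; rw [h, mul_zero] at e1; exact mul_ne_zero hp h1 e1.symm
    rw [div_eq_iff h1, mul_assoc, div_mul_eq_mul_div, ← mul_div_assoc, eq_div_iff h3]
    have h2 : (2:ℝ) ^ n ≠ 0 := by positivity
    apply mul_left_cancel₀ hp; apply mul_left_cancel₀ h2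
    rw [pow_succ] at e2
    linear_combination (-(eval 1 (P n)) * 2 ^ n) * e2 + 2 ^ n * 2 * eval 1 (P (n+1)) * e1
  refine ⟨fun n => (P (n+1)).eval 1 / (P n).eval 1, ?_, ((i1.mul hf.shift).div hf hc c0).congr' heq, ?_, ?_⟩
  · filter_upwards [hne] with n h1
    refine ⟨fun h => h1 ?_, rfl⟩
    rw [sA, hD, h]; simp
  · have := (i2.mul hc').div hc c0
    rw [one_mul, div_self c0] at this
    exact this.congr' heq
  · have := ((i3.mul hc').add (diff_lim hf)).div hc c0
    rw [add_zero, mul_div_cancel_right₀ _ c0] at this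
    refine this.congr' ?_
    filter_upwards [heq, hne] with n h1 h2
    rw [← h1]; simp only [Function.comp, Pi.div_apply]; field_simp; ring

lemma chr {L L' : ℝ[X] →ₗ[ℝ] ℝ} {P P' : ℕ → ℝ[X]} (hL' : PF L') (hP : OP L P) (hP' : OP L' P')
    (h : ∀ p, L' p = 2 * L ((1 - X) * p)) {n : ℕ} {ρ : ℝ} (h0 : (P n).eval 1 ≠ 0) (hρ : ρ = (P (n+1)).eval 1 / (P n).eval 1) :
    (X - C 1) * P' n = P (n+1) - C ρ * P n ∧ L' (P' n * P' n) = 2 * ρ * L (P n * P n) := by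
  obtain ⟨m1, d1, o1⟩ := hP n
  obtain ⟨m2, d2, o2⟩ := hP (n+1)
  obtain ⟨m3, d3, o3⟩ := hP' n
  have hdl : (C ρ * P n).degree < (P (n+1)).degree := by
    rw [degree_eq_natDegree m2.ne_zero, d2]
    refine (degree_mul_le _ _).trans_lt ((add_le_add_left degree_C_le _).trans_lt ?_)
    rw [zero_add]
    rw [degree_eq_natDegree m1.ne_zero, d1]; exact_mod_cast Nat.lt_succ_self n
  have hRm : (P (n+1) - C ρ * P n).Monic := m2.sub_of_left hdl
  obtain ⟨Q, hQ⟩ := dvd_iff_isRoot.mpr (show (P (n+1) - C ρ * P n).IsRoot 1 by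
    rw [IsRoot, eval_sub, eval_mul, eval_C, hρ, div_mul_cancel₀ _ h0, sub_self])
  have hQm : Q.Monic := (monic_X_sub_C (1:ℝ)).of_mul_monic_left (hQ ▸ hRm)
  have hQd : Q.natDegree = n := by
    have := congrArg natDegree hQ
    rw [(monic_X_sub_C (1:ℝ)).natDegree_mul hQm, natDegree_X_sub_C, natDegree_eq_of_degree_eq (degree_sub_eq_left_of_degree_lt hdl), d2] at this
    omega
  have horth : ∀ q : ℝ[X], L' (Q * q) = 2 * (ρ * L (P n * q) - L (P (n+1) * q)) := by
    intro q
    rw [h, show (1 - X) * (Q * q) = ρ • (P n * q) - P (n+1) * q by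
      rw [smul_eq_C_mul, ← mul_assoc, ← mul_assoc, ← sub_mul]
      congr 1
      rw [C_1] at hQ
      linear_combination hQ, map_sub, map_smul, smul_eq_mul]
  have hQP : Q = P' n := op_unique hL' hQm m3 hQd d3 (fun q hq => by
    rw [horth, o1 q hq, o2 q (hq.trans (by exact_mod_cast Nat.lt_succ_self n))]; ring) o3
  rw [← hQP]
  refine ⟨hQ.symm, ?_⟩
  rw [horth, o2 Q (by rw [degree_eq_natDegree hQm.ne_zero, hQd]; exact_mod_cast Nat.lt_succ_self n)]
  have := o1 _ (degm hQm m1 hQd d1)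
  rw [mul_sub, map_sub, sub_eq_zero] at this
  rw [this]; ring

lemma Dc_sub (p q : ℝ[X]) (c : ℝ) (m : ℕ) : Dc (p + C c * q) m = Dc p m + c * Dc q m := by
  simp [Dc, map_add, taylor_mul, taylor_C]

lemma Dc_Xsub (q : ℝ[X]) (m : ℕ) : Dc ((X - C 1) * q) (m+1) = Dc q m := by
  rw [Dc, taylor_mul, map_sub, taylor_X, taylor_C, add_sub_cancel_right, coeff_X_mul, Dc]

lemma Dc_Xadd (q : ℝ[X]) (m : ℕ) : Dc ((X + C 1) * q) m = (if m = 0 then 0 else Dc q (m-1)) + 2 * Dc q m := by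
  rw [Dc, taylor_mul, map_add, taylor_X, taylor_C, add_assoc, ← C_add, add_mul, coeff_add, coeff_C_mul, Dc, Dc]
  cases m <;> norm_num

theorem chr_step {L L' : ℝ[X] →ₗ[ℝ] ℝ} {P P' : ℕ → ℝ[X]} (hL' : PF L') (hP : OP L P) (hP' : OP L' P')
    (h : ∀ p, L' p = 2 * L ((1 - X) * p)) {a b : ℝ} (hT : TA a P) (hTb : TA b (rf P)) :
    ∃ r : ℕ → ℝ, AE r ∧ Tendsto r atTop (𝓝 1) ∧ Tendsto (fun n : ℕ => (n:ℝ) * (r n - 1)) atTop (𝓝 a) ∧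
      (∀ᶠ n in atTop, L' (P' n * P' n) = r n * L (P n * P n)) ∧ TA (a+1) P' ∧ TA b (rf P') := by
  obtain ⟨ρ, hρ, r1, r2, r3⟩ := ratio_lim hT
  refine ⟨fun n => 2 * ρ n, r1, r2, r3, ?_, fun m => ?_, fun m => ?_⟩
  · filter_upwards [hρ] with n hn
    exact (chr hL' hP hP' h hn.1 hn.2).2
  · obtain ⟨c, c0, hf, hc⟩ := hT (m+1)
    obtain ⟨k1, k2⟩ := comb_lim (a + 2 * (m+1 : ℕ)) hf hc r1 r2 r3
    have heq : ∀ᶠ n : ℕ in atTop, 2⁻¹ * ((n:ℝ) * ((1 + (n:ℝ)⁻¹) ^ (a + 2 * (m+1 : ℕ)) * sA a P (m+1) (n+1) - 2 * ρ n * sA a P (m+1) n)) = sA (a+1) P' m n := by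
      filter_upwards [hρ, nat_ev] with n hn n0
      have e0 := congrArg (fun p => Dc p (m+1)) (chr hL' hP hP' h hn.1 hn.2).1
      simp only [Dc_Xsub] at e0
      rw [show P (n+1) - C (ρ n) * P n = P (n+1) + C (-ρ n) * P n by rw [C_neg]; ring, Dc_sub] at e0
      have e1 := sA_eq (a := a) (P := P) (m := m+1) n0
      have e2 := sA_eq (a := a) (P := P) (m := m+1) (n := n+1) (by positivity)
      have e3 := sA_eq (a := a+1) (P := P') (m := m) n0
      rw [rpow_shift n0] at e2
      have hx : (n:ℝ) ^ (a + 2 * (m+1 : ℕ)) = n * (n:ℝ) ^ (a + 1 + 2 * m) := by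
        rw [mul_comm (n:ℝ), ← Real.rpow_add_one n0.ne']; congr 1; push_cast; ring
      have hp : (n:ℝ) ^ (a + 1 + 2 * m) ≠ 0 := (Real.rpow_pos_of_pos n0 _).ne'
      apply mul_left_cancel₀ hp
      rw [← e3, e0]
      rw [hx] at e1 e2
      rw [pow_succ] at e2
      linear_combination (-2⁻¹) * e2 + ρ n * e1
    refine ⟨2⁻¹ * ((a + 2 * (m+1 : ℕ) - a) * c), ?_, ((AE.const _).mul k1).congr' heq, (k2.const_mul _).congr' heq⟩
    have : (a + 2 * (m+1 : ℕ) - a : ℝ) ≠ 0 := by push_cast; ring_nf; positivity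
    positivity
  · suffices hs : ∀ c, Tendsto (sA b (rf P) m) atTop (𝓝 c) → AE (sA b (rf P') m) ∧ Tendsto (sA b (rf P') m) atTop (𝓝 (2⁻¹ * c)) by
      obtain ⟨c, c0, -, hc⟩ := hTb m
      exact ⟨2⁻¹ * c, by positivity, hs c hc⟩
    have hm0 : ∀ᶠ n : ℕ in atTop, ∀ m, (2:ℝ)^(n+1) * ((if m = 0 then 0 else Dc (rf P' n) (m-1)) + 2 * Dc (rf P' n) m)
        = 2^(n+1) * Dc (rf P (n+1)) m + 2 * ρ n * (2 ^ n * Dc (rf P n) m) := by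
      filter_upwards [hρ] with n hn m
      have e0 := congrArg (fun p => C ((-1:ℝ)^(n+1)) * p.comp (-X)) (chr hL' hP hP' h hn.1 hn.2).1
      have e1 : (X + C 1) * rf P' n = rf P (n+1) + C (ρ n) * rf P n := by
        simp only [rf]
        simp only [mul_comp, sub_comp, X_comp, C_comp, pow_succ, C_mul, C_neg, C_1, one_comp] at e0 ⊢
        linear_combination e0
      rw [← Dc_Xadd, e1, Dc_sub]; ring
    have key : ∀ m (e : ℕ → ℝ), AE e → Tendsto e atTop (𝓝 0) →
        (∀ᶠ n : ℕ in atTop, 2 ^ n * (if m = 0 then 0 else Dc (rf P' n) (m-1)) = (n:ℝ) ^ (b + 2 * m) * e n) →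
        ∀ c, Tendsto (sA b (rf P) m) atTop (𝓝 c) → AE (sA b (rf P') m) ∧ Tendsto (sA b (rf P') m) atTop (𝓝 (2⁻¹ * c)) := by
      intro m e he he0 hem c hc
      obtain ⟨c', -, hf, -⟩ := hTb m
      obtain ⟨i1, i2, -⟩ := inv_rpow (b + 2 * m)
      have heq : ∀ᶠ n : ℕ in atTop, 4⁻¹ * ((1 + (n:ℝ)⁻¹) ^ (b + 2 * m) * sA b (rf P) m (n+1) + 2 * ρ n * sA b (rf P) m n) - 2⁻¹ * e n = sA b (rf P') m n := by
        filter_upwards [hm0, nat_ev, hem] with n hn n0 h4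
        have e0 := hn m
        rw [sA_eq (a := b) (P := rf P) n0, sA_eq (a := b) (P := rf P) (n := n+1) (by positivity), rpow_shift n0, pow_succ] at e0
        have e3 := sA_eq (a := b) (P := rf P') (m := m) n0
        have hp : (n:ℝ) ^ (b + 2 * m) ≠ 0 := (Real.rpow_pos_of_pos n0 _).ne'
        apply mul_left_cancel₀ hp
        linear_combination (-4⁻¹) * e0 + 2⁻¹ * h4 + e3
      refine ⟨(((AE.const _).mul ((i1.mul hf.shift).add (r1.mul hf))).sub ((AE.const _).mul he)).congr' heq, ?_⟩
      have := (((i2.mul (hc.comp (tendsto_add_atTop_nat 1))).add (r2.mul hc)).const_mul (4⁻¹)).sub (he0.const_mul 2⁻¹)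
      convert this.congr' heq using 2
      ring
    induction m with
    | zero => exact key 0 (fun _ => 0) (AE.const 0) tendsto_const_nhds (by simp)
    | succ m ih =>
      obtain ⟨c', -, -, hc'⟩ := hTb m
      obtain ⟨j1, j2⟩ := ih c' hc'
      refine key (m+1) (fun n => ((n:ℝ)⁻¹)^2 * sA b (rf P') m n) ((AE.invn.pow 2).mul j1) (by simpa using (AE.inv_tendsto.pow 2).mul j2) ?_
      filter_upwards [nat_ev] with n n0
      simp only [Nat.add_eq_zero_iff, one_ne_zero, and_false, if_false, Nat.add_sub_cancel]
      rw [sA_eq (a := b) n0, show b + 2 * ((m+1:ℕ):ℝ) = b + 2 * m + (2:ℕ) by push_cast; ring, Real.rpow_add_natCast n0.ne']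
      field_simp
end

section
open Topology Polynomial

variable {a b : ℝ}

lemma nsub (θ : ℝ) : ‖1 - cexp (I * θ)‖ ^ 2 = 2 * (1 - Real.cos θ) := by
  rw [mul_comm, Complex.exp_mul_I, ← Complex.ofReal_cos, ← Complex.ofReal_sin, ← Complex.normSq_eq_norm_sq, Complex.normSq_apply]
  simp only [Complex.sub_re, Complex.sub_im, Complex.add_re, Complex.add_im, Complex.one_re, Complex.one_im, Complex.ofReal_re, Complex.ofReal_im, Complex.mul_re, Complex.mul_im, Complex.I_re, Complex.I_im]
  linear_combination Real.sin_sq_add_cos_sq θ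

lemma nadd (θ : ℝ) : ‖1 + cexp (I * θ)‖ ^ 2 = 2 * (1 + Real.cos θ) := by
  have := parallelogram_law_with_norm ℝ (1:ℂ) (cexp (I * θ))
  have hz : ‖cexp (I * θ)‖ = 1 := by rw [mul_comm, Complex.norm_exp_ofReal_mul_I]
  rw [nsub, hz, norm_one] at this
  linarith

lemma Fd_sq (a b : ℝ) (S : ℂ → ℂ) (θ : ℝ) : ‖Fd a b S (cexp (I * θ))‖ ^ 2
    = (2 * (1 - Real.cos θ)) ^ a * (2 * (1 + Real.cos θ)) ^ b * Real.exp (2 * (S (cexp (I * θ))).re) := by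
  have h : ∀ (x c : ℝ), 0 ≤ x → (x ^ c) ^ 2 = (x ^ 2) ^ c := fun x c hx => by
    rw [← Real.rpow_natCast, ← Real.rpow_mul hx, mul_comm, Real.rpow_mul hx, Real.rpow_natCast]
  rw [Fd_norm, mul_pow, mul_pow, h _ _ (norm_nonneg _), h _ _ (norm_nonneg _), nsub, nadd, ← Real.exp_nat_mul]; norm_num

lemma S0 : SData (fun _ => 0) 2 := ⟨by norm_num, differentiableOn_const _, by simp⟩

def qJ (a b : ℝ) : ℝ[X] := C (b - a) - C (a + b + 1) * X

lemma ibp (ha : -(1/2) < a) (hb : -(1/2) < b) (p : ℝ[X]) :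
    LW a b (fun _ => 0) ((1 - X ^ 2) * derivative p + qJ a b * p) = 0 := by
  rw [LW_apply S0 ha hb]
  have hi := LW_int S0 ha hb ((1 - X ^ 2) * derivative p + qJ a b * p)
  rw [← integral_Ioc_eq_integral_Ioo, ← intervalIntegral.integral_of_le Real.pi_pos.le]
  rw [← intervalIntegrable_iff_integrableOn_Ioo_of_le Real.pi_pos.le] at hi
  have hA : 0 < a + 1/2 := by linarith
  have hB : 0 < b + 1/2 := by linarith
  rw [intervalIntegral.integral_eq_sub_of_hasDerivAt_of_le
    (f := fun θ => -(1/2) * (p.eval (Real.cos θ) * ((2 * (1 - Real.cos θ)) ^ (a + 1/2) * (2 * (1 + Real.cos θ)) ^ (b + 1/2)))) Real.pi_pos.le ?_ ?_ hi]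
  · simp [Real.zero_rpow (show a + 2⁻¹ ≠ 0 by linarith), Real.zero_rpow (show b + 2⁻¹ ≠ 0 by linarith)]
  · have h1 : Continuous fun θ => (2 * (1 - Real.cos θ)) ^ (a + 1/2) := Continuous.rpow_const (by fun_prop) (fun _ => Or.inr hA.le)
    have h2 : Continuous fun θ => (2 * (1 + Real.cos θ)) ^ (b + 1/2) := Continuous.rpow_const (by fun_prop) (fun _ => Or.inr hB.le)
    exact (continuous_const.mul ((by fun_prop : Continuous fun θ => p.eval (Real.cos θ)).mul (h1.mul h2))).continuousOn
  · intro θ hθ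
    have hs := Real.sin_pos_of_mem_Ioo hθ
    have hsc := Real.sin_sq_add_cos_sq θ
    have hu : 0 < 2 * (1 - Real.cos θ) := by nlinarith
    have hv : 0 < 2 * (1 + Real.cos θ) := by nlinarith
    have hc := Real.hasDerivAt_cos θ
    have d1 := (((hc.const_sub 1).const_mul 2).rpow_const (p := a + 1/2) (Or.inl hu.ne'))
    have d2 := (((hc.const_add 1).const_mul 2).rpow_const (p := b + 1/2) (Or.inl hv.ne'))
    have d3 := (p.hasDerivAt (Real.cos θ)).comp θ hc
    refine ((d3.mul (d1.mul d2)).const_mul (-(1/2))).congr_deriv ?_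
    simp only [Pi.mul_apply, Function.comp, qJ, eval_add, eval_mul, eval_sub, eval_pow, eval_one, eval_X, eval_C]
    rw [Fd_sq, Real.rpow_sub_one hu.ne', Real.rpow_sub_one hv.ne', Real.rpow_add hu, Real.rpow_add hv]
    have hsuv : (2 * (1 - Real.cos θ)) ^ (1/2:ℝ) * (2 * (1 + Real.cos θ)) ^ (1/2:ℝ) = 2 * Real.sin θ := by
      rw [← Real.mul_rpow hu.le hv.le, ← Real.sqrt_eq_rpow, show 2 * (1 - Real.cos θ) * (2 * (1 + Real.cos θ)) = (2 * Real.sin θ) ^ 2 by linear_combination (-4) * hsc,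
        Real.sqrt_sq (by positivity)]
    set c := Real.cos θ
    set s := Real.sin θ
    set U := (2 * (1 - c)) ^ (1/2:ℝ)
    set V := (2 * (1 + c)) ^ (1/2:ℝ)
    have hc1 : 1 - c ≠ 0 := by linarith
    have hc2 : 1 + c ≠ 0 := by linarith
    simp only [Complex.zero_re, mul_zero, Real.exp_zero, mul_one]
    set W := (2 * (1 - c)) ^ a * (2 * (1 + c)) ^ b with hW
    have e1 : s * (U * V) / (2 * (1 - c)) = 1 + c := by
      rw [hsuv, div_eq_iff hu.ne']; linear_combination 2 * hsc
    have e2 : s * (U * V) / (2 * (1 + c)) = 1 - c := by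
      rw [hsuv, div_eq_iff hv.ne']; linear_combination 2 * hsc
    have e3 : s * (U * V) = 2 * (1 - c ^ 2) := by rw [hsuv]; linear_combination 2 * hsc
    trans -(1/2) * W * (-(s * (U * V)) * eval c (derivative p) + eval c p * (2 * (a + 1/2) * (s * (U * V) / (2 * (1 - c))) - 2 * (b + 1/2) * (s * (U * V) / (2 * (1 + c)))))
    · rw [hW]; ring
    · rw [e1, e2, e3]; ring

def MJ (a b : ℝ) (f : ℝ[X]) : ℝ[X] := (1 - X ^ 2) * derivative (derivative f) + qJ a b * derivative f

lemma MJ_symm (ha : -(1/2) < a) (hb : -(1/2) < b) (f g : ℝ[X]) :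
    LW a b (fun _ => 0) (MJ a b f * g) = LW a b (fun _ => 0) (f * MJ a b g) := by
  have h1 := ibp ha hb (derivative f * g)
  have h2 := ibp ha hb (derivative g * f)
  rw [derivative_mul] at h1 h2
  rw [← sub_eq_zero, ← map_sub]
  rw [← sub_self (0:ℝ)]
  nth_rewrite 1 [← h1]
  rw [← h2, ← map_sub]
  congr 1
  rw [MJ, MJ]; ring

lemma Dc_der (f : ℝ[X]) (m : ℕ) : Dc (derivative f) m = (m+1) * Dc f (m+1) := by
  have : taylor 1 (derivative f) = derivative (taylor 1 f) := by simp [taylor_apply, derivative_comp]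
  rw [Dc, this, coeff_derivative, Dc, mul_comm]

lemma MJ_coeff (f : ℝ[X]) (m : ℕ) : Dc (MJ a b f) m = -((m+1) * (2 * m + 2 * a + 1) * Dc f (m+1)) - m * (m + a + b) * Dc f m := by
  have h0 : ∀ q : ℝ[X], Dc ((X - C 1) * q) 0 = 0 := fun q => by simp [Dc, taylor_coeff_zero]
  have hsm : ∀ (p q : ℝ[X]) (m : ℕ), Dc (p + q) m = Dc p m + Dc q m := fun p q m => by simp [Dc]
  have hC : ∀ (c : ℝ) (q : ℝ[X]) (m : ℕ), Dc (C c * q) m = c * Dc q m := fun c q m => by simp [Dc, taylor_mul]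
  have e : MJ a b f = C (-1) * ((X - C 1) * ((X - C 1) * derivative (derivative f)))
      + (C (-2) * ((X - C 1) * derivative (derivative f)) + (C (-(2 * a + 1)) * derivative f + C (-(a + b + 1)) * ((X - C 1) * derivative f))) := by
    rw [MJ, qJ]; simp only [map_sub, map_add, map_neg, map_mul, C_1, map_ofNat]; ring
  rw [e, hsm, hsm, hsm, hC, hC, hC, hC]
  rcases m with _ | _ | m
  · rw [h0, h0, h0, Dc_der]; push_cast; ring
  · rw [Dc_Xsub, h0, Dc_Xsub, Dc_Xsub]; simp only [Dc_der]; push_cast; ring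
  · simp only [Dc_Xsub, Dc_der]; push_cast; ring

lemma deg_Dc {f : ℝ[X]} {n : ℕ} : f.degree < n ↔ ∀ m, n ≤ m → Dc f m = 0 := by
  rw [← degree_taylor f 1, degree_lt_iff_coeff_zero]; rfl

variable {P : ℕ → ℝ[X]}

lemma Dc_top {L : ℝ[X] →ₗ[ℝ] ℝ} (hP : OP L P) (n : ℕ) : Dc (P n) n = 1 ∧ ∀ m, n < m → Dc (P n) m = 0 := by
  obtain ⟨h1, h2, -⟩ := hP n
  refine ⟨?_, fun m hm => (deg_Dc (n := n+1)).mp ?_ m hm⟩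
  · have := coeff_taylor_natDegree (r := (1:ℝ)) (f := P n)
    rwa [h2, h1.leadingCoeff] at this
  · rw [degree_eq_natDegree h1.ne_zero, h2]; exact_mod_cast Nat.lt_succ_self n

/-- the differential equation, in Taylor coefficients at `1` -/
lemma jac_rec (ha : -(1/2) < a) (hb : -(1/2) < b) (hP : OP (LW a b (fun _ => 0)) P) (n m : ℕ) :
    (m+1) * (2 * m + 2 * a + 1) * Dc (P n) (m+1) = (n * (n + a + b) - m * (m + a + b)) * Dc (P n) m := by
  have hsm : ∀ (p q : ℝ[X]) (m : ℕ), Dc (p + q) m = Dc p m + Dc q m := fun p q m => by simp [Dc]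
  have hC : ∀ (c : ℝ) (q : ℝ[X]) (m : ℕ), Dc (C c * q) m = c * Dc q m := fun c q m => by simp [Dc, taylor_mul]
  set D := MJ a b (P n) + C (n * (n + a + b)) * P n with hD
  obtain ⟨t1, t2⟩ := Dc_top hP n
  have hDd : D.degree < n := deg_Dc.mpr fun m hm => by
    rw [hD, hsm, hC, MJ_coeff, t2 (m+1) (by omega)]
    rcases hm.eq_or_lt with rfl | h
    · ring
    · rw [t2 m h]; ring
  have hMD : (MJ a b D).degree < n := deg_Dc.mpr fun m hm => by
    rw [MJ_coeff, deg_Dc.mp hDd m hm, deg_Dc.mp hDd (m+1) (by omega)]; ring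
  have hD0 : D = 0 := by
    by_contra h
    have h1 := LW_PF S0 ha hb D h
    have o := (hP n).2.2
    nth_rewrite 1 [hD] at h1
    rw [add_mul, map_add, MJ_symm ha hb, o _ hMD, mul_assoc, ← smul_eq_C_mul, map_smul, o _ hDd] at h1
    simp at h1
  have h1 := congrArg (fun p => Dc p m) hD0
  simp only [hD, hsm, hC, MJ_coeff] at h1
  have h2 : Dc (0:ℝ[X]) m = 0 := by simp [Dc]
  rw [h2] at h1
  linarith
end

section
open Topology Polynomial

variable {a b : ℝ} {P : ℕ → ℝ[X]}

/-- recurrence of the norms of the Jacobi polynomials -/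
lemma jac_norm (ha : -(1/2) < a) (hb : -(1/2) < b) (hP : OP (LW a b (fun _ => 0)) P) (k : ℕ) :
    LW a b (fun _ => 0) (P (k+2) * P (k+2)) = ((k+2) * (2*k+2*a+3) * (2*k+2*b+3) * (k+1+a+b) /
      ((2*k+2+a+b) * (2*k+3+a+b)^2 * (2*k+4+a+b))) * LW a b (fun _ => 0) (P (k+1) * P (k+1)) := by
  set L := LW a b (fun _ => 0)
  have hk : (0:ℝ) ≤ k := by positivity
  have p1 : 2*k+2+a+b ≠ 0 := by linarith
  have p2 : 2*k+3+a+b ≠ 0 := by linarith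
  have p3 : 2*k+4+a+b ≠ 0 := by linarith
  have p4 : 2*k+5+a+b ≠ 0 := by linarith
  have u1 := jac_rec ha hb hP (k+2) (k+1)
  have v1 := jac_rec ha hb hP (k+2) k
  have u2 := jac_rec ha hb hP (k+3) (k+2)
  have v2 := jac_rec ha hb hP (k+3) (k+1)
  obtain ⟨t1, t1'⟩ := Dc_top hP (k+1)
  obtain ⟨t2, t2'⟩ := Dc_top hP (k+2)
  obtain ⟨t3, t3'⟩ := Dc_top hP (k+3)
  simp only [show k+1+1 = k+2 from rfl, show k+2+1 = k+3 from rfl, t2, t3] at u1 v1 u2 v2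
  push_cast at u1 v1 u2 v2
  have U1 : Dc (P (k+2)) (k+1) = (k+2)*(2*k+2*a+3)/(2*k+3+a+b) := by
    rw [eq_div_iff p2]; linear_combination -u1
  have U2 : Dc (P (k+3)) (k+2) = (k+3)*(2*k+2*a+5)/(2*k+5+a+b) := by
    rw [eq_div_iff p4]; linear_combination -u2
  have V1 : Dc (P (k+2)) k = (k+1)*(2*k+2*a+1)*Dc (P (k+2)) (k+1)/(2*(2*k+2+a+b)) := by
    rw [eq_div_iff (by positivity)]; linear_combination -v1
  have V2 : Dc (P (k+3)) (k+1) = (k+2)*(2*k+2*a+3)*Dc (P (k+3)) (k+2)/(2*(2*k+4+a+b)) := by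
    rw [eq_div_iff (by positivity)]; linear_combination -v2
  set A := Dc (P (k+2)) (k+1) - Dc (P (k+3)) (k+2) with hA
  set B := Dc (P (k+2)) k - Dc (P (k+3)) (k+1) - A * Dc (P (k+2)) (k+1) with hB
  have hBv : B = ((k+2) * (2*k+2*a+3) * (2*k+2*b+3) * (k+1+a+b) / ((2*k+2+a+b) * (2*k+3+a+b)^2 * (2*k+4+a+b))) := by
    rw [hB, hA, V1, V2, U1, U2]
    obtain ⟨x, rfl⟩ : ∃ x, b = x - (2*k+2+a) := ⟨2*k+2+a+b, by ring⟩
    have e0 : 2*k+2+a+(x - (2*k+2+a)) = x := by ring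
    have e1 : 2*k+3+a+(x - (2*k+2+a)) = x+1 := by ring
    have e2 : 2*k+4+a+(x - (2*k+2+a)) = x+2 := by ring
    have e3 : 2*k+5+a+(x - (2*k+2+a)) = x+3 := by ring
    rw [e0] at p1 ⊢; rw [e1] at p2 ⊢; rw [e2] at p3 ⊢; rw [e3] at p4 ⊢
    field_simp; ring
  rw [← hBv]
  set E := ((X - C 1) * P (k+2) + C (-1) * P (k+3)) + C (-A) * P (k+2) with hE
  have hEd : (E + C (-B) * P (k+1)).degree < (k+1 : ℕ) := deg_Dc.mpr fun m hm => by
    obtain ⟨j, rfl⟩ : ∃ j, m = j + 1 := ⟨m-1, by omega⟩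
    rw [hE, Dc_sub, Dc_sub, Dc_sub, Dc_Xsub]
    rcases (by omega : j = k ∨ j = k+1 ∨ k+2 ≤ j) with rfl | rfl | h
    · rw [t1, hB]; ring
    · rw [t1' _ (by omega), t2, hA]; ring
    · rw [t1' _ (by omega), t2' (j+1) (by omega)]
      rcases h.eq_or_lt with rfl | h
      · rw [t2, t3]; ring
      · rw [t2' _ h, t3' _ (by omega)]; ring
  obtain ⟨m1, d1, o1⟩ := hP (k+1)
  obtain ⟨m2, d2, o2⟩ := hP (k+2)
  obtain ⟨m3, d3, o3⟩ := hP (k+3)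
  have dg : (P (k+1)).degree = (k+1:ℕ) := by rw [degree_eq_natDegree m1.ne_zero, d1]
  have z1 := o1 _ hEd
  have z2 : L (P (k+2) * P (k+1)) = 0 := o2 _ (by rw [dg]; exact_mod_cast (by omega : k+1 < k+2))
  have z3 : L (P (k+3) * P (k+1)) = 0 := o3 _ (by rw [dg]; exact_mod_cast (by omega : k+1 < k+3))
  have z4 := o2 _ (degm ((monic_X_sub_C (1:ℝ)).mul m1) m2 (by rw [(monic_X_sub_C (1:ℝ)).natDegree_mul m1, natDegree_X_sub_C, d1]; omega) d2)
  have e : P (k+1) * (E + C (-B) * P (k+1)) = P (k+2) * ((X - C 1) * P (k+1) - P (k+2)) + P (k+2) * P (k+2)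
     - P (k+3) * P (k+1) - A • (P (k+2) * P (k+1)) - B • (P (k+1) * P (k+1)) := by
    rw [hE, smul_eq_C_mul, smul_eq_C_mul]; simp only [map_neg, C_1]; ring
  rw [e, map_sub, map_sub, map_sub, map_add, z4, z3, map_smul, z2, map_smul, smul_eq_mul, smul_eq_mul] at z1
  linarith

lemma jac_c (ha : -(1/2) < a) (hb : -(1/2) < b) (hP : OP (LW a b (fun _ => 0)) P) {κ : ℕ → ℝ} {c : ℝ}
    (hκ : ∀ᶠ n in atTop, LW a b (fun _ => 0) (P n * P n) = 2 * Real.pi * ((2⁻¹) ^ n) ^ 2 * κ n) (hA : AE κ) (h1 : Tendsto κ atTop (𝓝 1))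
    (hc : Tendsto (fun n : ℕ => (n:ℝ) * (κ n - 1)) atTop (𝓝 c)) : c = ((a - 1/2)^2 + (b - 1/2)^2)/2 - 1/4 := by
  have i0 := AE.inv_tendsto
  have l1 : Tendsto (fun n : ℕ => (n:ℝ)^2 * (κ (n+1) - κ n)) atTop (𝓝 (-c)) := by
    have q1 := diff_lim (hA.mul_n h1)
    have q2 : Tendsto (fun n : ℕ => 1 - ((n+1 : ℕ) : ℝ)⁻¹) atTop (𝓝 (1 - 0)) :=
      tendsto_const_nhds.sub (i0.comp (tendsto_add_atTop_nat 1))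
    have := q1.sub (q2.mul (hc.comp (tendsto_add_atTop_nat 1)))
    rw [sub_zero, one_mul, zero_sub] at this
    refine this.congr' ?_
    filter_upwards [nat_ev] with n hn
    simp only [Function.comp, smul_eq_mul]; push_cast; field_simp; ring
  have m2 : Tendsto (fun n : ℕ => 2 + (a+b+1) * (n:ℝ)⁻¹) atTop (𝓝 2) := by simpa using (tendsto_const_nhds (x := (2:ℝ))).add (i0.const_mul (a+b+1))
  have l2 : Tendsto (fun n : ℕ => ((1 - (a+b-1)^2 - (a-b)^2) * (2 + (a+b+1) * (n:ℝ)⁻¹)^2 + (a+b-1)^2*(a-b)^2*((n:ℝ)⁻¹)^2)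
      / (((2 + (a+b+1) * (n:ℝ)⁻¹)^2 - ((n:ℝ)⁻¹)^2) * (2 + (a+b+1) * (n:ℝ)⁻¹)^2) * κ n) atTop
      (𝓝 (((1 - (a+b-1)^2 - (a-b)^2) * 2^2 + (a+b-1)^2*(a-b)^2*0^2) / ((2^2 - 0^2) * 2^2) * 1)) :=
    ((((m2.pow 2).const_mul _).add ((i0.pow 2).const_mul _)).div (((m2.pow 2).sub (i0.pow 2)).mul (m2.pow 2)) (by norm_num)).mul h1
  have := tendsto_nhds_unique l1 (l2.congr' ?_)
  · nlinarith
  filter_upwards [hκ, (tendsto_add_atTop_nat 1).eventually hκ, eventually_ge_atTop 1] with n k1 k2 hn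
  obtain ⟨k, rfl⟩ : ∃ k, n = k + 1 := ⟨n-1, by omega⟩
  have hk : (0:ℝ) ≤ k := by positivity
  have h := jac_norm ha hb hP k
  rw [k1, k2] at h
  have p1 : 2*k+2+a+b ≠ 0 := by linarith
  have p2 : 2*k+3+a+b ≠ 0 := by linarith
  have p3 : 2*k+4+a+b ≠ 0 := by linarith
  have pp := Real.pi_ne_zero
  have h' : κ (k+1+1) = 4 * ((k+2) * (2*k+2*a+3) * (2*k+2*b+3) * (k+1+a+b) / ((2*k+2+a+b) * (2*k+3+a+b)^2 * (2*k+4+a+b))) * κ (k+1) := by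
    have : (2 * Real.pi * ((2⁻¹) ^ (k+1)) ^ 2) ≠ 0 := by positivity
    apply mul_left_cancel₀ this
    rw [pow_succ (2⁻¹ : ℝ) (k+1)] at h
    linear_combination 4 * h
  have hn : ((k:ℝ)+1) ≠ 0 := by positivity
  have q1 : 2 + (a+b+1) * ((k:ℝ)+1)⁻¹ = (2*k+3+a+b) / (k+1) := by field_simp; ring
  have q2 : ((2*k+3+a+b) / ((k:ℝ)+1))^2 - (((k:ℝ)+1)⁻¹)^2 = (2*k+2+a+b)*(2*k+4+a+b)/((k:ℝ)+1)^2 := by field_simp; ring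
  rw [h']; push_cast
  rw [q1, q2]
  obtain ⟨x, rfl⟩ : ∃ x, b = x - (2*k+2+a) := ⟨2*k+2+a+b, by ring⟩
  have e0 : 2*k+2+a+(x - (2*k+2+a)) = x := by ring
  have e1 : 2*k+3+a+(x - (2*k+2+a)) = x+1 := by ring
  have e2 : 2*k+4+a+(x - (2*k+2+a)) = x+2 := by ring
  rw [e0] at p1 ⊢; rw [e1] at p2 ⊢; rw [e2] at p3 ⊢
  field_simp; ring

lemma jac_ratio (ha : -(1/2) < a) (hb : -(1/2) < b) (hP : OP (LW a b (fun _ => 0)) P) {n : ℕ} (hn : 1 ≤ n) :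
    Dc (P n) 0 ≠ 0 ∧ Dc (P (n+1)) 0 = (2*n+2*a+1)*(n+a+b)/((2*n+a+b)*(2*n+a+b+1)) * Dc (P n) 0 := by
  have hn' : (1:ℝ) ≤ n := by exact_mod_cast hn
  have t := (Dc_top hP n).1
  have t' := (Dc_top hP (n+1)).1
  constructor
  · intro h0
    have : ∀ m, Dc (P n) m = 0 := fun m => by
      induction m with
      | zero => exact h0
      | succ m ih =>
        have := jac_rec ha hb hP n m
        rw [ih, mul_zero] at this
        have hm : (0:ℝ) ≤ m := by positivity
        exact (mul_eq_zero.mp this).resolve_left (mul_ne_zero (by positivity) (by linarith))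
    rw [this] at t; exact zero_ne_one t
  · have p1 : 2*n+a+b ≠ 0 := by linarith
    have p2 : 2*n+a+b+1 ≠ 0 := by linarith
    set K := (n+1)*(2*n+2*a+1)/((2*n+a+b)*(2*n+a+b+1)) with hK
    have key : ((n:ℝ)+1-(0:ℕ)) * Dc (P (n+1)) 0 = K * (n+(0:ℕ)+a+b) * Dc (P n) 0 := by
      refine Nat.decreasingInduction (motive := fun m _ => ((n:ℝ)+1-m) * Dc (P (n+1)) m = K * (n+m+a+b) * Dc (P n) m)
        (fun m hm ih => ?_) ?_ (Nat.zero_le n)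
      · have r1 := jac_rec ha hb hP n m
        have r2 := jac_rec ha hb hP (n+1) m
        have hm' : (m:ℝ) < n := by exact_mod_cast hm
        have hm0 : (0:ℝ) ≤ m := by positivity
        have c1 : ((n:ℝ) - m) * (n+1+m+a+b) ≠ 0 := mul_ne_zero (by linarith) (by linarith)
        apply mul_left_cancel₀ c1
        push_cast at ih r2
        linear_combination ((m:ℝ)+1)*(2*m+2*a+1)*ih - (n-m)*r2 + K*(n+m+1+a+b)*r1
      · have r2 := jac_rec ha hb hP (n+1) n
        rw [t'] at r2; push_cast at r2
        rw [t, hK, show ((n:ℝ)+1)*(2*n+2*a+1)/((2*n+a+b)*(2*n+a+b+1)) * (n+n+a+b) = (n+1)*(2*n+2*a+1)/(2*n+a+b+1) by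
          rw [show (n:ℝ)+n+a+b = 2*n+a+b by ring, div_mul_eq_mul_div, mul_comm (2*n+a+b), mul_div_mul_right _ _ p1]]
        rw [mul_one, eq_div_iff p2]; linear_combination -r2
    have : (n:ℝ)+1 ≠ 0 := by positivity
    apply mul_left_cancel₀ this
    push_cast at key
    rw [sub_zero, add_zero] at key
    rw [key, hK]; field_simp

lemma lim_ne {f r : ℕ → ℝ} {c : ℝ} (hf : Tendsto f atTop (𝓝 c)) (h0 : ∀ᶠ n in atTop, f n ≠ 0) (hr : AE r) (h1 : Tendsto r atTop (𝓝 1))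
    (h2 : Tendsto (fun n : ℕ => (n:ℝ) * (r n - 1)) atTop (𝓝 0)) (h : ∀ᶠ n in atTop, f (n+1) = r n * f n) : c ≠ 0 := by
  have hb : (fun n => r n - 1) =O[atTop] (fun n : ℕ => ((n:ℝ)^2)⁻¹) := by
    obtain ⟨d, hd⟩ := ((hr.mul_n h1).mul_n (L := 0) (by simpa using h2)).exists_tendsto
    have := (hd.isBigO_one ℝ).mul (Asymptotics.isBigO_refl (fun n : ℕ => ((n:ℝ)^2)⁻¹) atTop)
    refine this.congr' ?_ (by simp)
    filter_upwards [nat_ev] with n hn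
    simp only [smul_eq_mul, sub_zero]; field_simp
  have hs : Summable fun n => r n - 1 := summable_of_isBigO_nat (Real.summable_nat_pow_inv.mpr (by norm_num)) hb
  have hl := Real.summable_log_one_add_of_summable hs
  obtain ⟨N, hN⟩ := eventually_atTop.mp (h0.and (h.and (h1.eventually (lt_mem_nhds (zero_lt_one)))))
  have ht := ((summable_nat_add_iff N).mpr hl).hasSum.tendsto_sum_nat
  have e : ∀ n, |f (n+N)| = |f N| * Real.exp (∑ i ∈ Finset.range n, Real.log (1 + (r (i+N) - 1))) := fun n => by
    induction n with
    | zero => simp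
    | succ n ih =>
      have := hN (n+N) (by omega)
      rw [Finset.sum_range_succ, Real.exp_add, ← mul_assoc, ← ih, show n+1+N = n+N+1 by ring, this.2.1, add_sub_cancel, Real.exp_log this.2.2, abs_mul, abs_of_pos this.2.2, mul_comm]
  have l := ((Real.continuous_exp.tendsto _).comp ht).const_mul |f N|
  have l' := (hf.comp (tendsto_add_atTop_nat N)).abs
  have := tendsto_nhds_unique l' (l.congr fun n => (e n).symm)
  rw [← abs_pos, this]
  exact mul_pos (abs_pos.mpr (hN N le_rfl).1) (Real.exp_pos _)

lemma jac_EU (ha : -(1/2) < a) (hb : -(1/2) < b) (hP : OP (LW a b (fun _ => 0)) P) {c : ℕ → ℝ}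
    (hc : ∀ m, Tendsto (sA a P m) atTop (𝓝 (c m))) : ∀ m, c m ≠ 0 := by
  have i0 := AE.inv_tendsto
  intro m
  induction m with
  | zero =>
    obtain ⟨i1, i2, i3⟩ := inv_rpow (-a)
    set u : ℕ → ℝ := fun n => (2+(2*a+1)*(n:ℝ)⁻¹)*(2+2*(a+b)*(n:ℝ)⁻¹)/((2+(a+b)*(n:ℝ)⁻¹)*(2+(a+b+1)*(n:ℝ)⁻¹)) with hu
    have lin : ∀ s : ℝ, AE (fun n : ℕ => 2 + s * (n:ℝ)⁻¹) ∧ Tendsto (fun n : ℕ => 2 + s * (n:ℝ)⁻¹) atTop (𝓝 2) := fun s =>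
      ⟨(AE.const 2).add ((AE.const s).mul AE.invn), by simpa using (tendsto_const_nhds (x := (2:ℝ))).add (i0.const_mul s)⟩
    have hd := (lin (a+b)).2.mul (lin (a+b+1)).2
    have uA : AE u := ((lin _).1.mul (lin _).1).div ((lin _).1.mul (lin _).1) hd (by norm_num)
    have u1 : Tendsto u atTop (𝓝 1) := by
      have := ((lin (2*a+1)).2.mul (lin (2*(a+b))).2).div hd (by norm_num)
      rwa [div_self (by norm_num)] at this
    have u2 : Tendsto (fun n : ℕ => (n:ℝ) * (u n - 1)) atTop (𝓝 a) := by
      have := ((tendsto_const_nhds (x := 4*a)).add (i0.const_mul ((a+b)*(4*a+1-(a+b))))).div hd (by norm_num)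
      rw [mul_zero, add_zero, show 4*a/(2*2) = a by ring] at this
      refine this.congr' ?_
      filter_upwards [nat_ev, hd.eventually_ne (by norm_num : (2*2:ℝ) ≠ 0)] with n hn hne
      rw [hu]; beta_reduce
      simp only [Pi.div_apply]
      rw [div_sub_one hne, ← mul_div_assoc]
      congr 1; field_simp; ring
    refine lim_ne (hc 0) ?_ (uA.mul i1) (by simpa using u1.mul i2) ?_ ?_
    · filter_upwards [eventually_ge_atTop 1] with n hn
      have h := (jac_ratio ha hb hP hn).1
      have hn' : (0:ℝ) < n := by exact_mod_cast hn
      rw [sA]; positivity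
    · have := (u2.mul i2).add i3
      rw [mul_one, add_neg_cancel] at this
      exact this.congr fun n => by ring
    · filter_upwards [eventually_ge_atTop 1] with n hn
      have h := (jac_ratio ha hb hP hn).2
      have hn' : (1:ℝ) ≤ n := by exact_mod_cast hn
      have hn0 : (0:ℝ) < n := by linarith
      have p1 : 2*n+a+b ≠ 0 := by linarith
      have p2 : 2*n+a+b+1 ≠ 0 := by linarith
      have hu' : u n = 2 * ((2*n+2*a+1)*(n+a+b)/((2*n+a+b)*(2*n+a+b+1))) := by
        have q1 : 2+(a+b)*(n:ℝ)⁻¹ = (2*n+a+b)/n := by field_simp; ring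
        have q2 : 2+(a+b+1)*(n:ℝ)⁻¹ = (2*n+a+b+1)/n := by field_simp; ring
        rw [hu]; beta_reduce; rw [q1, q2]; field_simp; ring
      rw [sA, sA, h, rpow_shift hn0, hu']; simp only [mul_zero, pow_zero]; ring
  | succ m ih =>
    intro h0
    have l1 := (hc (m+1)).const_mul ((m+1)*(2*m+2*a+1))
    have l2 := (((tendsto_const_nhds (x := (1:ℝ))).add (i0.const_mul (a+b))).sub ((i0.pow 2).const_mul (m*(m+a+b)))).mul (hc m)
    have := tendsto_nhds_unique l1 (l2.congr' ?_)
    · rw [h0] at this; apply ih; simpa using this.symm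
    filter_upwards [nat_ev] with n hn
    have h := jac_rec ha hb hP n m
    rw [sA, sA, show 2*(m+1) = 2*m+2 by ring, pow_add]
    have e : ((n:ℝ)⁻¹)^2 * (n * (n+a+b) - m*(m+a+b)) = 1 + (a+b)*(n:ℝ)⁻¹ - m*(m+a+b)*((n:ℝ)⁻¹)^2 := by field_simp; ring
    linear_combination (-(2^n * (n:ℝ)^(-a) * ((n:ℝ)⁻¹)^(2*m) * Dc (P n) m)) * e - 2^n * (n:ℝ)^(-a) * ((n:ℝ)⁻¹)^(2*m) * ((n:ℝ)⁻¹)^2 * h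
end

section
open Topology Polynomial

variable {a b R : ℝ} {S : ℂ → ℂ} {P : ℕ → ℝ[X]}

def KA (a b : ℝ) (S : ℂ → ℂ) (P : ℕ → ℝ[X]) : Prop :=
  ∃ κ : ℕ → ℝ, (∀ᶠ n in atTop, LW a b S (P n * P n) = 2 * Real.pi * ((2⁻¹) ^ n * Real.exp (S 0).re) ^ 2 * κ n) ∧
    AE κ ∧ Tendsto κ atTop (𝓝 1) ∧ Tendsto (fun n : ℕ => (n:ℝ) * (κ n - 1)) atTop (𝓝 (((a - 1/2)^2 + (b - 1/2)^2)/2 - 1/4))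

def GG (a b : ℝ) (S : ℂ → ℂ) : Prop := ∀ P, OP (LW a b S) P → KA a b S P ∧ TA a P ∧ TA b (rf P)

lemma SData.refl (hS : SData S R) : SData (fun z => S (-z)) R where
  one_lt := hS.one_lt
  diff := hS.diff.comp differentiable_neg.differentiableOn (fun z hz => by simpa using hz)
  conj z hz := by rw [← hS.conj _ (by simpa using hz), map_neg]

lemma rf_op (hS : SData S R) (ha : -(1/2) < a) (hb : -(1/2) < b) (hP : OP (LW a b S) P) : OP (LW b a (fun z => S (-z))) (rf P) := by
  intro n
  obtain ⟨h1, h2, h3⟩ := hP n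
  have hm : (rf P n).Monic := by
    have := h1.neg_one_pow_natDegree_mul_comp_neg_X
    rw [h2] at this; simpa [rf] using this
  have hd : (rf P n).degree = n := by
    rw [rf, degree_C_mul (by simp), degree_comp_neg_X, degree_eq_natDegree h1.ne_zero, h2]
  refine ⟨hm, natDegree_eq_of_degree_eq_some hd, fun Q hQ => ?_⟩
  rw [LW_refl hS hS.refl ha hb, rf, mul_assoc, mul_comp, C_comp, mul_comp, comp_neg_X_comp_neg_X, ← smul_eq_C_mul, map_smul,
    h3 _ (by rwa [degree_comp_neg_X]), smul_zero]

lemma rf_rf (P : ℕ → ℝ[X]) : rf (rf P) = P := by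
  funext n
  rw [rf, rf, mul_comp, C_comp, comp_neg_X_comp_neg_X, ← mul_assoc, ← C_mul, ← mul_pow]; simp

lemma GG.refl (hS : SData S R) (ha : -(1/2) < a) (hb : -(1/2) < b) (h : GG a b S) : GG b a (fun z => S (-z)) := by
  intro P hP
  have hQ := rf_op hS.refl hb ha hP
  simp only [neg_neg] at hQ
  obtain ⟨⟨κ, k1, k2, k3, k4⟩, h2, h3⟩ := h _ hQ
  rw [rf_rf] at h3
  refine ⟨⟨κ, ?_, k2, k3, by rwa [add_comm ((a - 1/2)^2)] at k4⟩, h3, h2⟩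
  filter_upwards [k1] with n hn
  rw [neg_zero, ← hn, LW_refl hS hS.refl ha hb, mul_comp]
  congr 1
  rw [rf, mul_mul_mul_comm, ← C_mul, ← mul_pow]; simp

lemma GG.step (hS : SData S R) (ha : -(1/2) < a) (hb : -(1/2) < b) (h : GG a b S) : GG (a+1) b S := by
  intro P' hP'
  obtain ⟨P, hP⟩ := op_exists (LW_PF hS ha hb)
  obtain ⟨⟨κ, k1, k2, k3, k4⟩, h2, h3⟩ := h _ hP
  obtain ⟨r, r1, r2, r3, r4, t1, t2⟩ := chr_step (LW_PF hS (by linarith) hb) hP hP' (LW_shift hS ha hb) h2 h3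
  refine ⟨⟨fun n => r n * κ n, ?_, r1.mul k2, by simpa using r2.mul k3, ?_⟩, t1, t2⟩
  · filter_upwards [k1, r4] with n e1 e2
    rw [e2, e1]; ring
  · have := (r3.mul k3).add k4
    rw [show a * 1 + (((a - 1/2)^2 + (b - 1/2)^2)/2 - 1/4) = (((a + 1 - 1/2)^2 + (b - 1/2)^2)/2 - 1/4) by ring] at this
    exact this.congr fun n => by ring

lemma base_half (ha : -(1/2) < a) (hb : -(1/2) < b) (ha1 : a ≤ 1) (hb1 : b ≤ 1) (hS : SData S R) (hP : OP (LW a b S) P) :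
    KA a b S P ∧ TA a P := by
  have ho : ∀ {S : ℂ → ℂ} {R : ℝ} {P : ℕ → ℝ[X]}, SData S R → OP (LW a b S) P → ∀ n : ℕ, ∀ Q : ℝ[X], Q.degree < n →
      ∫ θ in Ioo 0 Real.pi, (P n).eval (Real.cos θ) * Q.eval (Real.cos θ) * ‖Fd a b S (cexp (I * θ))‖ ^ 2 = 0 := by
    intro S R P hS hP n Q hQ
    have := (hP n).2.2 Q hQ
    rw [LW_apply hS ha hb] at this
    simpa only [eval_mul] using this
  have hsq : ∀ {S : ℂ → ℂ} {R : ℝ} {P : ℕ → ℝ[X]}, SData S R → ∀ n, LW a b S (P n * P n) = ∫ θ in Ioo 0 Real.pi, (P n).eval (Real.cos θ) ^ 2 * ‖Fd a b S (cexp (I * θ))‖ ^ 2 := by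
    intro S R P hS n
    rw [LW_apply hS ha hb]; simp only [eval_mul, sq]
  obtain ⟨P0, hP0⟩ := op_exists (LW_PF S0 ha hb)
  obtain ⟨κ0, z1, z2, z3, z4, z5⟩ := base_all S0 ha hb ha1 hb1 (fun n => (hP0 n).1) (fun n => (hP0 n).2.1) (ho S0 hP0)
  have hc := jac_c ha hb hP0 (by filter_upwards [z1] with n hn; rw [hsq S0, hn]; simp) z2 z3 z4
  have hE := jac_EU ha hb hP0 (fun m => (z5 m).2)
  obtain ⟨κ, k1, k2, k3, k4, k5⟩ := base_all hS ha hb ha1 hb1 (fun n => (hP n).1) (fun n => (hP n).2.1) (ho hS hP)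
  rw [hc] at k4
  refine ⟨⟨κ, by filter_upwards [k1] with n hn; rw [hsq hS, hn], k2, k3, k4⟩, fun m => ⟨_, ?_, (k5 m).1, (k5 m).2⟩⟩
  exact mul_ne_zero (by positivity) (right_ne_zero_of_mul (hE m))

theorem GG.all (ha : -(1/2) < a) (hb : -(1/2) < b) (hS : SData S R) : GG a b S := by
  have h1 : ∀ (k : ℕ) (a b : ℝ) (S : ℂ → ℂ), SData S R → -(1/2) < a → -(1/2) < b → a ≤ k+1 → b ≤ 1 → GG a b S := by
    intro k
    induction k with
    | zero =>
      intro a b S hS ha hb ha1 hb1 P hP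
      rw [Nat.cast_zero, zero_add] at ha1
      obtain ⟨h1, h2⟩ := base_half ha hb ha1 hb1 hS hP
      exact ⟨h1, h2, (base_half hb ha hb1 ha1 hS.refl (rf_op hS ha hb hP)).2⟩
    | succ k ih =>
      intro a b S hS ha hb ha1 hb1
      rcases le_or_gt a (k+1) with h | h
      · exact ih a b S hS ha hb h hb1
      · have hk : (0:ℝ) ≤ k := by positivity
        push_cast at ha1
        have := GG.step hS (by linarith) hb (ih (a-1) b S hS (by linarith) hb (by linarith) hb1)
        rwa [sub_add_cancel] at this
  have h2 : ∀ (k : ℕ) (a b : ℝ) (S : ℂ → ℂ), SData S R → -(1/2) < a → -(1/2) < b → b ≤ k+1 → GG a b S := by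
    intro k
    induction k with
    | zero =>
      intro a b S hS ha hb hb1
      obtain ⟨k, hk⟩ := exists_nat_ge a
      exact h1 k a b S hS ha hb (by linarith) (by simpa using hb1)
    | succ k ih =>
      intro a b S hS ha hb hb1
      rcases le_or_gt b (k+1) with h | h
      · exact ih a b S hS ha hb h
      · have hk : (0:ℝ) ≤ k := by positivity
        push_cast at hb1
        have hb' : -(1/2) < b - 1 := by linarith
        have := GG.refl hS.refl hb ha ((by simpa using GG.step hS.refl hb' ha (GG.refl hS ha hb' (ih a (b-1) S hS ha hb' (by linarith))) : GG b a (fun z => S (-z))))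
        simpa only [neg_neg] using this
  obtain ⟨k, hk⟩ := exists_nat_ge b
  exact h2 k a b S hS ha hb (by linarith)
end

section
open Topology

lemma e_pow (θ : ℝ) (n : ℤ) : haveI : Fact (0 < 2 * Real.pi) := ⟨Real.two_pi_pos⟩
    fourier n (θ : AddCircle (2 * Real.pi)) = cexp (I * θ) ^ n := by
  rw [fourier_coe_apply, ← Complex.exp_int_mul]; congr 1; push_cast
  have : (Real.pi : ℂ) ≠ 0 := by exact_mod_cast Real.pi_ne_zero
  field_simp

theorem exists_S {U : Set ℂ} {h : ℂ → ℂ} (hU : IsOpen U) (hseg : ∀ x ∈ Icc (-1:ℝ) 1, (x:ℂ) ∈ U) (hd : DifferentiableOn ℂ h U)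
    (hre : ∀ z ∈ U, 0 < (h z).re) (him : ∀ x ∈ Icc (-1:ℝ) 1, (h x).im = 0) :
    ∃ (S : ℂ → ℂ) (R : ℝ), SData S R ∧ (∀ θ : ℝ, 2 * (S (cexp (I * θ))).re = Real.log (h (Real.cos θ)).re) ∧
      ∫ θ in (0:ℝ)..Real.pi, Real.log (h (Real.cos θ)).re = 2 * Real.pi * (S 0).re := by
  haveI : Fact (0 < 2 * Real.pi) := ⟨Real.two_pi_pos⟩
  have hpi : (Real.pi : ℂ) ≠ 0 := by exact_mod_cast Real.pi_ne_zero
  have hl : DifferentiableOn ℂ (fun z => Complex.log (h z)) U := hd.clog fun z hz => Or.inl (hre z hz)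
  have hcos : ∀ θ : ℝ, Real.cos θ ∈ Icc (-1:ℝ) 1 := fun θ => ⟨Real.neg_one_le_cos θ, Real.cos_le_one θ⟩
  have hlr : ∀ x ∈ Icc (-1:ℝ) 1, Complex.log (h x) = (Real.log (h x).re : ℝ) := fun x hx => by
    rw [Complex.ofReal_log (hre _ (hseg x hx)).le]; congr 1
    exact Complex.ext rfl (by simpa using him x hx)
  have hR1 : ∀ x : AddCircle (2 * Real.pi), (fourier 1 x).re ∈ Icc (-1:ℝ) 1 := fun x => by
    rw [fourier_apply]; exact abs_le.mp ((Complex.abs_re_le_norm _).trans (Circle.norm_coe _).le)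
  let f : C(AddCircle (2 * Real.pi), ℂ) := ⟨fun x => Complex.log (h ((fourier 1 x).re : ℝ)),
    hl.continuousOn.comp_continuous (by fun_prop) fun x => hseg _ (hR1 x)⟩
  have fv : ∀ θ : ℝ, f (θ : AddCircle (2 * Real.pi)) = (Real.log (h (Real.cos θ)).re : ℝ) := fun θ => by
    have : (fourier 1 (θ : AddCircle (2 * Real.pi))).re = Real.cos θ := by
      rw [e_pow, zpow_one, mul_comm, Complex.exp_mul_I, ← Complex.ofReal_cos, ← Complex.ofReal_sin, Complex.add_re, Complex.ofReal_re, Complex.re_ofReal_mul, Complex.I_re, mul_zero, add_zero]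
    change Complex.log (h ((fourier 1 (θ : AddCircle (2 * Real.pi))).re : ℝ)) = _
    rw [this, hlr _ (hcos θ)]
  have hsym : ∀ n, fourierCoeff f (-n) = fourierCoeff f n := fun n => by
    rw [fourierCoeff, fourierCoeff, ← integral_neg_eq_self]
    congr 1; funext t
    induction t using QuotientAddGroup.induction_on with | _ θ
    rw [show -((θ : ℝ) : AddCircle (2 * Real.pi)) = ((-θ : ℝ) : AddCircle (2 * Real.pi)) from rfl, fv, fv, e_pow, e_pow, Real.cos_neg]
    push_cast; rw [mul_neg, Complex.exp_neg, neg_neg, inv_zpow, zpow_neg]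
  have hconj : ∀ n, starRingEnd ℂ (fourierCoeff f n) = fourierCoeff f n := fun n => by
    refine Eq.trans ?_ (hsym n)
    unfold fourierCoeff
    rw [← integral_conj]
    congr 1; funext t
    rw [smul_eq_mul, smul_eq_mul, map_mul, ← fourier_neg]; congr 1
    induction t using QuotientAddGroup.induction_on with | _ θ
    rw [fv, Complex.conj_ofReal]
  -- exponential decay
  obtain ⟨M, R, hR, hM⟩ : ∃ M R : ℝ, 1 < R ∧ ∀ n : ℕ, ‖fourierCoeff f n‖ ≤ M * (R⁻¹) ^ n := by
    have Jc : ContinuousOn (fun z : ℂ => (z + z⁻¹) / 2) {0}ᶜ := ((continuousOn_id.add continuousOn_inv₀).div_const _)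
    have hJ : ∀ θ : ℝ, (cexp (I * θ) + (cexp (I * θ))⁻¹) / 2 = (Real.cos θ : ℝ) := fun θ => by
      rw [← Complex.exp_neg, Complex.ofReal_cos, Complex.cos, mul_comm I, neg_mul]
    obtain ⟨δ, δ0, hδ⟩ := (isCompact_sphere (0:ℂ) 1).exists_cthickening_subset_open (Jc.isOpen_inter_preimage isOpen_compl_singleton hU) (by
      intro z hz
      have hz' : ‖z‖ = 1 := by simpa using hz
      refine ⟨by rintro rfl; simp at hz', ?_⟩
      have : z = cexp (I * z.arg) := by nth_rewrite 1 [← Complex.norm_mul_exp_arg_mul_I z]; rw [hz']; simp [mul_comm]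
      rw [mem_preimage, this, hJ]; exact hseg _ (hcos _))
    have hV : ∀ z ∈ Metric.closedBall (0:ℂ) (1+δ) \ Metric.ball 0 1, z ≠ 0 ∧ (z + z⁻¹) / 2 ∈ U := by
      rintro z ⟨h1, h2⟩
      rw [mem_closedBall_zero_iff] at h1
      rw [mem_ball_zero_iff, not_lt] at h2
      have h0 : ‖z‖ ≠ 0 := by linarith
      refine hδ (Metric.mem_cthickening_of_dist_le z (z / ‖z‖) δ _ (by simp [h0]) ?_)
      rw [dist_eq_norm, show z - z / ‖z‖ = (z / ‖z‖) * ((‖z‖ - 1 : ℝ) : ℂ) by push_cast; have : (‖z‖:ℂ) ≠ 0 := by exact_mod_cast h0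
                                                                              field_simp, norm_mul, norm_div, Complex.norm_real, norm_norm, div_self h0, Complex.norm_real,
        Real.norm_of_nonneg (by linarith)]
      linarith
    have hd2 : ∀ z ∈ Metric.closedBall (0:ℂ) (1+δ) \ Metric.ball 0 1, DifferentiableAt ℂ (fun z => Complex.log (h ((z + z⁻¹) / 2))) z := fun z hz => by
      have h1 : DifferentiableAt ℂ (fun z : ℂ => (z + z⁻¹) / 2) z := (differentiableAt_id.add (differentiableAt_inv (hV z hz).1)).div_const 2
      exact DifferentiableAt.comp (g := fun z => Complex.log (h z)) z ((hl _ (hV z hz).2).differentiableAt (hU.mem_nhds (hV z hz).2)) h1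
    have hK : IsCompact (Metric.closedBall (0:ℂ) (1+δ) \ Metric.ball 0 1) := (isCompact_closedBall _ _).diff Metric.isOpen_ball
    obtain ⟨M, hM⟩ := hK.exists_bound_of_continuousOn (fun z hz => (hd2 z hz).continuousAt.continuousWithinAt)
    refine ⟨M, 1+δ, by linarith, fun n => ?_⟩
    have hG : ∀ z ∈ Metric.closedBall (0:ℂ) (1+δ) \ Metric.ball 0 1, DifferentiableAt ℂ (fun z => (z ^ (n+1))⁻¹ * Complex.log (h ((z + z⁻¹) / 2))) z :=
      fun z hz => ((differentiableAt_id.pow _).inv (pow_ne_zero _ (hV z hz).1)).mul (hd2 z hz)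
    have e := circleIntegral_eq_of_differentiable_on_annulus_off_countable one_pos (by linarith : 1 ≤ 1+δ) countable_empty
      (fun z hz => (hG z hz).continuousAt.continuousWithinAt) (fun z hz => hG z ⟨Metric.ball_subset_closedBall hz.1.1, fun h' => hz.1.2 (Metric.ball_subset_closedBall h')⟩)
    have hc : fourierCoeff f n = (2 * Real.pi * I : ℂ)⁻¹ • ∮ z in C(0, 1), (z ^ (n+1))⁻¹ * Complex.log (h ((z + z⁻¹) / 2)) := by
      rw [fourierCoeff_eq_intervalIntegral f n 0, circleIntegral, zero_add, ← Complex.coe_smul, mul_inv, smul_eq_mul, smul_eq_mul, ← intervalIntegral.integral_const_mul, ← intervalIntegral.integral_const_mul]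
      refine intervalIntegral.integral_congr fun θ _ => ?_
      have hz : circleMap 0 1 θ = cexp (I * θ) := by rw [circleMap, mul_comm I]; simp
      have h0 := Complex.exp_ne_zero (I * θ)
      beta_reduce
      rw [deriv_circleMap, hz, hJ, hlr _ (hcos θ), fv, e_pow, zpow_neg, zpow_natCast]
      simp only [smul_eq_mul]; push_cast; field_simp; ring
    rw [hc, ← e]
    refine (circleIntegral.norm_two_pi_i_inv_smul_integral_le_of_norm_le_const (by linarith) (C := M * ((1+δ)⁻¹) ^ (n+1)) fun z hz => ?_).trans (le_of_eq ?_)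
    · have hz' : ‖z‖ = 1+δ := by simpa using hz
      have := hM z ⟨by simp [hz'], by simp [hz', δ0.le]⟩
      rw [norm_mul, norm_inv, norm_pow, hz', mul_comm, inv_pow]
      gcongr
    · rw [pow_succ]; field_simp
  have hM0 : 0 ≤ M := by simpa using (norm_nonneg _).trans (hM 0)
  set R' := (1 + R) / 2 with hR'
  have hq : R' * R⁻¹ < 1 := by rw [← div_eq_mul_inv, div_lt_one (by linarith)]; linarith
  have hq0 : 0 ≤ R' * R⁻¹ := by positivity
  set c : ℕ → ℂ := fun n => fourierCoeff f n with hcdef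
  have hb : ∀ n, ∀ z ∈ Metric.ball (0:ℂ) R', ‖c n * z ^ n‖ ≤ M * (R' * R⁻¹) ^ n := fun n z hz => by
    rw [norm_mul, norm_pow, mul_comm R', mul_pow, ← mul_assoc]
    have : ‖z‖ ≤ R' := (mem_ball_zero_iff.mp hz).le
    exact mul_le_mul (hM n) (pow_le_pow_left₀ (norm_nonneg _) this _) (by positivity) (by positivity)
  have hs : Summable fun n => M * (R' * R⁻¹) ^ n := (summable_geometric_of_lt_one hq0 hq).mul_left M
  have hsz : ∀ z ∈ Metric.ball (0:ℂ) R', Summable fun n => c n * z ^ n := fun z hz => .of_norm_bounded hs fun n => hb n z hz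
  have hS0 : (∑' n, c n * (0:ℂ) ^ n) = c 0 := by
    rw [tsum_eq_single 0 fun n hn => by rw [zero_pow hn, mul_zero], pow_zero, mul_one]
  have c0 : c 0 = ((c 0).re : ℂ) := (Complex.conj_eq_iff_re.mp (hconj 0)).symm
  have hSc : ∀ z : ℂ, (∑' n, c n * (starRingEnd ℂ z) ^ n) - c 0 / 2 = starRingEnd ℂ ((∑' n, c n * z ^ n) - c 0 / 2) := fun z => by
    have h2 : starRingEnd ℂ (c 0) = c 0 := hconj 0
    rw [map_sub, map_div₀, h2, Complex.conj_tsum, Complex.conj_ofNat]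
    congr 2; funext n
    rw [map_mul, map_pow, show starRingEnd ℂ (c n) = c n from hconj n]
  refine ⟨fun z => (∑' n, c n * z ^ n) - c 0 / 2, R', ⟨by linarith, ?_, fun z _ => hSc z⟩, fun θ => ?_, ?_⟩
  · exact (differentiableOn_tsum_of_summable_norm hs (fun n => ((differentiable_id.pow n).const_mul _).differentiableOn) Metric.isOpen_ball (fun n z hz => hb n z hz)).sub_const _
  · have hnorm : ‖cexp (I * θ)‖ = 1 := by rw [mul_comm, Complex.norm_exp_ofReal_mul_I]
    have hin : cexp (I * θ) ∈ Metric.ball (0:ℂ) R' := by rw [mem_ball_zero_iff, hnorm]; linarith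
    have hin' : starRingEnd ℂ (cexp (I * θ)) ∈ Metric.ball (0:ℂ) R' := by simpa using hin
    have hinv : (cexp (I * θ))⁻¹ = starRingEnd ℂ (cexp (I * θ)) := Complex.inv_eq_conj hnorm
    have hsn : Summable fun n : ℕ => fourierCoeff f n := by simpa using hsz 1 (by rw [mem_ball_zero_iff, norm_one]; linarith)
    have hsum : Summable (fourierCoeff f) := Summable.of_nat_of_neg hsn (by simpa only [hsym] using hsn)
    have hp := (has_pointwise_sum_fourier_series_of_summable hsum (θ : AddCircle (2 * Real.pi))).nat_add_neg
    have h2 := hp.unique (((hsz _ hin).hasSum.add (hsz _ hin').hasSum).congr_fun fun n => by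
      rw [hsym, e_pow, e_pow, zpow_neg, ← inv_zpow, hinv, zpow_natCast, zpow_natCast]; rfl)
    rw [fv, e_pow, zpow_zero] at h2
    have h3 := hSc (cexp (I * θ))
    have h4 := congrArg Complex.re h2
    have h5 := congrArg Complex.re h3
    rw [Complex.conj_re] at h5
    simp only [Complex.add_re, Complex.sub_re, Complex.ofReal_re, smul_eq_mul, mul_one] at h4 h5 ⊢
    have h6 : (c 0 / 2).re = (c 0).re / 2 := by rw [c0]; norm_cast
    have h7 : (fourierCoeff f 0).re = (c 0).re := rfl
    linarith
  · beta_reduce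
    rw [hS0, show c 0 - c 0 / 2 = ((((c 0).re / 2 : ℝ)) : ℂ) by push_cast; rw [← c0]; ring, Complex.ofReal_re]
    have h1 : c 0 = _ := fourierCoeff_eq_intervalIntegral f 0 (-Real.pi)
    have h2 : ∀ θ : ℝ, fourier (-0) (θ : AddCircle (2 * Real.pi)) • f (θ : AddCircle (2 * Real.pi)) = ((Real.log (h (Real.cos θ)).re : ℝ) : ℂ) := fun θ => by
      rw [fv, neg_zero, fourier_zero, one_smul]
    simp only [h2] at h1
    rw [show -Real.pi + 2 * Real.pi = Real.pi by ring, intervalIntegral.integral_ofReal, ← Complex.coe_smul] at h1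
    have h3 := congrArg Complex.re h1
    rw [smul_eq_mul, ← Complex.ofReal_mul, Complex.ofReal_re] at h3
    have hcont : Continuous fun θ : ℝ => Real.log (h (Real.cos θ)).re := by
      have : Continuous fun θ : ℝ => (f (θ : AddCircle (2 * Real.pi))).re := Complex.continuous_re.comp (f.continuous.comp (AddCircle.continuous_mk' _))
      simpa only [fv, Complex.ofReal_re] using this
    rw [← intervalIntegral.integral_add_adjacent_intervals (hcont.intervalIntegrable _ 0) (hcont.intervalIntegrable _ _)] at h3
    have h4 := intervalIntegral.integral_comp_neg (a := 0) (b := Real.pi) fun θ : ℝ => Real.log (h (Real.cos θ)).re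
    simp only [Real.cos_neg, neg_zero] at h4
    rw [← h4] at h3
    have := Real.pi_ne_zero
    rw [h3]; field_simp; ring
end

section
open Topology

lemma cos_subst (g : ℝ → ℝ) : ∫ x in (-1:ℝ)..1, g x = ∫ θ in Ioo 0 Real.pi, Real.sin θ * g (Real.cos θ) := by
  have hi : Real.cos '' Ioo 0 Real.pi = Ioo (-1) 1 := by
    ext x; constructor
    · rintro ⟨θ, hθ, rfl⟩
      have h1 := Real.sin_pos_of_mem_Ioo hθ
      have h2 := Real.sin_sq_add_cos_sq θ
      constructor <;> nlinarith
    · rintro ⟨h1, h2⟩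
      refine ⟨Real.arccos x, ⟨Real.arccos_pos.mpr h2, ?_⟩, Real.cos_arccos h1.le h2.le⟩
      exact (Real.arccos_le_pi x).lt_of_ne fun h => by rw [Real.arccos_eq_pi] at h; linarith
  have := integral_image_eq_integral_abs_deriv_smul measurableSet_Ioo (fun θ _ => (Real.hasDerivAt_cos θ).hasDerivWithinAt)
    (Real.injOn_cos.mono Ioo_subset_Icc_self) g
  rw [hi] at this
  rw [intervalIntegral.integral_of_le (by norm_num), integral_Ioc_eq_integral_Ioo, this]
  refine setIntegral_congr_fun measurableSet_Ioo fun θ hθ => ?_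
  beta_reduce
  rw [abs_neg, abs_of_pos (Real.sin_pos_of_mem_Ioo hθ), smul_eq_mul]

lemma log_one_sub_cos : IntervalIntegrable (fun θ => Real.log (1 - Real.cos θ)) volume 0 Real.pi ∧
    ∫ θ in (0:ℝ)..Real.pi, Real.log (1 - Real.cos θ) = -(Real.pi * Real.log 2) := by
  have e : ∀ θ ∈ uIoo 0 Real.pi, Real.log 2 + 2 * Real.log (Real.sin (2⁻¹ * θ)) = Real.log (1 - Real.cos θ) := fun θ hθ => by
    rw [uIoo_of_le Real.pi_pos.le] at hθ
    have h1 : 0 < Real.sin (2⁻¹ * θ) := Real.sin_pos_of_pos_of_lt_pi (by linarith [hθ.1]) (by linarith [hθ.1, hθ.2])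
    have h2 : 1 - Real.cos θ = 2 * Real.sin (2⁻¹ * θ) ^ 2 := by
      have h3 := Real.cos_two_mul (2⁻¹ * θ)
      have h4 := Real.sin_sq_add_cos_sq (2⁻¹ * θ)
      rw [show 2 * (2⁻¹ * θ) = θ by ring] at h3
      linarith
    rw [h2, Real.log_mul two_ne_zero (by positivity), Real.log_pow]; norm_num
  have hi : IntervalIntegrable (fun θ => Real.log (Real.sin (2⁻¹ * θ))) volume 0 Real.pi := by
    have := (intervalIntegrable_log_sin (a := 0) (b := Real.pi / 2)).comp_mul_left (c := 2⁻¹)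
    rwa [zero_div, show Real.pi / 2 / 2⁻¹ = Real.pi by ring] at this
  have hi2 := (intervalIntegrable_const (c := Real.log 2) (μ := volume) (a := 0) (b := Real.pi)).add (hi.const_mul 2)
  refine ⟨hi2.congr_uIoo e, ?_⟩
  rw [← intervalIntegral.integral_congr_uIoo e, intervalIntegral.integral_add intervalIntegrable_const (hi.const_mul 2), intervalIntegral.integral_const_mul,
    intervalIntegral.integral_comp_mul_left (fun θ => Real.log (Real.sin θ)) (by norm_num : (2⁻¹:ℝ) ≠ 0), mul_zero,
    show 2⁻¹ * Real.pi = Real.pi / 2 by ring, integral_log_sin_zero_pi_div_two, intervalIntegral.integral_const]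
  simp only [smul_eq_mul, sub_zero, inv_inv]; ring

lemma log_one_add_cos : IntervalIntegrable (fun θ => Real.log (1 + Real.cos θ)) volume 0 Real.pi ∧
    ∫ θ in (0:ℝ)..Real.pi, Real.log (1 + Real.cos θ) = -(Real.pi * Real.log 2) := by
  have h1 := (log_one_sub_cos.1.comp_sub_left Real.pi).symm
  have h2 := intervalIntegral.integral_comp_sub_left (a := 0) (b := Real.pi) (fun θ => Real.log (1 - Real.cos θ)) Real.pi
  simp only [Real.cos_pi_sub, sub_neg_eq_add, sub_zero, sub_self] at h1 h2
  exact ⟨h1, h2.trans log_one_sub_cos.2⟩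
end

theorem stmt2
    (α β : ℝ) (hα : -1 < α) (hβ : -1 < β)
    (U : Set ℂ) (hUopen : IsOpen U) (hUseg : seg ⊆ U)
    (h : ℂ → ℂ) (hh : AnalyticOn ℂ h U)
    (hhre : ∀ z ∈ U, 0 < (h z).re)
    (hhreal : ∀ x ∈ Set.Icc (-1:ℝ) 1, (h (x:ℂ)).im = 0)
    (w : ℝ → ℝ)
    (hw : ∀ x ∈ Set.Ioo (-1:ℝ) 1, w x = (1 - x) ^ α * (1 + x) ^ β * (h (x:ℂ)).re)
    (P : ℕ → Polynomial ℝ)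
    (hPmonic : ∀ n, (P n).Monic)
    (hPdeg : ∀ n, (P n).natDegree = n)
    (hPorth : ∀ n, ∀ k < n, ∫ x in (-1:ℝ)..1, (P n).eval x * x ^ k * w x = 0)
    (γ : ℕ → ℝ)
    (hγ : ∀ n, γ n = (∫ x in (-1:ℝ)..1, (P n).eval x ^ 2 * w x) ^ (-(1/2) : ℝ))
    (hγpos : ∀ n, 0 < γ n)
    (Dinf : ℝ)
    (hDinf : Dinf = Real.exp ((1 / (2 * Real.pi)) *
      ∫ x in (-1:ℝ)..1, Real.log (w x) / Real.sqrt (1 - x ^ 2)))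
    :
    ∃ Γ : ℕ → ℝ,
      Γ 1 = -(4 * α ^ 2 - 1) / 16 - (4 * β ^ 2 - 1) / 16 ∧
      ∀ ℓ : ℕ, ∃ C > (0:ℝ), ∀ n : ℕ, 1 ≤ n →
        |Real.sqrt Real.pi * Dinf * (γ n / 2 ^ n)
          - (1 + ∑ k ∈ Finset.Icc 1 ℓ, Γ k / (n : ℝ) ^ k)|
        ≤ C / (n : ℝ) ^ (ℓ + 1) := by
  have hseg : ∀ x ∈ Icc (-1:ℝ) 1, (x:ℂ) ∈ U := fun x hx => hUseg ⟨x, hx, rfl⟩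
  obtain ⟨S, R, hS, hSre, hS0⟩ := exists_S hUopen hseg hh.differentiableOn hhre hhreal
  have hπ := Real.pi_pos
  have ha : -(1/2) < α + 1/2 := by linarith
  have hb : -(1/2) < β + 1/2 := by linarith
  have hcm : ∀ θ ∈ Ioo 0 Real.pi, 0 < Real.sin θ ∧ Real.cos θ ∈ Ioo (-1:ℝ) 1 := fun θ hθ => by
    have h1 := Real.sin_pos_of_mem_Ioo hθ
    have h2 := Real.sin_sq_add_cos_sq θ
    exact ⟨h1, by nlinarith, by nlinarith⟩
  have hhp : ∀ x ∈ Ioo (-1:ℝ) 1, 0 < (h (x:ℂ)).re := fun x hx => hhre _ (hseg x ⟨hx.1.le, hx.2.le⟩)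
  set A : ℝ := 2 ^ (α + β + 1) with hA
  have hA0 : 0 < A := by positivity
  have hLW : ∀ p : Polynomial ℝ, LW (α + 1/2) (β + 1/2) S p = A * ∫ x in (-1:ℝ)..1, p.eval x * w x := fun p => by
    rw [LW_apply hS ha hb, cos_subst, ← integral_const_mul]
    refine setIntegral_congr_fun measurableSet_Ioo fun θ hθ => ?_
    obtain ⟨hs, hx⟩ := hcm θ hθ
    have hsc := Real.sin_sq_add_cos_sq θ
    have hu : 0 < 1 - Real.cos θ := by linarith [hx.2]
    have hv : 0 < 1 + Real.cos θ := by linarith [hx.1]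
    beta_reduce
    have hsuv : (1 - Real.cos θ) ^ (1/2:ℝ) * (1 + Real.cos θ) ^ (1/2:ℝ) = Real.sin θ := by
      rw [← Real.mul_rpow hu.le hv.le, ← Real.sqrt_eq_rpow, show (1 - Real.cos θ) * (1 + Real.cos θ) = Real.sin θ ^ 2 by linarith, Real.sqrt_sq hs.le]
    have h2 : A = 2 ^ (α + 1/2) * 2 ^ (β + 1/2) := by rw [hA, ← Real.rpow_add two_pos]; congr 1; ring
    rw [Fd_sq, hSre, Real.exp_log (hhp _ hx), hw _ hx, Real.mul_rpow two_pos.le hu.le, Real.mul_rpow two_pos.le hv.le, Real.rpow_add hu, Real.rpow_add hv,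
      ← hsuv, h2]
    ring
  have hOP : OP (LW (α + 1/2) (β + 1/2) S) P := fun n => ⟨hPmonic n, hPdeg n, fun Q hQ => by
    have hQ' : Q = ∑ i ∈ Finset.range n, Polynomial.C (Q.coeff i) * Polynomial.X ^ i := by
      by_cases hz : Q = 0
      · simp [hz]
      · exact Q.as_sum_range_C_mul_X_pow' ((Polynomial.natDegree_lt_iff_degree_lt hz).mpr hQ)
    rw [hQ', Finset.mul_sum, map_sum]
    refine Finset.sum_eq_zero fun i hi => ?_
    rw [mul_left_comm, ← Polynomial.smul_eq_C_mul, map_smul, hLW]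
    simp only [Polynomial.eval_mul, Polynomial.eval_pow, Polynomial.eval_X]
    rw [hPorth n i (Finset.mem_range.mp hi), mul_zero, smul_zero]⟩
  obtain ⟨⟨κ, hκ, hκA, hκ1, hκn⟩, -, -⟩ := GG.all ha hb hS P hOP
  have hD : Real.pi * Dinf ^ 2 * A = 2 * Real.pi * Real.exp (S 0).re ^ 2 := by
    have h1 : ∫ x in (-1:ℝ)..1, Real.log (w x) / Real.sqrt (1 - x ^ 2) = 2 * Real.pi * (S 0).re - Real.pi * Real.log 2 * (α + β) := by
      have hcont : Continuous fun θ : ℝ => Real.log (h (Real.cos θ)).re := by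
        have : Continuous fun θ : ℝ => h (Real.cos θ) := hh.continuousOn.comp_continuous (by fun_prop) fun θ => hseg _ ⟨Real.neg_one_le_cos θ, Real.cos_le_one θ⟩
        exact (Complex.continuous_re.comp this).log fun θ => (hhre _ (hseg _ ⟨Real.neg_one_le_cos θ, Real.cos_le_one θ⟩)).ne'
      have e : ∫ θ in (0:ℝ)..Real.pi, (α * Real.log (1 - Real.cos θ) + β * Real.log (1 + Real.cos θ) + Real.log (h (Real.cos θ)).re) =
          2 * Real.pi * (S 0).re - Real.pi * Real.log 2 * (α + β) := by
        have i1 := log_one_sub_cos.1.const_mul α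
        have i2 := log_one_add_cos.1.const_mul β
        rw [intervalIntegral.integral_add (i1.add i2) (hcont.intervalIntegrable _ _), intervalIntegral.integral_add i1 i2, intervalIntegral.integral_const_mul,
          intervalIntegral.integral_const_mul, log_one_sub_cos.2, log_one_add_cos.2, hS0]
        ring
      rw [cos_subst, ← e, intervalIntegral.integral_of_le hπ.le, integral_Ioc_eq_integral_Ioo]
      refine setIntegral_congr_fun measurableSet_Ioo fun θ hθ => ?_
      obtain ⟨hs, hx⟩ := hcm θ hθ
      have hu : 0 < 1 - Real.cos θ := by linarith [hx.2]
      have hv : 0 < 1 + Real.cos θ := by linarith [hx.1]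
      have hp := hhp _ hx
      beta_reduce
      rw [show 1 - Real.cos θ ^ 2 = Real.sin θ ^ 2 by linarith [Real.sin_sq_add_cos_sq θ], Real.sqrt_sq hs.le, hw _ hx, Real.log_mul (by positivity) hp.ne',
        Real.log_mul (by positivity) (by positivity), Real.log_rpow hu, Real.log_rpow hv]
      field_simp
    have h2 : Dinf ^ 2 = Real.exp (S 0).re ^ 2 * 2 ^ (-(α + β)) := by
      rw [hDinf, h1, Real.rpow_def_of_pos two_pos, ← Real.exp_nat_mul, ← Real.exp_nat_mul, ← Real.exp_add]
      congr 1; push_cast; field_simp; ring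
    have h3 : (2:ℝ) ^ (-(α + β)) * A = 2 := by
      rw [hA, ← Real.rpow_add two_pos, show -(α + β) + (α + β + 1) = 1 by ring, Real.rpow_one]
    calc Real.pi * Dinf ^ 2 * A = Real.pi * Real.exp (S 0).re ^ 2 * (2 ^ (-(α + β)) * A) := by rw [h2]; ring
      _ = _ := by rw [h3]; ring
  have hD0 : 0 < Dinf := by rw [hDinf]; exact Real.exp_pos _
  have hev : (fun n => κ n ^ (-(1/2):ℝ)) =ᶠ[atTop] fun n => Real.sqrt Real.pi * Dinf * (γ n / 2 ^ n) := by
    filter_upwards [hκ, hκ1.eventually (lt_mem_nhds one_pos)] with n h1 h2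
    have hI : ∫ x in (-1:ℝ)..1, (P n).eval x ^ 2 * w x = (Real.sqrt Real.pi * Dinf * 2⁻¹ ^ n) ^ 2 * κ n := by
      rw [hLW] at h1
      simp only [Polynomial.eval_mul] at h1
      simp only [← sq] at h1
      refine mul_left_cancel₀ hA0.ne' (h1.trans ?_)
      rw [mul_pow, mul_pow, mul_pow, Real.sq_sqrt hπ.le]
      calc _ = 2 * Real.pi * Real.exp (S 0).re ^ 2 * ((2⁻¹ ^ n) ^ 2 * κ n) := by ring
        _ = _ := by rw [← hD]; ring
    have hc : 0 < Real.sqrt Real.pi * Dinf * 2⁻¹ ^ n := by positivity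
    have hc2 : ((Real.sqrt Real.pi * Dinf * 2⁻¹ ^ n) ^ 2) ^ (-(1/2):ℝ) = (Real.sqrt Real.pi * Dinf * 2⁻¹ ^ n)⁻¹ := by
      rw [Real.rpow_neg (by positivity), ← Real.sqrt_eq_rpow, Real.sqrt_sq hc.le]
    rw [hγ n, hI, Real.mul_rpow (by positivity) h2.le, hc2, inv_pow]
    have h5 : Real.sqrt Real.pi ≠ 0 := by positivity
    have h6 := hD0.ne'
    generalize κ n ^ (-(1/2):ℝ) = y
    field_simp
  obtain ⟨Γ, h0, h1, hΓ⟩ := (((hκA.rpow hκ1 one_pos (-(1/2))).congr' hev)).extract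
  have hy : Tendsto (fun n => κ n ^ (-(1/2):ℝ)) atTop (nhds 1) := by
    have := hκ1.rpow_const (p := -(1/2)) (Or.inl one_ne_zero)
    rwa [Real.one_rpow] at this
  have hΓ0 : Γ 0 = 1 := tendsto_nhds_unique h0 (hy.congr' hev)
  refine ⟨Γ, ?_, fun l => ?_⟩
  · refine tendsto_nhds_unique h1 ?_
    have h2 := ((hκn.mul (hy.pow 2)).neg).div (hy.add_const 1) (by norm_num)
    rw [show -(((((α + 1/2) - 1/2) ^ 2 + ((β + 1/2) - 1/2) ^ 2) / 2 - 1/4) * 1 ^ 2) / (1 + 1) = -(4 * α ^ 2 - 1) / 16 - (4 * β ^ 2 - 1) / 16 by ring] at h2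
    refine h2.congr' ?_
    filter_upwards [hev, hκ1.eventually (lt_mem_nhds one_pos)] with n h3 h4
    simp only [Pi.div_apply, Pi.neg_apply]
    rw [hΓ0, ← h3]
    have hyp : 0 < κ n ^ (-(1/2):ℝ) := by positivity
    have h5 : κ n * (κ n ^ (-(1/2):ℝ)) ^ 2 = 1 := by
      rw [← Real.rpow_natCast, ← Real.rpow_mul h4.le, show (-(1/2):ℝ) * ((2:ℕ):ℝ) = -1 by norm_num, Real.rpow_neg_one, mul_inv_cancel₀ h4.ne']
    generalize κ n ^ (-(1/2):ℝ) = y at *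
    rw [div_eq_iff (by positivity), show (n:ℝ) * (y - 1) * (y + 1) = n * (y ^ 2 - 1) by ring,
      show -((n:ℝ) * (κ n - 1) * y ^ 2) = n * (y ^ 2 - κ n * y ^ 2) by ring, h5]
  · obtain ⟨C, hC, hb⟩ := hΓ l
    refine ⟨C, hC, fun n hn => ?_⟩
    have := hb n hn
    rwa [Finset.range_eq_Ico, Finset.sum_eq_sum_Ico_succ_bot (Nat.succ_pos l), hΓ0, pow_zero, div_one] at this
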